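/- For f ∈ H^{1/2}(𝕋³), an interval I ⊂ [0,1], and a ∈ (0,1) with ap > 10/3, the refined Strichartz estimate holds: ‖e^{itΔ}f‖_{Z(I)} ≲ ‖f‖^a_{H^{1/2}(𝕋³)} · (sup_{N dyadic} N^{−1}‖P_N e^{itΔ}f‖_{L^∞_{t,x}(I×𝕋³)})^{1−a}. -/

import Mathlib

open MeasureTheory
open scoped BigOperators

noncomputable section

def znrm (ξ : Fin 3 → ℤ) : ℝ := Real.sqrt (∑ i, ((ξ i : ℝ)) ^ 2)

def cube3 : Set (Fin 3 → ℝ) := Set.univ.pi fun _ => Set.Icc (-Real.pi) Real.pi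

/-- Littlewood–Paley piece `P_K e^{itΔ}f` of the free evolution on `𝕋³` of the
function `f` with Fourier coefficients `c`. -/
def PKlin (c : (Fin 3 → ℤ) → ℂ) (K t : ℝ) (x : Fin 3 → ℝ) : ℂ :=
  ∑' ξ : Fin 3 → ℤ,
    (if K ≤ znrm ξ ∧ znrm ξ < 2 * K then (1 : ℂ) else 0) *
      Complex.exp (-(Complex.I) * ((t * (znrm ξ) ^ 2 : ℝ) : ℂ)) * c ξ *
      Complex.exp (Complex.I * (((∑ i, x i * (ξ i : ℝ)) : ℝ) : ℂ))

/-- The `H^{1/2}(𝕋³)` norm of the function with Fourier coefficients `c`. -/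
def H12norm (c : (Fin 3 → ℤ) → ℂ) : ℝ :=
  Real.sqrt (∑' ξ : Fin 3 → ℤ, Real.sqrt (1 + (znrm ξ) ^ 2) * ‖c ξ‖ ^ 2)

namespace TorusStrichartz

/-! ### Averages over finite groups -/

set_option linter.unusedSectionVars false

section Averages

variable {G G' A B : Type*} [AddCommGroup G] [AddCommGroup G'] [AddCommGroup A] [Fintype A]
  [AddCommGroup B] [Fintype B]

/-- The average of `f` over the translates of `g` by the image of a finite group. -/
def havg (ι : A →+ G) (f : G → ℝ) (g : G) : ℝ := (∑ a, f (g + ι a)) / Fintype.card A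

lemma card_pos_real (A : Type*) [AddCommGroup A] [Fintype A] : (0 : ℝ) < Fintype.card A := by
  exact_mod_cast Fintype.card_pos

lemma havg_mono (ι : A →+ G) {f f' : G → ℝ} (h : ∀ g, f g ≤ f' g) (g : G) :
    havg ι f g ≤ havg ι f' g := by
  unfold havg
  have := card_pos_real A
  gcongr
  exact h _

lemma havg_nonneg (ι : A →+ G) {f : G → ℝ} (h : ∀ g, 0 ≤ f g) (g : G) : 0 ≤ havg ι f g :=
  div_nonneg (Finset.sum_nonneg fun _ _ => h _) (Nat.cast_nonneg _)

lemma havg_const_mul (ι : A →+ G) (c : ℝ) (f : G → ℝ) (g : G) :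
    havg ι (fun x => c * f x) g = c * havg ι f g := by
  simp only [havg, ← Finset.mul_sum, mul_div_assoc]

lemma havg_sum (ι : A →+ G) {κ : Type*} (s : Finset κ) (f : κ → G → ℝ) (g : G) :
    havg ι (fun x => ∑ k ∈ s, f k x) g = ∑ k ∈ s, havg ι (f k) g := by
  simp only [havg]
  rw [Finset.sum_comm, Finset.sum_div]

lemma havg_add (ι : A →+ G) (f f' : G → ℝ) (g : G) :
    havg ι (fun x => f x + f' x) g = havg ι f g + havg ι f' g := by
  simp only [havg, Finset.sum_add_distrib, add_div]

lemma havg_congr (ι : A →+ G) {f f' : G → ℝ} {g : G} (h : ∀ a, f (g + ι a) = f' (g + ι a)) :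
    havg ι f g = havg ι f' g := by
  simp only [havg, h]

lemma havg_of_inv (ι : A →+ G) {f : G → ℝ} {g : G} (h : ∀ a, f (g + ι a) = f g) :
    havg ι f g = f g := by
  have := (card_pos_real A).ne'
  simp only [havg, h]
  simp [this]

lemma havg_add_map (ι : A →+ G) (f : G → ℝ) (g : G) (b : A) :
    havg ι f (g + ι b) = havg ι f g := by
  unfold havg
  congr 1
  refine Fintype.sum_equiv (Equiv.addLeft b) _ _ fun a => ?_
  simp [add_assoc]

lemma havg_translate (ι : A →+ G) (f : G → ℝ) (g h : G) :
    havg ι (fun x => f (x + h)) g = havg ι f (g + h) := by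
  simp only [havg, add_right_comm]

lemma havg_add_of_mem (ι : A →+ G) (f : G → ℝ) (g : G) {h : G} (hh : h ∈ ι.range) :
    havg ι f (g + h) = havg ι f g := by
  obtain ⟨b, rfl⟩ := hh
  exact havg_add_map ι f g b

lemma havg_inv_of_inv (ι : A →+ G) {f : G → ℝ} {h : G} (hf : ∀ g, f (g + h) = f g) (g : G) :
    havg ι f (g + h) = havg ι f g := by
  rw [← havg_translate]
  simp only [hf]

lemma havg_comm (ι : A →+ G) (ι' : B →+ G) (f : G → ℝ) (g : G) :
    havg ι (havg ι' f) g = havg ι' (havg ι f) g := by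
  simp only [havg, ← Finset.sum_div, div_div]
  rw [Finset.sum_comm, mul_comm]
  simp only [add_right_comm]

lemma havg_havg (ι : A →+ G) (ι' : B →+ G) (h : ι'.range ≤ ι.range) (f : G → ℝ) (g : G) :
    havg ι (havg ι' f) g = havg ι f g := by
  rw [havg_comm]
  exact havg_of_inv ι' fun b => havg_add_of_mem ι f g (h ⟨b, rfl⟩)

lemma havg_comp (ι : A →+ G) (T : G →+ G') (f : G' → ℝ) (g : G) :
    havg ι (fun x => f (T x)) g = havg (T.comp ι) f (T g) := by
  simp [havg]

lemma havg_comp_le (φ : A →+ B) (ι : B →+ G) {f : G → ℝ} (hf : ∀ g, 0 ≤ f g) {k : ℝ}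
    (hk : (Nat.card φ.ker : ℝ) * Fintype.card B ≤ k * Fintype.card A) (g : G) :
    havg (ι.comp φ) f g ≤ k * havg ι f g := by
  classical
  have key : ∑ a, f (g + ι (φ a)) ≤ (Nat.card φ.ker : ℝ) * ∑ b, f (g + ι b) := by
    rw [← Finset.sum_fiberwise (s := Finset.univ) (g := φ), Finset.mul_sum]
    refine Finset.sum_le_sum fun b _ => ?_
    have h1 : ∀ a ∈ Finset.univ.filter (fun a => φ a = b), f (g + ι (φ a)) = f (g + ι b) := by
      intro a ha
      rw [(Finset.mem_filter.1 ha).2]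
    rw [Finset.sum_congr rfl h1, Finset.sum_const, nsmul_eq_mul]
    refine mul_le_mul_of_nonneg_right ?_ (hf _)
    norm_cast
    by_cases hb : ∃ a0, φ a0 = b
    · obtain ⟨a0, rfl⟩ := hb
      rw [Nat.card_eq_fintype_card, Fintype.card_subtype]
      refine Finset.card_le_card_of_injOn (fun a => a - a0) ?_ ?_
      · intro a ha
        simp at ha
        simp [AddMonoidHom.mem_ker, ha]
      · intro a _ a' _ h
        simpa using h
    · rw [Finset.filter_eq_empty_iff.2]
      · simp
      · intro a _ h
        exact hb ⟨a, h⟩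
  have hA := card_pos_real A
  have hB := card_pos_real B
  have hS : 0 ≤ ∑ b, f (g + ι b) := Finset.sum_nonneg fun _ _ => hf _
  simp only [havg, AddMonoidHom.comp_apply]
  rw [div_le_iff₀ hA]
  refine key.trans ?_
  have : k * ((∑ b, f (g + ι b)) / Fintype.card B) * Fintype.card A
      = (k * Fintype.card A) / Fintype.card B * ∑ b, f (g + ι b) := by ring
  rw [this]
  refine mul_le_mul_of_nonneg_right ?_ hS
  rwa [le_div_iff₀ hB]

/-- Hölder's inequality for averages with several factors. -/
lemma havg_prod_rpow_le (ι : A →+ G) {κ : Type*} (s : Finset κ) (f : κ → G → ℝ)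
    (hf : ∀ k g, 0 ≤ f k g) {β : κ → ℝ} (hβ : ∀ k ∈ s, 0 < β k) (hs : ∑ k ∈ s, β k ≤ 1) (g : G) :
    havg ι (fun x => ∏ k ∈ s, f k x ^ β k) g ≤ ∏ k ∈ s, havg ι (f k) g ^ β k := by
  classical
  have hA := card_pos_real A
  by_cases h0 : ∃ k ∈ s, havg ι (f k) g = 0
  · obtain ⟨k, hk, h0⟩ := h0
    have hz : ∀ a, f k (g + ι a) = 0 := by
      rw [havg, div_eq_zero_iff, or_iff_left hA.ne',
        Finset.sum_eq_zero_iff_of_nonneg fun _ _ => hf _ _] at h0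
      exact fun a => h0 a (Finset.mem_univ a)
    have : havg ι (fun x => ∏ k ∈ s, f k x ^ β k) g = 0 := by
      have h1 : ∀ a, ∏ k ∈ s, f k (g + ι a) ^ β k = 0 := fun a =>
        Finset.prod_eq_zero hk (by rw [hz, Real.zero_rpow (hβ k hk).ne'])
      simp [havg, h1]
    rw [this]
    exact Finset.prod_nonneg fun _ _ => Real.rpow_nonneg (havg_nonneg ι (hf _) g) _
  · push Not at h0
    have hpos : ∀ k ∈ s, 0 < havg ι (f k) g := fun k hk =>
      lt_of_le_of_ne (havg_nonneg ι (hf k) g) (h0 k hk).symm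
    set P := ∏ k ∈ s, havg ι (f k) g ^ β k with hP
    have hPpos : 0 < P := Finset.prod_pos fun k hk => Real.rpow_pos_of_pos (hpos k hk) _
    have hpt : ∀ x, ∏ k ∈ s, f k x ^ β k ≤
        P * (∑ k ∈ s, β k * (f k x / havg ι (f k) g) + (1 - ∑ k ∈ s, β k)) := by
      intro x
      have h1 := Real.geom_mean_le_arith_mean_weighted (Finset.insertNone s)
        (fun o : Option κ => o.elim (1 - ∑ k ∈ s, β k) β)
        (fun o : Option κ => o.elim 1 fun k => f k x / havg ι (f k) g) (by
          intro o ho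
          cases o with
          | none => simpa using hs
          | some k => exact (hβ k (by simpa using ho)).le) (by
          rw [Finset.sum_insertNone]; simp) (by
          intro o ho
          cases o with
          | none => simp
          | some k => exact div_nonneg (hf _ _) (hpos k (by simpa using ho)).le)
      simp only [Finset.prod_insertNone, Finset.sum_insertNone, Option.elim, Real.one_rpow,
        one_mul, mul_one] at h1
      have h2 : ∏ k ∈ s, f k x ^ β k = P * ∏ k ∈ s, (f k x / havg ι (f k) g) ^ β k := by
        rw [hP, ← Finset.prod_mul_distrib]
        refine Finset.prod_congr rfl fun k hk => ?_
        rw [Real.div_rpow (hf _ _) (hpos k hk).le,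
          mul_div_cancel₀ _ (Real.rpow_pos_of_pos (hpos k hk) _).ne']
      rw [h2]
      refine mul_le_mul_of_nonneg_left ?_ hPpos.le
      linarith
    refine (havg_mono ι hpt g).trans ?_
    rw [havg_const_mul, havg_add, havg_sum]
    have h3 : ∑ k ∈ s, havg ι (fun x => β k * (f k x / havg ι (f k) g)) g = ∑ k ∈ s, β k := by
      refine Finset.sum_congr rfl fun k hk => ?_
      rw [havg_const_mul]
      have : (fun x => f k x / havg ι (f k) g) = fun x => (havg ι (f k) g)⁻¹ * f k x := by
        ext x; ring
      rw [this, havg_const_mul, inv_mul_cancel₀ (hpos k hk).ne', mul_one]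
    rw [h3, havg_of_inv ι (f := fun _ => 1 - ∑ k ∈ s, β k) (fun _ => rfl)]
    simp

/-- Iterated averages over a list of directions. -/
def mavg {κ : Type*} (ι : κ → A →+ G) (l : List κ) (f : G → ℝ) : G → ℝ :=
  l.foldr (fun k f => havg (ι k) f) f

lemma mavg_nonneg {κ : Type*} (ι : κ → A →+ G) (l : List κ) {f : G → ℝ} (h : ∀ g, 0 ≤ f g)
    (g : G) : 0 ≤ mavg ι l f g := by
  induction l generalizing g with
  | nil => exact h g
  | cons k l ih => exact havg_nonneg _ ih g

lemma mavg_inv_of_inv {κ : Type*} (ι : κ → A →+ G) (l : List κ) {f : G → ℝ} {h : G}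
    (hf : ∀ g, f (g + h) = f g) (g : G) : mavg ι l f (g + h) = mavg ι l f g := by
  induction l generalizing g with
  | nil => exact hf g
  | cons k l ih => exact havg_inv_of_inv _ ih g

lemma mavg_inv_of_mem {κ : Type*} (ι : κ → A →+ G) (l : List κ) (f : G → ℝ) {k : κ} (hk : k ∈ l)
    (a : A) (g : G) : mavg ι l f (g + ι k a) = mavg ι l f g := by
  induction l generalizing g with
  | nil => simp at hk
  | cons k' l ih =>
    rcases List.mem_cons.1 hk with rfl | h
    · exact havg_add_map _ _ _ _
    · exact havg_inv_of_inv _ (ih h) g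

lemma havg_mavg {κ : Type*} (ι : κ → A →+ G) (l : List κ) (ψ : B →+ G)
    (hψ : ∀ k, (ι k).range ≤ ψ.range) (f : G → ℝ) (g : G) :
    havg ψ (mavg ι l f) g = havg ψ f g := by
  induction l generalizing g with
  | nil => rfl
  | cons k l ih =>
    change havg ψ (havg (ι k) (mavg ι l f)) g = _
    rw [havg_havg _ _ (hψ k), ih]

/-- One step of the Loomis–Whitney inequality. -/
lemma havg_prod_rpow_le_of_inv {n : ℕ} (ι : A →+ G) (k : Fin n) (f : Fin n → G → ℝ)
    (hf : ∀ j g, 0 ≤ f j g) (hk : ∀ a g, f k (g + ι a) = f k g) {β : ℝ} (hβ : 0 < β)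
    (hn : β * (n - 1) ≤ 1) (g : G) :
    havg ι (fun x => ∏ j, f j x ^ β) g ≤ ∏ j, havg ι (f j) g ^ β := by
  have h1 : havg ι (fun x => ∏ j, f j x ^ β) g =
      f k g ^ β * havg ι (fun x => ∏ j ∈ Finset.univ.erase k, f j x ^ β) g := by
    rw [← havg_const_mul]
    refine havg_congr ι fun a => ?_
    rw [← Finset.mul_prod_erase _ _ (Finset.mem_univ k), hk]
  rw [h1, ← Finset.mul_prod_erase _ _ (Finset.mem_univ k), havg_of_inv ι (fun a => hk a g)]
  refine mul_le_mul_of_nonneg_left ?_ (Real.rpow_nonneg (hf _ _) _)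
  refine havg_prod_rpow_le ι _ f hf (fun _ _ => hβ) ?_ g
  rw [Finset.sum_const, Finset.card_erase_of_mem (Finset.mem_univ k), Finset.card_univ,
    Fintype.card_fin, nsmul_eq_mul, mul_comm, Nat.cast_sub (by have := k.2; omega)]
  simpa using hn

lemma mavg_prod_rpow_le {n : ℕ} (ι : Fin n → A →+ G) (l : List (Fin n)) (f : Fin n → G → ℝ)
    (hf : ∀ j g, 0 ≤ f j g) (hk : ∀ k a g, f k (g + ι k a) = f k g) {β : ℝ} (hβ : 0 < β)
    (hn : β * (n - 1) ≤ 1) (g : G) :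
    mavg ι l (fun x => ∏ j, f j x ^ β) g ≤ ∏ j, mavg ι l (f j) g ^ β := by
  induction l generalizing g with
  | nil => exact le_rfl
  | cons k l ih =>
    refine (havg_mono (ι k) ih g).trans ?_
    exact havg_prod_rpow_le_of_inv (ι k) k (fun j => mavg ι l (f j))
      (fun j => mavg_nonneg ι l (hf j)) (fun a g => mavg_inv_of_inv ι l (hk k a) g) hβ hn g

/-- The sum of a finite family of homomorphisms, as a homomorphism on the power. -/
def sumHom {n : ℕ} (ι : Fin n → A →+ G) : (Fin n → A) →+ G :=
  ∑ k, (ι k).comp (Pi.evalAddMonoidHom (fun _ => A) k)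

lemma sumHom_apply {n : ℕ} (ι : Fin n → A →+ G) (a : Fin n → A) :
    sumHom ι a = ∑ k, ι k (a k) := by
  simp [sumHom]

/-- The Loomis–Whitney inequality for averages. -/
lemma havg_sumHom_prod_rpow_le {n : ℕ} (ι : Fin n → A →+ G) (f : Fin n → G → ℝ)
    (hf : ∀ j g, 0 ≤ f j g) (hk : ∀ k a g, f k (g + ι k a) = f k g) {β : ℝ} (hβ : 0 < β)
    (hn : β * (n - 1) ≤ 1) (g : G) :
    havg (sumHom ι) (fun x => ∏ j, f j x ^ β) g ≤ ∏ j, havg (sumHom ι) (f j) g ^ β := by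
  classical
  set l := List.finRange n
  have hr : ∀ k, (ι k).range ≤ (sumHom ι).range := by
    rintro k _ ⟨a, rfl⟩
    refine ⟨Pi.single k a, ?_⟩
    rw [sumHom_apply, Finset.sum_eq_single k]
    · simp
    · intro j _ hj
      simp [hj]
    · simp
  have hinv : ∀ f : G → ℝ, ∀ a g, mavg ι l f (g + sumHom ι a) = mavg ι l f g := by
    intro f a g
    rw [sumHom_apply]
    have : ∀ s : Finset (Fin n), mavg ι l f (g + ∑ k ∈ s, ι k (a k)) = mavg ι l f g := by
      intro s
      induction s using Finset.induction_on with
      | empty => simp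
      | insert k s hks ih =>
        rw [Finset.sum_insert hks, add_comm (ι k (a k)), ← add_assoc,
          mavg_inv_of_mem ι l f (List.mem_finRange k), ih]
    exact this _
  have heq : ∀ f : G → ℝ, havg (sumHom ι) f g = mavg ι l f g := by
    intro f
    rw [← havg_mavg ι l _ hr, havg_of_inv _ (fun a => hinv f a g)]
  simp only [heq]
  exact mavg_prod_rpow_le ι l f hf hk hβ hn g

end Averages

/-! ### Weighted Jensen and Minkowski inequalities -/

lemma rpow_sum_le_weighted {κ : Type*} (s : Finset κ) {v a : κ → ℝ} (hv : ∀ k ∈ s, 0 ≤ v k)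
    (ha : ∀ k ∈ s, 0 ≤ a k) (hva : ∀ k ∈ s, a k = 0 → v k = 0) {r : ℝ} (hr : 1 < r) :
    (∑ k ∈ s, v k) ^ r ≤ (∑ k ∈ s, a k) ^ (r - 1) * ∑ k ∈ s, a k ^ (1 - r) * v k ^ r := by
  have hr0 : 0 < r := by linarith
  have hconj : (r / (r - 1)).HolderConjugate r := by
    rw [Real.holderConjugate_iff]
    refine ⟨by rw [lt_div_iff₀ (by linarith)]; linarith, ?_⟩
    field_simp
    ring
  have h := Real.inner_le_Lp_mul_Lq_of_nonneg s hconj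
    (f := fun k => a k ^ ((r - 1) / r)) (g := fun k => a k ^ (-((r - 1) / r)) * v k)
    (fun k hk => Real.rpow_nonneg (ha k hk) _)
    (fun k hk => mul_nonneg (Real.rpow_nonneg (ha k hk) _) (hv k hk))
  have e1 : ∑ k ∈ s, a k ^ ((r - 1) / r) * (a k ^ (-((r - 1) / r)) * v k) = ∑ k ∈ s, v k := by
    refine Finset.sum_congr rfl fun k hk => ?_
    rcases (ha k hk).eq_or_lt with h0 | h0
    · rw [hva k hk h0.symm]; simp
    · rw [← mul_assoc, ← Real.rpow_add h0]; simp
  have e2 : ∑ k ∈ s, (a k ^ ((r - 1) / r)) ^ (r / (r - 1)) = ∑ k ∈ s, a k := by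
    refine Finset.sum_congr rfl fun k hk => ?_
    rw [← Real.rpow_mul (ha k hk)]
    have : (r - 1) / r * (r / (r - 1)) = 1 := by
      have : r - 1 ≠ 0 := by linarith
      field_simp
    rw [this, Real.rpow_one]
  have e3 : ∑ k ∈ s, (a k ^ (-((r - 1) / r)) * v k) ^ r = ∑ k ∈ s, a k ^ (1 - r) * v k ^ r := by
    refine Finset.sum_congr rfl fun k hk => ?_
    rw [Real.mul_rpow (Real.rpow_nonneg (ha k hk) _) (hv k hk), ← Real.rpow_mul (ha k hk)]
    congr 2
    field_simp
    ring
  simp only [e1, e2, e3] at h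
  have hA : 0 ≤ ∑ k ∈ s, a k := Finset.sum_nonneg ha
  have hB : 0 ≤ ∑ k ∈ s, a k ^ (1 - r) * v k ^ r := Finset.sum_nonneg fun k hk =>
    mul_nonneg (Real.rpow_nonneg (ha k hk) _) (Real.rpow_nonneg (hv k hk) _)
  calc (∑ k ∈ s, v k) ^ r ≤ _ := Real.rpow_le_rpow (Finset.sum_nonneg hv) h hr0.le
    _ = _ := by
      rw [Real.mul_rpow (Real.rpow_nonneg hA _) (Real.rpow_nonneg hB _), ← Real.rpow_mul hA,
        ← Real.rpow_mul hB]
      congr 1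
      · congr 1
        field_simp
      · rw [one_div, inv_mul_cancel₀ hr0.ne', Real.rpow_one]

section
variable {G A : Type*} [AddCommGroup G] [AddCommGroup A] [Fintype A]

/-- Minkowski's inequality for averages. -/
lemma havg_rpow_sum_le (ι : A →+ G) {κ : Type*} (s : Finset κ) (u : κ → G → ℝ)
    (hu : ∀ k g, 0 ≤ u k g) {r : ℝ} (hr : 1 < r) (g : G) :
    havg ι (fun x => (∑ k ∈ s, u k x ^ r⁻¹) ^ r) g ≤ (∑ k ∈ s, havg ι (u k) g ^ r⁻¹) ^ r := by
  have hr0 : 0 < r := by linarith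
  have hA := card_pos_real A
  set a : κ → ℝ := fun k => havg ι (u k) g ^ r⁻¹ with hadef
  have ha : ∀ k, 0 ≤ a k := fun k => Real.rpow_nonneg (havg_nonneg ι (hu k) g) _
  have hz : ∀ k, a k = 0 → ∀ b, u k (g + ι b) = 0 := by
    intro k hk b
    have h0 : havg ι (u k) g = 0 := by
      rwa [hadef, Real.rpow_eq_zero (havg_nonneg ι (hu k) g) (inv_pos.2 hr0).ne'] at hk
    rw [havg, div_eq_zero_iff, or_iff_left hA.ne',
        Finset.sum_eq_zero_iff_of_nonneg fun _ _ => hu _ _] at h0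
    exact h0 b (Finset.mem_univ b)
  have hpt : ∀ b, (∑ k ∈ s, u k (g + ι b) ^ r⁻¹) ^ r ≤
      (∑ k ∈ s, a k) ^ (r - 1) * ∑ k ∈ s, a k ^ (1 - r) * u k (g + ι b) := by
    intro b
    have := rpow_sum_le_weighted s (v := fun k => u k (g + ι b) ^ r⁻¹) (a := a)
      (fun k _ => Real.rpow_nonneg (hu _ _) _) (fun k _ => ha k)
      (fun k _ hk => by rw [hz k hk b, Real.zero_rpow (inv_pos.2 hr0).ne']) hr
    refine this.trans (le_of_eq ?_)
    congr 1
    refine Finset.sum_congr rfl fun k _ => ?_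
    rw [Real.rpow_inv_rpow (hu _ _) hr0.ne']
  have h1 : havg ι (fun x => (∑ k ∈ s, u k x ^ r⁻¹) ^ r) g ≤
      havg ι (fun x => (∑ k ∈ s, a k) ^ (r - 1) * ∑ k ∈ s, a k ^ (1 - r) * u k x) g := by
    unfold havg
    gcongr with b
    exact hpt b
  refine h1.trans ?_
  rw [havg_const_mul, havg_sum]
  have h2 : ∑ k ∈ s, havg ι (fun x => a k ^ (1 - r) * u k x) g = ∑ k ∈ s, a k := by
    refine Finset.sum_congr rfl fun k _ => ?_
    rw [havg_const_mul]
    rcases (ha k).eq_or_lt with h0 | h0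
    · have : havg ι (u k) g = 0 := by
        simp [havg, hz k h0.symm]
      rw [this, ← h0, mul_zero]
    · have : havg ι (u k) g = a k ^ r := by
        rw [hadef, Real.rpow_inv_rpow (havg_nonneg ι (hu k) g) hr0.ne']
      rw [this, ← Real.rpow_add h0]
      simp
  rw [h2]
  rcases (Finset.sum_nonneg fun k (_ : k ∈ s) => ha k).eq_or_lt with h0 | h0
  · rw [← h0]; simp [hr0.ne']
  · nth_rewrite 2 [← Real.rpow_one (∑ k ∈ s, a k)]
    rw [← Real.rpow_add h0]
    simp

end

/-! ### Quantitative elimination over the 2-adic integers -/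

lemma zmod_two_pow_mul_odd_eq_zero {R : ℕ} {x : ℤ} (hx : Odd x) {a : ZMod (2 ^ R)}
    (h : (x : ZMod (2 ^ R)) * a = 0) : a = 0 := by
  have hc : IsCoprime x ((2 ^ R : ℕ) : ℤ) := by
    push_cast
    refine IsCoprime.pow_right ?_
    exact Int.isCoprime_iff_gcd_eq_one.2 (by
      rw [Int.gcd_comm]; exact Int.isCoprime_iff_gcd_eq_one.1 (Int.isCoprime_two_left.2 hx))
  have hu : IsUnit (x : ZMod (2 ^ R)) := by
    obtain ⟨y, z, hyz⟩ := hc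
    refine IsUnit.of_mul_eq_one (y : ZMod (2 ^ R)) ?_
    have := congrArg (Int.cast : ℤ → ZMod (2 ^ R)) hyz
    push_cast at this
    have h2 : (2 : ZMod (2 ^ R)) ^ R = 0 := by
      have := ZMod.natCast_self (2 ^ R)
      push_cast at this
      exact this
    rw [h2, mul_zero, add_zero, mul_comm] at this
    exact this
  exact (hu.mul_right_eq_zero).1 h

/-- Either some `n` of the vectors `W i` are quantitatively independent over the 2-adic integers,
or all of them are close to a common hyperplane. -/
lemma exists_transversal_or_hyperplane {κ : Type*} (u : ℕ) : ∀ (n : ℕ) (W : κ → Fin n → ℤ),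
    (∃ f : Fin n → κ, ∀ (R : ℕ) (a : Fin n → ZMod (2 ^ R)),
      (∀ j, ∑ k, a k * (W (f k) j : ZMod (2 ^ R)) = 0) → ∀ k, 2 ^ u * a k = 0) ∨
    (∃ l : Fin n → ℤ, (∃ j, Odd (l j)) ∧ ∀ i, (2 : ℤ) ^ u ∣ ∑ j, l j * W i j)
  | 0, _ => Or.inl ⟨Fin.elim0, fun _ _ _ k => k.elim0⟩
  | n + 1, W => by
    classical
    by_cases hall : ∀ i j, (2 : ℤ) ^ u ∣ W i j
    · refine Or.inr ⟨Pi.single 0 1, ⟨0, by simp⟩, fun i => ?_⟩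
      rw [Finset.sum_eq_single 0]
      · simpa using hall i 0
      · intro j _ hj
        simp [hj]
      · simp
    have hex : ∃ w, ∃ i j, ¬ (2 : ℤ) ^ (w + 1) ∣ W i j := by
      push Not at hall
      obtain ⟨i, j, h⟩ := hall
      exact ⟨u, i, j, fun h' => h ((pow_dvd_pow 2 (Nat.le_succ u)).trans h')⟩
    obtain ⟨i0, j0, h0⟩ := Nat.find_spec hex
    set w := Nat.find hex with hw
    have hdvd : ∀ i j, (2 : ℤ) ^ w ∣ W i j := by
      intro i j
      rcases Nat.eq_zero_or_pos w with h | h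
      · simp [h]
      · by_contra hc
        have := Nat.find_min hex (m := w - 1) (by omega)
        exact this ⟨i, j, by rwa [Nat.sub_add_cancel h]⟩
    have hwu : w ≤ u := by
      by_contra hc
      push Not at hall
      obtain ⟨i, j, h⟩ := hall
      exact h ((pow_dvd_pow 2 (by omega)).trans (hdvd i j))
    choose x hx using hdvd
    have hodd : Odd (x i0 j0) := by
      rw [← Int.not_even_iff_odd, even_iff_two_dvd]
      rintro ⟨y, hy⟩
      exact h0 ⟨y, by rw [hx, hy]; ring⟩
    set W' : κ → Fin n → ℤ := fun i j =>
      x i0 j0 * W i (j0.succAbove j) - x i j0 * W i0 (j0.succAbove j) with hW'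
    rcases exists_transversal_or_hyperplane u n W' with ⟨f, hf⟩ | ⟨l, ⟨j1, hj1⟩, hl⟩
    · refine Or.inl ⟨Fin.cons i0 f, fun R a ha => ?_⟩
      simp only [Fin.sum_univ_succ, Fin.cons_zero, Fin.cons_succ] at ha
      set b : ZMod (2 ^ R) := x i0 j0 * a 0 + ∑ k : Fin n, a k.succ * x (f k) j0 with hb
      have hbw : (2 : ZMod (2 ^ R)) ^ w * b = 0 := by
        refine zmod_two_pow_mul_odd_eq_zero (x := 1) (by decide) ?_
        have h1 := ha j0
        simp only [hx, Int.cast_mul, Int.cast_pow, Int.cast_ofNat] at h1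
        rw [← h1, hb, mul_add, Finset.mul_sum]
        push_cast
        rw [one_mul]
        congr 1
        · ring
        · exact Finset.sum_congr rfl fun k _ => by ring
      have hz : ∀ j : Fin n, ∑ k, a k.succ * (W' (f k) j : ZMod (2 ^ R)) = 0 := by
        intro j
        have h1 := ha (j0.succAbove j)
        have h2 : (x i0 j0 : ZMod (2 ^ R)) * (a 0 * (W i0 (j0.succAbove j) : ZMod (2 ^ R)) +
            ∑ k : Fin n, a k.succ * (W (f k) (j0.succAbove j) : ZMod (2 ^ R))) =
            b * W i0 (j0.succAbove j) + ∑ k, a k.succ * (W' (f k) j : ZMod (2 ^ R)) := by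
          rw [hb, add_mul, mul_add, add_assoc, Finset.sum_mul, Finset.mul_sum,
            ← Finset.sum_add_distrib]
          congr 1
          · ring
          · refine Finset.sum_congr rfl fun k _ => ?_
            simp only [hW']
            push_cast
            ring
        rw [h1, mul_zero, hx i0 (j0.succAbove j)] at h2
        push_cast at h2
        have h3 : b * ((2 : ZMod (2 ^ R)) ^ w * (x i0 (j0.succAbove j) : ZMod (2 ^ R))) = 0 := by
          rw [← mul_assoc, mul_comm b, hbw, zero_mul]
        rw [h3, zero_add] at h2
        exact h2.symm
      have hs := hf R (fun k => a k.succ) hz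
      have hub : (2 : ZMod (2 ^ R)) ^ u * b = 0 := by
        rw [← Nat.sub_add_cancel hwu, pow_add, mul_assoc, hbw, mul_zero]
      intro k
      refine Fin.cases ?_ hs k
      refine zmod_two_pow_mul_odd_eq_zero hodd ?_
      rw [hb, mul_add, Finset.mul_sum] at hub
      have h4 : ∑ k : Fin n, (2 : ZMod (2 ^ R)) ^ u * (a k.succ * (x (f k) j0 : ZMod (2 ^ R))) = 0 :=
        Finset.sum_eq_zero fun k _ => by rw [← mul_assoc, hs k, zero_mul]
      rw [h4, add_zero] at hub
      rw [← hub]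
      ring
    · refine Or.inr ⟨j0.insertNth (-∑ j, l j * x i0 (j0.succAbove j)) fun j => x i0 j0 * l j,
        ⟨j0.succAbove j1, ?_⟩, fun i => ?_⟩
      · simpa using hodd.mul hj1
      · have : ∑ j, (j0.insertNth (α := fun _ => ℤ) (-∑ j, l j * x i0 (j0.succAbove j))
            fun j => x i0 j0 * l j) j * W i j = ∑ j, l j * W' i j := by
          rw [Fin.sum_univ_succAbove _ j0]
          simp only [Fin.insertNth_apply_same, Fin.insertNth_apply_succAbove, hW']
          rw [← eq_sub_iff_add_eq', neg_mul, Finset.sum_mul, sub_neg_eq_add,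
            ← Finset.sum_add_distrib]
          refine Finset.sum_congr rfl fun j _ => ?_
          rw [hx i j0, hx i0 (j0.succAbove j)]
          ring
        rw [this]
        exact hl i

/-! ### The torus, its 2-power torsion and exponential sums -/

abbrev Tor (n : ℕ) := Fin n → UnitAddCircle

/-- The pairing of an integer vector with a point of the torus. -/
def pair {n : ℕ} (v : Fin n → ℤ) (g : Tor n) : UnitAddCircle := ∑ j, v j • g j

/-- The character of the torus with frequency `v`. -/
def chr {n : ℕ} (v : Fin n → ℤ) (g : Tor n) : ℂ := (AddCircle.toCircle (pair v g) : ℂ)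

lemma pair_add {n : ℕ} (v : Fin n → ℤ) (g h : Tor n) : pair v (g + h) = pair v g + pair v h := by
  simp [pair, smul_add, Finset.sum_add_distrib]

lemma chr_add {n : ℕ} (v : Fin n → ℤ) (g h : Tor n) : chr v (g + h) = chr v g * chr v h := by
  simp [chr, pair_add, AddCircle.toCircle_add]

@[simp] lemma norm_chr {n : ℕ} (v : Fin n → ℤ) (g : Tor n) : ‖chr v g‖ = 1 :=
  Circle.norm_coe _

lemma toCircle_injective : Function.Injective (AddCircle.toCircle : UnitAddCircle → Circle) :=
  AddCircle.injective_toCircle one_ne_zero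

/-- The embedding of `(ℤ / 2 ^ r) ^ n` as the `2 ^ r`-torsion of the torus. -/
def tors (n r : ℕ) : (Fin n → ZMod (2 ^ r)) →+ Tor n where
  toFun a j := ZMod.toAddCircle (a j)
  map_zero' := by ext j; simp
  map_add' a b := by ext j; simp

@[simp] lemma tors_apply {n r : ℕ} (a : Fin n → ZMod (2 ^ r)) (j : Fin n) :
    tors n r a j = ZMod.toAddCircle (a j) := rfl

lemma exists_toAddCircle_eq {r : ℕ} {x : UnitAddCircle} (h : (2 ^ r : ℕ) • x = 0) :
    ∃ a : ZMod (2 ^ r), ZMod.toAddCircle a = x := by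
  induction x using QuotientAddGroup.induction_on with
  | H z =>
    have h1 : (((2 ^ r : ℕ) • z : ℝ) : UnitAddCircle) = 0 := h
    rw [AddCircle.coe_eq_zero_iff] at h1
    obtain ⟨k, hk⟩ := h1
    refine ⟨(k : ZMod (2 ^ r)), ?_⟩
    rw [ZMod.toAddCircle_intCast]
    have h2 : (0 : ℝ) < ((2 ^ r : ℕ) : ℝ) := by positivity
    have : (k : ℝ) / ((2 ^ r : ℕ) : ℝ) = z := by
      rw [div_eq_iff h2.ne']
      simp only [nsmul_eq_mul, zsmul_eq_mul, mul_one] at hk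
      rw [hk, mul_comm]
    rw [this]

lemma two_pow_nsmul_toAddCircle {r : ℕ} (a : ZMod (2 ^ r)) :
    (2 ^ r : ℕ) • ZMod.toAddCircle a = 0 := by
  rw [← map_nsmul]
  simp

lemma mem_tors_range {n r : ℕ} {h : Tor n} :
    h ∈ (tors n r).range ↔ ∀ j, (2 ^ r : ℕ) • h j = 0 := by
  constructor
  · rintro ⟨a, rfl⟩ j
    exact two_pow_nsmul_toAddCircle _
  · intro hh
    choose a ha using fun j => exists_toAddCircle_eq (hh j)
    exact ⟨a, funext ha⟩

lemma tors_range_mono {n r r' : ℕ} (h : r ≤ r') : (tors n r).range ≤ (tors n r').range := by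
  intro x hx
  rw [mem_tors_range] at hx ⊢
  intro j
  rw [← Nat.sub_add_cancel h, pow_add, mul_smul, hx j, smul_zero]

lemma zsmul_eq_zero_of_dvd {k : ℕ} {z : ℤ} {x : UnitAddCircle} (hx : k • x = 0)
    (h : (k : ℤ) ∣ z) : z • x = 0 := by
  obtain ⟨y, rfl⟩ := h
  rw [mul_comm, mul_smul, natCast_zsmul, hx, smul_zero]

/-- An integral quadratic form with polar form `S`, anisotropic over the 2-adic numbers. -/
structure AnisoForm (d e : ℕ) where
  Q : (Fin d → ℤ) → ℤ
  S : (Fin d → ℤ) →+ (Fin d → ℤ)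
  map_add : ∀ ξ η, Q (ξ + η) = Q ξ + S ξ ⬝ᵥ η + Q η
  map_smul : ∀ (k : ℤ) η, Q (k • η) = k ^ 2 * Q η
  aniso : ∀ v, (2 : ℤ) ^ e ∣ Q v → ∀ i, 2 ∣ v i

abbrev Cap (d m : ℕ) := Fin d → ZMod (2 ^ m)

/-- Reduction of a frequency modulo `2 ^ m`. -/
def cap {d : ℕ} (m : ℕ) (ξ : Fin d → ℤ) : Cap d m := fun j => (ξ j : ZMod (2 ^ m))

lemma cap_eq_iff {d m : ℕ} {ξ ξ' : Fin d → ℤ} :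
    cap m ξ = cap m ξ' ↔ ∃ η : Fin d → ℤ, ξ' = ξ + (2 : ℤ) ^ m • η := by
  constructor
  · intro h
    have : ∀ j, ∃ y, ξ' j - ξ j = 2 ^ m * y := by
      intro j
      have h1 := congrFun h j
      simp only [cap] at h1
      rw [ZMod.intCast_eq_intCast_iff_dvd_sub] at h1
      exact_mod_cast h1
    choose y hy using this
    refine ⟨y, funext fun j => ?_⟩
    simp only [Pi.add_apply, Pi.smul_apply, smul_eq_mul]
    linarith [hy j]
  · rintro ⟨η, rfl⟩
    funext j
    simp only [cap, Pi.add_apply, Pi.smul_apply, smul_eq_mul]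
    rw [ZMod.intCast_eq_intCast_iff_dvd_sub]
    exact ⟨η j, by push_cast; ring⟩

lemma cap_le {d m m' : ℕ} (h : m ≤ m') {ξ ξ' : Fin d → ℤ} (hc : cap m' ξ = cap m' ξ') :
    cap m ξ = cap m ξ' := by
  rw [cap_eq_iff] at hc ⊢
  obtain ⟨η, rfl⟩ := hc
  refine ⟨(2 : ℤ) ^ (m' - m) • η, ?_⟩
  rw [smul_smul, ← pow_add, Nat.add_sub_cancel' h]

namespace AnisoForm
variable {d e : ℕ} (q : AnisoForm d e)

/-- The point of the paraboloid above `ξ`. -/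
def pt (ξ : Fin d → ℤ) : Fin (d + 1) → ℤ := Fin.cons (q.Q ξ) ξ

/-- The normal direction of the paraboloid at `ξ`. -/
def nor (ξ : Fin d → ℤ) : Fin (d + 1) → ℤ := Fin.cons 1 (-(q.S ξ))

/-- The exponential sum with frequencies on the paraboloid. -/
def F {ι : Type*} (s : Finset ι) (ξ : ι → Fin d → ℤ) (c : ι → ℂ) (g : Tor (d + 1)) : ℂ :=
  ∑ i ∈ s, c i * chr (q.pt (ξ i)) g

lemma map_zero : q.Q 0 = 0 := by simpa using q.map_smul 0 0

lemma F_add_eq {ι : Type*} {s : Finset ι} {ξ : ι → Fin d → ℤ} {h : Tor (d + 1)} {z : ℂ}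
    (hz : ∀ i ∈ s, chr (q.pt (ξ i)) h = z) (c : ι → ℂ) (g : Tor (d + 1)) :
    q.F s ξ c (g + h) = z * q.F s ξ c g := by
  simp only [F, Finset.mul_sum]
  refine Finset.sum_congr rfl fun i hi => ?_
  rw [chr_add, hz i hi]
  ring

lemma norm_F_add_eq {ι : Type*} {s : Finset ι} {ξ : ι → Fin d → ℤ} {h : Tor (d + 1)}
    (hz : ∀ i ∈ s, ∀ i' ∈ s, chr (q.pt (ξ i)) h = chr (q.pt (ξ i')) h) (c : ι → ℂ)
    (g : Tor (d + 1)) : ‖q.F s ξ c (g + h)‖ = ‖q.F s ξ c g‖ := by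
  rcases s.eq_empty_or_nonempty with rfl | ⟨i0, h0⟩
  · simp [F]
  · rw [q.F_add_eq (fun i hi => hz i hi i0 h0), norm_mul, norm_chr, one_mul]

lemma chr_pt_tors {m : ℕ} {ξ ξ' : Fin d → ℤ} (hc : cap m ξ = cap m ξ') {h : Tor (d + 1)}
    (hh : h ∈ (tors (d + 1) m).range) : chr (q.pt ξ) h = chr (q.pt ξ') h := by
  rw [mem_tors_range] at hh
  obtain ⟨η, rfl⟩ := cap_eq_iff.1 hc
  unfold chr pair
  congr 2
  refine Finset.sum_congr rfl fun j _ => ?_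
  rw [eq_comm, ← sub_eq_zero, ← sub_smul]
  refine zsmul_eq_zero_of_dvd (hh j) ?_
  refine Fin.cases ?_ (fun j => ?_) j
  · simp only [pt, Fin.cons_zero, q.map_add, q.map_smul]
    refine ⟨q.S ξ ⬝ᵥ η + 2 ^ m * q.Q η, ?_⟩
    rw [dotProduct_smul]
    push_cast
    simp only [smul_eq_mul]
    ring
  · simp only [pt, Fin.cons_succ, Pi.add_apply, Pi.smul_apply, smul_eq_mul]
    exact ⟨η j, by push_cast; ring⟩

/-- Multiples of an integer vector by a point of the circle. -/
def _root_.TorusStrichartz.line {n : ℕ} (v : Fin n → ℤ) (u : UnitAddCircle) : Tor n :=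
  fun j => v j • u

lemma _root_.TorusStrichartz.pair_line {n : ℕ} (w v : Fin n → ℤ) (u : UnitAddCircle) :
    pair w (line v u) = (w ⬝ᵥ v) • u := by
  simp [pair, line, smul_smul, dotProduct, Finset.sum_smul]

lemma pt_dot_nor (ξ δ : Fin d → ℤ) :
    q.pt (ξ + δ) ⬝ᵥ q.nor ξ = q.Q δ + (q.Q ξ - q.S ξ ⬝ᵥ ξ) := by
  simp only [pt, nor, dotProduct, Fin.sum_univ_succ, Fin.cons_zero, Fin.cons_succ, mul_one,
    Pi.neg_apply, q.map_add, mul_neg, Finset.sum_neg_distrib, Pi.add_apply, add_mul,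
    Finset.sum_add_distrib]
  have h1 : ∑ i, δ i * q.S ξ i = ∑ i, q.S ξ i * δ i := Finset.sum_congr rfl fun _ _ => mul_comm _ _
  have h2 : ∑ i, ξ i * q.S ξ i = ∑ i, q.S ξ i * ξ i := Finset.sum_congr rfl fun _ _ => mul_comm _ _
  rw [h1, h2]
  ring

lemma chr_pt_line {m : ℕ} {ξ ξ' : Fin d → ℤ} (hc : cap m ξ = cap m ξ') {u : UnitAddCircle}
    (hu : (2 ^ (2 * m) : ℕ) • u = 0) :
    chr (q.pt ξ') (line (q.nor ξ) u) = chr (q.pt ξ) (line (q.nor ξ) u) := by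
  obtain ⟨η, rfl⟩ := cap_eq_iff.1 hc
  unfold chr
  rw [pair_line, pair_line, pt_dot_nor]
  have h0 := q.pt_dot_nor ξ 0
  rw [add_zero, q.map_zero, zero_add] at h0
  rw [h0, add_smul, q.map_smul]
  have : ((2 ^ m) ^ 2 * q.Q η) • u = 0 :=
    zsmul_eq_zero_of_dvd hu ⟨q.Q η, by push_cast; ring⟩
  rw [this, zero_add]

/-- Orthogonality of pieces with distinct residues. -/
lemma sum_mul_conj_eq_zero {ι : Type*} {s s' : Finset ι} {ξ : ι → Fin d → ℤ} {m r : ℕ}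
    (hmr : m ≤ r) {θ θ' : Cap d m} (hθ : θ ≠ θ') (hs : ∀ i ∈ s, cap m (ξ i) = θ)
    (hs' : ∀ i ∈ s', cap m (ξ i) = θ') (c : ι → ℂ) (g : Tor (d + 1)) :
    ∑ a, q.F s ξ c (g + tors (d + 1) r a) *
      (starRingEnd ℂ) (q.F s' ξ c (g + tors (d + 1) r a)) = 0 := by
  classical
  rcases s.eq_empty_or_nonempty with rfl | ⟨i, hi⟩
  · simp [F]
  rcases s'.eq_empty_or_nonempty with rfl | ⟨i', hi'⟩
  · simp [F]
  obtain ⟨j, hj⟩ := Function.ne_iff.1 hθ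
  set h : Tor (d + 1) := Pi.single j.succ (ZMod.toAddCircle (1 : ZMod (2 ^ m))) with hh
  have hm : h ∈ (tors (d + 1) m).range := by
    refine ⟨Pi.single j.succ 1, ?_⟩
    funext k
    by_cases hk : k = j.succ
    · subst hk; simp [hh]
    · simp [hh, hk]
  obtain ⟨b, hb⟩ := tors_range_mono hmr hm
  set z := chr (q.pt (ξ i)) h
  set z' := chr (q.pt (ξ i')) h
  have hz : ∀ k ∈ s, chr (q.pt (ξ k)) h = z := fun k hk =>
    q.chr_pt_tors (by rw [hs k hk, hs i hi]) hm
  have hz' : ∀ k ∈ s', chr (q.pt (ξ k)) h = z' := fun k hk =>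
    q.chr_pt_tors (by rw [hs' k hk, hs' i' hi']) hm
  have hchr : ∀ v : Fin d → ℤ, pair (q.pt v) h = ZMod.toAddCircle (cap m v j) := by
    intro v
    unfold pair
    rw [Finset.sum_eq_single j.succ]
    · rw [hh, Pi.single_eq_same, ← map_zsmul]
      simp [pt, cap]
    · intro k _ hk
      simp [hh, hk]
    · simp
  have hzz : z * (starRingEnd ℂ) z' ≠ 1 := by
    intro heq
    have h1 : z = z' := by
      have h2 : (starRingEnd ℂ) z' * z' = 1 := by
        rw [mul_comm, Complex.mul_conj, Complex.normSq_eq_norm_sq]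
        simp [z']
      calc z = z * ((starRingEnd ℂ) z' * z') := by rw [h2, mul_one]
        _ = z' := by rw [← mul_assoc, heq, one_mul]
    have h3 : pair (q.pt (ξ i)) h = pair (q.pt (ξ i')) h :=
      toCircle_injective (Subtype.ext h1)
    rw [hchr, hchr, hs i hi, hs' i' hi'] at h3
    exact hj (ZMod.toAddCircle_injective _ h3)
  set T := ∑ a, q.F s ξ c (g + tors (d + 1) r a) *
      (starRingEnd ℂ) (q.F s' ξ c (g + tors (d + 1) r a)) with hT
  have hTT : T = z * (starRingEnd ℂ) z' * T := by
    conv_lhs => rw [hT, ← Equiv.sum_comp (Equiv.addRight b)]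
    rw [hT, Finset.mul_sum]
    refine Finset.sum_congr rfl fun a _ => ?_
    rw [Equiv.coe_addRight, _root_.map_add, hb, ← add_assoc, q.F_add_eq hz, q.F_add_eq hz', map_mul]
    ring
  have : (1 - z * (starRingEnd ℂ) z') * T = 0 := by rw [sub_mul, one_mul, ← hTT, sub_self]
  exact (mul_eq_zero.1 this).resolve_left (sub_ne_zero.2 hzz.symm)

end AnisoForm

/-- The average over the `2 ^ r`-torsion. -/
abbrev avg {n : ℕ} (r : ℕ) (f : Tor n → ℝ) (g : Tor n) : ℝ := havg (tors n r) f g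

lemma avg_avg {n r r' : ℕ} (h : r' ≤ r) (f : Tor n → ℝ) (g : Tor n) :
    avg r (avg r' f) g = avg r f g := havg_havg _ _ (tors_range_mono h) f g

/-- The members of `s` with frequency in a given residue class. -/
def fil {ι : Type*} {d : ℕ} (s : Finset ι) (ξ : ι → Fin d → ℤ) (m : ℕ) (θ : Cap d m) : Finset ι :=
  by classical exact s.filter fun i => cap m (ξ i) = θ

lemma mem_fil {ι : Type*} {d : ℕ} {s : Finset ι} {ξ : ι → Fin d → ℤ} {m : ℕ} {θ : Cap d m} {i : ι} :
    i ∈ fil s ξ m θ ↔ i ∈ s ∧ cap m (ξ i) = θ := by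
  simp [fil]

lemma sum_fil {ι M : Type*} [AddCommMonoid M] {d : ℕ} (s : Finset ι) (ξ : ι → Fin d → ℤ) (m : ℕ)
    (f : ι → M) : ∑ θ, ∑ i ∈ fil s ξ m θ, f i = ∑ i ∈ s, f i := by
  classical
  unfold fil
  convert Finset.sum_fiberwise s (fun i => cap m (ξ i)) f

namespace AnisoForm
variable {d e : ℕ} (q : AnisoForm d e)

lemma sum_F_fil {ι : Type*} (s : Finset ι) (ξ : ι → Fin d → ℤ) (m : ℕ) (c : ι → ℂ)
    (g : Tor (d + 1)) : ∑ θ, q.F (fil s ξ m θ) ξ c g = q.F s ξ c g := sum_fil s ξ m _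

lemma avg_norm_sq {ι : Type*} (s : Finset ι) (ξ : ι → Fin d → ℤ) {m r : ℕ} (hmr : m ≤ r)
    (c : ι → ℂ) (g : Tor (d + 1)) :
    avg r (fun x => ‖q.F s ξ c x‖ ^ 2) g =
      ∑ θ : Cap d m, avg r (fun x => ‖q.F (fil s ξ m θ) ξ c x‖ ^ 2) g := by
  classical
  simp only [avg, havg]
  rw [← Finset.sum_div]
  congr 1
  rw [Finset.sum_comm]
  apply Complex.ofReal_injective
  have hn : ∀ z : ℂ, ((‖z‖ ^ 2 : ℝ) : ℂ) = z * (starRingEnd ℂ) z := by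
    intro z
    rw [Complex.mul_conj, Complex.normSq_eq_norm_sq]
  simp only [Complex.ofReal_sum, hn]
  rw [Finset.sum_comm]
  have h1 : ∀ x, q.F s ξ c x * (starRingEnd ℂ) (q.F s ξ c x) =
      ∑ θ : Cap d m, ∑ θ' : Cap d m,
        q.F (fil s ξ m θ) ξ c x * (starRingEnd ℂ) (q.F (fil s ξ m θ') ξ c x) := by
    intro x
    rw [← Finset.sum_mul_sum, ← map_sum, q.sum_F_fil]
  simp only [h1]
  rw [Finset.sum_comm]
  refine Finset.sum_congr rfl fun θ _ => ?_
  rw [Finset.sum_comm, Finset.sum_eq_single θ]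
  · intro θ' _ hne
    exact q.sum_mul_conj_eq_zero hmr hne.symm (fun i hi => (mem_fil.1 hi).2)
      (fun i hi => (mem_fil.1 hi).2) c g
  · simp

end AnisoForm

/-! ### Averages along transversal directions and ball inflation -/

/-- The homomorphism from `ℤ / 2 ^ R` to the torus in the direction `v`. -/
def lineHom {n : ℕ} (v : Fin n → ℤ) (R : ℕ) : ZMod (2 ^ R) →+ Tor n where
  toFun a := line v (ZMod.toAddCircle a)
  map_zero' := by funext j; simp [line]
  map_add' a b := by funext j; simp [line]

lemma lineHom_apply {n : ℕ} (v : Fin n → ℤ) (R : ℕ) (a : ZMod (2 ^ R)) :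
    lineHom v R a = line v (ZMod.toAddCircle a) := rfl

/-- Quantitative linear independence of `n` integer vectors over the 2-adic integers. -/
def Transversal {n : ℕ} (σ : ℕ) (v : Fin n → Fin n → ℤ) : Prop :=
  ∀ (R : ℕ) (a : Fin n → ZMod (2 ^ R)),
    (∀ j, ∑ k, a k * (v k j : ZMod (2 ^ R)) = 0) → ∀ k, 2 ^ σ * a k = 0

/-- The endomorphism of `(ℤ / 2 ^ R) ^ n` given by an integer matrix. -/
def matHom {n : ℕ} (v : Fin n → Fin n → ℤ) (R : ℕ) :
    (Fin n → ZMod (2 ^ R)) →+ (Fin n → ZMod (2 ^ R)) where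
  toFun a j := ∑ k, a k * (v k j : ZMod (2 ^ R))
  map_zero' := by funext j; simp
  map_add' a b := by funext j; simp [add_mul, Finset.sum_add_distrib]

lemma sumHom_lineHom {n : ℕ} (v : Fin n → Fin n → ℤ) (R : ℕ) :
    sumHom (fun k => lineHom (v k) R) = (tors n R).comp (matHom v R) := by
  refine AddMonoidHom.ext fun a => funext fun j => ?_
  rw [sumHom_apply, Finset.sum_apply]
  simp only [AddMonoidHom.comp_apply, tors_apply, matHom, AddMonoidHom.coe_mk, ZeroHom.coe_mk,
    map_sum, lineHom_apply, line]
  refine Finset.sum_congr rfl fun k _ => ?_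
  rw [← map_zsmul, zsmul_eq_mul, mul_comm]

lemma card_ker_matHom_le {n σ : ℕ} {v : Fin n → Fin n → ℤ} (hv : Transversal σ v) (R : ℕ) :
    Nat.card (matHom v R).ker ≤ 2 ^ (σ * n) := by
  classical
  have h1 : Nat.card (matHom v R).ker =
      (Finset.univ.filter fun a => a ∈ (matHom v R).ker).card := by
    rw [Nat.card_eq_fintype_card, Fintype.card_subtype]
  rw [h1]
  have h2 : (Finset.univ.filter fun a => a ∈ (matHom v R).ker) ⊆
      Fintype.piFinset fun _ : Fin n =>
        Finset.univ.filter fun x : ZMod (2 ^ R) => (2 ^ σ : ℕ) • x = 0 := by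
    intro a ha
    simp only [Finset.mem_filter, Finset.mem_univ, true_and, AddMonoidHom.mem_ker,
      Fintype.mem_piFinset] at ha ⊢
    intro k
    rw [nsmul_eq_mul]
    push_cast
    exact hv R a (fun j => congrFun ha j) k
  refine (Finset.card_le_card h2).trans ?_
  rw [Fintype.card_piFinset]
  simp only [Finset.prod_const, Finset.card_univ, Fintype.card_fin]
  rw [pow_mul]
  exact Nat.pow_le_pow_left (IsAddCyclic.card_nsmul_eq_zero_le (by positivity)) n

lemma havg_transversal_le {n σ : ℕ} {v : Fin n → Fin n → ℤ} (hv : Transversal σ v) (R : ℕ)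
    {f : Tor n → ℝ} (hf : ∀ g, 0 ≤ f g) (g : Tor n) :
    havg (sumHom fun k => lineHom (v k) R) f g ≤ 2 ^ (σ * n) * avg R f g := by
  rw [sumHom_lineHom]
  refine havg_comp_le _ _ hf ?_ g
  refine mul_le_mul_of_nonneg_right ?_ (Nat.cast_nonneg _)
  exact_mod_cast card_ker_matHom_le hv R

/-- The constant lost in one transversal averaging step. -/
def stepConst (n σ : ℕ) (β : ℝ) : ℝ := ∏ _j : Fin n, ((2 : ℝ) ^ (σ * n)) ^ β

lemma stepConst_pos (n σ : ℕ) (β : ℝ) : 0 < stepConst n σ β :=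
  Finset.prod_pos fun _ _ => Real.rpow_pos_of_pos (by positivity) _

lemma avg_prod_rpow_le_of_transversal {n σ : ℕ} {v : Fin n → Fin n → ℤ} (hv : Transversal σ v)
    (R : ℕ) (f : Fin n → Tor n → ℝ) (hf : ∀ j g, 0 ≤ f j g)
    (hinv : ∀ j u g, (2 ^ R : ℕ) • u = 0 → f j (g + line (v j) u) = f j g) {β : ℝ} (hβ : 0 < β)
    (hn : β * (n - 1) ≤ 1) (g : Tor n) :
    avg R (fun x => ∏ j, f j x ^ β) g ≤ stepConst n σ β * ∏ j, avg R (f j) g ^ β := by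
  set ψ := sumHom fun k => lineHom (v k) R with hψ
  have hr : ψ.range ≤ (tors n R).range := by
    rw [hψ, sumHom_lineHom]
    rintro _ ⟨a, rfl⟩
    exact ⟨_, rfl⟩
  rw [avg, ← havg_havg _ ψ hr]
  have h1 : ∀ x, havg ψ (fun x => ∏ j, f j x ^ β) x ≤
      stepConst n σ β * ∏ j, avg R (f j) x ^ β := by
    intro x
    refine (havg_sumHom_prod_rpow_le _ f hf
      (fun k a g => hinv k _ g (two_pow_nsmul_toAddCircle a)) hβ hn x).trans ?_
    rw [stepConst, ← Finset.prod_mul_distrib]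
    refine Finset.prod_le_prod (fun j _ => Real.rpow_nonneg (havg_nonneg _ (hf j) _) _)
      fun j _ => ?_
    rw [← Real.mul_rpow (by positivity) (havg_nonneg _ (hf j) _)]
    exact Real.rpow_le_rpow (havg_nonneg _ (hf j) _) (havg_transversal_le hv R (hf j) x) hβ.le
  refine (havg_mono _ h1 g).trans (le_of_eq ?_)
  exact havg_of_inv _ fun a => by simp only [avg, havg_add_map]

namespace AnisoForm
variable {d e : ℕ} (q : AnisoForm d e)

/-- The pointwise square function at scale `m`. -/
def sqf {ι : Type*} (s : Finset ι) (ξ : ι → Fin d → ℤ) (c : ι → ℂ) (m : ℕ)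
    (x : Tor (d + 1)) : ℝ := ∑ θ : Cap d m, ‖q.F (fil s ξ m θ) ξ c x‖ ^ 2

lemma sqf_nonneg {ι : Type*} (s : Finset ι) (ξ : ι → Fin d → ℤ) (c : ι → ℂ) (m : ℕ)
    (x : Tor (d + 1)) : 0 ≤ q.sqf s ξ c m x := Finset.sum_nonneg fun _ _ => by positivity

lemma norm_F_fil_add_tors {ι : Type*} (s : Finset ι) (ξ : ι → Fin d → ℤ) (c : ι → ℂ) {m : ℕ}
    (θ : Cap d m) {h : Tor (d + 1)} (hh : h ∈ (tors (d + 1) m).range) (g : Tor (d + 1)) :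
    ‖q.F (fil s ξ m θ) ξ c (g + h)‖ = ‖q.F (fil s ξ m θ) ξ c g‖ :=
  q.norm_F_add_eq (fun i hi i' hi' => q.chr_pt_tors
    (by rw [(mem_fil.1 hi).2, (mem_fil.1 hi').2]) hh) c g

lemma avg_norm_F_add_line {ι : Type*} {s : Finset ι} {ξ : ι → Fin d → ℤ} (c : ι → ℂ) {m b r : ℕ}
    (hrb : r + b ≤ 2 * m) {ζ : Fin d → ℤ} (hs : ∀ i ∈ s, cap b (ξ i) = cap b ζ)
    (θ : Cap d m) (t : ℝ) {u : UnitAddCircle} (hu : (2 ^ (r + b) : ℕ) • u = 0) (g : Tor (d + 1)) :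
    avg r (fun x => ‖q.F (fil s ξ m θ) ξ c x‖ ^ t) (g + line (q.nor ζ) u) =
      avg r (fun x => ‖q.F (fil s ξ m θ) ξ c x‖ ^ t) g := by
  rcases (fil s ξ m θ).eq_empty_or_nonempty with h0 | ⟨i0, hi0⟩
  · simp [h0, F, avg, havg]
  obtain ⟨η, hη⟩ := cap_eq_iff.1 (hs i0 (mem_fil.1 hi0).1)
  set w : Fin (d + 1) → ℤ := Fin.cons 0 (-(q.S η)) with hw
  have h1 : line (q.nor ζ) u = line (q.nor (ξ i0)) u + line w ((2 ^ b : ℕ) • u) := by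
    funext j
    simp only [line, Pi.add_apply, nor, hw, hη]
    refine Fin.cases ?_ (fun j => ?_) j
    · simp
    · simp only [Fin.cons_succ, Pi.neg_apply, _root_.map_add, map_zsmul, Pi.add_apply,
        Pi.smul_apply, smul_eq_mul]
      rw [← natCast_zsmul u, smul_smul, ← add_smul]
      congr 1
      push_cast
      ring
  have h2 : line w ((2 ^ b : ℕ) • u) ∈ (tors (d + 1) r).range := by
    rw [mem_tors_range]
    intro j
    simp only [line]
    rw [smul_comm, smul_smul, ← pow_add, hu, smul_zero]
  rw [h1, ← add_assoc, avg, havg_add_of_mem _ _ _ h2]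
  refine havg_inv_of_inv _ (fun x => ?_) g
  have hu2 : (2 ^ (2 * m) : ℕ) • u = 0 := by
    rw [← Nat.sub_add_cancel hrb, pow_add, mul_smul, hu, smul_zero]
  rw [q.norm_F_add_eq (fun i hi i' hi' => ?_)]
  exact (q.chr_pt_line (m := m) ((mem_fil.1 hi0).2.trans (mem_fil.1 hi).2.symm) hu2).trans
    (q.chr_pt_line (m := m) ((mem_fil.1 hi0).2.trans (mem_fil.1 hi').2.symm) hu2).symm

/-- Iterated transversal averaging of products of sums of powers of small pieces. -/
lemma avg_prod_weighted_le {ι : Type*} {s : Fin (d + 1) → Finset ι} {ξ : ι → Fin d → ℤ}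
    (c : ι → ℂ) {m b σ : ℕ} {ζ : Fin (d + 1) → Fin d → ℤ}
    (hs : ∀ j, ∀ i ∈ s j, cap b (ξ i) = cap b (ζ j)) (hT : Transversal σ fun j => q.nor (ζ j))
    (w : Fin (d + 1) → Cap d m → ℝ) (hw : ∀ j θ, 0 ≤ w j θ) {t β : ℝ} (hβ : 0 < β)
    (hn : β * d ≤ 1) (l : ℕ) (hl : b * l ≤ m) (g : Tor (d + 1)) :
    avg (m + b * l) (fun x => ∏ j, (∑ θ, w j θ * ‖q.F (fil (s j) ξ m θ) ξ c x‖ ^ t) ^ β) g ≤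
      stepConst (d + 1) σ β ^ l *
        ∏ j, avg (m + b * l) (fun x => ∑ θ, w j θ * ‖q.F (fil (s j) ξ m θ) ξ c x‖ ^ t) g ^ β := by
  set f : Fin (d + 1) → Tor (d + 1) → ℝ :=
    fun j x => ∑ θ, w j θ * ‖q.F (fil (s j) ξ m θ) ξ c x‖ ^ t with hfdef
  have hf : ∀ j x, 0 ≤ f j x := fun j x => Finset.sum_nonneg fun θ _ =>
    mul_nonneg (hw j θ) (Real.rpow_nonneg (norm_nonneg _) _)
  change avg (m + b * l) (fun x => ∏ j, f j x ^ β) g ≤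
    stepConst (d + 1) σ β ^ l * ∏ j, avg (m + b * l) (f j) g ^ β
  induction l generalizing g with
  | zero =>
    have hinv : ∀ j x a, f j (x + tors (d + 1) m a) = f j x := by
      intro j x a
      simp only [hfdef, q.norm_F_fil_add_tors (s j) ξ c _ ⟨a, rfl⟩]
    simp only [mul_zero, add_zero, pow_zero, one_mul]
    rw [avg, havg_of_inv _ (fun a => by simp only [hinv])]
    refine le_of_eq (Finset.prod_congr rfl fun j _ => ?_)
    rw [avg, havg_of_inv _ (fun a => hinv j g a)]
  | succ l ih =>
    have hl' : b * l ≤ m := (Nat.mul_le_mul_left b (Nat.le_succ l)).trans hl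
    have hr : m + b * l ≤ m + b * (l + 1) := by rw [mul_add]; omega
    rw [← avg_avg hr]
    refine (havg_mono _ (ih hl') g).trans ?_
    rw [havg_const_mul, pow_succ, mul_assoc]
    refine mul_le_mul_of_nonneg_left ?_ (pow_nonneg (stepConst_pos _ _ _).le _)
    have key := avg_prod_rpow_le_of_transversal hT (m + b * (l + 1))
      (fun j => avg (m + b * l) (f j)) (fun j x => havg_nonneg _ (hf j) x) ?_ hβ
      (by push_cast; simpa using hn) g
    · simpa only [avg_avg hr] using key
    · intro j u x hu
      have hfj : ∀ y, avg (m + b * l) (f j) y =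
          ∑ θ, w j θ * avg (m + b * l) (fun x => ‖q.F (fil (s j) ξ m θ) ξ c x‖ ^ t) y := by
        intro y
        rw [avg, hfdef, havg_sum]
        exact Finset.sum_congr rfl fun θ _ => havg_const_mul _ _ _ _
      rw [hfj, hfj]
      refine Finset.sum_congr rfl fun θ _ => ?_
      rw [q.avg_norm_F_add_line c (by rw [mul_add] at hl; omega) (hs j) θ t (b := b)]
      rwa [mul_add, mul_one, ← add_assoc] at hu

/-- Ball inflation. -/
lemma ball_inflation {ι : Type*} {s : Fin (d + 1) → Finset ι} {ξ : ι → Fin d → ℤ}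
    (c : ι → ℂ) {b σ : ℕ} {ζ : Fin (d + 1) → Fin d → ℤ} (hd : d ≤ 3)
    (hs : ∀ j, ∀ i ∈ s j, cap b (ξ i) = cap b (ζ j)) (hT : Transversal σ fun j => q.nor (ζ j))
    (l m : ℕ) (hm : m = b * l) (g : Tor (d + 1)) :
    avg (2 * m) (fun x => ∏ j, q.sqf (s j) ξ c m x ^ ((5 / 3 : ℝ) / (d + 1))) g ≤
      stepConst (d + 1) σ ((4 / 3 : ℝ) / (d + 1)) ^ l *
        ∏ j, (∑ θ, avg (2 * m) (fun x => ‖q.F (fil (s j) ξ m θ) ξ c x‖ ^ (5 / 2 : ℝ)) g ^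
          (4 / 5 : ℝ)) ^ ((5 / 3 : ℝ) / (d + 1)) := by
  set β : ℝ := (4 / 3 : ℝ) / (d + 1) with hβdef
  have hd1 : (0 : ℝ) < d + 1 := by positivity
  have hβ : 0 < β := by positivity
  have hβ5 : (5 / 3 : ℝ) / (d + 1) = (5 / 4) * β := by rw [hβdef]; field_simp
  have hn : β * d ≤ 1 := by
    have : (d : ℝ) ≤ 3 := by exact_mod_cast hd
    rw [hβdef, div_mul_eq_mul_div, div_le_one hd1]
    linarith
  set N : Fin (d + 1) → Cap d m → Tor (d + 1) → ℝ := fun j θ x => ‖q.F (fil (s j) ξ m θ) ξ c x‖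
  have hN : ∀ j θ x, 0 ≤ N j θ x := fun _ _ _ => norm_nonneg _
  set a : Fin (d + 1) → Cap d m → ℝ := fun j θ =>
    avg (2 * m) (fun x => N j θ x ^ (5 / 2 : ℝ)) g ^ (4 / 5 : ℝ) with hadef
  have havn : ∀ j θ, 0 ≤ avg (2 * m) (fun x => N j θ x ^ (5 / 2 : ℝ)) g := fun j θ =>
    havg_nonneg _ (fun x => Real.rpow_nonneg (hN j θ x) _) g
  have ha : ∀ j θ, 0 ≤ a j θ := fun j θ => Real.rpow_nonneg (havn j θ) _
  have haz : ∀ j θ, a j θ = 0 → avg (2 * m) (fun x => N j θ x ^ (5 / 2 : ℝ)) g = 0 := by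
    intro j θ h
    rwa [hadef, Real.rpow_eq_zero (havn j θ) (by norm_num)] at h
  have hz : ∀ j θ, a j θ = 0 → ∀ y, N j θ (g + tors (d + 1) (2 * m) y) = 0 := by
    intro j θ h y
    have h0 := haz j θ h
    rw [avg, havg, div_eq_zero_iff, or_iff_left (card_pos_real _).ne',
      Finset.sum_eq_zero_iff_of_nonneg fun _ _ => Real.rpow_nonneg (hN _ _ _) _] at h0
    have h1 := h0 y (Finset.mem_univ y)
    rwa [Real.rpow_eq_zero (hN _ _ _) (by norm_num)] at h1
  set f : Fin (d + 1) → Tor (d + 1) → ℝ := fun j x =>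
    ∑ θ, a j θ ^ (1 - 5 / 4 : ℝ) * N j θ x ^ (5 / 2 : ℝ) with hfdef
  have hf : ∀ j x, 0 ≤ f j x := fun j x => Finset.sum_nonneg fun θ _ =>
    mul_nonneg (Real.rpow_nonneg (ha j θ) _) (Real.rpow_nonneg (hN j θ x) _)
  have hA : ∀ j, 0 ≤ ∑ θ, a j θ := fun j => Finset.sum_nonneg fun θ _ => ha j θ
  have hpt : ∀ y, ∏ j, q.sqf (s j) ξ c m (g + tors (d + 1) (2 * m) y) ^ ((5 / 3 : ℝ) / (d + 1)) ≤
      (∏ j, ((∑ θ, a j θ) ^ (5 / 4 - 1 : ℝ)) ^ β) *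
        ∏ j, f j (g + tors (d + 1) (2 * m) y) ^ β := by
    intro y
    rw [← Finset.prod_mul_distrib]
    refine Finset.prod_le_prod (fun j _ => Real.rpow_nonneg (q.sqf_nonneg _ _ _ _ _) _) fun j _ => ?_
    rw [hβ5, Real.rpow_mul (q.sqf_nonneg _ _ _ _ _),
      ← Real.mul_rpow (Real.rpow_nonneg (hA j) _) (hf j _)]
    refine Real.rpow_le_rpow (Real.rpow_nonneg (q.sqf_nonneg _ _ _ _ _) _) ?_ hβ.le
    have := rpow_sum_le_weighted Finset.univ
      (v := fun θ => N j θ (g + tors (d + 1) (2 * m) y) ^ 2) (a := a j)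
      (fun θ _ => by positivity) (fun θ _ => ha j θ)
      (fun θ _ h => by rw [hz j θ h y]; simp) (r := 5 / 4) (by norm_num)
    refine this.trans (le_of_eq ?_)
    congr 1
    refine Finset.sum_congr rfl fun θ _ => ?_
    congr 1
    rw [← Real.rpow_natCast, ← Real.rpow_mul (hN _ _ _)]
    norm_num
  have h1 : avg (2 * m) (fun x => ∏ j, q.sqf (s j) ξ c m x ^ ((5 / 3 : ℝ) / (d + 1))) g ≤
      avg (2 * m) (fun x => (∏ j, ((∑ θ, a j θ) ^ (5 / 4 - 1 : ℝ)) ^ β) * ∏ j, f j x ^ β) g := by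
    have := card_pos_real (Fin (d + 1) → ZMod (2 ^ (2 * m)))
    unfold avg havg
    gcongr with y
    exact hpt y
  have h2 := q.avg_prod_weighted_le c hs hT (fun j θ => a j θ ^ (1 - 5 / 4 : ℝ))
    (fun j θ => Real.rpow_nonneg (ha j θ) _) (t := 5 / 2) hβ hn l hm.ge g
  rw [← hm, ← two_mul] at h2
  have h3 : ∀ j, avg (2 * m) (f j) g = ∑ θ, a j θ := by
    intro j
    rw [avg, hfdef, havg_sum]
    refine Finset.sum_congr rfl fun θ _ => ?_
    rw [havg_const_mul]
    rcases (ha j θ).eq_or_lt with h0 | h0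
    · have := haz j θ h0.symm
      rw [avg] at this
      rw [this, ← h0, mul_zero]
    · have : avg (2 * m) (fun x => N j θ x ^ (5 / 2 : ℝ)) g = a j θ ^ (5 / 4 : ℝ) := by
        rw [hadef, ← Real.rpow_mul (havn j θ)]
        norm_num
      rw [avg] at this
      rw [this, ← Real.rpow_add h0]
      norm_num
  refine h1.trans ?_
  rw [avg, havg_const_mul]
  refine (mul_le_mul_of_nonneg_left h2 (Finset.prod_nonneg fun j _ =>
    Real.rpow_nonneg (Real.rpow_nonneg (hA j) _) _)).trans (le_of_eq ?_)
  rw [mul_left_comm, ← Finset.prod_mul_distrib]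
  congr 1
  refine Finset.prod_congr rfl fun j _ => ?_
  have h4 := h3 j
  simp only [hfdef, N] at h4
  rw [h4, ← Real.mul_rpow (Real.rpow_nonneg (hA j) _) (hA j), hβ5, Real.rpow_mul (hA j)]
  congr 1
  rcases (hA j).eq_or_lt with h0 | h0
  · rw [← h0]; norm_num
  · nth_rewrite 2 [← Real.rpow_one (∑ θ, a j θ)]
    rw [← Real.rpow_add h0]
    norm_num

end AnisoForm

/-! ### Decoupling constants and rescaling -/

/-- Sums over the classes of a labelling depend only on the induced partition. -/
lemma sum_filter_label {ι A M : Type*} [Fintype A] [DecidableEq A] [DecidableEq ι]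
    [AddCommMonoid M] (s : Finset ι) (f : ι → A) (G : Finset ι → M) (hG : G ∅ = 0) :
    ∑ a, G (s.filter fun i => f i = a) =
      ∑ P ∈ s.image (fun i => s.filter fun i' => f i' = f i), G P := by
  have h1 : s.image (fun i => s.filter fun i' => f i' = f i) =
      (s.image f).image fun a => s.filter fun i' => f i' = a := by
    rw [Finset.image_image]; rfl
  rw [h1, Finset.sum_image]
  · refine (Finset.sum_subset (Finset.subset_univ _) fun a _ ha => ?_).symm
    rw [Finset.filter_false_of_mem, hG]
    rintro i hi rfl
    exact ha (Finset.mem_image_of_mem f hi)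
  · intro a ha b _ hab
    obtain ⟨i, hi, rfl⟩ := Finset.mem_image.1 ha
    have : i ∈ s.filter fun i' => f i' = f i := by simp [hi]
    simp only at hab
    rw [hab] at this
    exact (Finset.mem_filter.1 this).2

lemma sum_fil_congr {ι M : Type*} [AddCommMonoid M] {d d' : ℕ} (s : Finset ι)
    (ξ : ι → Fin d → ℤ) (ξ' : ι → Fin d' → ℤ) (m m' : ℕ)
    (h : ∀ i ∈ s, ∀ i' ∈ s, cap m (ξ i') = cap m (ξ i) ↔ cap m' (ξ' i') = cap m' (ξ' i))
    (G : Finset ι → M) (hG : G ∅ = 0) :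
    ∑ θ, G (fil s ξ m θ) = ∑ θ, G (fil s ξ' m' θ) := by
  classical
  have h1 : ∀ (d m : ℕ) (ξ : ι → Fin d → ℤ), ∑ θ, G (fil s ξ m θ) =
      ∑ P ∈ s.image (fun i => s.filter fun i' => cap m (ξ i') = cap m (ξ i)), G P := by
    intro d m ξ
    rw [← sum_filter_label s (fun i => cap m (ξ i)) G hG]
    refine Finset.sum_congr rfl fun θ _ => congrArg G ?_
    ext i
    simp [mem_fil]
  rw [h1, h1]
  congr 1
  refine Finset.image_congr fun i hi => Finset.filter_congr fun i' hi' => h i hi i' hi'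

namespace AnisoForm
variable {d e : ℕ} (q : AnisoForm d e)

/-- The integrand `|F| ^ (10 / 3)`. -/
def Fp {ι : Type*} (s : Finset ι) (ξ : ι → Fin d → ℤ) (c : ι → ℂ) (x : Tor (d + 1)) : ℝ :=
  ‖q.F s ξ c x‖ ^ (10 / 3 : ℝ)

lemma Fp_nonneg {ι : Type*} (s : Finset ι) (ξ : ι → Fin d → ℤ) (c : ι → ℂ) (x : Tor (d + 1)) :
    0 ≤ q.Fp s ξ c x := Real.rpow_nonneg (norm_nonneg _) _

lemma Fp_empty {ι : Type*} (ξ : ι → Fin d → ℤ) (c : ι → ℂ) : q.Fp ∅ ξ c = fun _ => 0 := by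
  funext x; simp [Fp, F, Real.zero_rpow]

/-- The square-summed norms of the pieces at scale `N`. -/
def dn {A ι : Type*} [AddCommGroup A] [Fintype A] (φ : A →+ Tor (d + 1)) (s : Finset ι)
    (ξ : ι → Fin d → ℤ) (c : ι → ℂ) (N : ℕ) (g : Tor (d + 1)) : ℝ :=
  ∑ θ : Cap d N, havg φ (q.Fp (fil s ξ N θ) ξ c) g ^ (3 / 5 : ℝ)

section
variable {A ι : Type*} [AddCommGroup A] [Fintype A]

lemma havg_Fp_nonneg (φ : A →+ Tor (d + 1)) (s : Finset ι)
    (ξ : ι → Fin d → ℤ) (c : ι → ℂ) (g : Tor (d + 1)) : 0 ≤ havg φ (q.Fp s ξ c) g :=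
  havg_nonneg _ (q.Fp_nonneg s ξ c) g

lemma dn_nonneg (φ : A →+ Tor (d + 1)) (s : Finset ι)
    (ξ : ι → Fin d → ℤ) (c : ι → ℂ) (N : ℕ) (g : Tor (d + 1)) : 0 ≤ q.dn φ s ξ c N g :=
  Finset.sum_nonneg fun _ _ => Real.rpow_nonneg (q.havg_Fp_nonneg _ _ _ _ _) _

lemma havg_Fp_empty (φ : A →+ Tor (d + 1)) (ξ : ι → Fin d → ℤ) (c : ι → ℂ) (g : Tor (d + 1)) :
    havg φ (q.Fp ∅ ξ c) g = 0 := by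
  rw [q.Fp_empty]; simp [havg]
end

/-- `K` is an admissible decoupling constant at scale `N`. -/
def Dec (N : ℕ) (K : ℝ) : Prop :=
  ∀ (ι : Type) (s : Finset ι) (ξ : ι → Fin d → ℤ) (c : ι → ℂ) (g : Tor (d + 1)),
    avg (2 * N) (q.Fp s ξ c) g ≤ K * q.dn (tors (d + 1) (2 * N)) s ξ c N g ^ (5 / 3 : ℝ)

variable {q}

lemma Dec.mono {N : ℕ} {K K' : ℝ} (h : q.Dec N K) (hK : K ≤ K') : q.Dec N K' :=
  fun ι s ξ c g => (h ι s ξ c g).trans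
    (mul_le_mul_of_nonneg_right hK (Real.rpow_nonneg (q.dn_nonneg _ _ _ _ _ _) _))

/-- Minkowski's inequality for the square-summed norms. -/
lemma havg_dn_le {A B ι : Type*} [AddCommGroup A] [Fintype A] [AddCommGroup B] [Fintype B]
    (φ : A →+ Tor (d + 1)) (ψ : B →+ Tor (d + 1))
    (hφ : ψ.range ≤ φ.range) (s : Finset ι) (ξ : ι → Fin d → ℤ) (c : ι → ℂ) (N : ℕ)
    (g : Tor (d + 1)) :
    havg φ (fun x => q.dn ψ s ξ c N x ^ (5 / 3 : ℝ)) g ≤ q.dn φ s ξ c N g ^ (5 / 3 : ℝ) := by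
  have h1 := havg_rpow_sum_le φ Finset.univ
    (fun θ : Cap d N => havg ψ (q.Fp (fil s ξ N θ) ξ c))
    (fun θ g => q.havg_Fp_nonneg _ _ _ _ g) (r := 5 / 3) (by norm_num) g
  have h2 : ((5 / 3 : ℝ))⁻¹ = 3 / 5 := by norm_num
  simpa only [h2, havg_havg _ _ hφ, dn] using h1

lemma Dec.havg_le {N : ℕ} {K : ℝ} (h : q.Dec N K) (hK : 0 ≤ K) {A : Type*} [AddCommGroup A]
    [Fintype A] (φ : A →+ Tor (d + 1)) (hφ : (tors (d + 1) (2 * N)).range ≤ φ.range) {ι : Type}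
    (s : Finset ι) (ξ : ι → Fin d → ℤ) (c : ι → ℂ) (g : Tor (d + 1)) :
    havg φ (q.Fp s ξ c) g ≤ K * q.dn φ s ξ c N g ^ (5 / 3 : ℝ) := by
  rw [← havg_havg φ _ hφ]
  refine (havg_mono φ (h ι s ξ c) g).trans ?_
  rw [havg_const_mul]
  exact mul_le_mul_of_nonneg_left (havg_dn_le φ _ hφ s ξ c N g) hK

variable (q)

lemma exists_nsmul_eq {n : ℕ} (hn : n ≠ 0) (y : UnitAddCircle) : ∃ x : UnitAddCircle, n • x = y := by
  induction y using QuotientAddGroup.induction_on with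
  | H z =>
    refine ⟨((z / n : ℝ) : UnitAddCircle), ?_⟩
    have : (((n • (z / n) : ℝ)) : UnitAddCircle) = (z : UnitAddCircle) := by
      rw [nsmul_eq_mul, mul_div_cancel₀ _ (by exact_mod_cast hn)]
    exact this

/-- Parabolic rescaling of the torus. -/
def rescale (m : ℕ) (ξ₀ : Fin d → ℤ) : Tor (d + 1) →+ Tor (d + 1) where
  toFun g := Fin.cons ((4 : ℤ) ^ m • g 0) fun j => (2 : ℤ) ^ m • g j.succ + (2 ^ m * q.S ξ₀ j) • g 0
  map_zero' := by
    funext j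
    refine Fin.cases ?_ (fun j => ?_) j <;> simp
  map_add' a b := by
    funext j
    refine Fin.cases ?_ (fun j => ?_) j
    · simp
    · simp only [Fin.cons_succ, Pi.add_apply, smul_add]
      abel

lemma rescale_zero (m : ℕ) (ξ₀ : Fin d → ℤ) (g : Tor (d + 1)) :
    q.rescale m ξ₀ g 0 = (4 : ℤ) ^ m • g 0 := rfl

lemma rescale_succ (m : ℕ) (ξ₀ : Fin d → ℤ) (g : Tor (d + 1)) (j : Fin d) :
    q.rescale m ξ₀ g j.succ = (2 : ℤ) ^ m • g j.succ + (2 ^ m * q.S ξ₀ j) • g 0 := rfl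

lemma pair_pt_rescale (m : ℕ) (ξ₀ η : Fin d → ℤ) (g : Tor (d + 1)) :
    pair (q.pt (ξ₀ + (2 : ℤ) ^ m • η)) g =
      pair (q.pt ξ₀) g + pair (q.pt η) (q.rescale m ξ₀ g) := by
  simp only [pair, Fin.sum_univ_succ, pt, Fin.cons_zero, Fin.cons_succ, rescale_zero, rescale_succ,
    q.map_add, q.map_smul, Pi.add_apply, Pi.smul_apply, smul_eq_mul, add_smul, smul_add,
    Finset.sum_add_distrib, smul_smul, dotProduct, Finset.sum_smul]
  have h1 : ∀ x, η x * (2 ^ m * q.S ξ₀ x) = q.S ξ₀ x * (2 ^ m * η x) := fun x => by ring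
  have h2 : ∀ x, η x * 2 ^ m = 2 ^ m * η x := fun x => by ring
  have h3 : q.Q η * 4 ^ m = (2 ^ m) ^ 2 * q.Q η := by
    rw [mul_comm, ← pow_mul, mul_comm m 2, pow_mul]; norm_num
  simp only [h1, h2, h3]
  abel

lemma norm_F_rescale {ι : Type*} (s : Finset ι) (m : ℕ) (ξ₀ : Fin d → ℤ) (η : ι → Fin d → ℤ)
    (c : ι → ℂ) (g : Tor (d + 1)) {ξ : ι → Fin d → ℤ}
    (hξ : ∀ i ∈ s, ξ i = ξ₀ + (2 : ℤ) ^ m • η i) :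
    ‖q.F s ξ c g‖ = ‖q.F s η c (q.rescale m ξ₀ g)‖ := by
  have : q.F s ξ c g = chr (q.pt ξ₀) g * q.F s η c (q.rescale m ξ₀ g) := by
    simp only [F, Finset.mul_sum]
    refine Finset.sum_congr rfl fun i hi => ?_
    rw [hξ i hi]
    unfold chr
    rw [pair_pt_rescale, AddCircle.toCircle_add, Circle.coe_mul]
    ring
  rw [this, norm_mul, norm_chr, one_mul]

lemma range_rescale {N m : ℕ} (hm : m ≤ N) (ξ₀ : Fin d → ℤ) :
    (tors (d + 1) (2 * (N - m))).range ≤ ((q.rescale m ξ₀).comp (tors (d + 1) (2 * N))).range := by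
  intro h hh
  rw [mem_tors_range] at hh
  have key : ∀ (k : ℕ) (y : UnitAddCircle), k ≤ 2 * N → (2 ^ (2 * N - k) : ℕ) • y = 0 →
      ∃ x : UnitAddCircle, (2 ^ k : ℕ) • x = y ∧ (2 ^ (2 * N) : ℕ) • x = 0 := by
    intro k y hk hy
    obtain ⟨x, hx⟩ := exists_nsmul_eq (pow_ne_zero k two_ne_zero) y
    refine ⟨x, hx, ?_⟩
    rw [← Nat.sub_add_cancel hk, pow_add, mul_smul, hx, hy]
  obtain ⟨t, ht, ht'⟩ := key (2 * m) (h 0) (by omega) (by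
    have := hh 0; rwa [Nat.mul_sub] at this)
  have hx : ∀ j : Fin d, ∃ x : UnitAddCircle,
      (2 ^ m : ℕ) • x = h j.succ - (2 ^ m * q.S ξ₀ j) • t ∧ (2 ^ (2 * N) : ℕ) • x = 0 := by
    intro j
    refine key m _ (by omega) ?_
    have h1 : (2 ^ (2 * N - m) : ℕ) • h j.succ = 0 := by
      have : 2 * N - m = m + 2 * (N - m) := by omega
      rw [this, pow_add, mul_smul, hh, smul_zero]
    have h2 : (2 ^ (2 * N - m) : ℕ) • ((2 ^ m * q.S ξ₀ j) • t) = 0 := by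
      rw [← natCast_zsmul, smul_smul]
      refine zsmul_eq_zero_of_dvd ht' ⟨q.S ξ₀ j, ?_⟩
      have : 2 * N = (2 * N - m) + m := by omega
      conv_rhs => rw [this]
      push_cast
      rw [pow_add]
      ring
    rw [smul_sub, h1, h2, sub_zero]
  choose x hx hx' using hx
  have hmem : (Fin.cons t x : Tor (d + 1)) ∈ (tors (d + 1) (2 * N)).range := by
    rw [mem_tors_range]
    intro j
    refine Fin.cases ?_ (fun j => ?_) j
    · simpa using ht'
    · simpa using hx' j
  obtain ⟨a, ha⟩ := hmem
  refine ⟨a, ?_⟩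
  rw [AddMonoidHom.comp_apply, ha]
  funext j
  refine Fin.cases ?_ (fun j => ?_) j
  · rw [rescale_zero, ← ht, pow_mul, ← natCast_zsmul]
    simp
  · rw [rescale_succ]
    simp only [Fin.cons_succ, Fin.cons_zero]
    have := hx j
    rw [← natCast_zsmul] at this
    push_cast at this
    rw [this, sub_add_cancel]

variable {q}

/-- Decoupling of a piece at scale `m` into pieces at scale `N`. -/
lemma Dec.rescale {N m : ℕ} (hm : m ≤ N) {K : ℝ} (h : q.Dec (N - m) K) (hK : 0 ≤ K) {ι : Type}
    (s : Finset ι) (ξ : ι → Fin d → ℤ) (c : ι → ℂ)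
    (hs : ∀ i ∈ s, ∀ i' ∈ s, cap m (ξ i) = cap m (ξ i')) (g : Tor (d + 1)) :
    avg (2 * N) (q.Fp s ξ c) g ≤ K * q.dn (tors (d + 1) (2 * N)) s ξ c N g ^ (5 / 3 : ℝ) := by
  classical
  rcases s.eq_empty_or_nonempty with rfl | ⟨i0, hi0⟩
  · rw [avg, q.havg_Fp_empty]
    exact mul_nonneg hK (Real.rpow_nonneg (q.dn_nonneg _ _ _ _ _ _) _)
  have h1 : ∀ i, ∃ η : Fin d → ℤ, i ∈ s → ξ i = ξ i0 + (2 : ℤ) ^ m • η := by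
    intro i
    by_cases hi : i ∈ s
    · obtain ⟨η, hη⟩ := cap_eq_iff.1 (hs i0 hi0 i hi)
      exact ⟨η, fun _ => hη⟩
    · exact ⟨0, fun h => absurd h hi⟩
  choose η hη using h1
  have hF : ∀ s' ⊆ s, q.Fp s' ξ c = fun x => q.Fp s' η c (q.rescale m (ξ i0) x) := by
    intro s' hs'
    funext x
    rw [Fp, Fp, q.norm_F_rescale s' m (ξ i0) η c x fun i hi => hη i (hs' hi)]
  have hl : ∀ i ∈ s, ∀ i' ∈ s, cap N (ξ i') = cap N (ξ i) ↔ cap (N - m) (η i') = cap (N - m) (η i) := by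
    intro i hi i' hi'
    rw [cap_eq_iff, cap_eq_iff, hη i hi, hη i' hi']
    have h2 : (2 : ℤ) ^ N = 2 ^ m * 2 ^ (N - m) := by rw [← pow_add, Nat.add_sub_cancel' hm]
    have h20 : (2 : ℤ) ^ m ≠ 0 := by positivity
    refine exists_congr fun y => ?_
    rw [h2, mul_smul, add_assoc, ← smul_add]
    constructor
    · intro h
      exact smul_right_injective _ h20 (add_left_cancel h)
    · intro h; rw [h]
  have hsum : q.dn (tors (d + 1) (2 * N)) s ξ c N g =
      q.dn ((q.rescale m (ξ i0)).comp (tors (d + 1) (2 * N))) s η c (N - m)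
        (q.rescale m (ξ i0) g) := by
    unfold dn
    rw [← sum_fil_congr s ξ η N (N - m) hl (fun P =>
      havg ((q.rescale m (ξ i0)).comp (tors (d + 1) (2 * N))) (q.Fp P η c)
        (q.rescale m (ξ i0) g) ^ (3 / 5 : ℝ))]
    · refine Finset.sum_congr rfl fun θ _ => ?_
      rw [hF _ (fun i hi => (mem_fil.1 hi).1), havg_comp]
    · rw [q.havg_Fp_empty, Real.zero_rpow (by norm_num)]
  rw [hsum, avg, hF s subset_rfl, havg_comp]
  exact h.havg_le hK _ (q.range_rescale hm _) s η c _

end AnisoForm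

/-! ### The multilinear iteration -/

lemma havg_mul_rpow_le {A G : Type*} [AddCommGroup A] [Fintype A] [AddCommGroup G] (φ : A →+ G)
    {u v : G → ℝ} (hu : ∀ x, 0 ≤ u x) (hv : ∀ x, 0 ≤ v x) {α β : ℝ} (hα : 0 < α) (hβ : 0 < β)
    (h : α + β ≤ 1) (g : G) :
    havg φ (fun x => u x ^ α * v x ^ β) g ≤ havg φ u g ^ α * havg φ v g ^ β := by
  have := havg_prod_rpow_le φ (Finset.univ : Finset (Fin 2)) ![u, v]
    (fun k x => by fin_cases k; exacts [hu x, hv x]) (β := ![α, β])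
    (fun k _ => by fin_cases k; exacts [hα, hβ]) (by simpa using h) g
  simpa using this

lemma havg_rpow_interp {A G : Type*} [AddCommGroup A] [Fintype A] [AddCommGroup G] (φ : A →+ G)
    {f : G → ℝ} (hf : ∀ x, 0 ≤ f x) (g : G) :
    havg φ (fun x => f x ^ (5 / 2 : ℝ)) g ^ (4 / 5 : ℝ) ≤
      havg φ (fun x => f x ^ 2) g ^ (1 / 2 : ℝ) *
        (havg φ (fun x => f x ^ (10 / 3 : ℝ)) g ^ (3 / 5 : ℝ)) ^ (1 / 2 : ℝ) := by
  have h1 : ∀ x, f x ^ (5 / 2 : ℝ) = (f x ^ 2) ^ (5 / 8 : ℝ) * (f x ^ (10 / 3 : ℝ)) ^ (3 / 8 : ℝ) := by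
    intro x
    rw [← Real.rpow_natCast, ← Real.rpow_mul (hf x), ← Real.rpow_mul (hf x),
      ← Real.rpow_add_of_nonneg (hf x) (by norm_num) (by norm_num)]
    norm_num
  have h2 := havg_mul_rpow_le φ (u := fun x => f x ^ 2) (v := fun x => f x ^ (10 / 3 : ℝ))
    (fun x => by positivity) (fun x => Real.rpow_nonneg (hf x) _) (α := 5 / 8) (β := 3 / 8)
    (by norm_num) (by norm_num) (by norm_num) g
  have e2 : 0 ≤ havg φ (fun x => f x ^ 2) g := havg_nonneg _ (fun x => by positivity) g
  have e3 : 0 ≤ havg φ (fun x => f x ^ (10 / 3 : ℝ)) g :=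
    havg_nonneg _ (fun x => Real.rpow_nonneg (hf x) _) g
  simp only [h1]
  refine (Real.rpow_le_rpow (havg_nonneg _ (fun x => ?_) g) h2 (by norm_num)).trans (le_of_eq ?_)
  · have := hf x; positivity
  rw [Real.mul_rpow (Real.rpow_nonneg e2 _) (Real.rpow_nonneg e3 _), ← Real.rpow_mul e2,
    ← Real.rpow_mul e3, ← Real.rpow_mul e3]
  norm_num

lemma havg_prod_rpow_inv_le {A G : Type*} [AddCommGroup A] [Fintype A] [AddCommGroup G]
    (φ : A →+ G) {d : ℕ} (f : Fin (d + 1) → G → ℝ) (hf : ∀ j x, 0 ≤ f j x) {B : ℝ} (hB : 0 ≤ B)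
    {g : G} (h : ∀ j, havg φ (f j) g ≤ B) :
    havg φ (fun x => ∏ j, f j x ^ ((1 : ℝ) / (d + 1))) g ≤ B := by
  have hd : (0 : ℝ) < d + 1 := by positivity
  refine (havg_prod_rpow_le φ Finset.univ f hf (fun _ _ => by positivity) ?_ g).trans ?_
  · simp only [Finset.sum_const, Finset.card_univ, Fintype.card_fin, nsmul_eq_mul]
    push_cast
    rw [mul_one_div_cancel hd.ne']
  · refine (Finset.prod_le_prod (fun j _ => Real.rpow_nonneg (havg_nonneg _ (hf j) g) _)
      fun j _ => Real.rpow_le_rpow (havg_nonneg _ (hf j) g) (h j) (by positivity)).trans ?_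
    rw [Finset.prod_const, Finset.card_univ, Fintype.card_fin, ← Real.rpow_natCast,
      ← Real.rpow_mul hB]
    push_cast
    rw [one_div_mul_cancel hd.ne', Real.rpow_one]

namespace AnisoForm
variable {d e : ℕ} {q : AnisoForm d e}

lemma sum_fil_fil {ι M : Type*} [AddCommMonoid M] (s : Finset ι) (ξ : ι → Fin d → ℤ) {m N : ℕ}
    (h : m ≤ N) (Θ : Cap d N) (G : Finset ι → M) (hG : G ∅ = 0) :
    ∑ θ, G (fil (fil s ξ m θ) ξ N Θ) = G (fil s ξ N Θ) := by
  classical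
  rcases (fil s ξ N Θ).eq_empty_or_nonempty with h0 | ⟨i0, hi0⟩
  · rw [h0, hG]
    refine Finset.sum_eq_zero fun θ _ => ?_
    have : fil (fil s ξ m θ) ξ N Θ = ∅ := by
      rw [Finset.eq_empty_iff_forall_notMem] at h0 ⊢
      intro i hi
      simp only [mem_fil] at hi h0
      exact h0 i ⟨hi.1.1, hi.2⟩
    rw [this, hG]
  · rw [mem_fil] at hi0
    rw [Finset.sum_eq_single (cap m (ξ i0))]
    · congr 1
      ext i
      simp only [mem_fil]
      constructor
      · exact fun hi => ⟨hi.1.1, hi.2⟩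
      · exact fun hi => ⟨⟨hi.1, cap_le h (hi.2.trans hi0.2.symm)⟩, hi.2⟩
    · intro θ _ hθ
      have : fil (fil s ξ m θ) ξ N Θ = ∅ := by
        rw [Finset.eq_empty_iff_forall_notMem]
        intro i hi
        simp only [mem_fil] at hi
        exact hθ (hi.1.2.symm.trans (cap_le h (hi.2.trans hi0.2.symm)))
      rw [this, hG]
    · simp

section
variable {A ι : Type*} [AddCommGroup A] [Fintype A]

lemma sum_dn_fil (φ : A →+ Tor (d + 1)) (s : Finset ι) (ξ : ι → Fin d → ℤ) (c : ι → ℂ) {m N : ℕ}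
    (h : m ≤ N) (g : Tor (d + 1)) :
    ∑ θ, q.dn φ (fil s ξ m θ) ξ c N g = q.dn φ s ξ c N g := by
  unfold dn
  rw [Finset.sum_comm]
  refine Finset.sum_congr rfl fun Θ _ => ?_
  refine sum_fil_fil s ξ h Θ (fun P => havg φ (q.Fp P ξ c) g ^ (3 / 5 : ℝ)) ?_
  rw [q.havg_Fp_empty, Real.zero_rpow (by norm_num)]

lemma dn_fil_le (φ : A →+ Tor (d + 1)) (s : Finset ι) (ξ : ι → Fin d → ℤ) (c : ι → ℂ) {m N : ℕ}
    (h : m ≤ N) (θ : Cap d m) (g : Tor (d + 1)) :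
    q.dn φ (fil s ξ m θ) ξ c N g ≤ q.dn φ s ξ c N g := by
  rw [← sum_dn_fil φ s ξ c h g]
  exact Finset.single_le_sum (f := fun θ => q.dn φ (fil s ξ m θ) ξ c N g)
    (fun θ _ => q.dn_nonneg _ _ _ _ _ _) (Finset.mem_univ θ)

lemma sqf_eq (s : Finset ι) (ξ : ι → Fin d → ℤ) (c : ι → ℂ) (m : ℕ) (x : Tor (d + 1)) :
    q.sqf s ξ c m x = ∑ θ : Cap d m, q.Fp (fil s ξ m θ) ξ c x ^ (3 / 5 : ℝ) := by
  unfold sqf Fp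
  refine Finset.sum_congr rfl fun θ _ => ?_
  rw [← Real.rpow_mul (norm_nonneg _), ← Real.rpow_natCast]
  norm_num

lemma havg_sqf_le (φ : A →+ Tor (d + 1)) (s : Finset ι) (ξ : ι → Fin d → ℤ) (c : ι → ℂ) (m : ℕ)
    (g : Tor (d + 1)) :
    havg φ (fun x => q.sqf s ξ c m x ^ (5 / 3 : ℝ)) g ≤ q.dn φ s ξ c m g ^ (5 / 3 : ℝ) := by
  have h1 := havg_rpow_sum_le φ Finset.univ (fun θ : Cap d m => q.Fp (fil s ξ m θ) ξ c)
    (fun θ g => q.Fp_nonneg _ _ _ g) (r := 5 / 3) (by norm_num) g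
  have h2 : ((5 / 3 : ℝ))⁻¹ = 3 / 5 := by norm_num
  simpa only [h2, dn, sqf_eq] using h1
end

lemma rpow_three_five {x : ℝ} (hx : 0 ≤ x) : (x ^ (5 / 3 : ℝ)) ^ (3 / 5 : ℝ) = x := by
  rw [← Real.rpow_mul hx]; norm_num

/-- Passing from pieces at scale `m` to pieces at scale `N`. -/
lemma Dec.dn_le {N m : ℕ} (hm : m ≤ N) {K : ℝ} (h : q.Dec (N - m) K) (hK : 0 ≤ K) {ι : Type}
    (s : Finset ι) (ξ : ι → Fin d → ℤ) (c : ι → ℂ) (g : Tor (d + 1)) :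
    q.dn (tors (d + 1) (2 * N)) s ξ c m g ^ (5 / 3 : ℝ) ≤
      K * q.dn (tors (d + 1) (2 * N)) s ξ c N g ^ (5 / 3 : ℝ) := by
  have h1 : q.dn (tors (d + 1) (2 * N)) s ξ c m g ≤
      K ^ (3 / 5 : ℝ) * q.dn (tors (d + 1) (2 * N)) s ξ c N g := by
    rw [← sum_dn_fil _ s ξ c hm g, Finset.mul_sum]
    refine Finset.sum_le_sum fun θ _ => ?_
    have h2 := h.rescale hm hK (fil s ξ m θ) ξ c
      (fun i hi i' hi' => (mem_fil.1 hi).2.trans (mem_fil.1 hi').2.symm) g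
    refine (Real.rpow_le_rpow (q.havg_Fp_nonneg _ _ _ _ _) h2 (by norm_num)).trans (le_of_eq ?_)
    rw [Real.mul_rpow hK (Real.rpow_nonneg (q.dn_nonneg _ _ _ _ _ _) _),
      rpow_three_five (q.dn_nonneg _ _ _ _ _ _)]
  refine (Real.rpow_le_rpow (q.dn_nonneg _ _ _ _ _ _) h1 (by norm_num)).trans (le_of_eq ?_)
  rw [Real.mul_rpow (Real.rpow_nonneg hK _) (q.dn_nonneg _ _ _ _ _ _), ← Real.rpow_mul hK]
  norm_num

/-- The multilinear expression at scale `m`. -/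
def ml (q : AnisoForm d e) {ι : Type*} (s : Fin (d + 1) → Finset ι) (ξ : ι → Fin d → ℤ)
    (c : ι → ℂ) (m : ℕ) (x : Tor (d + 1)) : ℝ :=
  ∏ j, q.sqf (s j) ξ c m x ^ ((5 / 3 : ℝ) / (d + 1))

lemma ml_nonneg {ι : Type*} (s : Fin (d + 1) → Finset ι) (ξ : ι → Fin d → ℤ)
    (c : ι → ℂ) (m : ℕ) (x : Tor (d + 1)) : 0 ≤ q.ml s ξ c m x :=
  Finset.prod_nonneg fun _ _ => Real.rpow_nonneg (q.sqf_nonneg _ _ _ _ _) _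

lemma rpow_div_succ {y : ℝ} (hy : 0 ≤ y) (d : ℕ) :
    y ^ ((5 / 3 : ℝ) / (d + 1)) = (y ^ (5 / 3 : ℝ)) ^ ((1 : ℝ) / (d + 1)) := by
  rw [← Real.rpow_mul hy]
  congr 1
  ring

section
variable {ι : Type} {s : Finset ι} {ξ : ι → Fin d → ℤ} (c : ι → ℂ) {b : ℕ}
  {τ : Fin (d + 1) → Cap d b}

lemma Dec.fil_le {N m : ℕ} (hm : m ≤ N) (hb : b ≤ N) {K : ℝ} (h : q.Dec (N - m) K) (hK : 0 ≤ K)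
    (τ : Cap d b) (g : Tor (d + 1)) :
    q.dn (tors (d + 1) (2 * N)) (fil s ξ b τ) ξ c m g ^ (5 / 3 : ℝ) ≤
      K * q.dn (tors (d + 1) (2 * N)) s ξ c N g ^ (5 / 3 : ℝ) := by
  refine (h.dn_le hm hK _ ξ c g).trans (mul_le_mul_of_nonneg_left ?_ hK)
  exact Real.rpow_le_rpow (q.dn_nonneg _ _ _ _ _ _) (dn_fil_le _ s ξ c hb τ g) (by norm_num)

lemma Dec.avg_ml_le {N m : ℕ} (hm : m ≤ N) (hb : b ≤ N) {K : ℝ} (h : q.Dec (N - m) K) (hK : 0 ≤ K)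
    (g : Tor (d + 1)) :
    avg (2 * N) (q.ml (fun j => fil s ξ b (τ j)) ξ c m) g ≤
      K * q.dn (tors (d + 1) (2 * N)) s ξ c N g ^ (5 / 3 : ℝ) := by
  have h0 : q.ml (fun j => fil s ξ b (τ j)) ξ c m = fun x =>
      ∏ j, (q.sqf (fil s ξ b (τ j)) ξ c m x ^ (5 / 3 : ℝ)) ^ ((1 : ℝ) / (d + 1)) := by
    funext x
    exact Finset.prod_congr rfl fun j _ => rpow_div_succ (q.sqf_nonneg _ _ _ _ _) d
  rw [h0]
  refine havg_prod_rpow_inv_le _ (fun j x => q.sqf (fil s ξ b (τ j)) ξ c m x ^ (5 / 3 : ℝ))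
    (fun j x => Real.rpow_nonneg (q.sqf_nonneg _ _ _ _ _) _)
    (mul_nonneg hK (Real.rpow_nonneg (q.dn_nonneg _ _ _ _ _ _) _)) fun j => ?_
  exact (havg_sqf_le _ _ ξ c m g).trans (h.fil_le c hm hb hK (τ j) g)

lemma sum_avg_norm_sq_eq_sqf (s : Finset ι) (ξ : ι → Fin d → ℤ) (m : ℕ) (x : Tor (d + 1)) :
    ∑ θ : Cap d m, avg (2 * m) (fun x => ‖q.F (fil s ξ m θ) ξ c x‖ ^ 2) x =
      q.sqf s ξ c (2 * m) x := by
  have h1 := q.avg_norm_sq s ξ (m := m) (r := 2 * m) (by omega) c x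
  have h2 := q.avg_norm_sq s ξ (m := 2 * m) (r := 2 * m) le_rfl c x
  rw [← h1, h2, sqf]
  refine Finset.sum_congr rfl fun θ _ => ?_
  rw [avg, havg_of_inv]
  intro a
  rw [q.norm_F_fil_add_tors s ξ c θ ⟨a, rfl⟩]

lemma sum_avg_rpow_le (s : Finset ι) (ξ : ι → Fin d → ℤ) (m : ℕ) (x : Tor (d + 1)) :
    ∑ θ, avg (2 * m) (fun x => ‖q.F (fil s ξ m θ) ξ c x‖ ^ (5 / 2 : ℝ)) x ^ (4 / 5 : ℝ) ≤
      Real.sqrt (q.sqf s ξ c (2 * m) x) * Real.sqrt (q.dn (tors (d + 1) (2 * m)) s ξ c m x) := by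
  rw [← sum_avg_norm_sq_eq_sqf, dn]
  refine (Finset.sum_le_sum fun θ _ => havg_rpow_interp _ (fun x => norm_nonneg _) x).trans ?_
  simp only [← Real.sqrt_eq_rpow]
  exact Real.sum_sqrt_mul_sqrt_le _ (fun θ => havg_nonneg _ (fun x => by positivity) x)
    (fun θ => Real.rpow_nonneg (q.havg_Fp_nonneg _ _ _ _ _) _)

/-- One step of the multilinear iteration. -/
lemma Dec.avg_ml_step (hd : d ≤ 3) {σ : ℕ} {ζ : Fin (d + 1) → Fin d → ℤ}
    (hτ : ∀ j, τ j = cap b (ζ j)) (hT : Transversal σ fun j => q.nor (ζ j)) {N m l : ℕ}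
    (hm : m = b * l) (h2m : 2 * m ≤ N) (hb : b ≤ N) {K : ℝ} (h : q.Dec (N - m) K) (hK : 0 ≤ K)
    (g : Tor (d + 1)) :
    avg (2 * N) (q.ml (fun j => fil s ξ b (τ j)) ξ c m) g ≤
      stepConst (d + 1) σ ((4 / 3 : ℝ) / (d + 1)) ^ l *
        Real.sqrt (avg (2 * N) (q.ml (fun j => fil s ξ b (τ j)) ξ c (2 * m)) g *
          (K * q.dn (tors (d + 1) (2 * N)) s ξ c N g ^ (5 / 3 : ℝ))) := by
  set P : Fin (d + 1) → Finset ι := fun j => fil s ξ b (τ j) with hP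
  set D : Fin (d + 1) → Tor (d + 1) → ℝ := fun j => q.dn (tors (d + 1) (2 * m)) (P j) ξ c m
  have hD : ∀ j x, 0 ≤ D j x := fun j x => q.dn_nonneg _ _ _ _ _ _
  set W : Tor (d + 1) → ℝ := fun x => ∏ j, (D j x ^ (5 / 3 : ℝ)) ^ ((1 : ℝ) / (d + 1)) with hW
  have hWn : ∀ x, 0 ≤ W x := fun x =>
    Finset.prod_nonneg fun j _ => Real.rpow_nonneg (Real.rpow_nonneg (hD j x) _) _
  set st := stepConst (d + 1) σ ((4 / 3 : ℝ) / (d + 1)) ^ l with hst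
  have hstn : 0 ≤ st := pow_nonneg (stepConst_pos _ _ _).le _
  have h1 : ∀ x, avg (2 * m) (q.ml P ξ c m) x ≤
      st * (q.ml P ξ c (2 * m) x ^ (1 / 2 : ℝ) * W x ^ (1 / 2 : ℝ)) := by
    intro x
    refine (q.ball_inflation c hd (s := P) (ζ := ζ) (fun j i hi => ?_) hT l m hm x).trans ?_
    · rw [← hτ]; exact (mem_fil.1 hi).2
    refine mul_le_mul_of_nonneg_left ?_ hstn
    rw [ml, hW, ← Real.finsetProd_rpow _ _ fun j _ => Real.rpow_nonneg (q.sqf_nonneg _ _ _ _ _) _,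
      ← Real.finsetProd_rpow _ _ fun j _ => Real.rpow_nonneg (Real.rpow_nonneg (hD j x) _) _,
      ← Finset.prod_mul_distrib]
    refine Finset.prod_le_prod (fun j _ => Real.rpow_nonneg (Finset.sum_nonneg fun θ _ =>
      Real.rpow_nonneg (havg_nonneg _ (fun x => Real.rpow_nonneg (norm_nonneg _) _) _) _) _)
      fun j _ => ?_
    rw [← rpow_div_succ (hD j x)]
    refine (Real.rpow_le_rpow (Finset.sum_nonneg fun θ _ =>
      Real.rpow_nonneg (havg_nonneg _ (fun x => Real.rpow_nonneg (norm_nonneg _) _) _) _)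
      (sum_avg_rpow_le c (P j) ξ m x) (by positivity)).trans (le_of_eq ?_)
    rw [Real.mul_rpow (Real.sqrt_nonneg _) (Real.sqrt_nonneg _), Real.sqrt_eq_rpow,
      Real.sqrt_eq_rpow, ← Real.rpow_mul (q.sqf_nonneg _ _ _ _ _), ← Real.rpow_mul (hD j x),
      ← Real.rpow_mul (q.sqf_nonneg _ _ _ _ _), ← Real.rpow_mul (hD j x), mul_comm (1 / 2 : ℝ)]
  rw [avg, ← havg_havg (tors (d + 1) (2 * N)) (tors (d + 1) (2 * m)) (tors_range_mono (by omega))]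
  refine (havg_mono _ h1 g).trans ?_
  rw [havg_const_mul]
  refine mul_le_mul_of_nonneg_left ?_ hstn
  refine (havg_mul_rpow_le _ (fun x => ml_nonneg _ _ _ _ x) hWn (by norm_num) (by norm_num)
    (by norm_num) g).trans ?_
  rw [Real.sqrt_mul (havg_nonneg _ (fun x => ml_nonneg _ _ _ _ x) g), Real.sqrt_eq_rpow,
    Real.sqrt_eq_rpow]
  refine mul_le_mul_of_nonneg_left ?_
    (Real.rpow_nonneg (havg_nonneg _ (fun x => ml_nonneg _ _ _ _ x) g) _)
  refine Real.rpow_le_rpow (havg_nonneg _ hWn g) ?_ (by norm_num)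
  refine havg_prod_rpow_inv_le _ (fun j x => D j x ^ (5 / 3 : ℝ))
    (fun j x => Real.rpow_nonneg (hD j x) _)
    (mul_nonneg hK (Real.rpow_nonneg (q.dn_nonneg _ _ _ _ _ _) _)) fun j => ?_
  exact (havg_dn_le _ _ (tors_range_mono (by omega)) _ ξ c m g).trans
    (h.fil_le c (by omega) hb hK (τ j) g)

/-- The multilinear iteration. -/
lemma avg_ml_iterate (hd : d ≤ 3) {σ : ℕ} {ζ : Fin (d + 1) → Fin d → ℤ}
    (hτ : ∀ j, τ j = cap b (ζ j)) (hT : Transversal σ fun j => q.nor (ζ j)) {N : ℕ} (hb : b ≤ N)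
    {C η : ℝ} (hC : 0 ≤ C) (h : ∀ N' ≤ N, q.Dec N' (C * 2 ^ (η * N'))) (g : Tor (d + 1)) (J : ℕ) :
    ∀ l, 2 ^ J * (b * l) ≤ N →
      avg (2 * N) (q.ml (fun j => fil s ξ b (τ j)) ξ c (b * l)) g ≤
        stepConst (d + 1) σ ((4 / 3 : ℝ) / (d + 1)) ^ (l * J) *
          (C * (2 : ℝ) ^ (η * (N - (b * l : ℕ) - J * (b * l : ℕ) / 2)) *
            q.dn (tors (d + 1) (2 * N)) s ξ c N g ^ (5 / 3 : ℝ)) := by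
  set X := q.dn (tors (d + 1) (2 * N)) s ξ c N g ^ (5 / 3 : ℝ)
  have hX : 0 ≤ X := Real.rpow_nonneg (q.dn_nonneg _ _ _ _ _ _) _
  set st := stepConst (d + 1) σ ((4 / 3 : ℝ) / (d + 1))
  have hst : 0 < st := stepConst_pos _ _ _
  induction J with
  | zero =>
    intro l hl
    have hm : b * l ≤ N := by simpa using hl
    refine ((h _ (Nat.sub_le N (b * l))).avg_ml_le c hm hb (by positivity) g).trans (le_of_eq ?_)
    rw [Nat.cast_sub hm]
    simp [X]
  | succ J ih =>
    intro l hl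
    have h2 : 2 ^ J * (b * (2 * l)) ≤ N := by
      calc 2 ^ J * (b * (2 * l)) = 2 ^ (J + 1) * (b * l) := by ring
        _ ≤ N := hl
    have h2m : 2 * (b * l) ≤ N := by
      refine le_trans ?_ hl
      rw [pow_succ, mul_assoc]
      exact Nat.le_mul_of_pos_left _ (Nat.two_pow_pos J)
    have hih := ih (2 * l) h2
    have hK : 0 ≤ C * (2 : ℝ) ^ (η * ((N - b * l : ℕ) : ℝ)) := by positivity
    have h3 := (h _ (Nat.sub_le N (b * l))).avg_ml_step c (s := s) (ξ := ξ) hd hτ hT rfl h2m hb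
      hK g
    rw [show b * (2 * l) = 2 * (b * l) by ring] at hih
    refine h3.trans ?_
    rw [mul_add, mul_one, add_comm (l * J) l, pow_add, mul_assoc (st ^ l)]
    refine mul_le_mul_of_nonneg_left ?_ (pow_nonneg hst.le l)
    refine Real.sqrt_le_iff.2 ⟨by positivity, ?_⟩
    refine (mul_le_mul_of_nonneg_right hih (by positivity)).trans (le_of_eq ?_)
    rw [Nat.cast_sub (by omega : b * l ≤ N)]
    have e1 : st ^ (2 * l * J) = (st ^ (l * J)) ^ 2 := by rw [← pow_mul]; congr 1; ring
    have e2 : (2 : ℝ) ^ (η * (N - (2 * (b * l) : ℕ) - J * (2 * (b * l) : ℕ) / 2)) *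
        2 ^ (η * ((N : ℝ) - (b * l : ℕ))) =
        ((2 : ℝ) ^ (η * (N - (b * l : ℕ) - (J + 1 : ℕ) * (b * l : ℕ) / 2))) ^ 2 := by
      rw [← Real.rpow_add two_pos, ← Real.rpow_natCast, ← Real.rpow_mul two_pos.le]
      congr 1
      push_cast
      ring
    rw [e1]
    linear_combination (st ^ (l * J)) ^ 2 * C ^ 2 * X ^ 2 * e2
end

end AnisoForm

/-! ### Reduction to a hyperplane -/

/-- The parametrization of the hyperplane `x k = b ⬝ u`. -/
def hyp {d : ℕ} (k : Fin (d + 1)) (b : Fin d → ℤ) : (Fin d → ℤ) →+ (Fin (d + 1) → ℤ) where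
  toFun u := k.insertNth (b ⬝ᵥ u) u
  map_zero' := by
    funext i
    refine Fin.succAboveCases k ?_ (fun j => ?_) i <;> simp
  map_add' u w := by
    funext i
    refine Fin.succAboveCases k ?_ (fun j => ?_) i <;> simp [dotProduct_add]

section
variable {d : ℕ} (k : Fin (d + 1)) (b : Fin d → ℤ)

@[simp] lemma hyp_self (u : Fin d → ℤ) : hyp k b u k = b ⬝ᵥ u := by simp [hyp]

@[simp] lemma hyp_succAbove (u : Fin d → ℤ) (j : Fin d) : hyp k b u (k.succAbove j) = u j := by
  simp [hyp]

/-- The transpose of `hyp` acting on a module. -/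
def hypT {M : Type*} [AddCommGroup M] (x : Fin (d + 1) → M) : Fin d → M :=
  fun j => x (k.succAbove j) + b j • x k

lemma sum_hyp {M : Type*} [AddCommGroup M] (u : Fin d → ℤ) (x : Fin (d + 1) → M) :
    ∑ i, hyp k b u i • x i = ∑ j, u j • hypT k b x j := by
  rw [Fin.sum_univ_succAbove _ k]
  simp only [hyp_self, hyp_succAbove, hypT, smul_add, Finset.sum_add_distrib, smul_smul, dotProduct,
    Finset.sum_smul]
  rw [add_comm]
  simp only [mul_comm]

lemma dot_hyp (w : Fin (d + 1) → ℤ) (u : Fin d → ℤ) : w ⬝ᵥ hyp k b u = hypT k b w ⬝ᵥ u := by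
  have := sum_hyp k b u w
  simp only [smul_eq_mul] at this
  rw [dotProduct_comm, dotProduct_comm (hypT k b w)]
  exact this

end

namespace AnisoForm
variable {d e : ℕ}

/-- The restriction of a form to a hyperplane. -/
def restrict (q : AnisoForm (d + 1) e) (k : Fin (d + 1)) (b : Fin d → ℤ) : AnisoForm d e where
  Q u := q.Q (hyp k b u)
  S :=
    { toFun := fun u => hypT k b (q.S (hyp k b u))
      map_zero' := by funext j; simp [hypT]
      map_add' := fun u w => by
        funext j
        simp only [hypT, _root_.map_add, Pi.add_apply, smul_add]
        abel }
  map_add u w := by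
    rw [_root_.map_add, q.map_add, dot_hyp]
    rfl
  map_smul c u := by rw [map_zsmul, q.map_smul]
  aniso u hu j := by simpa using q.aniso _ hu (k.succAbove j)

variable (q : AnisoForm (d + 1) e) (k : Fin (d + 1)) (b : Fin d → ℤ)

/-- The map of tori dual to the affine embedding of the hyperplane through `γ`. -/
def restrictHom (γ : Fin (d + 1) → ℤ) : Tor (d + 1 + 1) →+ Tor (d + 1) where
  toFun g := Fin.cons (g 0) fun j =>
    hypT k b (fun i => g (Fin.succ i)) j + hypT k b (q.S γ) j • g 0
  map_zero' := by
    funext j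
    refine Fin.cases ?_ (fun j => ?_) j <;> simp [hypT]
  map_add' a a' := by
    funext j
    refine Fin.cases ?_ (fun j => ?_) j
    · simp
    · simp only [Fin.cons_succ, Pi.add_apply, smul_add, hypT]
      abel

lemma pair_pt_hyp (γ : Fin (d + 1) → ℤ) (u : Fin d → ℤ) (g : Tor (d + 1 + 1)) :
    pair (q.pt (γ + hyp k b u)) g =
      pair (q.pt γ) g + pair ((q.restrict k b).pt u) (q.restrictHom k b γ g) := by
  have h1 := sum_hyp k b u fun i => g (Fin.succ i)
  have h2 : (q.S γ ⬝ᵥ hyp k b u) • g 0 = ∑ j, u j • hypT k b (q.S γ) j • g 0 := by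
    rw [dot_hyp, dotProduct, Finset.sum_smul]
    simp only [smul_smul, mul_comm]
  have h3 : pair ((q.restrict k b).pt u) (q.restrictHom k b γ g) = q.Q (hyp k b u) • g 0 +
      ∑ j, u j • (hypT k b (fun i => g (Fin.succ i)) j + hypT k b (q.S γ) j • g 0) := by
    rw [pair, Fin.sum_univ_succ]
    rfl
  rw [h3]
  simp only [pair, Fin.sum_univ_succ (n := d + 1), pt, Fin.cons_zero, Fin.cons_succ, q.map_add,
    Pi.add_apply, add_smul, smul_add, Finset.sum_add_distrib, h1, h2]
  abel

lemma range_restrictHom (γ : Fin (d + 1) → ℤ) (r : ℕ) :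
    (tors (d + 1) r).range ≤ ((q.restrictHom k b γ).comp (tors (d + 1 + 1) r)).range := by
  intro h hh
  rw [mem_tors_range] at hh
  set x : Tor (d + 1) := k.insertNth 0 fun j => h j.succ - hypT k b (q.S γ) j • h 0 with hx
  have hmem : (Fin.cons (h 0) x : Tor (d + 1 + 1)) ∈ (tors (d + 1 + 1) r).range := by
    rw [mem_tors_range]
    intro j
    refine Fin.cases ?_ (fun j => ?_) j
    · simpa using hh 0
    · rw [Fin.cons_succ]
      refine Fin.succAboveCases k ?_ (fun j => ?_) j
      · simp [hx]
      · simp only [hx, Fin.insertNth_apply_succAbove]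
        rw [smul_sub, hh, smul_comm, hh, smul_zero, sub_zero]
  obtain ⟨a, ha⟩ := hmem
  refine ⟨a, ?_⟩
  rw [AddMonoidHom.comp_apply, ha]
  funext j
  refine Fin.cases ?_ (fun j => ?_) j
  · simp [restrictHom]
  · simp [restrictHom, hypT, hx]

variable {q}

/-- Decoupling for frequencies near a hyperplane. -/
lemma avg_Fp_le_of_hyperplane {v : ℕ} {K : ℝ} (hK : 0 ≤ K)
    (hDec : ∀ q' : AnisoForm d e, q'.Dec v K) {ι : Type} (s : Finset ι) (ξ : ι → Fin (d + 1) → ℤ)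
    (c : ι → ℂ) (h : Fin (d + 1) → ℤ) (κ : ℤ) {k : Fin (d + 1)} (hk : Odd (h k))
    (hs : ∀ i ∈ s, (2 : ℤ) ^ (2 * v) ∣ h ⬝ᵥ ξ i - κ) (g : Tor (d + 1 + 1)) :
    avg (2 * v) (q.Fp s ξ c) g ≤
      K * q.dn (tors (d + 1 + 1) (2 * v)) s ξ c v g ^ (5 / 3 : ℝ) := by
  obtain ⟨r, r', hr⟩ : ∃ r r' : ℤ, r * h k + r' * 2 ^ (2 * v) = 1 := by
    have : IsCoprime (h k) (2 ^ (2 * v)) :=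
      IsCoprime.pow_right (Int.isCoprime_iff_gcd_eq_one.2 (by
        rw [Int.gcd_comm]; exact Int.isCoprime_iff_gcd_eq_one.1 (Int.isCoprime_two_left.2 hk)))
    exact this
  set b : Fin d → ℤ := fun j => -(r * h (k.succAbove j)) with hb
  set γ : Fin (d + 1) → ℤ := k.insertNth (r * κ) 0 with hγ
  set u : ι → Fin d → ℤ := fun i j => ξ i (k.succAbove j) with hu
  have hcap : ∀ i ∈ s, cap (2 * v) (ξ i) = cap (2 * v) (γ + hyp k b (u i)) := by
    intro i hi
    funext j
    simp only [cap]
    rw [ZMod.intCast_eq_intCast_iff_dvd_sub]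
    push_cast
    refine Fin.succAboveCases k ?_ (fun j => ?_) j
    · obtain ⟨y, hy⟩ := hs i hi
      have h1 : h ⬝ᵥ ξ i = h k * ξ i k + ∑ j, h (k.succAbove j) * ξ i (k.succAbove j) := by
        rw [dotProduct, Fin.sum_univ_succAbove _ k]
      have h2 : b ⬝ᵥ u i = -(r * ∑ j, h (k.succAbove j) * ξ i (k.succAbove j)) := by
        simp [hb, hu, dotProduct, Finset.mul_sum, mul_assoc]
      refine ⟨-(r * y + r' * ξ i k), ?_⟩
      simp only [Pi.add_apply, hyp_self, h2, hγ, Fin.insertNth_apply_same]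
      rw [h1] at hy
      linear_combination (-r) * hy + (ξ i k) * hr
    · simp [hγ, hu]
  set c' : ι → ℂ := fun i => c i * chr (q.pt (ξ i)) g with hc'
  set A := q.restrictHom k b γ with hA
  have hF : ∀ P ⊆ s, ∀ a, q.Fp P ξ c (g + tors (d + 1 + 1) (2 * v) a) =
      (q.restrict k b).Fp P u c' (A (0 + tors (d + 1 + 1) (2 * v) a)) := by
    intro P hP a
    rw [zero_add, Fp, Fp]
    congr 1
    have : q.F P ξ c (g + tors (d + 1 + 1) (2 * v) a) =
        chr (q.pt γ) (tors (d + 1 + 1) (2 * v) a) *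
          (q.restrict k b).F P u c' (A (tors (d + 1 + 1) (2 * v) a)) := by
      simp only [F, Finset.mul_sum]
      refine Finset.sum_congr rfl fun i hi => ?_
      rw [chr_add, q.chr_pt_tors (hcap i (hP hi)) ⟨a, rfl⟩, hc']
      have h3 : chr (q.pt (γ + hyp k b (u i))) (tors (d + 1 + 1) (2 * v) a) =
          chr (q.pt γ) (tors (d + 1 + 1) (2 * v) a) *
            chr ((q.restrict k b).pt (u i)) (A (tors (d + 1 + 1) (2 * v) a)) := by
        unfold chr
        rw [pair_pt_hyp, AddCircle.toCircle_add, Circle.coe_mul]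
      rw [h3]
      ring
    rw [this, norm_mul, norm_chr, one_mul]
  have havgF : ∀ P ⊆ s, avg (2 * v) (q.Fp P ξ c) g =
      havg (A.comp (tors (d + 1 + 1) (2 * v))) ((q.restrict k b).Fp P u c') (A 0) := by
    intro P hP
    rw [← havg_comp]
    simp only [avg, havg, hF P hP]
  have hl : ∀ i ∈ s, ∀ i' ∈ s, cap v (ξ i') = cap v (ξ i) ↔ cap v (u i') = cap v (u i) := by
    intro i hi i' hi'
    constructor
    · intro h
      funext j
      exact congrFun h (k.succAbove j)
    · intro h
      rw [cap_le (by omega) (hcap i hi), cap_le (by omega) (hcap i' hi')]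
      obtain ⟨y, hy⟩ := cap_eq_iff.1 h
      rw [hy, cap_eq_iff]
      exact ⟨hyp k b y, by rw [_root_.map_add, map_zsmul, add_assoc]⟩
  have hsum : q.dn (tors (d + 1 + 1) (2 * v)) s ξ c v g =
      (q.restrict k b).dn (A.comp (tors (d + 1 + 1) (2 * v))) s u c' v (A 0) := by
    unfold dn
    rw [← sum_fil_congr s ξ u v v hl (fun P =>
      havg (A.comp (tors (d + 1 + 1) (2 * v))) ((q.restrict k b).Fp P u c') (A 0) ^ (3 / 5 : ℝ))]
    · refine Finset.sum_congr rfl fun θ _ => ?_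
      rw [← havgF _ fun i hi => (mem_fil.1 hi).1]
    · rw [havg_Fp_empty, Real.zero_rpow (by norm_num)]
  rw [havgF s subset_rfl, hsum]
  exact (hDec _).havg_le hK _ (q.range_restrictHom k b γ _) s u c' _

end AnisoForm

/-! ### The broad–narrow dichotomy -/

lemma add_rpow_le_two_rpow {x y r : ℝ} (hx : 0 ≤ x) (hy : 0 ≤ y) (hr : 0 ≤ r) :
    (x + y) ^ r ≤ 2 ^ r * (x ^ r + y ^ r) := by
  rcases le_total x y with h | h
  · calc (x + y) ^ r ≤ (2 * y) ^ r := Real.rpow_le_rpow (by positivity) (by linarith) hr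
      _ = 2 ^ r * y ^ r := Real.mul_rpow two_pos.le hy
      _ ≤ _ := mul_le_mul_of_nonneg_left (by linarith [Real.rpow_nonneg hx r]) (by positivity)
  · calc (x + y) ^ r ≤ (2 * x) ^ r := Real.rpow_le_rpow (by positivity) (by linarith) hr
      _ = 2 ^ r * x ^ r := Real.mul_rpow two_pos.le hx
      _ ≤ _ := mul_le_mul_of_nonneg_left (by linarith [Real.rpow_nonneg hy r]) (by positivity)

lemma havg_rpow_le_of_norm_sub_le {A G : Type*} [AddCommGroup A] [Fintype A] [AddCommGroup G]
    (φ : A →+ G) {r M : ℝ} (hr : 0 ≤ r) (hM0 : 0 ≤ M) {u w : G → ℂ} {g : G}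
    (huw : ∀ a, ‖u (g + φ a) - w (g + φ a)‖ ≤ M) :
    havg φ (fun x => ‖u x‖ ^ r) g ≤ 2 ^ r * (havg φ (fun x => ‖w x‖ ^ r) g + M ^ r) := by
  have h2 : M ^ r = havg φ (fun _ => M ^ r) g :=
    (havg_of_inv φ (f := fun _ => M ^ r) (g := g) fun _ => rfl).symm
  rw [h2, ← havg_add, ← havg_const_mul]
  have := card_pos_real A
  unfold havg
  gcongr with a
  refine le_trans (Real.rpow_le_rpow (norm_nonneg _) ?_ hr)
    (add_rpow_le_two_rpow (norm_nonneg _) hM0 hr)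
  calc _ = ‖w (g + φ a) + (u (g + φ a) - w (g + φ a))‖ := by congr 1; ring
    _ ≤ _ := (norm_add_le _ _).trans (add_le_add le_rfl (huw a))

/-- A representative of a residue class. -/
def rep {d m : ℕ} (τ : Cap d m) : Fin d → ℤ := fun j => ((τ j).val : ℤ)

@[simp] lemma cap_rep {d m : ℕ} (τ : Cap d m) : cap m (rep τ) = τ := by
  funext j
  simp [cap, rep]

lemma exists_two_pow_mul_odd {n : ℕ} (h : Fin n → ℤ) (e : ℕ) (hh : ∃ j, ¬ (2 : ℤ) ^ (e + 1) ∣ h j) :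
    ∃ f ≤ e, ∃ h' : Fin n → ℤ, h = (2 : ℤ) ^ f • h' ∧ ∃ k, Odd (h' k) := by
  induction e generalizing h with
  | zero =>
    obtain ⟨j, hj⟩ := hh
    exact ⟨0, le_rfl, h, by simp, j, by
      rw [← Int.not_even_iff_odd, even_iff_two_dvd]; simpa using hj⟩
  | succ e ih =>
    by_cases ho : ∃ k, Odd (h k)
    · exact ⟨0, Nat.zero_le _, h, by simp, ho⟩
    · push Not at ho
      have h2 : ∀ k, ∃ y, h k = 2 * y := fun k => even_iff_two_dvd.1 (Int.not_odd_iff_even.1 (ho k))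
      choose y hy using h2
      obtain ⟨j, hj⟩ := hh
      obtain ⟨f, hf, h', hh', hk⟩ := ih y ⟨j, fun hd => hj (by
        rw [hy j, pow_succ, mul_comm]; exact mul_dvd_mul_left 2 hd)⟩
      refine ⟨f + 1, by omega, h', ?_, hk⟩
      funext k
      rw [hy k, hh']
      simp only [Pi.smul_apply, smul_eq_mul]
      ring

namespace AnisoForm
variable {d e : ℕ} {q : AnisoForm d e}

lemma S_dot_comm (ξ η : Fin d → ℤ) : q.S ξ ⬝ᵥ η = q.S η ⬝ᵥ ξ := by
  have h1 := q.map_add ξ η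
  have h2 := q.map_add η ξ
  rw [add_comm] at h2
  linarith

lemma S_dot_self (ξ : Fin d → ℤ) : q.S ξ ⬝ᵥ ξ = 2 * q.Q ξ := by
  have h1 := q.map_add ξ ξ
  have h2 := q.map_smul 2 ξ
  rw [two_smul] at h2
  linarith

/-- Normals close to a common hyperplane come from frequencies close to a common hyperplane. -/
lemma exists_hyperplane {m v : ℕ} (hm : 2 * v ≤ m) (X : Set (Cap d m))
    (hX : X.Nonempty) (l : Fin (d + 1) → ℤ) (hl : ∃ j, Odd (l j))
    (hd : ∀ τ ∈ X, (2 : ℤ) ^ (2 * v + e + 1) ∣ ∑ j, l j * q.nor (rep τ) j) :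
    ∃ (h : Fin d → ℤ) (κ : ℤ) (k : Fin d), Odd (h k) ∧
      ∀ ξ : Fin d → ℤ, cap m ξ ∈ X → (2 : ℤ) ^ (2 * v) ∣ h ⬝ᵥ ξ - κ := by
  set l' : Fin d → ℤ := fun j => l j.succ with hl'
  have hsum : ∀ τ : Cap d m, ∑ j, l j * q.nor (rep τ) j = l 0 - q.S l' ⬝ᵥ rep τ := by
    intro τ
    rw [Fin.sum_univ_succ]
    simp only [nor, Fin.cons_zero, Fin.cons_succ, Pi.neg_apply, mul_neg, Finset.sum_neg_distrib,
      mul_one, ← sub_eq_add_neg]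
    congr 1
    rw [S_dot_comm, dotProduct_comm]
    rfl
  have hodd : ∃ j, Odd (l' j) := by
    by_contra hno
    push Not at hno
    have h2 : ∀ k, ∃ y, l' k = 2 * y := fun k =>
      even_iff_two_dvd.1 (Int.not_odd_iff_even.1 (hno k))
    choose y hy using h2
    have h3 : l' = (2 : ℤ) • y := by funext k; simp [hy k]
    obtain ⟨τ, hτ⟩ := hX
    have h4 := hd τ hτ
    rw [hsum, h3, map_zsmul, smul_dotProduct] at h4
    have h5 : (2 : ℤ) ∣ l 0 - (2 : ℤ) • (q.S y ⬝ᵥ rep τ) := (dvd_pow_self 2 (by omega)).trans h4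
    have h6 : (2 : ℤ) ∣ l 0 := by
      rw [smul_eq_mul] at h5
      omega
    obtain ⟨j, hj⟩ := hl
    revert hj
    refine Fin.cases ?_ (fun j => ?_) j
    · rw [← Int.not_even_iff_odd, even_iff_two_dvd]; exact fun h => h h6
    · exact fun h => hno j h
  obtain ⟨j0, hj0⟩ := hodd
  obtain ⟨f, hf, h, hh, k, hk⟩ := exists_two_pow_mul_odd (q.S l') e (by
    by_contra hno
    push Not at hno
    have h1 : (2 : ℤ) ^ (e + 1) ∣ q.S l' ⬝ᵥ l' :=
      Finset.dvd_sum fun j _ => (hno j).mul_right _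
    rw [S_dot_self, pow_succ, mul_comm] at h1
    have h2 := q.aniso l' (Int.dvd_of_mul_dvd_mul_left two_ne_zero h1) j0
    rw [← Int.not_even_iff_odd, even_iff_two_dvd] at hj0
    exact hj0 h2)
  have hl0 : (2 : ℤ) ^ f ∣ l 0 := by
    obtain ⟨τ, hτ⟩ := hX
    have h4 := (pow_dvd_pow (2 : ℤ) (by omega : f ≤ 2 * v + e + 1)).trans (hd τ hτ)
    rw [hsum, hh, smul_dotProduct] at h4
    exact (dvd_sub_left (Dvd.intro _ rfl)).1 h4
  obtain ⟨κ, hκ⟩ := hl0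
  refine ⟨h, κ, k, hk, fun ξ hξ => ?_⟩
  have h4 := hd _ hξ
  rw [hsum, hh, smul_dotProduct, hκ, smul_eq_mul, ← mul_sub,
    show 2 * v + e + 1 = f + (2 * v + e + 1 - f) by omega, pow_add] at h4
  have h5 := (pow_dvd_pow (2 : ℤ) (by omega : 2 * v ≤ 2 * v + e + 1 - f)).trans
    (Int.dvd_of_mul_dvd_mul_left (by positivity) h4)
  obtain ⟨y, hy⟩ := cap_eq_iff.1 (cap_le hm (cap_rep (cap m ξ)))
  rw [hy, dotProduct_add, dotProduct_smul, smul_eq_mul]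
  have h6 : h ⬝ᵥ rep (cap m ξ) + 2 ^ (2 * v) * h ⬝ᵥ y - κ =
      -(κ - h ⬝ᵥ rep (cap m ξ)) + 2 ^ (2 * v) * h ⬝ᵥ y := by ring
  rw [h6]
  exact dvd_add ((dvd_neg).2 h5) (Dvd.intro _ rfl)

/-- A sum over a union of residue classes is dominated by the sums over the classes. -/
lemma norm_F_le_sum {ι : Type*} (s P : Finset ι) (ξ : ι → Fin d → ℤ) (c : ι → ℂ) {m : ℕ}
    (X : Finset (Cap d m)) (hPX : ∀ i ∈ P, cap m (ξ i) ∈ X)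
    (hP : ∀ i ∈ P, ∀ i' ∈ s, cap m (ξ i) = cap m (ξ i') → i' ∈ P) (hPs : P ⊆ s)
    (x : Tor (d + 1)) : ‖q.F P ξ c x‖ ≤ ∑ τ ∈ X, ‖q.F (fil s ξ m τ) ξ c x‖ := by
  rw [← q.sum_F_fil P ξ m c x]
  refine (norm_sum_le _ _).trans ?_
  rw [← Finset.sum_subset (Finset.subset_univ X)]
  · refine Finset.sum_le_sum fun τ _ => ?_
    rcases (fil P ξ m τ).eq_empty_or_nonempty with h0 | ⟨i0, hi0⟩
    · rw [h0]; simp [F]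
    · rw [mem_fil] at hi0
      have : fil P ξ m τ = fil s ξ m τ := by
        ext i
        simp only [mem_fil]
        exact ⟨fun h => ⟨hPs h.1, h.2⟩, fun h => ⟨hP i0 hi0.1 i h.1 (hi0.2.trans h.2.symm), h.2⟩⟩
      rw [this]
  · intro τ _ hτ
    have : fil P ξ m τ = ∅ := by
      rw [Finset.eq_empty_iff_forall_notMem]
      intro i hi
      rw [mem_fil] at hi
      exact hτ (hi.2 ▸ hPX i hi.1)
    rw [this]
    simp [F]

/-- The transversal tuples of residue classes. -/
def goodTuples (q : AnisoForm d e) (m σ : ℕ) : Finset (Fin (d + 1) → Cap d m) := by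
  classical exact Finset.univ.filter fun T => Transversal σ fun j => q.nor (rep (T j))

lemma mem_goodTuples {m σ : ℕ} {T : Fin (d + 1) → Cap d m} :
    T ∈ q.goodTuples m σ ↔ Transversal σ fun j => q.nor (rep (T j)) := by
  simp [goodTuples]

end AnisoForm

namespace AnisoForm
variable {d e : ℕ} {q : AnisoForm (d + 1) e}

/-- The narrow case. -/
lemma avg_Fp_le_of_narrow {v m : ℕ} (hm : 2 * v ≤ m) {K : ℝ} (hK : 0 ≤ K)
    (hDec : ∀ q' : AnisoForm d e, q'.Dec v K) {ι : Type} (s : Finset ι)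
    (ξ : ι → Fin (d + 1) → ℤ) (c : ι → ℂ) (g : Tor (d + 1 + 1)) (X : Finset (Cap (d + 1) m))
    (h : Fin (d + 1) → ℤ) (κ : ℤ) (k : Fin (d + 1)) (hk : Odd (h k))
    (hX : ∀ ξ' : Fin (d + 1) → ℤ, cap m ξ' ∈ X → (2 : ℤ) ^ (2 * v) ∣ h ⬝ᵥ ξ' - κ) {M : ℝ}
    (hM0 : 0 ≤ M) (hM : ∑ τ ∈ Xᶜ, ‖q.F (fil s ξ m τ) ξ c g‖ ≤ M) :
    avg (2 * v) (q.Fp s ξ c) g ≤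
      2 ^ (10 / 3 : ℝ) * 8 ^ (5 / 3 : ℝ) * K *
        q.dn (tors (d + 1 + 1) (2 * v)) s ξ c v g ^ (5 / 3 : ℝ) +
      (2 ^ (10 / 3 : ℝ) + 2 ^ (10 / 3 : ℝ) * K *
        (8 * Fintype.card (Cap (d + 1) v)) ^ (5 / 3 : ℝ)) * M ^ (10 / 3 : ℝ) := by
  classical
  set Y := s.filter fun i => cap m (ξ i) ∈ X with hY
  have hYs : Y ⊆ s := Finset.filter_subset _ _
  have hA : ∀ τ a, ‖q.F (fil s ξ m τ) ξ c (g + tors (d + 1 + 1) (2 * v) a)‖ =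
      ‖q.F (fil s ξ m τ) ξ c g‖ := fun τ a =>
    q.norm_F_fil_add_tors s ξ c τ (tors_range_mono hm ⟨a, rfl⟩) g
  -- comparison of a union of classes at scale `v` with its part over `X`
  have hsplit : ∀ P ⊆ s, (∀ i ∈ P, ∀ i' ∈ s, cap m (ξ i) = cap m (ξ i') → i' ∈ P) → ∀ a,
      ‖q.F P ξ c (g + tors (d + 1 + 1) (2 * v) a) -
        q.F (P.filter fun i => cap m (ξ i) ∈ X) ξ c (g + tors (d + 1 + 1) (2 * v) a)‖ ≤ M := by
    intro P hPs hP a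
    have h1 : q.F P ξ c (g + tors (d + 1 + 1) (2 * v) a) -
        q.F (P.filter fun i => cap m (ξ i) ∈ X) ξ c (g + tors (d + 1 + 1) (2 * v) a) =
        q.F (P.filter fun i => ¬ cap m (ξ i) ∈ X) ξ c (g + tors (d + 1 + 1) (2 * v) a) := by
      simp only [F]
      rw [← Finset.sum_filter_add_sum_filter_not P fun i => cap m (ξ i) ∈ X]
      ring
    rw [h1]
    refine (norm_F_le_sum s _ ξ c Xᶜ (fun i hi => ?_) (fun i hi i' hi' hii => ?_) ?_ _).trans ?_
    · simpa using (Finset.mem_filter.1 hi).2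
    · rw [Finset.mem_filter] at hi ⊢
      exact ⟨hP i hi.1 i' hi' hii, hii ▸ hi.2⟩
    · exact (Finset.filter_subset _ _).trans hPs
    · simpa only [hA] using hM
  have hcmp : ∀ u w : Tor (d + 1 + 1) → ℂ,
      (∀ a, ‖u (g + tors (d + 1 + 1) (2 * v) a) - w (g + tors (d + 1 + 1) (2 * v) a)‖ ≤ M) →
      avg (2 * v) (fun x => ‖u x‖ ^ (10 / 3 : ℝ)) g ≤
        2 ^ (10 / 3 : ℝ) * (avg (2 * v) (fun x => ‖w x‖ ^ (10 / 3 : ℝ)) g + M ^ (10 / 3 : ℝ)) :=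
    fun u w huw => havg_rpow_le_of_norm_sub_le (tors (d + 1 + 1) (2 * v)) (by norm_num) hM0 huw
  have h1 : avg (2 * v) (q.Fp s ξ c) g ≤
      2 ^ (10 / 3 : ℝ) * (avg (2 * v) (q.Fp Y ξ c) g + M ^ (10 / 3 : ℝ)) :=
    hcmp _ _ (hsplit s subset_rfl fun _ _ i' hi' _ => hi')
  have h2 := avg_Fp_le_of_hyperplane (q := q) hK hDec Y ξ c h κ hk
    (fun i hi => hX _ (Finset.mem_filter.1 hi).2) g
  have h3 : q.dn (tors (d + 1 + 1) (2 * v)) Y ξ c v g ≤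
      4 * q.dn (tors (d + 1 + 1) (2 * v)) s ξ c v g +
        4 * Fintype.card (Cap (d + 1) v) * M ^ 2 := by
    unfold dn
    have h4 : 4 * (Fintype.card (Cap (d + 1) v) : ℝ) * M ^ 2 =
        ∑ _π : Cap (d + 1) v, 4 * M ^ 2 := by
      rw [Finset.sum_const, nsmul_eq_mul, Finset.card_univ]
      ring
    rw [h4, Finset.mul_sum, ← Finset.sum_add_distrib]
    refine Finset.sum_le_sum fun π _ => ?_
    have hfil : fil Y ξ v π = (fil s ξ v π).filter fun i => cap m (ξ i) ∈ X := by
      ext i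
      simp only [mem_fil, hY, Finset.mem_filter]
      tauto
    have h5 : avg (2 * v) (q.Fp (fil Y ξ v π) ξ c) g ≤
        2 ^ (10 / 3 : ℝ) * (avg (2 * v) (q.Fp (fil s ξ v π) ξ c) g + M ^ (10 / 3 : ℝ)) := by
      refine hcmp _ _ fun a => ?_
      rw [norm_sub_rev, hfil]
      refine hsplit _ (fun i hi => (mem_fil.1 hi).1) (fun i hi i' hi' hii => ?_) a
      rw [mem_fil] at hi ⊢
      exact ⟨hi', (cap_le (by omega) hii).symm.trans hi.2⟩
    have hn := q.havg_Fp_nonneg (tors (d + 1 + 1) (2 * v)) (fil s ξ v π) ξ c g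
    refine (Real.rpow_le_rpow (q.havg_Fp_nonneg _ _ _ _ _) h5 (by norm_num)).trans ?_
    rw [Real.mul_rpow (by positivity) (by positivity), ← Real.rpow_mul two_pos.le]
    have e1 : (2 : ℝ) ^ (10 / 3 * (3 / 5) : ℝ) = 4 := by
      rw [show (10 / 3 * (3 / 5) : ℝ) = (2 : ℕ) by norm_num, Real.rpow_natCast]; norm_num
    have e2 : (M ^ (10 / 3 : ℝ)) ^ (3 / 5 : ℝ) = M ^ 2 := by
      rw [← Real.rpow_mul hM0, show (10 / 3 * (3 / 5) : ℝ) = (2 : ℕ) by norm_num, Real.rpow_natCast]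
    rw [e1, ← mul_add, ← e2]
    refine mul_le_mul_of_nonneg_left ?_ (by norm_num)
    exact Real.rpow_add_le_add_rpow hn (by positivity) (by norm_num) (by norm_num)
  have hdn := q.dn_nonneg (tors (d + 1 + 1) (2 * v)) s ξ c v g
  have h4 : q.dn (tors (d + 1 + 1) (2 * v)) Y ξ c v g ^ (5 / 3 : ℝ) ≤
      8 ^ (5 / 3 : ℝ) * q.dn (tors (d + 1 + 1) (2 * v)) s ξ c v g ^ (5 / 3 : ℝ) +
        (8 * Fintype.card (Cap (d + 1) v)) ^ (5 / 3 : ℝ) * M ^ (10 / 3 : ℝ) := by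
    refine (Real.rpow_le_rpow (q.dn_nonneg _ _ _ _ _ _) h3 (by norm_num)).trans ?_
    refine (add_rpow_le_two_rpow (by positivity) (by positivity) (by norm_num)).trans (le_of_eq ?_)
    have e3 : M ^ (10 / 3 : ℝ) = (M ^ 2) ^ (5 / 3 : ℝ) := by
      rw [← Real.rpow_natCast, ← Real.rpow_mul hM0]; norm_num
    rw [e3, mul_add, ← Real.mul_rpow (by positivity) (by positivity),
      ← Real.mul_rpow (by positivity) (by positivity), ← Real.mul_rpow (by positivity) hdn,
      ← Real.mul_rpow (by positivity) (by positivity)]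
    ring_nf
  refine h1.trans ?_
  have h5 := h2.trans (mul_le_mul_of_nonneg_left h4 hK)
  have h6 : (0 : ℝ) ≤ 2 ^ (10 / 3 : ℝ) := by positivity
  nlinarith [mul_le_mul_of_nonneg_left h5 h6]

end AnisoForm

lemma havg_le_of_forall_le {A G : Type*} [AddCommGroup A] [Fintype A] [AddCommGroup G]
    (φ : A →+ G) {f : G → ℝ} {g : G} {M : ℝ} (h : ∀ a, f (g + φ a) ≤ M) : havg φ f g ≤ M := by
  unfold havg
  rw [div_le_iff₀ (card_pos_real _), mul_comm, ← nsmul_eq_mul, ← Finset.card_univ]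
  exact Finset.sum_le_card_nsmul _ _ _ fun a _ => h a

namespace AnisoForm
variable {d e : ℕ}

lemma card_cap (d m : ℕ) : Fintype.card (Cap d m) = 2 ^ (d * m) := by
  simp [Cap, ZMod.card, ← pow_mul, mul_comm]

lemma prod_rpow_le_ml (q : AnisoForm d e) {ι : Type*} (s : Fin (d + 1) → Finset ι)
    (ξ : ι → Fin d → ℤ) (c : ι → ℂ) (m : ℕ) (x : Tor (d + 1)) :
    ∏ j, ‖q.F (s j) ξ c x‖ ^ ((10 / 3 : ℝ) / (d + 1)) ≤
      (2 ^ (d * m) : ℝ) ^ (5 / 3 : ℝ) * q.ml s ξ c m x := by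
  have h1 : ∀ j, ‖q.F (s j) ξ c x‖ ^ ((10 / 3 : ℝ) / (d + 1)) ≤
      (2 ^ (d * m) : ℝ) ^ ((5 / 3 : ℝ) / (d + 1)) * q.sqf (s j) ξ c m x ^ ((5 / 3 : ℝ) / (d + 1)) := by
    intro j
    have h2 : ‖q.F (s j) ξ c x‖ ^ 2 ≤ (2 ^ (d * m) : ℝ) * q.sqf (s j) ξ c m x := by
      rw [← q.sum_F_fil (s j) ξ m c x]
      calc _ ≤ (∑ θ, ‖q.F (fil (s j) ξ m θ) ξ c x‖) ^ 2 :=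
            pow_le_pow_left₀ (norm_nonneg _) (norm_sum_le _ _) 2
        _ ≤ (Finset.univ : Finset (Cap d m)).card * ∑ θ, ‖q.F (fil (s j) ξ m θ) ξ c x‖ ^ 2 :=
            sq_sum_le_card_mul_sum_sq
        _ = _ := by rw [Finset.card_univ, card_cap]; push_cast; rfl
    rw [← Real.mul_rpow (by positivity) (q.sqf_nonneg _ _ _ _ _),
      show (10 / 3 : ℝ) / (d + 1) = (2 : ℕ) * ((5 / 3) / (d + 1)) by push_cast; ring,
      Real.rpow_mul (norm_nonneg _), Real.rpow_natCast]
    exact Real.rpow_le_rpow (by positivity) h2 (by positivity)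
  refine (Finset.prod_le_prod (fun j _ => by positivity) fun j _ => h1 j).trans (le_of_eq ?_)
  rw [Finset.prod_mul_distrib, Finset.prod_const, Finset.card_univ, Fintype.card_fin,
    ← Real.rpow_natCast, ← Real.rpow_mul (by positivity)]
  congr 2
  push_cast
  field_simp

/-- Broad–narrow decomposition. -/
lemma broad_narrow (q : AnisoForm (d + 1) e) {v m : ℕ} (hm : 2 * v ≤ m) {K : ℝ} (hK : 0 ≤ K)
    (hDec : ∀ q' : AnisoForm d e, q'.Dec v K) {ι : Type} (s : Finset ι)
    (ξ : ι → Fin (d + 1) → ℤ) (c : ι → ℂ) (g : Tor (d + 1 + 1)) :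
    avg (2 * v) (q.Fp s ξ c) g ≤
      2 ^ (10 / 3 : ℝ) * 8 ^ (5 / 3 : ℝ) * K *
        q.dn (tors (d + 1 + 1) (2 * v)) s ξ c v g ^ (5 / 3 : ℝ) +
      (2 ^ (10 / 3 : ℝ) + 2 ^ (10 / 3 : ℝ) * K *
        (8 * Fintype.card (Cap (d + 1) v)) ^ (5 / 3 : ℝ)) *
          ∑ τ : Cap (d + 1) m, q.Fp (fil s ξ m τ) ξ c g +
      ((2 ^ ((d + 1) * m) : ℝ) ^ 2) ^ (10 / 3 : ℝ) * ∑ T ∈ q.goodTuples m (2 * v + e + 1),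
        ∏ j, ‖q.F (fil s ξ m (T j)) ξ c g‖ ^ ((10 / 3 : ℝ) / ((d + 1 : ℕ) + 1)) := by
  classical
  set A : Cap (d + 1) m → ℝ := fun τ => ‖q.F (fil s ξ m τ) ξ c g‖ with hAdef
  set κ : ℝ := 2 ^ ((d + 1) * m) with hκ
  have hκ1 : 1 ≤ κ := one_le_pow₀ (by norm_num)
  have hcard : ((Fintype.card (Cap (d + 1) m) : ℕ) : ℝ) = κ := by rw [card_cap]; push_cast; rfl
  have hA0 : ∀ τ, 0 ≤ A τ := fun τ => norm_nonneg _
  have hdn := q.dn_nonneg (tors (d + 1 + 1) (2 * v)) s ξ c v g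
  have hT1 : 0 ≤ 2 ^ (10 / 3 : ℝ) * 8 ^ (5 / 3 : ℝ) * K *
        q.dn (tors (d + 1 + 1) (2 * v)) s ξ c v g ^ (5 / 3 : ℝ) := by positivity
  have hFpn : ∀ τ, 0 ≤ q.Fp (fil s ξ m τ) ξ c g := fun τ => q.Fp_nonneg _ _ _ _
  have hT2 : 0 ≤ (2 ^ (10 / 3 : ℝ) + 2 ^ (10 / 3 : ℝ) * K *
        (8 * Fintype.card (Cap (d + 1) v)) ^ (5 / 3 : ℝ)) *
          ∑ τ : Cap (d + 1) m, q.Fp (fil s ξ m τ) ξ c g :=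
    mul_nonneg (by positivity) (Finset.sum_nonneg fun τ _ => hFpn τ)
  have hpr : ∀ T : Fin (d + 1 + 1) → Cap (d + 1) m,
      0 ≤ ∏ j, ‖q.F (fil s ξ m (T j)) ξ c g‖ ^ ((10 / 3 : ℝ) / ((d + 1 : ℕ) + 1)) :=
    fun T => Finset.prod_nonneg fun j _ => by positivity
  have hT3 : 0 ≤ (κ ^ 2) ^ (10 / 3 : ℝ) * ∑ T ∈ q.goodTuples m (2 * v + e + 1),
        ∏ j, ‖q.F (fil s ξ m (T j)) ξ c g‖ ^ ((10 / 3 : ℝ) / ((d + 1 : ℕ) + 1)) :=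
    mul_nonneg (by positivity) (Finset.sum_nonneg fun T _ => hpr T)
  obtain ⟨τ0, hτ0⟩ := Finite.exists_max A
  set X : Finset (Cap (d + 1) m) := Finset.univ.filter fun τ => A τ0 ≤ κ * A τ with hX
  have hX0 : τ0 ∈ X := by
    simp only [hX, Finset.mem_filter, Finset.mem_univ, true_and]
    nlinarith [hA0 τ0]
  rcases exists_transversal_or_hyperplane (2 * v + e + 1) (d + 1 + 1)
    (fun τ : X => q.nor (rep τ.1)) with ⟨f, hf⟩ | ⟨l, hl, hd⟩
  · set T : Fin (d + 1 + 1) → Cap (d + 1) m := fun j => (f j).1 with hT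
    have hTg : T ∈ q.goodTuples m (2 * v + e + 1) := mem_goodTuples.2 hf
    have hpt : ∀ a, q.Fp s ξ c (g + tors (d + 1 + 1) (2 * v) a) ≤ (κ ^ 2) ^ (10 / 3 : ℝ) *
        ∏ j, A (T j) ^ ((10 / 3 : ℝ) / ((d + 1 : ℕ) + 1)) := by
      intro a
      have h1 : ‖q.F s ξ c (g + tors (d + 1 + 1) (2 * v) a)‖ ≤ κ * A τ0 := by
        rw [← q.sum_F_fil s ξ m c]
        refine (norm_sum_le _ _).trans ?_
        rw [← hcard, ← nsmul_eq_mul, ← Finset.card_univ]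
        refine Finset.sum_le_card_nsmul _ _ _ fun τ _ => ?_
        rw [q.norm_F_fil_add_tors s ξ c τ (tors_range_mono hm ⟨a, rfl⟩) g]
        exact hτ0 τ
      have h2 : ∀ j, κ * A τ0 ≤ κ ^ 2 * A (T j) := fun j => by
        have := (Finset.mem_filter.1 (f j).2).2
        nlinarith
      have hn : ((d + 1 : ℕ) : ℝ) + 1 ≠ 0 := by positivity
      have h0 : 0 ≤ κ * A τ0 := mul_nonneg (by positivity) (hA0 _)
      calc _ ≤ (κ * A τ0) ^ (10 / 3 : ℝ) := Real.rpow_le_rpow (norm_nonneg _) h1 (by norm_num)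
        _ = ∏ _j : Fin (d + 1 + 1), (κ * A τ0) ^ ((10 / 3 : ℝ) / ((d + 1 : ℕ) + 1)) := by
          rw [Finset.prod_const, Finset.card_univ, Fintype.card_fin, ← Real.rpow_natCast,
            ← Real.rpow_mul h0]
          congr 1
          push_cast at hn ⊢
          field_simp
        _ ≤ ∏ j, (κ ^ 2 * A (T j)) ^ ((10 / 3 : ℝ) / ((d + 1 : ℕ) + 1)) :=
          Finset.prod_le_prod (fun j _ => by positivity) fun j _ =>
            Real.rpow_le_rpow h0 (h2 j) (by positivity)
        _ = _ := by
          have : ∀ j, (κ ^ 2 * A (T j)) ^ ((10 / 3 : ℝ) / ((d + 1 : ℕ) + 1)) =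
            (κ ^ 2) ^ ((10 / 3 : ℝ) / ((d + 1 : ℕ) + 1)) *
              A (T j) ^ ((10 / 3 : ℝ) / ((d + 1 : ℕ) + 1)) := fun j =>
              Real.mul_rpow (by positivity) (hA0 _)
          simp only [this]
          rw [Finset.prod_mul_distrib, Finset.prod_const, Finset.card_univ, Fintype.card_fin,
            ← Real.rpow_natCast, ← Real.rpow_mul (by positivity)]
          congr 2
          push_cast at hn ⊢
          field_simp
    have h3 : avg (2 * v) (q.Fp s ξ c) g ≤ (κ ^ 2) ^ (10 / 3 : ℝ) *
        ∏ j, A (T j) ^ ((10 / 3 : ℝ) / ((d + 1 : ℕ) + 1)) :=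
      havg_le_of_forall_le (tors (d + 1 + 1) (2 * v)) hpt
    have h4 : ∏ j, A (T j) ^ ((10 / 3 : ℝ) / ((d + 1 : ℕ) + 1)) ≤
        ∑ T ∈ q.goodTuples m (2 * v + e + 1),
          ∏ j, ‖q.F (fil s ξ m (T j)) ξ c g‖ ^ ((10 / 3 : ℝ) / ((d + 1 : ℕ) + 1)) :=
      Finset.single_le_sum (f := fun T : Fin (d + 1 + 1) → Cap (d + 1) m =>
        ∏ j, ‖q.F (fil s ξ m (T j)) ξ c g‖ ^ ((10 / 3 : ℝ) / ((d + 1 : ℕ) + 1)))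
        (fun T _ => hpr T) hTg
    have h5 := h3.trans (mul_le_mul_of_nonneg_left h4 (by positivity))
    linarith
  · obtain ⟨h, κ', k, hk, hh⟩ := q.exists_hyperplane hm (X : Set (Cap (d + 1) m)) ⟨τ0, hX0⟩ l hl
      fun τ hτ => hd ⟨τ, hτ⟩
    have hM : ∑ τ ∈ Xᶜ, ‖q.F (fil s ξ m τ) ξ c g‖ ≤ A τ0 := by
      have hτ : ∀ τ ∈ Xᶜ, ‖q.F (fil s ξ m τ) ξ c g‖ ≤ A τ0 / κ := by
        intro τ hτ
        simp only [hX, Finset.mem_compl, Finset.mem_filter, Finset.mem_univ, true_and, not_le] at hτ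
        rw [le_div_iff₀ (by positivity), mul_comm]
        exact hτ.le
      refine (Finset.sum_le_card_nsmul _ _ _ hτ).trans ?_
      rw [nsmul_eq_mul]
      have : ((Xᶜ).card : ℝ) ≤ κ := by
        rw [← hcard]; exact_mod_cast Finset.card_le_univ _
      calc _ ≤ κ * (A τ0 / κ) :=
            mul_le_mul_of_nonneg_right this (div_nonneg (hA0 _) (by positivity))
        _ = _ := by field_simp
    have h1 := q.avg_Fp_le_of_narrow hm hK hDec s ξ c g X h κ' k hk
      (fun ξ' h' => hh ξ' h') (hA0 τ0) hM
    have h2 : A τ0 ^ (10 / 3 : ℝ) ≤ ∑ τ : Cap (d + 1) m, q.Fp (fil s ξ m τ) ξ c g :=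
      Finset.single_le_sum (f := fun τ => q.Fp (fil s ξ m τ) ξ c g) (fun τ _ => hFpn τ)
        (Finset.mem_univ τ0)
    have h3 := mul_le_mul_of_nonneg_left h2 (show 0 ≤ 2 ^ (10 / 3 : ℝ) + 2 ^ (10 / 3 : ℝ) * K *
        (8 * Fintype.card (Cap (d + 1) v)) ^ (5 / 3 : ℝ) by positivity)
    linarith

end AnisoForm

namespace AnisoForm
variable {d e : ℕ}

lemma dec_trivial (q : AnisoForm d e) (N : ℕ) :
    q.Dec N (2 ^ ((5 / 3 : ℝ) * d * N)) := by
  intro ι s ξ c g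
  have h1 : ∀ x, q.Fp s ξ c x ≤ 2 ^ ((5 / 3 : ℝ) * d * N) * q.sqf s ξ c N x ^ (5 / 3 : ℝ) := by
    intro x
    have h2 : ‖q.F s ξ c x‖ ^ 2 ≤ (2 ^ (d * N) : ℝ) * q.sqf s ξ c N x := by
      rw [← q.sum_F_fil s ξ N c x]
      calc _ ≤ (∑ θ, ‖q.F (fil s ξ N θ) ξ c x‖) ^ 2 :=
            pow_le_pow_left₀ (norm_nonneg _) (norm_sum_le _ _) 2
        _ ≤ (Finset.univ : Finset (Cap d N)).card * ∑ θ, ‖q.F (fil s ξ N θ) ξ c x‖ ^ 2 :=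
            sq_sum_le_card_mul_sum_sq
        _ = _ := by rw [Finset.card_univ, card_cap]; push_cast; rfl
    have h3 : (2 : ℝ) ^ ((5 / 3 : ℝ) * d * N) = (2 ^ (d * N) : ℝ) ^ (5 / 3 : ℝ) := by
      rw [← Real.rpow_natCast, ← Real.rpow_mul two_pos.le]
      congr 1
      push_cast
      ring
    unfold Fp
    rw [h3, ← Real.mul_rpow (by positivity) (q.sqf_nonneg _ _ _ _ _),
      show (10 / 3 : ℝ) = (2 : ℕ) * (5 / 3) by norm_num,
      Real.rpow_mul (norm_nonneg _), Real.rpow_natCast]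
    exact Real.rpow_le_rpow (by positivity) h2 (by positivity)
  refine (havg_mono _ h1 g).trans ?_
  rw [havg_const_mul]
  refine mul_le_mul_of_nonneg_left ?_ (by positivity)
  exact q.havg_sqf_le _ s ξ c N g

lemma avg_broad_le (q : AnisoForm d e) (hd : d ≤ 3) {ι : Type} (s : Finset ι)
    (ξ : ι → Fin d → ℤ) (c : ι → ℂ) {b N σ : ℕ} (hb : b ≤ N) {C η : ℝ} (hC : 0 ≤ C)
    (h : ∀ N' ≤ N, q.Dec N' (C * 2 ^ (η * N'))) (g : Tor (d + 1)) (J l : ℕ)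
    (hl : 2 ^ J * (b * l) ≤ N) :
    avg (2 * N) (fun x => ∑ T ∈ q.goodTuples b σ,
        ∏ j, ‖q.F (fil s ξ b (T j)) ξ c x‖ ^ ((10 / 3 : ℝ) / (d + 1))) g ≤
      (2 ^ (d * b * (d + 1)) : ℝ) * ((2 ^ (d * (b * l)) : ℝ) ^ (5 / 3 : ℝ) *
        (stepConst (d + 1) σ ((4 / 3 : ℝ) / (d + 1)) ^ (l * J) *
          (C * (2 : ℝ) ^ (η * (N - (b * l : ℕ) - J * (b * l : ℕ) / 2)) *
            q.dn (tors (d + 1) (2 * N)) s ξ c N g ^ (5 / 3 : ℝ)))) := by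
  rw [avg, havg_sum]
  have hX := q.dn_nonneg (tors (d + 1) (2 * N)) s ξ c N g
  have hst := stepConst_pos (d + 1) σ ((4 / 3 : ℝ) / (d + 1))
  set Z := (2 ^ (d * (b * l)) : ℝ) ^ (5 / 3 : ℝ) *
        (stepConst (d + 1) σ ((4 / 3 : ℝ) / (d + 1)) ^ (l * J) *
          (C * (2 : ℝ) ^ (η * (N - (b * l : ℕ) - J * (b * l : ℕ) / 2)) *
            q.dn (tors (d + 1) (2 * N)) s ξ c N g ^ (5 / 3 : ℝ))) with hZ
  have hZ0 : 0 ≤ Z := by positivity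
  have h1 : ∀ T ∈ q.goodTuples b σ, havg (tors (d + 1) (2 * N)) (fun x =>
      ∏ j, ‖q.F (fil s ξ b (T j)) ξ c x‖ ^ ((10 / 3 : ℝ) / (d + 1))) g ≤ Z := by
    intro T hT
    refine (havg_mono _ (fun x => q.prod_rpow_le_ml (fun j => fil s ξ b (T j)) ξ c (b * l) x)
      g).trans ?_
    rw [havg_const_mul]
    refine mul_le_mul_of_nonneg_left ?_ (by positivity)
    exact avg_ml_iterate c hd (fun j => (cap_rep (T j)).symm) (mem_goodTuples.1 hT) hb hC h g J l hl
  refine (Finset.sum_le_card_nsmul _ _ _ h1).trans ?_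
  rw [nsmul_eq_mul]
  refine mul_le_mul_of_nonneg_right ?_ hZ0
  have h2 : (q.goodTuples b σ).card ≤ 2 ^ (d * b * (d + 1)) := by
    refine (Finset.card_le_univ _).trans (le_of_eq ?_)
    rw [Fintype.card_fun, card_cap, Fintype.card_fin, ← pow_mul]
  exact_mod_cast h2

/-- Narrow, concentrated and broad contributions, averaged at the full scale. -/
lemma avg_Fp_le_broad_narrow (q : AnisoForm (d + 1) e) {v b N : ℕ} (hvb : 2 * v ≤ b) (hb : b ≤ N)
    {K K₁ K₂ : ℝ} (hK : 0 ≤ K) (hDec : ∀ q' : AnisoForm d e, q'.Dec v K)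
    (hK₁ : 0 ≤ K₁) (h₁ : q.Dec (N - v) K₁) (hK₂ : 0 ≤ K₂) (h₂ : q.Dec (N - b) K₂)
    {ι : Type} (s : Finset ι) (ξ : ι → Fin (d + 1) → ℤ) (c : ι → ℂ) (g : Tor (d + 1 + 1)) :
    avg (2 * N) (q.Fp s ξ c) g ≤
      (2 ^ (10 / 3 : ℝ) * 8 ^ (5 / 3 : ℝ) * K * K₁ +
      (2 ^ (10 / 3 : ℝ) + 2 ^ (10 / 3 : ℝ) * K *
        (8 * Fintype.card (Cap (d + 1) v)) ^ (5 / 3 : ℝ)) * K₂) *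
          q.dn (tors (d + 1 + 1) (2 * N)) s ξ c N g ^ (5 / 3 : ℝ) +
      ((2 ^ ((d + 1) * b) : ℝ) ^ 2) ^ (10 / 3 : ℝ) *
        avg (2 * N) (fun x => ∑ T ∈ q.goodTuples b (2 * v + e + 1),
          ∏ j, ‖q.F (fil s ξ b (T j)) ξ c x‖ ^ ((10 / 3 : ℝ) / ((d + 1 : ℕ) + 1))) g := by
  have hX := q.dn_nonneg (tors (d + 1 + 1) (2 * N)) s ξ c N g
  rw [← avg_avg (show 2 * v ≤ 2 * N by omega)]
  refine (havg_mono _ (fun x => q.broad_narrow hvb hK hDec s ξ c x) g).trans ?_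
  rw [havg_add, havg_add, havg_const_mul, havg_const_mul, havg_const_mul]
  refine add_le_add ?_ le_rfl
  rw [add_mul (_ * K₁) (_ * K₂), mul_assoc _ K₁, mul_assoc _ K₂]
  refine add_le_add (mul_le_mul_of_nonneg_left ?_ (by positivity))
    (mul_le_mul_of_nonneg_left ?_ (by positivity))
  · exact (havg_dn_le _ _ (tors_range_mono (by omega)) s ξ c v g).trans
      (h₁.dn_le (by omega) hK₁ s ξ c g)
  · rw [havg_sum]
    have h3 : ∀ τ : Cap (d + 1) b, havg (tors (d + 1 + 1) (2 * N)) (q.Fp (fil s ξ b τ) ξ c) g ≤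
        K₂ * q.dn (tors (d + 1 + 1) (2 * N)) (fil s ξ b τ) ξ c N g ^ (5 / 3 : ℝ) := fun τ =>
      h₂.rescale hb hK₂ (fil s ξ b τ) ξ c
        (fun i hi i' hi' => (mem_fil.1 hi).2.trans (mem_fil.1 hi').2.symm) g
    refine (Finset.sum_le_sum fun τ _ => h3 τ).trans ?_
    rw [← Finset.mul_sum, ← sum_dn_fil _ s ξ c hb g]
    refine mul_le_mul_of_nonneg_left ?_ hK₂
    set y : Cap (d + 1) b → ℝ := fun τ =>
      q.dn (tors (d + 1 + 1) (2 * N)) (fil s ξ b τ) ξ c N g with hy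
    have hy0 : ∀ τ, 0 ≤ y τ := fun τ => q.dn_nonneg _ _ _ _ _ _
    have hs0 : 0 ≤ ∑ τ, y τ := Finset.sum_nonneg fun τ _ => hy0 τ
    have hsp : ∀ z : ℝ, 0 ≤ z → z ^ (5 / 3 : ℝ) = z * z ^ (2 / 3 : ℝ) := fun z hz => by
      rcases hz.eq_or_lt with rfl | hz
      · norm_num
      · rw [← Real.rpow_one_add' hz.le (by norm_num)]; norm_num
    rw [hsp _ hs0, Finset.sum_mul]
    refine Finset.sum_le_sum fun τ _ => ?_
    rw [hsp _ (hy0 τ)]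
    exact mul_le_mul_of_nonneg_left (Real.rpow_le_rpow (hy0 τ)
      (Finset.single_le_sum (fun τ _ => hy0 τ) (Finset.mem_univ τ)) (by norm_num)) (hy0 τ)

end AnisoForm

lemma exists_nat_decay (A : ℝ) {ε : ℝ} (hε : 0 < ε) :
    ∃ n₀ : ℕ, ∀ n : ℕ, n₀ ≤ n → A * 2 ^ (-(ε * n)) ≤ 1 / 4 := by
  have h1 : Filter.Tendsto (fun n : ℕ => A * ((2 : ℝ) ^ (-ε)) ^ n) Filter.atTop (nhds (A * 0)) :=
    (tendsto_pow_atTop_nhds_zero_of_lt_one (by positivity)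
      (Real.rpow_lt_one_of_one_lt_of_neg one_lt_two (by linarith))).const_mul A
  rw [mul_zero] at h1
  obtain ⟨n₀, hn⟩ := Filter.eventually_atTop.1 (h1.eventually (gt_mem_nhds (show (0 : ℝ) < 1 / 4 by norm_num)))
  refine ⟨n₀, fun n h => ?_⟩
  have := (hn n h).le
  rwa [← Real.rpow_natCast, ← Real.rpow_mul two_pos.le, neg_mul] at this

lemma stepConst_eq (n σ : ℕ) (hn : n ≠ 0) :
    stepConst n σ ((4 / 3 : ℝ) / n) = 2 ^ ((4 / 3 : ℝ) * σ * n) := by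
  unfold stepConst
  rw [Finset.prod_const, Finset.card_univ, Fintype.card_fin, ← Real.rpow_natCast,
    ← Real.rpow_natCast (2 : ℝ), ← Real.rpow_mul two_pos.le, ← Real.rpow_mul two_pos.le]
  congr 1
  push_cast
  have : (n : ℝ) ≠ 0 := by exact_mod_cast hn
  field_simp

namespace AnisoForm
variable {d e : ℕ}

/-- The broad contribution gains a power. -/
lemma avg_broad_le_of_gain (q : AnisoForm d e) (hd : d ≤ 3) {ι : Type} (s : Finset ι)
    (ξ : ι → Fin d → ℤ) (c : ι → ℂ) {b N σ J : ℕ} (hb0 : 0 < b) (hb : b ≤ N) {C ε η : ℝ}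
    (hC : 0 ≤ C) (hε : 0 < ε) (hη : ε ≤ η) (hσ : (4 / 3 : ℝ) * σ * (d + 1) ≤ ε / 4 * b)
    (hJ : 5 / 3 * (d : ℝ) + 1 ≤ ε / 4 * J)
    (h : ∀ N' ≤ N, q.Dec N' (C * 2 ^ (η * N'))) (g : Tor (d + 1)) :
    avg (2 * N) (fun x => ∑ T ∈ q.goodTuples b σ,
        ∏ j, ‖q.F (fil s ξ b (T j)) ξ c x‖ ^ ((10 / 3 : ℝ) / (d + 1))) g ≤
      (2 ^ (d * b * (d + 1)) : ℝ) * 2 ^ b * C * 2 ^ ((η - (2 ^ J)⁻¹) * N) *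
            q.dn (tors (d + 1) (2 * N)) s ξ c N g ^ (5 / 3 : ℝ) := by
  set l := N / (b * 2 ^ J) with hl
  have hpos : 0 < b * 2 ^ J := by positivity
  have hl1 : 2 ^ J * (b * l) ≤ N := by
    have := Nat.mul_div_le N (b * 2 ^ J)
    calc 2 ^ J * (b * l) = b * 2 ^ J * l := by ring
      _ ≤ N := this
  refine (q.avg_broad_le hd s ξ c (σ := σ) hb hC h g J l hl1).trans ?_
  have hX := Real.rpow_nonneg (q.dn_nonneg (tors (d + 1) (2 * N)) s ξ c N g) (5 / 3 : ℝ)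
  set X := q.dn (tors (d + 1) (2 * N)) s ξ c N g ^ (5 / 3 : ℝ)
  have hst : stepConst (d + 1) σ ((4 / 3 : ℝ) / (d + 1)) ^ (l * J) =
      2 ^ ((4 / 3 : ℝ) * σ * (d + 1) * (l * J)) := by
    have := stepConst_eq (d + 1) σ (by omega)
    push_cast at this
    rw [this, ← Real.rpow_natCast, ← Real.rpow_mul two_pos.le]
    push_cast
    rfl
  have hcs : (2 ^ (d * (b * l)) : ℝ) ^ (5 / 3 : ℝ) = 2 ^ ((5 / 3 : ℝ) * d * (b * l)) := by
    rw [← Real.rpow_natCast, ← Real.rpow_mul two_pos.le]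
    congr 1
    push_cast
    ring
  have key : (2 : ℝ) ^ ((5 / 3 : ℝ) * d * (b * l)) * ((2 : ℝ) ^ ((4 / 3 : ℝ) * σ * (d + 1) * (l * J)) *
      2 ^ (η * (N - (b * l : ℕ) - J * (b * l : ℕ) / 2))) ≤ 2 ^ b * 2 ^ ((η - (2 ^ J)⁻¹) * N) := by
    rw [← Real.rpow_natCast 2 b, ← Real.rpow_add two_pos, ← Real.rpow_add two_pos,
      ← Real.rpow_add two_pos]
    refine Real.rpow_le_rpow_of_exponent_le one_le_two ?_
    push_cast
    have h1 : (N : ℝ) * (2 ^ J)⁻¹ ≤ b * l + b := by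
      have h2 : N < b * 2 ^ J * (l + 1) := by
        exact Nat.lt_mul_div_succ N hpos
      have h3 : (N : ℝ) ≤ b * 2 ^ J * (l + 1) := by exact_mod_cast h2.le
      rw [← div_eq_mul_inv, div_le_iff₀ (by positivity)]
      nlinarith
    have hJ0 : (0 : ℝ) ≤ J := Nat.cast_nonneg _
    have hl0 : (0 : ℝ) ≤ l := Nat.cast_nonneg _
    have hb' : (0 : ℝ) ≤ b := Nat.cast_nonneg _
    have h4 := mul_le_mul_of_nonneg_right hσ (mul_nonneg hl0 hJ0)
    have h5 := mul_le_mul_of_nonneg_right hJ (mul_nonneg hb' hl0)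
    have h6 : ε * (J * (b * l) / 2) ≤ η * (J * (b * l) / 2) :=
      mul_le_mul_of_nonneg_right hη (by positivity)
    have h7 : 0 ≤ η * (b * l) := mul_nonneg (hε.le.trans hη) (by positivity)
    nlinarith
  rw [hst, hcs]
  calc _ = (2 ^ (d * b * (d + 1)) : ℝ) * ((2 : ℝ) ^ ((5 / 3 : ℝ) * d * (b * l)) *
        ((2 : ℝ) ^ ((4 / 3 : ℝ) * σ * (d + 1) * (l * J)) *
          2 ^ (η * (N - (b * l : ℕ) - J * (b * l : ℕ) / 2)))) * (C * X) := by ring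
    _ ≤ (2 ^ (d * b * (d + 1)) : ℝ) * (2 ^ b * 2 ^ ((η - (2 ^ J)⁻¹) * N)) * (C * X) := by gcongr
    _ = _ := by ring

lemma exists_improve (hd : d + 1 ≤ 3)
    (ih : ∀ ε : ℝ, 0 < ε → ∃ C : ℝ, 0 < C ∧ ∀ (q' : AnisoForm d e) (N : ℕ),
      q'.Dec N (C * 2 ^ (ε * N))) {ε : ℝ} (hε : 0 < ε) :
    ∃ δ : ℝ, 0 < δ ∧ ∀ η : ℝ, ε ≤ η →
      (∃ C : ℝ, 0 < C ∧ ∀ (q : AnisoForm (d + 1) e) (N : ℕ), q.Dec N (C * 2 ^ (η * N))) →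
      ∃ C : ℝ, 0 < C ∧ ∀ (q : AnisoForm (d + 1) e) (N : ℕ), q.Dec N (C * 2 ^ (max ε (η - δ) * N)) := by
  obtain ⟨C₀, hC₀, ih⟩ := ih (ε / 2) (by positivity)
  obtain ⟨v₀, hv₀⟩ := exists_nat_decay (2 ^ (10 / 3 : ℝ) * 8 ^ (5 / 3 : ℝ) * C₀)
    (show 0 < ε / 2 by positivity)
  set v := v₀ + 1 with hv
  replace hv₀ := hv₀ v (by omega)
  set K := C₀ * 2 ^ (ε / 2 * v) with hKdef
  have hK : 0 ≤ K := by positivity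
  set C₂ := 2 ^ (10 / 3 : ℝ) + 2 ^ (10 / 3 : ℝ) * K *
        (8 * Fintype.card (Cap (d + 1) v)) ^ (5 / 3 : ℝ) with hC₂
  have hC₂0 : 0 ≤ C₂ := by positivity
  obtain ⟨b₀, hb₀⟩ := exists_nat_decay C₂ hε
  set σ := 2 * v + e + 1 with hσ
  obtain ⟨b₁, hb₁⟩ := exists_nat_ge ((4 / 3 : ℝ) * σ * (d + 2) / (ε / 4))
  set b := max (max b₀ b₁) (2 * v) with hb
  have hvb : 2 * v ≤ b := le_max_right _ _
  replace hb₀ := hb₀ b ((le_max_left _ _).trans (le_max_left _ _))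
  have hb₁' : (4 / 3 : ℝ) * σ * ((d + 1 : ℕ) + 1) ≤ ε / 4 * b := by
    have : (b₁ : ℝ) ≤ b := by exact_mod_cast (le_max_right b₀ b₁).trans (le_max_left _ _)
    rw [div_le_iff₀ (by positivity)] at hb₁
    push_cast
    nlinarith
  obtain ⟨J, hJ⟩ := exists_nat_ge ((5 / 3 * ((d + 1 : ℕ) : ℝ) + 1) / (ε / 4))
  rw [div_le_iff₀ (by positivity), mul_comm (J : ℝ)] at hJ
  refine ⟨(2 ^ J)⁻¹, by positivity, fun η hη hC => ?_⟩
  obtain ⟨C, hC, h⟩ := hC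
  set η' := max ε (η - (2 ^ J)⁻¹) with hη'
  have hη'0 : ε ≤ η' := le_max_left _ _
  set C₃ : ℝ := ((2 ^ ((d + 1) * b) : ℝ) ^ 2) ^ (10 / 3 : ℝ) *
    ((2 ^ ((d + 1) * b * (d + 1 + 1)) : ℝ) * 2 ^ b) with hC₃
  have hC₃0 : 0 < C₃ := by positivity
  set C' := C * 2 ^ (η * b) + 2 * C₃ * C with hC'
  have hC'0 : 0 < C' := by positivity
  refine ⟨C', hC'0, fun q N => ?_⟩
  induction N using Nat.strong_induction_on with
  | _ N IH =>
  rcases lt_or_ge N b with hN | hN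
  · refine (h q N).mono ?_
    have h1 : (2 : ℝ) ^ (η * N) ≤ 2 ^ (η * b) :=
      Real.rpow_le_rpow_of_exponent_le one_le_two (mul_le_mul_of_nonneg_left
        (by exact_mod_cast hN.le) (hε.le.trans hη))
    have h2 : (1 : ℝ) ≤ 2 ^ (η' * N) :=
      Real.one_le_rpow one_le_two (mul_nonneg (hε.le.trans hη'0) (Nat.cast_nonneg _))
    calc C * 2 ^ (η * N) ≤ C * 2 ^ (η * b) := by gcongr
      _ ≤ C' := by rw [hC']; nlinarith [mul_pos hC₃0 hC]
      _ ≤ _ := le_mul_of_one_le_right hC'0.le h2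
  · intro ι s ξ c g
    have hX := Real.rpow_nonneg (q.dn_nonneg (tors (d + 1 + 1) (2 * N)) s ξ c N g) (5 / 3 : ℝ)
    refine (q.avg_Fp_le_broad_narrow hvb hN hK (fun q' => ih q' v)
      (by positivity) (IH (N - v) (by omega)) (by positivity) (IH (N - b) (by omega))
      s ξ c g).trans ?_
    have hbr := q.avg_broad_le_of_gain hd s ξ c (σ := σ) (J := J) (by omega) hN hC.le hε hη hb₁' hJ
      (fun N' _ => h q N') g
    rw [← hC₂]
    set X := q.dn (tors (d + 1 + 1) (2 * N)) s ξ c N g ^ (5 / 3 : ℝ)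
    have e1 : ∀ w : ℕ, w ≤ N → (2 : ℝ) ^ (η' * ((N - w : ℕ) : ℝ)) ≤
        2 ^ (-(ε * w)) * 2 ^ (η' * N) := by
      intro w hw
      rw [← Real.rpow_add two_pos]
      refine Real.rpow_le_rpow_of_exponent_le one_le_two ?_
      push_cast [hw]
      nlinarith [mul_le_mul_of_nonneg_right hη'0 (Nat.cast_nonneg (α := ℝ) w)]
    set E := (2 : ℝ) ^ (η' * N)
    have hE : 0 < E := by positivity
    have t1 : 2 ^ (10 / 3 : ℝ) * 8 ^ (5 / 3 : ℝ) * K * (C' * 2 ^ (η' * ((N - v : ℕ) : ℝ))) ≤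
        1 / 4 * (C' * E) := by
      calc _ ≤ 2 ^ (10 / 3 : ℝ) * 8 ^ (5 / 3 : ℝ) * K * (C' * (2 ^ (-(ε * v)) * E)) := by
            gcongr; exact e1 v (by omega)
        _ = (2 ^ (10 / 3 : ℝ) * 8 ^ (5 / 3 : ℝ) * C₀ * (2 ^ (ε / 2 * v) * 2 ^ (-(ε * v)))) *
            (C' * E) := by rw [hKdef]; ring
        _ = (2 ^ (10 / 3 : ℝ) * 8 ^ (5 / 3 : ℝ) * C₀ * 2 ^ (-(ε / 2 * v))) * (C' * E) := by
            rw [← Real.rpow_add two_pos]; congr 3; ring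
        _ ≤ _ := by gcongr
    have t2 : C₂ * (C' * 2 ^ (η' * ((N - b : ℕ) : ℝ))) ≤ 1 / 4 * (C' * E) := by
      calc _ ≤ C₂ * (C' * (2 ^ (-(ε * b)) * E)) := by gcongr; exact e1 b hN
        _ = (C₂ * 2 ^ (-(ε * b))) * (C' * E) := by ring
        _ ≤ _ := by gcongr
    have t3 : (2 : ℝ) ^ ((η - (2 ^ J)⁻¹) * N) ≤ E :=
      Real.rpow_le_rpow_of_exponent_le one_le_two
        (mul_le_mul_of_nonneg_right (le_max_right _ _) (Nat.cast_nonneg _))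
    have t4 : C₃ * (C * 2 ^ ((η - (2 ^ J)⁻¹) * N) * X) ≤ 1 / 2 * (C' * E) * X := by
      calc _ ≤ C₃ * (C * E * X) := by gcongr
        _ ≤ _ := by
          rw [hC']
          have : 0 ≤ C * 2 ^ (η * b) * E * X := by positivity
          nlinarith
    have t5 : ((2 ^ ((d + 1) * b) : ℝ) ^ 2) ^ (10 / 3 : ℝ) *
        avg (2 * N) (fun x => ∑ T ∈ q.goodTuples b σ,
          ∏ j, ‖q.F (fil s ξ b (T j)) ξ c x‖ ^ ((10 / 3 : ℝ) / ((d + 1 : ℕ) + 1))) g ≤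
        C₃ * (C * 2 ^ ((η - (2 ^ J)⁻¹) * N) * X) := by
      refine (mul_le_mul_of_nonneg_left hbr (by positivity)).trans (le_of_eq ?_)
      rw [hC₃]; ring
    have t6 := mul_le_mul_of_nonneg_right (add_le_add t1 t2) hX
    refine (add_le_add t6 (t5.trans t4)).trans (le_of_eq ?_)
    ring

/-- `ℓ²` decoupling for 2-adic paraboloids of dimension at most three. -/
theorem exists_dec (e : ℕ) : ∀ d : ℕ, d ≤ 3 → ∀ ε : ℝ, 0 < ε → ∃ C : ℝ, 0 < C ∧
    ∀ (q : AnisoForm d e) (N : ℕ), q.Dec N (C * 2 ^ (ε * N))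
  | 0, _, ε, hε => ⟨1, one_pos, fun q N => (q.dec_trivial N).mono (by
      rw [one_mul]
      refine Real.rpow_le_rpow_of_exponent_le one_le_two ?_
      simp; positivity)⟩
  | d + 1, hd, ε, hε => by
    obtain ⟨δ, hδ, himp⟩ := exists_improve hd (exists_dec e d (by omega)) hε
    set η₀ : ℝ := ε + 5 / 3 * ((d + 1 : ℕ) : ℝ) with hη₀
    have hk : ∀ k : ℕ, ∃ C : ℝ, 0 < C ∧ ∀ (q : AnisoForm (d + 1) e) (N : ℕ),
        q.Dec N (C * 2 ^ (max ε (η₀ - k * δ) * N)) := by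
      intro k
      induction k with
      | zero =>
        refine ⟨1, one_pos, fun q N => (q.dec_trivial N).mono ?_⟩
        rw [one_mul]
        refine Real.rpow_le_rpow_of_exponent_le one_le_two
          (mul_le_mul_of_nonneg_right (le_max_of_le_right ?_) (Nat.cast_nonneg _))
        simp only [Nat.cast_zero, zero_mul, sub_zero, hη₀]
        linarith
      | succ k ihk =>
        obtain ⟨C, hC, h⟩ := himp _ (le_max_left _ _) ihk
        refine ⟨C, hC, fun q N => (h q N).mono ?_⟩
        refine mul_le_mul_of_nonneg_left (Real.rpow_le_rpow_of_exponent_le one_le_two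
          (mul_le_mul_of_nonneg_right ?_ (Nat.cast_nonneg _))) hC.le
        refine max_le (le_max_left _ _) ?_
        rcases max_cases ε (η₀ - k * δ) with ⟨h1, _⟩ | ⟨h1, _⟩
        · rw [h1]; exact le_max_of_le_left (by linarith)
        · rw [h1]; refine le_max_of_le_right ?_
          push_cast
          linarith
    obtain ⟨k, hk1⟩ := exists_nat_ge ((η₀ - ε) / δ)
    obtain ⟨C, hC, h⟩ := hk k
    rw [div_le_iff₀ hδ] at hk1
    rw [max_eq_left (by linarith)] at h
    exact ⟨C, hC, h⟩

end AnisoForm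

/-! ### Quadratic Gauss sums and Gaussian kernels -/

lemma card_two_mul_eq_zero_le (q : ℕ) [NeZero q] :
    (Finset.univ.filter fun h : ZMod q => 2 * h = 0).card ≤ 2 := by
  have h1 : ((Finset.univ.filter fun h : ZMod q => 2 * h = 0).image ZMod.val).card =
      (Finset.univ.filter fun h : ZMod q => 2 * h = 0).card :=
    Finset.card_image_of_injective _ (ZMod.val_injective q)
  rw [← h1]
  have h2 : (Finset.univ.filter fun h : ZMod q => 2 * h = 0).image ZMod.val ⊆ {0, q / 2} := by
    intro x hx
    obtain ⟨h, hh, rfl⟩ := Finset.mem_image.1 hx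
    have h3 := (Finset.mem_filter.1 hh).2
    have h4 : q ∣ 2 * h.val := by
      rw [← ZMod.natCast_eq_zero_iff]
      push_cast
      rw [ZMod.natCast_zmod_val]
      exact h3
    obtain ⟨k, hk⟩ := h4
    have h5 := ZMod.val_lt h
    have hk2 : k < 2 := by
      by_contra hcon
      have : q * 2 ≤ q * k := Nat.mul_le_mul_left _ (by omega)
      omega
    simp only [Finset.mem_insert, Finset.mem_singleton]
    interval_cases k
    · left; omega
    · right; omega
  exact (Finset.card_le_card h2).trans Finset.card_le_two

lemma norm_gauss_sum_sq_le (q : ℕ) [NeZero q] (a : ZMod q) (ha : IsUnit a) (k : ZMod q) :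
    ‖∑ r : ZMod q, ZMod.stdAddChar (a * r ^ 2 + k * r)‖ ^ 2 ≤ 2 * q := by
  set ψ := ZMod.stdAddChar (N := q) with hψ
  have hprim : ψ.IsPrimitive := ZMod.isPrimitive_stdAddChar q
  have hconj : ∀ x : ZMod q, (starRingEnd ℂ) (ψ x) = ψ (-x) := fun x => by
    rw [AddChar.map_neg_eq_conj]
  have h1 : ((‖∑ r : ZMod q, ψ (a * r ^ 2 + k * r)‖ ^ 2 : ℝ) : ℂ) =
      ∑ h : ZMod q, ψ (a * h ^ 2 + k * h) * ∑ s : ZMod q, ψ (s * (2 * a * h)) := by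
    rw [← Complex.normSq_eq_norm_sq, ← Complex.mul_conj, map_sum, Finset.sum_mul_sum,
      Finset.sum_comm]
    have : ∀ s : ZMod q, ∑ r : ZMod q, ψ (a * r ^ 2 + k * r) * (starRingEnd ℂ) (ψ (a * s ^ 2 + k * s)) =
        ∑ h : ZMod q, ψ (a * h ^ 2 + k * h) * ψ (s * (2 * a * h)) := by
      intro s
      rw [← Equiv.sum_comp (Equiv.addRight s)]
      refine Finset.sum_congr rfl fun h _ => ?_
      rw [hconj, ← AddChar.map_add_eq_mul, ← AddChar.map_add_eq_mul, Equiv.coe_addRight]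
      congr 1
      ring
    simp only [this]
    rw [Finset.sum_comm]
    simp only [Finset.mul_sum]
  have h2 : ‖∑ h : ZMod q, ψ (a * h ^ 2 + k * h) * ∑ s : ZMod q, ψ (s * (2 * a * h))‖ ≤ 2 * q := by
    refine (norm_sum_le _ _).trans ?_
    calc _ ≤ ∑ h : ZMod q, if 2 * h = 0 then (q : ℝ) else 0 := by
          refine Finset.sum_le_sum fun h _ => ?_
          rw [norm_mul, AddChar.norm_apply, one_mul, AddChar.sum_mulShift _ hprim]
          have : 2 * a * h = 0 ↔ 2 * h = 0 := by
            rw [mul_comm 2 a, mul_assoc, ha.mul_right_eq_zero]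
          simp only [this]
          split_ifs <;> simp [ZMod.card]
      _ = (Finset.univ.filter fun h : ZMod q => 2 * h = 0).card * (q : ℝ) := by
          rw [← Finset.sum_filter, Finset.sum_const, nsmul_eq_mul]
      _ ≤ 2 * q := by
          gcongr
          exact_mod_cast card_two_mul_eq_zero_le q
  rw [← h1, Complex.norm_real, Real.norm_of_nonneg (by positivity)] at h2
  exact h2

lemma summable_exp_neg_mul_sq {x : ℝ} (hx : 0 < x) :
    Summable fun n : ℤ => Real.exp (-Real.pi * x * (n : ℝ) ^ 2) := by
  have := summable_pow_mul_jacobiTheta₂_term_bound 0 hx 0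
  refine this.congr fun n => ?_
  simp [mul_assoc]

lemma exp_neg_mul_sub_sq_le {κ y : ℝ} (hκ : 1 / 9 ≤ κ) (hy0 : 0 ≤ y) (hy1 : y ≤ 1) (n : ℤ) :
    Real.exp (-Real.pi * κ * ((n : ℝ) - y) ^ 2) ≤
      Real.exp (Real.pi / 9) * Real.exp (-Real.pi * (1 / 18) * (n : ℝ) ^ 2) := by
  rw [← Real.exp_add]
  apply Real.exp_le_exp.2
  have h1 : (n : ℝ) ^ 2 / 2 - 1 ≤ ((n : ℝ) - y) ^ 2 := by
    nlinarith [sq_nonneg ((n : ℝ) - 2 * y)]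
  have h2 : (1 / 9) * ((n : ℝ) - y) ^ 2 ≤ κ * ((n : ℝ) - y) ^ 2 :=
    mul_le_mul_of_nonneg_right hκ (sq_nonneg _)
  nlinarith [Real.pi_pos]

/-- A shifted Gaussian with width bounded above has bounded sum over the integers. -/
lemma exists_tsum_exp_shift_le : ∃ C : ℝ, 0 < C ∧ ∀ κ y : ℝ, 1 / 9 ≤ κ →
    Summable (fun n : ℤ => Real.exp (-Real.pi * κ * ((n : ℝ) - y) ^ 2)) ∧
    ∑' n : ℤ, Real.exp (-Real.pi * κ * ((n : ℝ) - y) ^ 2) ≤ C := by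
  have hs : Summable fun n : ℤ =>
      Real.exp (Real.pi / 9) * Real.exp (-Real.pi * (1 / 18) * (n : ℝ) ^ 2) :=
    (summable_exp_neg_mul_sq (by norm_num)).mul_left _
  refine ⟨∑' n : ℤ, Real.exp (Real.pi / 9) * Real.exp (-Real.pi * (1 / 18) * (n : ℝ) ^ 2),
    hs.tsum_pos (fun _ => by positivity) 0 (by positivity), fun κ y hκ => ?_⟩
  have key : ∀ n : ℤ, Real.exp (-Real.pi * κ * (((n + ⌊y⌋ : ℤ) : ℝ) - y) ^ 2) ≤
      Real.exp (Real.pi / 9) * Real.exp (-Real.pi * (1 / 18) * (n : ℝ) ^ 2) := fun n => by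
    have := exp_neg_mul_sub_sq_le hκ (Int.fract_nonneg y) (Int.fract_lt_one y).le n
    refine le_trans (le_of_eq ?_) this
    congr 3
    push_cast
    rw [← Int.self_sub_floor]
    ring
  have hs2 := hs.of_nonneg_of_le (fun n => (Real.exp_pos _).le) key
  refine ⟨(Equiv.addRight ⌊y⌋).summable_iff.1 hs2, ?_⟩
  rw [← (Equiv.addRight ⌊y⌋).tsum_eq]
  exact hs2.tsum_le_tsum key hs

/-- The sum over residue classes modulo `q` of the shifts by `k / q` is a sum over the integers. -/
lemma sum_tsum_residue (q : ℕ) [NeZero q] {f : ℤ → ℝ} (hf : Summable f) :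
    ∑ k : Fin q, ∑' m : ℤ, f (m * q + k) = ∑' n, f n := by
  have h1 : Summable fun x : ℤ × Fin q => f (x.1 * q + (x.2 : ℕ)) := by
    have := (Int.divModEquiv q).symm.summable_iff.2 hf
    refine this.congr fun x => ?_
    simp [Function.comp, Int.divModEquiv_symm_apply]
  rw [← (Int.divModEquiv q).symm.tsum_eq]
  have h2 : (fun x : ℤ × Fin q => f ((Int.divModEquiv q).symm x)) =
      fun x => f (x.1 * q + (x.2 : ℕ)) := by
    funext x; simp [Int.divModEquiv_symm_apply]
  have h3 : Summable fun x : Fin q × ℤ => f (x.2 * q + (x.1 : ℕ)) :=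
    (Equiv.prodComm (Fin q) ℤ).summable_iff.2 h1
  rw [h2, ← (Equiv.prodComm (Fin q) ℤ).tsum_eq (fun x : ℤ × Fin q => f (x.1 * q + (x.2 : ℕ)))]
  exact ((h3.tsum_prod).trans (tsum_fintype _)).symm

lemma norm_tsum_gauss_le {z : ℂ} (hz : 0 < z.re) (θ : ℝ)
    (hs : Summable fun n : ℤ => Real.exp (-Real.pi * (1 / z).re * ((n : ℝ) - θ) ^ 2)) :
    ‖∑' n : ℤ, Complex.exp (-Real.pi * z * n ^ 2 + 2 * Real.pi * (Complex.I * θ) * n)‖ ≤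
      ‖z‖ ^ (-(1 / 2) : ℝ) * ∑' n : ℤ, Real.exp (-Real.pi * (1 / z).re * ((n : ℝ) - θ) ^ 2) := by
  have hz0 : z ≠ 0 := fun h => by simp [h] at hz
  rw [Complex.tsum_exp_neg_quadratic hz, norm_mul]
  have h1 : ‖1 / z ^ (1 / 2 : ℂ)‖ = ‖z‖ ^ (-(1 / 2) : ℝ) := by
    rw [norm_div, norm_one, Real.rpow_neg (norm_nonneg _), one_div]
    congr 1
    have := Complex.norm_cpow_real z (1 / 2)
    rw [← this]
    norm_num
  rw [h1]
  have h2 : ∀ n : ℤ, ‖Complex.exp (-Real.pi / z * (n + Complex.I * (Complex.I * θ)) ^ 2)‖ =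
      Real.exp (-Real.pi * (1 / z).re * ((n : ℝ) - θ) ^ 2) := fun n => by
    rw [Complex.norm_exp]
    congr 1
    have : (-Real.pi / z * (n + Complex.I * (Complex.I * θ)) ^ 2 : ℂ) =
        ((-Real.pi * ((n : ℝ) - θ) ^ 2 : ℝ) : ℂ) * (1 / z) := by
      rw [← mul_assoc Complex.I, Complex.I_mul_I]
      push_cast
      ring
    rw [this, Complex.re_ofReal_mul]
    ring
  have h3 : Summable fun n : ℤ =>
      ‖Complex.exp (-Real.pi / z * (n + Complex.I * (Complex.I * θ)) ^ 2)‖ :=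
    hs.congr fun n => (h2 n).symm
  gcongr
  refine (norm_tsum_le_tsum_norm h3).trans (le_of_eq ?_)
  exact tsum_congr h2

lemma sum_tsum_residue_zmod (q : ℕ) [NeZero q] {f : ℤ → ℝ} (hf : Summable f) :
    ∑ k : ZMod q, ∑' m : ℤ, f (m * q + k.val) = ∑' n, f n := by
  rw [← sum_tsum_residue q hf]
  obtain ⟨n, rfl⟩ := Nat.exists_eq_succ_of_ne_zero (NeZero.ne q)
  rfl

/-- Discrete Fourier expansion of the quadratic phase modulo `q`. -/
lemma stdAddChar_sq_eq (q : ℕ) [NeZero q] (a n : ZMod q) :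
    ZMod.stdAddChar (a * n ^ 2) = (1 / q : ℂ) * ∑ k : ZMod q,
      (∑ r : ZMod q, ZMod.stdAddChar (a * r ^ 2 + k * r)) * ZMod.stdAddChar (-(k * n)) := by
  have h1 : ∑ k : ZMod q,
      (∑ r : ZMod q, ZMod.stdAddChar (a * r ^ 2 + k * r)) * ZMod.stdAddChar (-(k * n)) =
      ∑ r : ZMod q, ZMod.stdAddChar (a * r ^ 2) * ∑ k : ZMod q, ZMod.stdAddChar (k * (r - n)) := by
    simp only [Finset.sum_mul, Finset.mul_sum]
    rw [Finset.sum_comm]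
    refine Finset.sum_congr rfl fun r _ => Finset.sum_congr rfl fun k _ => ?_
    rw [← AddChar.map_add_eq_mul, ← AddChar.map_add_eq_mul]
    congr 1
    ring
  rw [h1]
  simp only [AddChar.sum_mulShift _ (ZMod.isPrimitive_stdAddChar q), ZMod.card]
  rw [Finset.sum_eq_single n]
  · have : (q : ℂ) ≠ 0 := Nat.cast_ne_zero.2 (NeZero.ne q)
    simp only [sub_self, if_true]
    field_simp
  · intro r _ hr
    simp [sub_ne_zero.2 hr]
  · simp

/-- The Gaussian-weighted quadratic exponential. -/
def gterm (N θ t : ℝ) (n : ℤ) : ℂ :=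
  Complex.exp (((-Real.pi * (1 / N ^ 2) * (n : ℝ) ^ 2 : ℝ) : ℂ) +
    ((2 * Real.pi * (θ * n + t * n ^ 2) : ℝ) : ℂ) * Complex.I)

lemma norm_gterm (N θ t : ℝ) (n : ℤ) :
    ‖gterm N θ t n‖ = Real.exp (-Real.pi * (1 / N ^ 2) * (n : ℝ) ^ 2) := by
  rw [gterm, Complex.norm_exp]
  congr 1
  rw [Complex.add_re, Complex.ofReal_re, Complex.re_ofReal_mul, Complex.I_re, mul_zero, add_zero]

lemma gterm_eq (N θ τ : ℝ) (q : ℕ) [NeZero q] (a n : ℤ) :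
    gterm N θ (a / q + τ) n =
      (1 / q : ℂ) * ∑ k : ZMod q,
        (∑ r : ZMod q, ZMod.stdAddChar ((a : ZMod q) * r ^ 2 + k * r)) *
        Complex.exp (-Real.pi * ((1 / N ^ 2 : ℝ) - 2 * τ * Complex.I) * n ^ 2 +
          2 * Real.pi * (Complex.I * ((θ - k.val / q : ℝ) : ℂ)) * n) := by
  have hq : (q : ℂ) ≠ 0 := Nat.cast_ne_zero.2 (NeZero.ne q)
  have h1 : gterm N θ (a / q + τ) n = ZMod.stdAddChar ((a : ZMod q) * (n : ZMod q) ^ 2) *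
      Complex.exp (-Real.pi * ((1 / N ^ 2 : ℝ) - 2 * τ * Complex.I) * n ^ 2 +
          2 * Real.pi * (Complex.I * θ) * n) := by
    have : ((a : ZMod q) * (n : ZMod q) ^ 2) = ((a * n ^ 2 : ℤ) : ZMod q) := by push_cast; ring
    rw [this, ZMod.stdAddChar_coe, ← Complex.exp_add, gterm]
    congr 1
    push_cast
    field_simp
    ring
  rw [h1, stdAddChar_sq_eq, mul_assoc, Finset.sum_mul]
  congr 1
  refine Finset.sum_congr rfl fun k _ => ?_
  rw [mul_assoc]
  congr 1
  have : (-(k * (n : ZMod q))) = ((-(k.val * n) : ℤ) : ZMod q) := by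
    push_cast
    rw [ZMod.natCast_zmod_val]
  rw [this, ZMod.stdAddChar_coe, ← Complex.exp_add]
  congr 1
  push_cast
  field_simp
  ring

lemma re_sub_two_mul_I (x τ : ℝ) : ((x : ℂ) - 2 * τ * Complex.I).re = x := by
  simp

lemma im_sub_two_mul_I (x τ : ℝ) : ((x : ℂ) - 2 * τ * Complex.I).im = -(2 * τ) := by
  simp

lemma re_one_div_gauss {N τ : ℝ} (hN : 0 < N) :
    (1 / (((1 / N ^ 2 : ℝ) : ℂ) - 2 * τ * Complex.I)).re = N ^ 2 / (1 + 4 * N ^ 4 * τ ^ 2) := by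
  rw [one_div, Complex.inv_re, Complex.normSq_apply, re_sub_two_mul_I, im_sub_two_mul_I]
  field_simp
  ring

lemma norm_gauss_ge {N τ : ℝ} (hN : 0 < N) :
    (1 + N ^ 2 * |τ|) / (2 * N ^ 2) ≤ ‖(((1 / N ^ 2 : ℝ) : ℂ) - 2 * τ * Complex.I)‖ := by
  have h1 : 1 / N ^ 2 ≤ ‖(((1 / N ^ 2 : ℝ) : ℂ) - 2 * τ * Complex.I)‖ := by
    refine le_trans (le_of_eq ?_) ((le_abs_self _).trans (Complex.abs_re_le_norm _))
    rw [re_sub_two_mul_I]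
  have h2 : 2 * |τ| ≤ ‖(((1 / N ^ 2 : ℝ) : ℂ) - 2 * τ * Complex.I)‖ := by
    refine le_trans (le_of_eq ?_) (Complex.abs_im_le_norm _)
    rw [im_sub_two_mul_I, abs_neg, abs_mul]
    norm_num
  have h3 : (1 + N ^ 2 * |τ|) / (2 * N ^ 2) = (1 / N ^ 2 + |τ|) / 2 := by
    field_simp
  rw [h3]
  linarith [abs_nonneg τ]

lemma summable_gterm {N : ℝ} (hN : 0 < N) (θ t : ℝ) : Summable (gterm N θ t) := by
  refine Summable.of_norm ?_
  simp only [norm_gterm]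
  exact summable_exp_neg_mul_sq (by positivity)

/-- Major arc estimate for the full Gaussian-weighted Weyl sum. -/
lemma exists_norm_tsum_gterm_le : ∃ C : ℝ, 0 < C ∧ ∀ (N θ τ : ℝ) (a : ℤ) (q : ℕ), 1 ≤ N → 0 < q →
    (q : ℝ) ≤ N → IsUnit (a : ZMod q) → |τ| ≤ 1 / (q * N) →
    ‖∑' n, gterm N θ (a / q + τ) n‖ ≤ C * (N * (q * (1 + N ^ 2 * |τ|)) ^ (-(1 / 2) : ℝ)) := by
  obtain ⟨C, hC, hshift⟩ := exists_tsum_exp_shift_le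
  refine ⟨2 * C, by positivity, fun N θ τ a q hN hq0 hqN ha hτ => ?_⟩
  have : NeZero q := ⟨hq0.ne'⟩
  have hq : (0 : ℝ) < q := by exact_mod_cast hq0
  have hN0 : 0 < N := by linarith
  set z : ℂ := ((1 / N ^ 2 : ℝ) : ℂ) - 2 * τ * Complex.I with hz
  have hzre : 0 < z.re := by
    rw [hz, re_sub_two_mul_I]
    positivity
  have hκ : (1 / z).re = N ^ 2 / (1 + 4 * N ^ 4 * τ ^ 2) := re_one_div_gauss hN0
  set κ := (1 / z).re with hκdef
  have hκ9 : 1 / 9 ≤ κ / (q : ℝ) ^ 2 := by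
    rw [hκ, div_div, div_le_div_iff₀ (by norm_num) (by positivity)]
    have h1 : q * N * |τ| ≤ 1 := by
      rw [le_div_iff₀ (by positivity)] at hτ
      linarith
    have h2 : (q * N * |τ|) ^ 2 ≤ 1 := pow_le_one₀ (by positivity) h1
    rw [mul_pow, sq_abs] at h2
    have h3 : (q : ℝ) ^ 2 ≤ N ^ 2 := pow_le_pow_left₀ hq.le hqN 2
    nlinarith [mul_le_mul_of_nonneg_left h2 (sq_nonneg N)]
  obtain ⟨hs, hle⟩ := hshift (κ / (q : ℝ) ^ 2) (q * θ) hκ9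
  set f : ℤ → ℝ := fun n => Real.exp (-Real.pi * (κ / (q : ℝ) ^ 2) * ((n : ℝ) - q * θ) ^ 2) with hf
  have hfe : ∀ (k : ZMod q) (m : ℤ), f (m * q + k.val) =
      Real.exp (-Real.pi * κ * ((m : ℝ) - (θ - k.val / q : ℝ)) ^ 2) := fun k m => by
    rw [hf]
    simp only
    congr 1
    push_cast
    field_simp
    ring
  have hfs : ∀ k : ZMod q, Summable fun m : ℤ =>
      Real.exp (-Real.pi * κ * ((m : ℝ) - (θ - k.val / q : ℝ)) ^ 2) := fun k => by
    have : Function.Injective fun m : ℤ => m * q + (k.val : ℤ) := fun x y hxy => by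
      simpa [hq0.ne'] using hxy
    exact (hs.comp_injective this).congr fun m => hfe k m
  have hterm : ∀ k : ZMod q, Summable fun n : ℤ => Complex.exp (-Real.pi * z * n ^ 2 +
          2 * Real.pi * (Complex.I * ((θ - k.val / q : ℝ) : ℂ)) * n) := fun k => by
    refine (summable_gterm hN0 (θ - k.val / q) τ).congr fun n => ?_
    rw [gterm, hz]
    congr 1
    push_cast
    ring
  have hsum : ∑' n, gterm N θ (a / q + τ) n = (1 / q : ℂ) * ∑ k : ZMod q,
        (∑ r : ZMod q, ZMod.stdAddChar ((a : ZMod q) * r ^ 2 + k * r)) *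
        ∑' n : ℤ, Complex.exp (-Real.pi * z * n ^ 2 +
          2 * Real.pi * (Complex.I * ((θ - k.val / q : ℝ) : ℂ)) * n) := by
    simp only [gterm_eq]
    rw [tsum_mul_left, Summable.tsum_finsetSum fun k _ => (hterm k).mul_left _]
    simp only [tsum_mul_left, hz]
  have hG : ∀ k : ZMod q, ‖∑ r : ZMod q, ZMod.stdAddChar ((a : ZMod q) * r ^ 2 + k * r)‖ ≤
      Real.sqrt (2 * q) := fun k => Real.le_sqrt_of_sq_le (norm_gauss_sum_sq_le q a ha k)
  have h3 : ‖∑' n, gterm N θ (a / q + τ) n‖ ≤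
      1 / q * (Real.sqrt (2 * q) * ‖z‖ ^ (-(1 / 2) : ℝ) * C) := by
    rw [hsum, norm_mul]
    have : ‖(1 / q : ℂ)‖ = 1 / q := by simp
    rw [this]
    gcongr
    refine (norm_sum_le _ _).trans ?_
    calc _ ≤ ∑ k : ZMod q, Real.sqrt (2 * q) * (‖z‖ ^ (-(1 / 2) : ℝ) *
          ∑' m : ℤ, f (m * q + k.val)) := by
          refine Finset.sum_le_sum fun k _ => ?_
          rw [norm_mul]
          gcongr
          · exact hG k
          · simp only [hfe]
            exact norm_tsum_gauss_le hzre _ (hfs k)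
      _ = Real.sqrt (2 * q) * ‖z‖ ^ (-(1 / 2) : ℝ) * ∑' n, f n := by
          rw [← sum_tsum_residue_zmod q hs, Finset.mul_sum]
          exact Finset.sum_congr rfl fun _ _ => by ring
      _ ≤ _ := by gcongr
  refine h3.trans ?_
  have hz2 : ‖z‖ ^ (-(1 / 2) : ℝ) ≤ Real.sqrt 2 * N * (1 + N ^ 2 * |τ|) ^ (-(1 / 2) : ℝ) := by
    have hpos : 0 < (1 + N ^ 2 * |τ|) / (2 * N ^ 2) := by positivity
    calc ‖z‖ ^ (-(1 / 2) : ℝ) ≤ ((1 + N ^ 2 * |τ|) / (2 * N ^ 2)) ^ (-(1 / 2) : ℝ) :=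
          Real.rpow_le_rpow_of_nonpos hpos (norm_gauss_ge hN0) (by norm_num)
      _ = _ := by
          rw [Real.div_rpow (by positivity) (by positivity), Real.rpow_neg (by positivity : 0 ≤ 2 * N ^ 2),
            ← Real.sqrt_eq_rpow, Real.sqrt_mul (by norm_num), Real.sqrt_sq hN0.le]
          field_simp
  rw [Real.mul_rpow hq.le (by positivity), Real.sqrt_mul (by norm_num)]
  have hqq : (q : ℝ) ^ (-(1 / 2) : ℝ) = 1 / q * Real.sqrt q := by
    rw [Real.rpow_neg hq.le, ← Real.sqrt_eq_rpow]
    field_simp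
    rw [Real.sq_sqrt hq.le]
  rw [hqq]
  calc _ ≤ 1 / q * (Real.sqrt 2 * Real.sqrt q *
        (Real.sqrt 2 * N * (1 + N ^ 2 * |τ|) ^ (-(1 / 2) : ℝ)) * C) := by gcongr
    _ = (Real.sqrt 2 * Real.sqrt 2) * C * (N * (1 / q * Real.sqrt q *
        (1 + N ^ 2 * |τ|) ^ (-(1 / 2) : ℝ))) := by ring
    _ = _ := by rw [Real.mul_self_sqrt (by norm_num)]

/-- Major arc estimate for a truncated Gaussian-weighted Weyl sum. -/
lemma exists_norm_sum_gterm_le : ∃ C : ℝ, 0 < C ∧ ∀ N : ℝ, 1 ≤ N → ∃ M : ℕ, 2 * N ≤ M ∧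
    ∀ (θ τ : ℝ) (a : ℤ) (q : ℕ), 0 < q →
    (q : ℝ) ≤ N → IsUnit (a : ZMod q) → |τ| ≤ 1 / (q * N) →
    ‖∑ n ∈ Finset.Icc (-(M : ℤ)) M, gterm N θ (a / q + τ) n‖ ≤
      C * (N * (q * (1 + N ^ 2 * |τ|)) ^ (-(1 / 2) : ℝ)) := by
  obtain ⟨C, hC, hfull⟩ := exists_norm_tsum_gterm_le
  refine ⟨C + 2, by positivity, fun N hN => ?_⟩
  have hN0 : 0 < N := by linarith
  have hs := summable_exp_neg_mul_sq (x := 1 / N ^ 2) (by positivity)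
  obtain ⟨s, hsv⟩ := hs.tsum_vanishing (Metric.ball_mem_nhds 0 one_pos)
  obtain ⟨M, hM2, hMs⟩ : ∃ M : ℕ, 2 * N ≤ M ∧ s ⊆ Finset.Icc (-(M : ℤ)) M := by
    refine ⟨⌈2 * N⌉₊ + ∑ x ∈ s, x.natAbs, ?_, fun x hx => ?_⟩
    · push_cast
      have h0 : (0 : ℝ) ≤ ∑ x ∈ s, (x.natAbs : ℝ) := Finset.sum_nonneg fun _ _ => by positivity
      linarith [Nat.le_ceil (2 * N)]
    · have := Finset.single_le_sum (f := Int.natAbs) (fun _ _ => Nat.zero_le _) hx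
      rw [Finset.mem_Icc]
      omega
  refine ⟨M, hM2, fun θ τ a q hq0 hqN ha hτ => ?_⟩
  have hq : (0 : ℝ) < q := by exact_mod_cast hq0
  have hsplit := (summable_gterm hN0 θ (a / q + τ)).sum_add_tsum_compl
    (s := Finset.Icc (-(M : ℤ)) M)
  have htail : ‖∑' n : ↑((Finset.Icc (-(M : ℤ)) M : Set ℤ)ᶜ), gterm N θ (a / q + τ) n‖ ≤ 1 := by
    have h1 := hsv ((Finset.Icc (-(M : ℤ)) M : Set ℤ)ᶜ)
      (Set.disjoint_left.2 fun x hx hxs => hx (by exact_mod_cast hMs hxs))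
    rw [mem_ball_zero_iff] at h1
    refine (norm_tsum_le_tsum_norm ?_).trans ((le_of_eq ?_).trans ((le_abs_self _).trans h1.le))
    · exact ((hs.congr fun n => (norm_gterm N θ _ n).symm)).subtype _
    · simp only [norm_gterm]
  have hmain := hfull N θ τ a q hN hq0 hqN ha hτ
  have hone : 1 ≤ 2 * (N * (q * (1 + N ^ 2 * |τ|)) ^ (-(1 / 2) : ℝ)) := by
    have hle : q * (1 + N ^ 2 * |τ|) ≤ (2 * N) ^ 2 := by
      have h1 : q * N * |τ| ≤ 1 := by
        rw [le_div_iff₀ (by positivity)] at hτ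
        linarith
      nlinarith
    have h2 : ((2 * N) ^ 2) ^ (-(1 / 2) : ℝ) ≤ (q * (1 + N ^ 2 * |τ|)) ^ (-(1 / 2) : ℝ) :=
      Real.rpow_le_rpow_of_nonpos (by positivity) hle (by norm_num)
    have h3 : ((2 * N) ^ 2) ^ (-(1 / 2) : ℝ) = (2 * N)⁻¹ := by
      rw [Real.rpow_neg (by positivity), ← Real.sqrt_eq_rpow, Real.sqrt_sq (by positivity)]
    rw [h3] at h2
    calc (1 : ℝ) = 2 * (N * (2 * N)⁻¹) := by field_simp
      _ ≤ _ := by gcongr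
  have heq : ∑ n ∈ Finset.Icc (-(M : ℤ)) M, gterm N θ (a / q + τ) n =
      (∑' n, gterm N θ (a / q + τ) n) -
        ∑' n : ↑((Finset.Icc (-(M : ℤ)) M : Set ℤ)ᶜ), gterm N θ (a / q + τ) n := by
    rw [← hsplit]
    simp
  rw [heq]
  refine (norm_sub_le _ _).trans ?_
  rw [add_mul]
  exact add_le_add hmain (htail.trans hone)

/-! ### Divisor sums -/

lemma card_divisors_mul_le (m n : ℕ) :
    (m * n).divisors.card ≤ m.divisors.card * n.divisors.card := by
  classical
  rw [Nat.divisors_mul]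
  exact Finset.card_mul_le

lemma sum_inv_le (X : ℕ) : ∑ m ∈ Finset.Icc 1 X, (1 / m : ℝ) ≤ 1 + Real.log X := by
  have h := harmonic_le_one_add_log X
  rw [harmonic_eq_sum_Icc] at h
  push_cast at h
  simpa [one_div] using h

lemma sum_card_divisors_pow_div_le (X : ℕ) (B : ℕ) :
    ∑ m ∈ Finset.Icc 1 X, ((m.divisors.card : ℝ) ^ B / m) ≤ (1 + Real.log X) ^ (2 ^ B) := by
  induction B with
  | zero => simpa using sum_inv_le X
  | succ B ih =>
    have hnn : (0 : ℝ) ≤ ∑ m ∈ Finset.Icc 1 X, ((m.divisors.card : ℝ) ^ B / m) :=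
      Finset.sum_nonneg fun _ _ => by positivity
    calc ∑ m ∈ Finset.Icc 1 X, ((m.divisors.card : ℝ) ^ (B + 1) / m)
        = ∑ m ∈ Finset.Icc 1 X, ∑ x ∈ m.divisorsAntidiagonal,
            (((x.1 * x.2).divisors.card : ℝ) ^ B / ((x.1 * x.2 : ℕ) : ℝ)) := by
          refine Finset.sum_congr rfl fun m _ => ?_
          have : ∀ x ∈ m.divisorsAntidiagonal,
              (((x.1 * x.2).divisors.card : ℝ) ^ B / ((x.1 * x.2 : ℕ) : ℝ)) =
                (m.divisors.card : ℝ) ^ B / m := fun x hx => by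
            rw [(Nat.mem_divisorsAntidiagonal.1 hx).1]
          rw [Finset.sum_congr rfl this, Finset.sum_const, nsmul_eq_mul,
            ← Nat.map_div_right_divisors, Finset.card_map]
          ring
      _ ≤ ∑ m ∈ Finset.Icc 1 X, ∑ x ∈ m.divisorsAntidiagonal,
            ((x.1.divisors.card : ℝ) ^ B / x.1) * ((x.2.divisors.card : ℝ) ^ B / x.2) := by
          refine Finset.sum_le_sum fun m _ => Finset.sum_le_sum fun x _ => ?_
          rw [div_mul_div_comm, ← mul_pow, Nat.cast_mul]
          gcongr
          exact_mod_cast card_divisors_mul_le x.1 x.2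
      _ = ∑ x ∈ (Finset.Icc 1 X).biUnion fun m => m.divisorsAntidiagonal,
            ((x.1.divisors.card : ℝ) ^ B / x.1) * ((x.2.divisors.card : ℝ) ^ B / x.2) := by
          rw [Finset.sum_biUnion]
          intro m _ n _ hmn
          rw [Function.onFun, Finset.disjoint_left]
          intro x hx hx'
          exact hmn ((Nat.mem_divisorsAntidiagonal.1 hx).1.symm.trans
            (Nat.mem_divisorsAntidiagonal.1 hx').1)
      _ ≤ ∑ x ∈ Finset.Icc 1 X ×ˢ Finset.Icc 1 X,
            ((x.1.divisors.card : ℝ) ^ B / x.1) * ((x.2.divisors.card : ℝ) ^ B / x.2) := by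
          refine Finset.sum_le_sum_of_subset_of_nonneg (fun x hx => ?_) fun _ _ _ => by positivity
          obtain ⟨m, hm, hx⟩ := Finset.mem_biUnion.1 hx
          obtain ⟨h1, h2⟩ := Nat.mem_divisorsAntidiagonal.1 hx
          rw [Finset.mem_Icc] at hm
          have hx1 : x.1 ≠ 0 := fun h => h2 (by rw [← h1, h, zero_mul])
          have hx2 : x.2 ≠ 0 := fun h => h2 (by rw [← h1, h, mul_zero])
          have h3 : x.1 ≤ m := Nat.le_of_dvd (by omega) ⟨_, h1.symm⟩
          have h4 : x.2 ≤ m := Nat.le_of_dvd (by omega) ⟨_, by rw [mul_comm]; exact h1.symm⟩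
          simp only [Finset.mem_product, Finset.mem_Icc]
          omega
      _ = (∑ m ∈ Finset.Icc 1 X, ((m.divisors.card : ℝ) ^ B / m)) ^ 2 := by
          rw [Finset.sum_product, sq, Finset.sum_mul_sum]
      _ ≤ ((1 + Real.log X) ^ (2 ^ B)) ^ 2 := pow_le_pow_left₀ hnn ih 2
      _ = _ := by rw [← pow_mul, pow_succ]

/-- Powers of the number of small divisors are controlled by divisor sums over moduli. -/
lemma card_dvd_pow_le (R B m : ℕ) (hm : m ≠ 0) :
    ((Finset.Icc 1 R).filter (· ∣ m)).card ^ B ≤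
      ∑ l ∈ (Finset.Icc 1 (R ^ B)).filter (· ∣ m), l.divisors.card ^ B := by
  classical
  set S := (Finset.Icc 1 R).filter (· ∣ m) with hS
  rw [← Fintype.card_piFinset_const S B]
  have hmaps : Set.MapsTo (fun d : Fin B → ℕ => Finset.univ.lcm d)
      (Fintype.piFinset fun _ : Fin B => S : Finset (Fin B → ℕ))
      ((Finset.Icc 1 (R ^ B)).filter (· ∣ m) : Finset ℕ) := by
    intro d hd
    have hd' : ∀ i, d i ∈ S := Fintype.mem_piFinset.1 (Finset.mem_coe.1 hd)
    have hmem : ∀ i, (1 ≤ d i ∧ d i ≤ R) ∧ d i ∣ m := fun i => by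
      simpa [hS] using hd' i
    have h1 : Finset.univ.lcm d ∣ m := Finset.lcm_dvd_iff.2 fun i _ => (hmem i).2
    have h2 : Finset.univ.lcm d ∣ ∏ i, d i :=
      Finset.lcm_dvd_iff.2 fun i _ => Finset.dvd_prod_of_mem _ (Finset.mem_univ i)
    have h3 : ∏ i, d i ≤ R ^ B :=
      (Finset.prod_le_prod' fun i _ => (hmem i).1.2).trans (by simp)
    have h4 : 0 < ∏ i, d i := Finset.prod_pos fun i _ => (hmem i).1.1
    simp only [Finset.coe_filter, Finset.mem_Icc, Set.mem_ofPred_eq]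
    exact ⟨⟨Nat.pos_of_dvd_of_pos h1 (Nat.pos_of_ne_zero hm),
      (Nat.le_of_dvd h4 h2).trans h3⟩, h1⟩
  rw [Finset.card_eq_sum_card_fiberwise hmaps]
  refine Finset.sum_le_sum fun l hl => ?_
  rw [← Fintype.card_piFinset_const l.divisors B]
  refine Finset.card_le_card fun d hd => ?_
  obtain ⟨_, hd2⟩ := Finset.mem_filter.1 hd
  have hl0 : l ≠ 0 := by
    have := (Finset.mem_Icc.1 (Finset.mem_filter.1 hl).1).1
    omega
  exact Fintype.mem_piFinset.2 fun i => Nat.mem_divisors.2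
    ⟨hd2 ▸ Finset.dvd_lcm (Finset.mem_univ i), hl0⟩

lemma sum_inv_sq_le {l : ℝ} {A : ℝ} (hl : 0 < l) (hA : 0 < A) (K : ℕ) :
    ∑ k ∈ Finset.Icc 1 K, 1 / (k * l + A) ^ 2 ≤ 1 / (l * A) := by
  have h : ∑ k ∈ Finset.Icc 1 K, 1 / ((k : ℝ) * l + A) ^ 2 ≤
      1 / (l * A) - 1 / (l * (K * l + A)) := by
    induction K with
    | zero => simp
    | succ K ih =>
      rw [Finset.sum_Icc_succ_top (by omega)]
      have h1 : 1 / (((K + 1 : ℕ) : ℝ) * l + A) ^ 2 ≤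
          1 / (l * (K * l + A)) - 1 / (l * (((K + 1 : ℕ) : ℝ) * l + A)) := by
        push_cast
        have hp : 0 < (K : ℝ) * l + A := by positivity
        have e : 1 / (l * (K * l + A)) - 1 / (l * (((K : ℝ) + 1) * l + A)) =
            1 / ((K * l + A) * (((K : ℝ) + 1) * l + A)) := by
          field_simp
          ring
        rw [e, sq]
        gcongr
        linarith
      linarith
  have : 0 ≤ 1 / (l * (K * l + A)) := by positivity
  linarith

lemma sum_dvd_inv_sq_le (l X : ℕ) (hl : 0 < l) {A : ℝ} (hA : 0 < A) :
    ∑ m ∈ (Finset.Icc 1 X).filter (l ∣ ·), 1 / ((m : ℝ) + A) ^ 2 ≤ 1 / (l * A) := by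
  refine le_trans ?_ (sum_inv_sq_le (l := l) (by exact_mod_cast hl) hA X)
  have hsub : (Finset.Icc 1 X).filter (l ∣ ·) ⊆ (Finset.Icc 1 X).image (· * l) := fun m hm => by
    obtain ⟨h1, k, rfl⟩ := Finset.mem_filter.1 hm
    rw [Finset.mem_Icc] at h1
    refine Finset.mem_image.2 ⟨k, Finset.mem_Icc.2 ⟨?_, ?_⟩, by ring⟩
    · rcases Nat.eq_zero_or_pos k with rfl | h
      · simp at h1
      · exact h
    · nlinarith
  refine (Finset.sum_le_sum_of_subset_of_nonneg hsub fun _ _ _ => by positivity).trans ?_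
  rw [Finset.sum_image fun a _ b _ h => Nat.eq_of_mul_eq_mul_right hl h]
  push_cast
  rfl

/-- Moments of the number of small divisors against a quadratically decaying weight. -/
lemma sum_card_dvd_pow_le (R B X : ℕ) {A : ℝ} (hA : 0 < A) :
    ∑ m ∈ Finset.Icc 1 X, (((Finset.Icc 1 R).filter (· ∣ m)).card : ℝ) ^ B / ((m : ℝ) + A) ^ 2 ≤
      (1 + B * Real.log R) ^ (2 ^ B) / A := by
  calc _ ≤ ∑ m ∈ Finset.Icc 1 X, ∑ l ∈ (Finset.Icc 1 (R ^ B)).filter (· ∣ m),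
        (l.divisors.card : ℝ) ^ B * (1 / ((m : ℝ) + A) ^ 2) := by
        refine Finset.sum_le_sum fun m hm => ?_
        rw [← Finset.sum_mul, mul_one_div]
        gcongr
        have := card_dvd_pow_le R B m (by have := (Finset.mem_Icc.1 hm).1; omega)
        exact_mod_cast this
    _ = ∑ l ∈ Finset.Icc 1 (R ^ B), (l.divisors.card : ℝ) ^ B *
          ∑ m ∈ (Finset.Icc 1 X).filter (l ∣ ·), 1 / ((m : ℝ) + A) ^ 2 := by
        simp only [Finset.sum_filter, Finset.mul_sum]
        rw [Finset.sum_comm]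
        refine Finset.sum_congr rfl fun l _ => Finset.sum_congr rfl fun m _ => ?_
        split_ifs <;> simp
    _ ≤ ∑ l ∈ Finset.Icc 1 (R ^ B), (l.divisors.card : ℝ) ^ B * (1 / (l * A)) := by
        refine Finset.sum_le_sum fun l hl => ?_
        gcongr
        exact sum_dvd_inv_sq_le l X (Finset.mem_Icc.1 hl).1 hA
    _ = (∑ l ∈ Finset.Icc 1 (R ^ B), (l.divisors.card : ℝ) ^ B / l) / A := by
        rw [Finset.sum_div]
        refine Finset.sum_congr rfl fun l _ => ?_
        rw [mul_one_div, div_div]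
    _ ≤ _ := by
        gcongr
        refine (sum_card_divisors_pow_div_le _ _).trans (le_of_eq ?_)
        rw [Nat.cast_pow, Real.log_pow]

/-! ### Ramanujan sums -/

lemma sum_divisors_moebius (n : ℕ) :
    ∑ e ∈ n.divisors, (ArithmeticFunction.moebius e : ℤ) = if n = 1 then 1 else 0 := by
  have h := congrArg (fun f => f n) ArithmeticFunction.coe_zeta_mul_moebius
  simp only [ArithmeticFunction.coe_zeta_mul_apply, ArithmeticFunction.one_apply] at h
  exact h

lemma sum_coprime_eq (q : ℕ) (hq : 0 < q) (h : ℕ → ℂ) :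
    ∑ a ∈ (Finset.range q).filter (Nat.Coprime · q), h a =
      ∑ e ∈ q.divisors, (ArithmeticFunction.moebius e : ℂ) *
        ∑ b ∈ Finset.range (q / e), h (e * b) := by
  have h1 : ∀ a, (if Nat.Coprime a q then h a else 0) =
      ∑ e ∈ q.divisors, if e ∣ a then (ArithmeticFunction.moebius e : ℂ) * h a else 0 := by
    intro a
    have h2 := sum_divisors_moebius (Nat.gcd a q)
    have h3 : (Nat.gcd a q).divisors = q.divisors.filter (· ∣ a) := by
      ext e
      simp only [Nat.mem_divisors, Finset.mem_filter, Nat.dvd_gcd_iff]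
      constructor
      · rintro ⟨⟨h1, h2⟩, _⟩; exact ⟨⟨h2, hq.ne'⟩, h1⟩
      · rintro ⟨⟨h1, _⟩, h2⟩; exact ⟨⟨h2, h1⟩, Nat.gcd_ne_zero_right hq.ne'⟩
    rw [h3] at h2
    rw [← Finset.sum_filter, ← Finset.sum_mul]
    have h4 : ∑ e ∈ q.divisors.filter (· ∣ a), (ArithmeticFunction.moebius e : ℂ) =
        if Nat.gcd a q = 1 then 1 else 0 := by
      have := congrArg (Int.cast : ℤ → ℂ) h2
      push_cast at this
      exact this
    rw [h4]
    simp [Nat.Coprime]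
  rw [Finset.sum_filter]
  simp only [h1]
  rw [Finset.sum_comm]
  refine Finset.sum_congr rfl fun e he => ?_
  obtain ⟨⟨k, rfl⟩, _⟩ := Nat.mem_divisors.1 he
  have he0 : 0 < e := Nat.pos_of_mul_pos_right hq
  rw [Nat.mul_div_cancel_left k he0, Finset.mul_sum, ← Finset.sum_filter]
  have : (Finset.range (e * k)).filter (e ∣ ·) = (Finset.range k).image (e * ·) := by
    ext a
    simp only [Finset.mem_filter, Finset.mem_range, Finset.mem_image]
    constructor
    · rintro ⟨h1, b, rfl⟩
      exact ⟨b, lt_of_mul_lt_mul_left h1 he0.le, rfl⟩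
    · rintro ⟨b, hb, rfl⟩
      exact ⟨Nat.mul_lt_mul_of_pos_left hb he0, dvd_mul_right _ _⟩
  rw [this, Finset.sum_image fun a _ b _ h => Nat.eq_of_mul_eq_mul_left he0 h]

lemma norm_sum_stdAddChar_div_le (L d : ℕ) [NeZero L] (hd : d ∣ L) (m : ℤ) :
    ‖∑ b ∈ Finset.range d, ZMod.stdAddChar ((b : ZMod L) * ((L / d : ℕ) : ZMod L) * (m : ZMod L))‖ ≤
      if (d : ℤ) ∣ m then (d : ℝ) else 0 := by
  split_ifs with h
  · refine (norm_sum_le _ _).trans ?_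
    simp [AddChar.norm_apply]
  · rw [norm_le_zero_iff]
    obtain ⟨k, rfl⟩ := hd
    have hdk : d * k ≠ 0 := NeZero.ne _
    have hd0 : 0 < d := Nat.pos_of_ne_zero (left_ne_zero_of_mul hdk)
    have hk0 : k ≠ 0 := right_ne_zero_of_mul hdk
    rw [Nat.mul_div_cancel_left k hd0]
    set y : ZMod (d * k) := (k : ZMod (d * k)) * m with hy
    set z : ℂ := ZMod.stdAddChar y with hz
    have h1 : ∀ b ∈ Finset.range d,
        ZMod.stdAddChar ((b : ZMod (d * k)) * (k : ZMod (d * k)) * (m : ZMod (d * k))) = z ^ b := by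
      intro b _
      rw [hz, ← AddChar.map_nsmul_eq_pow, nsmul_eq_mul, hy, mul_assoc]
    rw [Finset.sum_congr rfl h1]
    have hz1 : z ≠ 1 := fun hcon => by
      have : y = 0 := by
        apply ZMod.injective_stdAddChar
        rw [AddChar.map_zero_eq_one, ← hcon]
      rw [hy] at this
      have h2 : ((k * m : ℤ) : ZMod (d * k)) = 0 := by push_cast; exact this
      rw [ZMod.intCast_zmod_eq_zero_iff_dvd] at h2
      apply h
      push_cast at h2
      rw [mul_comm (d : ℤ)] at h2
      exact Int.dvd_of_mul_dvd_mul_left (by exact_mod_cast hk0) h2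
    have hzd : z ^ d = 1 := by
      rw [hz, ← AddChar.map_nsmul_eq_pow, nsmul_eq_mul, hy, ← mul_assoc]
      have : ((d : ZMod (d * k)) * (k : ZMod (d * k))) = 0 := by
        rw [← Nat.cast_mul, ZMod.natCast_self]
      rw [this, zero_mul, AddChar.map_zero_eq_one]
    rw [geom_sum_eq hz1, hzd]
    simp

/-- Ramanujan sum bound. -/
lemma norm_ramanujan_le (L q : ℕ) [NeZero L] (hq0 : 0 < q) (hq : q ∣ L) (m : ℤ) :
    ‖∑ a ∈ (Finset.range q).filter (Nat.Coprime · q),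
      ZMod.stdAddChar ((a : ZMod L) * ((L / q : ℕ) : ZMod L) * (m : ZMod L))‖ ≤
      ∑ d ∈ q.divisors, if (d : ℤ) ∣ m then (d : ℝ) else 0 := by
  rw [sum_coprime_eq q hq0 fun a => ZMod.stdAddChar ((a : ZMod L) * ((L / q : ℕ) : ZMod L) * (m : ZMod L)),
    ← Nat.sum_div_divisors q fun d => if (d : ℤ) ∣ m then (d : ℝ) else 0]
  refine (norm_sum_le _ _).trans (Finset.sum_le_sum fun e he => ?_)
  rw [norm_mul]
  have h1 : ‖(ArithmeticFunction.moebius e : ℂ)‖ ≤ 1 := by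
    rw [Complex.norm_intCast]
    exact_mod_cast ArithmeticFunction.abs_moebius_le_one
  obtain ⟨⟨k, rfl⟩, _⟩ := Nat.mem_divisors.1 he
  have he0 : 0 < e := Nat.pos_of_mul_pos_right hq0
  have hk0 : 0 < k := Nat.pos_of_mul_pos_left hq0
  rw [Nat.mul_div_cancel_left k he0]
  have h2 := norm_sum_stdAddChar_div_le L k ((dvd_mul_left k e).trans hq) m
  refine le_trans ?_ h2
  have h3 : ∀ b ∈ Finset.range k, ZMod.stdAddChar
      (((e * b : ℕ) : ZMod L) * ((L / (e * k) : ℕ) : ZMod L) * (m : ZMod L)) =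
      ZMod.stdAddChar ((b : ZMod L) * ((L / k : ℕ) : ZMod L) * (m : ZMod L)) := by
    intro b _
    have : L / k = e * (L / (e * k)) := by
      obtain ⟨j, rfl⟩ := hq
      rw [Nat.mul_div_cancel_left j hq0, mul_comm e k, mul_assoc, Nat.mul_div_cancel_left _ hk0]
    rw [this]
    push_cast
    congr 1
    ring
  rw [Finset.sum_congr rfl h3]
  exact mul_le_of_le_one_left (norm_nonneg _) h1

lemma norm_stdAddChar_sub_one_ge (L : ℕ) [NeZero L] (m : ℤ) (hm : 2 * |m| ≤ L) :
    4 * |(m : ℝ)| / L ≤ ‖ZMod.stdAddChar (m : ZMod L) - 1‖ := by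
  have hL : (0 : ℝ) < L := by exact_mod_cast Nat.pos_of_ne_zero (NeZero.ne L)
  have h1 : (ZMod.stdAddChar (m : ZMod L) : ℂ) =
      Complex.exp (Complex.I * ((2 * Real.pi * m / L : ℝ) : ℂ)) := by
    rw [ZMod.stdAddChar_coe]
    congr 1
    push_cast
    ring
  rw [h1, Complex.norm_exp_I_mul_ofReal_sub_one, norm_mul, Real.norm_eq_abs, Real.norm_eq_abs]
  have h2 : |2 * Real.pi * m / L / 2| = Real.pi * |(m : ℝ)| / L := by
    rw [show 2 * Real.pi * m / L / 2 = Real.pi * m / L by ring, abs_div, abs_mul,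
      abs_of_pos Real.pi_pos, abs_of_pos hL]
  have hm' : 2 * |(m : ℝ)| ≤ L := by exact_mod_cast hm
  have h3 := Real.mul_abs_le_abs_sin (x := 2 * Real.pi * m / L / 2) (by
    rw [h2, div_le_div_iff₀ hL (by norm_num)]
    nlinarith [Real.pi_pos])
  rw [h2] at h3
  have h4 : 2 / Real.pi * (Real.pi * |(m : ℝ)| / L) = 2 * |(m : ℝ)| / L := by
    field_simp
  rw [h4] at h3
  have : |(2 : ℝ)| = 2 := by norm_num
  rw [this]
  calc 4 * |(m : ℝ)| / L = 2 * (2 * |(m : ℝ)| / L) := by ring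
    _ ≤ _ := by gcongr

/-- Geometric sums over a symmetric interval. -/
lemma norm_sum_Icc_stdAddChar_le (L : ℕ) [NeZero L] (m : ℤ) (hm0 : m ≠ 0) (hm : 2 * |m| ≤ L) (ρ : ℕ) :
    ‖∑ r ∈ Finset.Icc (-(ρ : ℤ)) ρ, ZMod.stdAddChar ((r : ZMod L) * (m : ZMod L))‖ ≤
      L / (2 * |(m : ℝ)|) := by
  have hL : (0 : ℝ) < L := by exact_mod_cast Nat.pos_of_ne_zero (NeZero.ne L)
  have hmpos : 0 < |(m : ℝ)| := abs_pos.2 (by exact_mod_cast hm0)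
  have h1 : (∑ r ∈ Finset.Icc (-(ρ : ℤ)) ρ, ZMod.stdAddChar ((r : ZMod L) * (m : ZMod L))) *
      (ZMod.stdAddChar (m : ZMod L) - 1) =
      ZMod.stdAddChar (((ρ + 1 : ℤ) : ZMod L) * (m : ZMod L)) - ZMod.stdAddChar (((-ρ : ℤ) : ZMod L) * (m : ZMod L)) := by
    rw [mul_sub, mul_one, Finset.sum_mul]
    have h2 : ∀ r : ℤ, (ZMod.stdAddChar ((r : ZMod L) * (m : ZMod L)) : ℂ) * ZMod.stdAddChar (m : ZMod L) =
        ZMod.stdAddChar (((r + 1 : ℤ) : ZMod L) * (m : ZMod L)) := fun r => by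
      rw [← AddChar.map_add_eq_mul]
      congr 1
      push_cast
      ring
    simp only [h2]
    rw [← Finset.sum_sub_distrib]
    have h3 : ∀ n : ℕ, ∑ r ∈ Finset.Icc (-(n : ℤ)) n,
        ((ZMod.stdAddChar (((r + 1 : ℤ) : ZMod L) * (m : ZMod L)) : ℂ) -
          ZMod.stdAddChar ((r : ZMod L) * (m : ZMod L))) =
        ZMod.stdAddChar (((n + 1 : ℤ) : ZMod L) * (m : ZMod L)) - ZMod.stdAddChar (((-n : ℤ) : ZMod L) * (m : ZMod L)) := by
      intro n
      induction n with
      | zero => simp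
      | succ n ih =>
        have hI : Finset.Icc (-((n + 1 : ℕ) : ℤ)) ((n + 1 : ℕ) : ℤ) =
            insert (-((n + 1 : ℕ) : ℤ)) (insert ((n + 1 : ℕ) : ℤ) (Finset.Icc (-(n : ℤ)) n)) := by
          ext x
          simp only [Finset.mem_insert, Finset.mem_Icc]
          push_cast
          omega
        rw [hI, Finset.sum_insert, Finset.sum_insert, ih]
        · have : (-((n + 1 : ℕ) : ℤ) + 1) = -n := by push_cast; ring
          rw [this]
          push_cast
          ring
        · simp
        · simp only [Finset.mem_insert, Finset.mem_Icc]
          push_cast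
          omega
    exact h3 ρ
  have h4 := congrArg norm h1
  rw [norm_mul] at h4
  have h5 : ‖(ZMod.stdAddChar (((ρ + 1 : ℤ) : ZMod L) * (m : ZMod L)) : ℂ) -
      ZMod.stdAddChar (((-ρ : ℤ) : ZMod L) * (m : ZMod L))‖ ≤ 2 := by
    refine (norm_sub_le _ _).trans ?_
    rw [AddChar.norm_apply, AddChar.norm_apply]
    norm_num
  have h6 := norm_stdAddChar_sub_one_ge L m hm
  rw [le_div_iff₀ (by positivity)]
  have h7 : ‖∑ r ∈ Finset.Icc (-(ρ : ℤ)) ρ, ZMod.stdAddChar ((r : ZMod L) * (m : ZMod L))‖ *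
      (4 * |(m : ℝ)| / L) ≤ 2 := by
    refine le_trans ?_ (h4.le.trans h5)
    gcongr
  rw [mul_div_assoc', div_le_iff₀ hL] at h7
  linarith

/-! ### Major arcs on a finite cyclic group -/

/-- Radius of the major arcs of denominator `q`, in units of `1 / L`. -/
def arcRad (L N R q : ℕ) : ℕ := L * R / (q * N ^ 2)

/-- Indicator of the major arcs. -/
def omega (L N R : ℕ) (t : ZMod L) : ℝ :=
  ∑ q ∈ Finset.Icc 1 R, ∑ a ∈ (Finset.range q).filter (Nat.Coprime · q),
    ∑ r ∈ Finset.Icc (-(arcRad L N R q : ℤ)) (arcRad L N R q),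
      if t = (a : ZMod L) * ((L / q : ℕ) : ZMod L) + (r : ZMod L) then 1 else 0

/-- Fourier coefficients of the indicator of the major arcs. -/
def omegaHat (L N R : ℕ) [NeZero L] (n : ZMod L) : ℂ :=
  (1 / L : ℂ) * ∑ t : ZMod L, (omega L N R t : ℂ) * ZMod.stdAddChar (-(t * n))

lemma omegaHat_eq (L N R : ℕ) [NeZero L] (n : ZMod L) :
    omegaHat L N R n = (1 / L : ℂ) * ∑ q ∈ Finset.Icc 1 R,
      (∑ a ∈ (Finset.range q).filter (Nat.Coprime · q),
        ZMod.stdAddChar ((a : ZMod L) * ((L / q : ℕ) : ZMod L) * (-n))) *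
      ∑ r ∈ Finset.Icc (-(arcRad L N R q : ℤ)) (arcRad L N R q),
        ZMod.stdAddChar ((r : ZMod L) * (-n)) := by
  rw [omegaHat]
  congr 1
  simp only [omega, Complex.ofReal_sum, Finset.sum_mul]
  rw [Finset.sum_comm]
  refine Finset.sum_congr rfl fun q _ => ?_
  rw [Finset.sum_comm]
  refine Finset.sum_congr rfl fun a _ => ?_
  rw [Finset.sum_comm, Finset.mul_sum]
  refine Finset.sum_congr rfl fun r _ => ?_
  rw [Finset.sum_eq_single ((a : ZMod L) * ((L / q : ℕ) : ZMod L) + (r : ZMod L))]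
  · rw [if_pos rfl, Complex.ofReal_one, one_mul, ← AddChar.map_add_eq_mul]
    congr 1
    ring
  · intro t _ ht
    rw [if_neg ht]
    simp
  · simp

lemma omegaHat_inversion (L N R : ℕ) [NeZero L] (t : ZMod L) :
    (omega L N R t : ℂ) = ∑ n : ZMod L, omegaHat L N R n * ZMod.stdAddChar (t * n) := by
  have hL : (L : ℂ) ≠ 0 := Nat.cast_ne_zero.2 (NeZero.ne L)
  simp only [omegaHat]
  have h1 : ∑ n : ZMod L, (1 / L : ℂ) *
      (∑ s : ZMod L, (omega L N R s : ℂ) * ZMod.stdAddChar (-(s * n))) * ZMod.stdAddChar (t * n) =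
      (1 / L : ℂ) * ∑ s : ZMod L, (omega L N R s : ℂ) *
        ∑ n : ZMod L, ZMod.stdAddChar (n * (t - s)) := by
    simp only [Finset.mul_sum, Finset.sum_mul]
    rw [Finset.sum_comm]
    refine Finset.sum_congr rfl fun s _ => Finset.sum_congr rfl fun n _ => ?_
    have : (ZMod.stdAddChar (n * (t - s)) : ℂ) =
        ZMod.stdAddChar (-(s * n)) * ZMod.stdAddChar (t * n) := by
      rw [← AddChar.map_add_eq_mul]
      congr 1
      ring
    rw [this]
    ring
  rw [h1]
  simp only [AddChar.sum_mulShift _ (ZMod.isPrimitive_stdAddChar L), ZMod.card]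
  rw [Finset.sum_eq_single t]
  · simp only [sub_self, if_true]
    field_simp
  · intro s _ hs
    simp [sub_ne_zero.2 hs.symm]
  · simp

lemma arcRad_card_le {L N R q : ℕ} (hq0 : 0 < q) (hqR : q ≤ R) (hN : 0 < N) (hL : N ^ 2 ≤ L) :
    (1 / L : ℝ) * (2 * arcRad L N R q + 1) ≤ 3 * (R / q) / (N : ℝ) ^ 2 := by
  have hN' : (0 : ℝ) < (N : ℝ) ^ 2 := by positivity
  have hL1 : (N : ℝ) ^ 2 ≤ L := by exact_mod_cast hL
  have hL0 : (0 : ℝ) < L := by linarith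
  have hq : (0 : ℝ) < q := by exact_mod_cast hq0
  have hR : (1 : ℝ) ≤ R / q := by rw [one_le_div hq]; exact_mod_cast hqR
  have h1 : (arcRad L N R q : ℝ) ≤ L * R / (q * N ^ 2) := by
    have := @Nat.cast_div_le ℝ _ _ _ (L * R) (q * N ^ 2)
    rw [arcRad]
    push_cast at this
    exact this
  have h2 : (1 : ℝ) ≤ L * (R / q) / N ^ 2 := by
    rw [le_div_iff₀ hN']
    nlinarith
  calc (1 / L : ℝ) * (2 * arcRad L N R q + 1)
      ≤ (1 / L : ℝ) * (2 * (L * R / (q * N ^ 2)) + L * (R / q) / N ^ 2) := by gcongr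
    _ = _ := by field_simp; ring

lemma norm_omegaHat_zero_le {L N R : ℕ} [NeZero L] (hN : 0 < N) (hL : N ^ 2 ≤ L) :
    ‖omegaHat L N R 0‖ ≤ 3 * (R : ℝ) ^ 2 / (N : ℝ) ^ 2 := by
  rw [omegaHat_eq, Finset.mul_sum]
  refine (norm_sum_le _ _).trans ?_
  calc _ ≤ ∑ q ∈ Finset.Icc 1 R, 3 * (R : ℝ) / (N : ℝ) ^ 2 := by
        refine Finset.sum_le_sum fun q hq => ?_
        obtain ⟨hq0, hqR⟩ := Finset.mem_Icc.1 hq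
        have hq1 : (0 : ℝ) < q := by exact_mod_cast hq0
        have h1 := arcRad_card_le (q := q) hq0 hqR hN hL
        rw [norm_mul, norm_mul]
        have h2 : ‖∑ a ∈ (Finset.range q).filter (Nat.Coprime · q),
            (ZMod.stdAddChar ((a : ZMod L) * ((L / q : ℕ) : ZMod L) * (-0)) : ℂ)‖ ≤ q := by
          refine (norm_sum_le _ _).trans ?_
          simp only [AddChar.norm_apply, Finset.sum_const, nsmul_eq_mul, mul_one]
          exact_mod_cast (Finset.card_filter_le _ _).trans (Finset.card_range q).le
        have h3 : ‖∑ r ∈ Finset.Icc (-(arcRad L N R q : ℤ)) (arcRad L N R q),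
            (ZMod.stdAddChar ((r : ZMod L) * (-0)) : ℂ)‖ ≤ 2 * arcRad L N R q + 1 := by
          refine (norm_sum_le _ _).trans ?_
          simp only [AddChar.norm_apply, Finset.sum_const, nsmul_eq_mul, mul_one, Int.card_Icc]
          have : ((arcRad L N R q : ℤ) + 1 - -(arcRad L N R q : ℤ)).toNat = 2 * arcRad L N R q + 1 := by
            omega
          rw [this]
          push_cast
          rfl
        have h4 : ‖(1 / L : ℂ)‖ = 1 / L := by simp
        rw [h4]
        calc _ ≤ (1 / L : ℝ) * (q * (2 * arcRad L N R q + 1)) := by gcongr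
          _ = q * ((1 / L : ℝ) * (2 * arcRad L N R q + 1)) := by ring
          _ ≤ q * (3 * (R / q) / (N : ℝ) ^ 2) := by gcongr
          _ = _ := by field_simp
    _ = _ := by
        simp
        ring

lemma sum_div_sum_dvd_le (R m : ℕ) :
    ∑ q ∈ Finset.Icc 1 R, (1 / q : ℝ) * ∑ d ∈ q.divisors, (if d ∣ m then (d : ℝ) else 0) ≤
      (1 + Real.log R) * ((Finset.Icc 1 R).filter (· ∣ m)).card := by
  calc _ ≤ ∑ q ∈ Finset.Icc 1 R, ∑ d ∈ (Finset.Icc 1 R).filter (· ∣ m),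
        (if d ∣ q then (d / q : ℝ) else 0) := by
        refine Finset.sum_le_sum fun q hq => ?_
        obtain ⟨hq0, hqR⟩ := Finset.mem_Icc.1 hq
        rw [← Finset.sum_filter, ← Finset.sum_filter, Finset.mul_sum]
        refine le_trans (le_of_eq (Finset.sum_congr rfl fun d _ => ?_))
          (Finset.sum_le_sum_of_subset_of_nonneg (fun d hd => ?_) fun _ _ _ => by positivity)
        · rw [one_div_mul_eq_div]
        · simp only [Finset.mem_filter, Nat.mem_divisors, Finset.mem_Icc] at hd ⊢
          have := Nat.le_of_dvd hq0 hd.1.1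
          have := Nat.pos_of_dvd_of_pos hd.1.1 hq0
          exact ⟨⟨⟨by omega, by omega⟩, hd.2⟩, hd.1.1⟩
    _ = ∑ d ∈ (Finset.Icc 1 R).filter (· ∣ m), ∑ q ∈ Finset.Icc 1 R,
        (if d ∣ q then (d / q : ℝ) else 0) := Finset.sum_comm
    _ ≤ ∑ d ∈ (Finset.Icc 1 R).filter (· ∣ m), (1 + Real.log R) := by
        refine Finset.sum_le_sum fun d hd => ?_
        have hd0 : 0 < d := (Finset.mem_Icc.1 (Finset.mem_filter.1 hd).1).1
        refine le_trans ?_ (sum_inv_le R)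
        rw [← Finset.sum_filter]
        have hsub : (Finset.Icc 1 R).filter (d ∣ ·) ⊆ (Finset.Icc 1 R).image (d * ·) := by
          intro q hq
          obtain ⟨h1, k, rfl⟩ := Finset.mem_filter.1 hq
          rw [Finset.mem_Icc] at h1
          refine Finset.mem_image.2 ⟨k, Finset.mem_Icc.2 ⟨?_, ?_⟩, rfl⟩
          · exact Nat.pos_of_mul_pos_left (show 0 < d * k by omega)
          · nlinarith
        refine (Finset.sum_le_sum_of_subset_of_nonneg hsub fun _ _ _ => by positivity).trans ?_
        rw [Finset.sum_image fun a _ b _ h => Nat.eq_of_mul_eq_mul_left hd0 h]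
        refine Finset.sum_le_sum fun k _ => le_of_eq ?_
        have : (d : ℝ) ≠ 0 := by positivity
        push_cast
        rw [div_mul_eq_div_div, div_self this]
    _ = _ := by
        rw [Finset.sum_const, nsmul_eq_mul, mul_comm]

/-- Decay of the Fourier coefficients of the major arcs. -/
lemma norm_omegaHat_le {L N R : ℕ} [NeZero L] (hN : 0 < N) (hL : N ^ 2 ≤ L)
    (hdvd : ∀ q, 0 < q → q ≤ R → q ∣ L) (n : ZMod L) (hn : n ≠ 0) :
    ‖omegaHat L N R n‖ ≤ 6 * R * (1 + Real.log R) *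
      ((Finset.Icc 1 R).filter (· ∣ n.valMinAbs.natAbs)).card /
        ((n.valMinAbs.natAbs : ℝ) + (N : ℝ) ^ 2) := by
  set m := n.valMinAbs with hm
  have hnm : -n = ((-m : ℤ) : ZMod L) := by
    push_cast
    rw [hm, ZMod.coe_valMinAbs]
  have hm0 : -m ≠ 0 := by
    rw [neg_ne_zero, hm, Ne, ZMod.valMinAbs_eq_zero]
    exact hn
  have hmL : 2 * |(-m)| ≤ L := by
    have := ZMod.valMinAbs_mem_Ioc n
    rw [← hm, Set.mem_Ioc] at this
    rw [abs_neg]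
    rcases abs_cases m with h | h <;> omega
  have habs : |((-m : ℤ) : ℝ)| = (m.natAbs : ℝ) := by
    push_cast
    rw [abs_neg, Nat.cast_natAbs, Int.cast_abs]
  have hmpos : (1 : ℝ) ≤ m.natAbs := by
    have : 1 ≤ m.natAbs := by omega
    exact_mod_cast this
  have hN' : (0 : ℝ) < (N : ℝ) ^ 2 := by positivity
  have hL0 : (0 : ℝ) < L := by
    have : (N : ℝ) ^ 2 ≤ L := by exact_mod_cast hL
    linarith
  rw [omegaHat_eq, Finset.mul_sum, hnm]
  refine (norm_sum_le _ _).trans ?_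
  calc _ ≤ ∑ q ∈ Finset.Icc 1 R, 6 * R / ((m.natAbs : ℝ) + (N : ℝ) ^ 2) *
        ((1 / q : ℝ) * ∑ d ∈ q.divisors, (if d ∣ m.natAbs then (d : ℝ) else 0)) := by
        refine Finset.sum_le_sum fun q hq => ?_
        obtain ⟨hq0, hqR⟩ := Finset.mem_Icc.1 hq
        have hq1 : (0 : ℝ) < q := by exact_mod_cast hq0
        have hRq : (1 : ℝ) ≤ R / q := by rw [one_le_div hq1]; exact_mod_cast hqR
        have h1 := norm_ramanujan_le L q hq0 (hdvd q hq0 hqR) (-m)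
        have h1' : ∀ d : ℕ, ((d : ℤ) ∣ -m) ↔ d ∣ m.natAbs := fun d => by
          rw [dvd_neg, Int.natCast_dvd]
        simp only [h1'] at h1
        have h2 : (1 / L : ℝ) * ‖∑ r ∈ Finset.Icc (-(arcRad L N R q : ℤ)) (arcRad L N R q),
            (ZMod.stdAddChar ((r : ZMod L) * ((-m : ℤ) : ZMod L)) : ℂ)‖ ≤
            6 * (R / q) / ((m.natAbs : ℝ) + (N : ℝ) ^ 2) := by
          rcases le_total ((N : ℝ) ^ 2) m.natAbs with hcase | hcase
          · have h3 := norm_sum_Icc_stdAddChar_le L (-m) hm0 hmL (arcRad L N R q)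
            rw [habs] at h3
            calc _ ≤ (1 / L : ℝ) * (L / (2 * (m.natAbs : ℝ))) := by gcongr
              _ = 1 / (2 * (m.natAbs : ℝ)) := by field_simp
              _ ≤ 1 / ((m.natAbs : ℝ) + (N : ℝ) ^ 2) := by gcongr; linarith
              _ ≤ _ := by gcongr; linarith
          · have h3 : ‖∑ r ∈ Finset.Icc (-(arcRad L N R q : ℤ)) (arcRad L N R q),
                (ZMod.stdAddChar ((r : ZMod L) * ((-m : ℤ) : ZMod L)) : ℂ)‖ ≤
                2 * arcRad L N R q + 1 := by
              refine (norm_sum_le _ _).trans ?_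
              simp only [AddChar.norm_apply, Finset.sum_const, nsmul_eq_mul, mul_one, Int.card_Icc]
              have : ((arcRad L N R q : ℤ) + 1 - -(arcRad L N R q : ℤ)).toNat =
                  2 * arcRad L N R q + 1 := by omega
              rw [this]
              push_cast
              rfl
            calc _ ≤ (1 / L : ℝ) * (2 * arcRad L N R q + 1) := by gcongr
              _ ≤ 3 * (R / q) / (N : ℝ) ^ 2 := arcRad_card_le hq0 hqR hN hL
              _ = 6 * (R / q) / (2 * (N : ℝ) ^ 2) := by field_simp; ring
              _ ≤ _ := by gcongr; linarith
        have h4 : ‖(1 / L : ℂ)‖ = 1 / L := by simp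
        rw [norm_mul, norm_mul, h4]
        calc _ = ‖∑ a ∈ (Finset.range q).filter (Nat.Coprime · q),
              (ZMod.stdAddChar ((a : ZMod L) * ((L / q : ℕ) : ZMod L) * ((-m : ℤ) : ZMod L)) : ℂ)‖ *
              ((1 / L : ℝ) * ‖∑ r ∈ Finset.Icc (-(arcRad L N R q : ℤ)) (arcRad L N R q),
                (ZMod.stdAddChar ((r : ZMod L) * ((-m : ℤ) : ZMod L)) : ℂ)‖) := by ring
          _ ≤ (∑ d ∈ q.divisors, if d ∣ m.natAbs then (d : ℝ) else 0) *
              (6 * (R / q) / ((m.natAbs : ℝ) + (N : ℝ) ^ 2)) := by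
              gcongr
          _ = _ := by ring
    _ ≤ 6 * R / ((m.natAbs : ℝ) + (N : ℝ) ^ 2) * ((1 + Real.log R) *
        ((Finset.Icc 1 R).filter (· ∣ m.natAbs)).card) := by
        rw [← Finset.mul_sum]
        gcongr
        exact sum_div_sum_dvd_le R m.natAbs
    _ = _ := by ring

/-- Moments of the nonzero Fourier coefficients of the major arcs. -/
lemma sum_norm_omegaHat_pow_le {L N R : ℕ} [NeZero L] (hN : 0 < N) (hR : 0 < R) (hL : N ^ 2 ≤ L)
    (hdvd : ∀ q, 0 < q → q ≤ R → q ∣ L) (B : ℕ) (hB : 2 ≤ B) :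
    ∑ n ∈ Finset.univ.filter (fun n : ZMod L => n ≠ 0), ‖omegaHat L N R n‖ ^ B ≤
      2 * (6 * R * (1 + Real.log R)) ^ B * (1 + B * Real.log R) ^ (2 ^ B) /
        ((N : ℝ) ^ 2) ^ (B - 1) := by
  have hN' : (0 : ℝ) < (N : ℝ) ^ 2 := by positivity
  have hlog : 0 ≤ Real.log R := Real.log_natCast_nonneg R
  set G : ℕ → ℝ := fun k => (6 * R * (1 + Real.log R) *
      ((Finset.Icc 1 R).filter (· ∣ k)).card / ((k : ℝ) + (N : ℝ) ^ 2)) ^ B with hG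
  have hG0 : ∀ k, 0 ≤ G k := fun k => by positivity
  have h1 : ∑ n ∈ Finset.univ.filter (fun n : ZMod L => n ≠ 0), ‖omegaHat L N R n‖ ^ B ≤
      ∑ n ∈ Finset.univ.filter (fun n : ZMod L => n ≠ 0), G n.valMinAbs.natAbs := by
    refine Finset.sum_le_sum fun n hn => ?_
    exact pow_le_pow_left₀ (norm_nonneg _)
      (norm_omegaHat_le hN hL hdvd n (Finset.mem_filter.1 hn).2) B
  have h2 : ∑ n ∈ Finset.univ.filter (fun n : ZMod L => n ≠ 0), G n.valMinAbs.natAbs ≤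
      2 * ∑ k ∈ Finset.Icc 1 L, G k := by
    have hmaps : ∀ n ∈ Finset.univ.filter (fun n : ZMod L => n ≠ 0),
        n.valMinAbs.natAbs ∈ Finset.Icc 1 L := fun n hn => by
      have h0 : n.valMinAbs ≠ 0 := by
        rw [Ne, ZMod.valMinAbs_eq_zero]
        exact (Finset.mem_filter.1 hn).2
      have := ZMod.valMinAbs_mem_Ioc n
      rw [Set.mem_Ioc] at this
      rw [Finset.mem_Icc]
      omega
    rw [← Finset.sum_fiberwise_of_maps_to hmaps, Finset.mul_sum]
    refine Finset.sum_le_sum fun k _ => ?_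
    have h3 : ∀ n ∈ (Finset.univ.filter (fun n : ZMod L => n ≠ 0)).filter
        (fun n => n.valMinAbs.natAbs = k), G n.valMinAbs.natAbs = G k := fun n hn => by
      rw [(Finset.mem_filter.1 hn).2]
    rw [Finset.sum_congr rfl h3, Finset.sum_const, nsmul_eq_mul]
    gcongr
    have hsub : (Finset.univ.filter (fun n : ZMod L => n ≠ 0)).filter
        (fun n => n.valMinAbs.natAbs = k) ⊆ {((k : ℤ) : ZMod L), ((-k : ℤ) : ZMod L)} := by
      intro n hn
      have hk := (Finset.mem_filter.1 hn).2
      rw [Finset.mem_insert, Finset.mem_singleton]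
      rcases Int.natAbs_eq n.valMinAbs with h | h
      · left; rw [← hk, ← h, ZMod.coe_valMinAbs]
      · right; rw [← hk, ← h, ZMod.coe_valMinAbs]
    exact_mod_cast (Finset.card_le_card hsub).trans Finset.card_le_two
  have h4 : ∀ k ∈ Finset.Icc 1 L, G k ≤ (6 * R * (1 + Real.log R)) ^ B / ((N : ℝ) ^ 2) ^ (B - 2) *
      ((((Finset.Icc 1 R).filter (· ∣ k)).card : ℝ) ^ B / ((k : ℝ) + (N : ℝ) ^ 2) ^ 2) := by
    intro k _
    simp only [hG]
    rw [div_pow, mul_pow (6 * R * (1 + Real.log R)), div_mul_div_comm]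
    gcongr
    calc ((N : ℝ) ^ 2) ^ (B - 2) * ((k : ℝ) + (N : ℝ) ^ 2) ^ 2
        ≤ ((k : ℝ) + (N : ℝ) ^ 2) ^ (B - 2) * ((k : ℝ) + (N : ℝ) ^ 2) ^ 2 := by
          gcongr
          linarith [(Nat.cast_nonneg k : (0 : ℝ) ≤ k)]
      _ = _ := by rw [← pow_add]; congr 1; omega
  have h5 := sum_card_dvd_pow_le R B L hN'
  calc _ ≤ 2 * ∑ k ∈ Finset.Icc 1 L, G k := h1.trans h2
    _ ≤ 2 * ((6 * R * (1 + Real.log R)) ^ B / ((N : ℝ) ^ 2) ^ (B - 2) *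
        ((1 + B * Real.log R) ^ (2 ^ B) / (N : ℝ) ^ 2)) := by
        gcongr
        refine (Finset.sum_le_sum h4).trans ?_
        rw [← Finset.mul_sum]
        gcongr
    _ = _ := by
        rw [show B - 1 = B - 2 + 1 by omega, pow_succ ((N : ℝ) ^ 2)]
        field_simp

lemma omega_ne_zero_of_hit {L N R : ℕ} {t : ZMod L} {q a : ℕ} {r : ℤ} (hq : q ∈ Finset.Icc 1 R)
    (ha : a ∈ (Finset.range q).filter (Nat.Coprime · q)) (hr : |r| ≤ arcRad L N R q)
    (ht : t = (a : ZMod L) * ((L / q : ℕ) : ZMod L) + (r : ZMod L)) : omega L N R t ≠ 0 := by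
  have hr' : r ∈ Finset.Icc (-(arcRad L N R q : ℤ)) (arcRad L N R q) :=
    Finset.mem_Icc.2 (abs_le.1 hr)
  have h0 : ∀ q a r, (0 : ℝ) ≤
      if t = ((a : ℕ) : ZMod L) * ((L / q : ℕ) : ZMod L) + ((r : ℤ) : ZMod L) then 1 else 0 :=
    fun q a r => by split_ifs <;> norm_num
  refine ne_of_gt (lt_of_lt_of_le one_pos ?_)
  refine le_trans ?_ (Finset.single_le_sum (fun q _ => Finset.sum_nonneg fun a _ =>
    Finset.sum_nonneg fun r _ => h0 q a r) hq)
  refine le_trans ?_ (Finset.single_le_sum (fun a _ => Finset.sum_nonneg fun r _ => h0 q a r) ha)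
  refine le_trans ?_ (Finset.single_le_sum (fun r _ => h0 q a r) hr')
  rw [if_pos ht]

lemma arcRad_mul_le (L N R q : ℕ) : arcRad L N R q * (q * N ^ 2) ≤ L * R := Nat.div_mul_le_self _ _

/-- Distinct major arcs are disjoint. -/
lemma arc_unique {L N R : ℕ} [NeZero L] (hN : 0 < N) (hR : 2 * R ^ 2 < N ^ 2)
    (hdvd : ∀ q, 0 < q → q ≤ R → q ∣ L) {q a q' a' : ℕ} {r r' : ℤ}
    (hq : q ∈ Finset.Icc 1 R) (hq' : q' ∈ Finset.Icc 1 R)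
    (ha : a ∈ (Finset.range q).filter (Nat.Coprime · q))
    (ha' : a' ∈ (Finset.range q').filter (Nat.Coprime · q'))
    (hr : r ∈ Finset.Icc (-(arcRad L N R q : ℤ)) (arcRad L N R q))
    (hr' : r' ∈ Finset.Icc (-(arcRad L N R q' : ℤ)) (arcRad L N R q'))
    (h : (a : ZMod L) * ((L / q : ℕ) : ZMod L) + (r : ZMod L) =
      (a' : ZMod L) * ((L / q' : ℕ) : ZMod L) + (r' : ZMod L)) : q = q' ∧ a = a' ∧ r = r' := by
  obtain ⟨hq0, hqR⟩ := Finset.mem_Icc.1 hq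
  obtain ⟨hq0', hqR'⟩ := Finset.mem_Icc.1 hq'
  obtain ⟨haq, hac⟩ := Finset.mem_filter.1 ha
  obtain ⟨haq', hac'⟩ := Finset.mem_filter.1 ha'
  rw [Finset.mem_range] at haq haq'
  have hL0 : (0 : ℤ) < L := by exact_mod_cast Nat.pos_of_ne_zero (NeZero.ne L)
  have hLq : (L : ℤ) = q * (L / q : ℕ) := by
    exact_mod_cast (Nat.mul_div_cancel' (hdvd q hq0 hqR)).symm
  have hLq' : (L : ℤ) = q' * (L / q' : ℕ) := by
    exact_mod_cast (Nat.mul_div_cancel' (hdvd q' hq0' hqR')).symm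
  have h1 : (((a' * (L / q' : ℕ) + r') - (a * (L / q : ℕ) + r) : ℤ) : ZMod L) = 0 := by
    simp only [Int.cast_sub, Int.cast_add, Int.cast_mul, Int.cast_natCast]
    rw [h, sub_self]
  rw [ZMod.intCast_zmod_eq_zero_iff_dvd] at h1
  obtain ⟨k, hk⟩ := h1
  set u : ℤ := a * q' - a' * q + k * q * q' with hu
  have hLu : L * u = (r' - r) * (q * q') := by
    have e1 : (L : ℤ) * (a * q') = a * (L / q : ℕ) * (q * q') := by
      conv_lhs => rw [hLq]
      ring
    have e2 : (L : ℤ) * (a' * q) = a' * (L / q' : ℕ) * (q * q') := by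
      conv_lhs => rw [hLq']
      ring
    have e3 : (L : ℤ) * (k * q * q') = (L * k) * (q * q') := by ring
    rw [hu, mul_add, mul_sub, e1, e2, e3, ← hk]
    ring
  have hr1 : |r| * (q * N ^ 2) ≤ L * R := by
    refine le_trans (mul_le_mul_of_nonneg_right (abs_le.2 (Finset.mem_Icc.1 hr)) (by positivity)) ?_
    exact_mod_cast arcRad_mul_le L N R q
  have hr2 : |r'| * (q' * N ^ 2) ≤ L * R := by
    refine le_trans (mul_le_mul_of_nonneg_right (abs_le.2 (Finset.mem_Icc.1 hr')) (by positivity)) ?_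
    exact_mod_cast arcRad_mul_le L N R q'
  have hu0 : u = 0 := by
    by_contra hne
    have hu1 : 1 ≤ |u| := Int.one_le_abs hne
    have h2 : L * |u| * N ^ 2 ≤ 2 * (L * R ^ 2) := by
      have : (L : ℤ) * |u| = |r' - r| * (q * q') := by
        rw [← abs_of_pos hL0, ← abs_mul, hLu, abs_mul, abs_of_nonneg (by positivity : (0 : ℤ) ≤ q * q')]
      rw [this]
      have h3 : |r' - r| ≤ |r'| + |r| := abs_sub _ _
      have hqR1 : (q : ℤ) ≤ R := by exact_mod_cast hqR
      have hqR1' : (q' : ℤ) ≤ R := by exact_mod_cast hqR'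
      have hLR : (0 : ℤ) ≤ L * R := by positivity
      calc |r' - r| * (q * q') * N ^ 2 ≤ (|r'| + |r|) * (q * q') * N ^ 2 := by gcongr
        _ = (|r'| * (q' * N ^ 2)) * q + (|r| * (q * N ^ 2)) * q' := by ring
        _ ≤ (L * R) * R + (L * R) * R := by gcongr
        _ = _ := by ring
    have h3 : (L : ℤ) * N ^ 2 ≤ L * |u| * N ^ 2 := by
      have : (L : ℤ) * 1 ≤ L * |u| := by gcongr
      rw [mul_one] at this
      gcongr
    have h4 : (2 * R ^ 2 : ℤ) < N ^ 2 := by exact_mod_cast hR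
    nlinarith
  have hdv : (q : ℤ) ∣ q' := by
    have h1 : (q : ℤ) ∣ a * q' := ⟨a' - k * q', by rw [hu] at hu0; linarith⟩
    have hcop : IsCoprime (q : ℤ) a := (Nat.isCoprime_iff_coprime.2 hac).symm
    exact hcop.dvd_of_dvd_mul_left h1
  have hdv' : (q' : ℤ) ∣ q := by
    have h1 : (q' : ℤ) ∣ a' * q := ⟨a + k * q, by rw [hu] at hu0; linarith⟩
    have hcop : IsCoprime (q' : ℤ) a' := (Nat.isCoprime_iff_coprime.2 hac').symm
    exact hcop.dvd_of_dvd_mul_left h1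
  have hqq : q = q' := Nat.dvd_antisymm (by exact_mod_cast hdv) (by exact_mod_cast hdv')
  subst hqq
  have hq1 : (0 : ℤ) < q := by exact_mod_cast hq0
  have hak : (a : ℤ) - a' + k * q = 0 := by
    have : (q : ℤ) * (a - a' + k * q) = 0 := by rw [hu] at hu0; linarith
    exact (mul_eq_zero.1 this).resolve_left hq1.ne'
  have hk0 : k = 0 := by
    have h1 : -1 < k := by nlinarith
    have h2 : k < 1 := by nlinarith
    omega
  refine ⟨rfl, ?_, ?_⟩
  · rw [hk0] at hak
    omega
  · have : (r' - r) * ((q : ℤ) * q) = 0 := by rw [← hLu, hu0, mul_zero]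
    have := (mul_eq_zero.1 this).resolve_right (by positivity)
    omega

lemma omega_eq_zero_or_one {L N R : ℕ} [NeZero L] (hN : 0 < N) (hR : 2 * R ^ 2 < N ^ 2)
    (hdvd : ∀ q, 0 < q → q ≤ R → q ∣ L) (t : ZMod L) : omega L N R t = 0 ∨ omega L N R t = 1 := by
  by_cases hex : ∃ q ∈ Finset.Icc 1 R, ∃ a ∈ (Finset.range q).filter (Nat.Coprime · q),
      ∃ r ∈ Finset.Icc (-(arcRad L N R q : ℤ)) (arcRad L N R q),
        t = (a : ZMod L) * ((L / q : ℕ) : ZMod L) + (r : ZMod L)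
  · right
    obtain ⟨q, hq, a, ha, r, hr, ht⟩ := hex
    rw [omega, Finset.sum_eq_single_of_mem q hq, Finset.sum_eq_single_of_mem a ha,
      Finset.sum_eq_single_of_mem r hr, if_pos ht]
    · intro r' hr' hne
      refine if_neg fun h => hne ?_
      exact (arc_unique hN hR hdvd hq hq ha ha hr' hr (h.symm.trans ht)).2.2
    · intro a' ha' hne
      refine Finset.sum_eq_zero fun r' hr' => if_neg fun h => hne ?_
      exact (arc_unique hN hR hdvd hq hq ha' ha hr' hr (h.symm.trans ht)).2.1
    · intro q' hq' hne
      refine Finset.sum_eq_zero fun a' ha' => Finset.sum_eq_zero fun r' hr' => if_neg fun h => hne ?_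
      exact (arc_unique hN hR hdvd hq' hq ha' ha hr' hr (h.symm.trans ht)).1
  · left
    refine Finset.sum_eq_zero fun q hq => Finset.sum_eq_zero fun a ha =>
      Finset.sum_eq_zero fun r hr => if_neg fun h => hex ⟨q, hq, a, ha, r, hr, h⟩

/-- The one-dimensional Gaussian weight. -/
def gw (N : ℕ) (n : ℤ) : ℝ := Real.exp (-Real.pi * (1 / (N : ℝ) ^ 2) * (n : ℝ) ^ 2)

lemma gterm_zmod (N L : ℕ) [NeZero L] (x t : ZMod L) (n : ℤ) :
    gterm N ((x.val : ℝ) / L) ((t.val : ℝ) / L) n =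
      gw N n * ZMod.stdAddChar (x * (n : ZMod L) + t * (n : ZMod L) ^ 2) := by
  have h : x * (n : ZMod L) + t * (n : ZMod L) ^ 2 =
      ((x.val * n + t.val * n ^ 2 : ℤ) : ZMod L) := by
    push_cast
    rw [ZMod.natCast_zmod_val, ZMod.natCast_zmod_val]
  have hL : (L : ℂ) ≠ 0 := Nat.cast_ne_zero.2 (NeZero.ne L)
  rw [h, ZMod.stdAddChar_coe, gterm, Complex.exp_add, gw, Complex.ofReal_exp]
  congr 2
  push_cast
  field_simp

/-- A time frequency off the major arcs has a Dirichlet approximation of large height. -/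
lemma exists_approx_of_omega_eq_zero {L N R : ℕ} [NeZero L] (hN : 0 < N)
    (hdvd : ∀ q, 0 < q → q ≤ R → q ∣ L) {t : ZMod L} (ht : omega L N R t = 0) :
    ∃ (a : ℤ) (q : ℕ) (τ : ℝ), 0 < q ∧ (q : ℝ) ≤ N ∧ IsUnit (a : ZMod q) ∧ |τ| ≤ 1 / (q * N) ∧
      (t.val : ℝ) / L = a / q + τ ∧ (R : ℝ) ≤ q * (1 + (N : ℝ) ^ 2 * |τ|) := by
  obtain ⟨y, hy1, hy2⟩ := Real.exists_rat_abs_sub_le_and_den_le ((t.val : ℝ) / L) hN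
  have hL : (0 : ℝ) < L := by exact_mod_cast Nat.pos_of_ne_zero (NeZero.ne L)
  have hN' : (0 : ℝ) < N := by exact_mod_cast hN
  have hq0 : 0 < y.den := y.den_pos
  have hq : (0 : ℝ) < y.den := by exact_mod_cast hq0
  have hcop : IsCoprime y.num (y.den : ℤ) := Int.isCoprime_iff_gcd_eq_one.2 y.reduced
  refine ⟨y.num, y.den, (t.val : ℝ) / L - y, hq0, by exact_mod_cast hy2, ?_, ?_, ?_, ?_⟩
  · exact (ZMod.coe_int_isUnit_iff_isCoprime _ _).2 hcop.symm
  · refine hy1.trans ?_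
    rw [mul_comm (y.den : ℝ)]
    gcongr
    linarith
  · rw [Rat.cast_def]; ring
  · by_contra! hlt
    have hqR : y.den ≤ R := by
      have : (y.den : ℝ) ≤ R := by
        refine le_trans ?_ hlt.le
        have : 0 ≤ (N : ℝ) ^ 2 * |(t.val : ℝ) / L - y| := by positivity
        nlinarith
      exact_mod_cast this
    have hqL := hdvd _ hq0 hqR
    have hLq : (L : ℝ) / y.den = ((L / y.den : ℕ) : ℝ) := by
      rw [Nat.cast_div hqL hq.ne']
    set r : ℤ := t.val - y.num * (L / y.den : ℕ) with hr
    have hrτ : (r : ℝ) = L * ((t.val : ℝ) / L - y) := by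
      rw [hr, Rat.cast_def]
      simp only [Int.cast_sub, Int.cast_mul, Int.cast_natCast]
      rw [← hLq]
      field_simp
    refine absurd ht (omega_ne_zero_of_hit (q := y.den) (a := (y.num % y.den).toNat) (r := r)
      (Finset.mem_Icc.2 ⟨hq0, hqR⟩) ?_ ?_ ?_)
    · have h0 : 0 ≤ y.num % y.den := Int.emod_nonneg _ (by positivity)
      have h1 : y.num % y.den < y.den := Int.emod_lt_of_pos _ (by exact_mod_cast hq0)
      rw [Finset.mem_filter, Finset.mem_range]
      refine ⟨by omega, ?_⟩
      rw [← Nat.isCoprime_iff_coprime, Int.toNat_of_nonneg h0]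
      have := hcop.add_mul_left_left (-(y.num / y.den))
      have e : y.num % y.den = y.num + y.den * -(y.num / y.den) := by
        have := Int.emod_add_mul_ediv y.num y.den
        linarith
      rw [e]
      exact this
    · have h1 : |(r : ℝ)| * (y.den * N ^ 2) ≤ L * R := by
        rw [hrτ, abs_mul, abs_of_pos hL]
        have : |(t.val : ℝ) / L - y| * (y.den * N ^ 2) ≤ R := by nlinarith
        calc _ = L * (|(t.val : ℝ) / L - y| * (y.den * N ^ 2)) := by ring
          _ ≤ _ := by gcongr
      have h2 : r.natAbs ≤ arcRad L N R y.den := by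
        rw [arcRad, Nat.le_div_iff_mul_le (by positivity)]
        have : ((r.natAbs * (y.den * N ^ 2) : ℕ) : ℝ) ≤ ((L * R : ℕ) : ℝ) := by
          push_cast
          rw [Nat.cast_natAbs, Int.cast_abs]
          exact h1
        exact_mod_cast this
      rw [Int.abs_eq_natAbs]
      exact_mod_cast h2
    · have h0 : 0 ≤ y.num % y.den := Int.emod_nonneg _ (by positivity)
      have h2 : (((y.num % y.den).toNat : ℕ) : ZMod L) = ((y.num % y.den : ℤ) : ZMod L) := by
        rw [← Int.cast_natCast, Int.toNat_of_nonneg h0]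
      have h3 : (t : ZMod L) = ((t.val : ℤ) : ZMod L) := by
        push_cast
        rw [ZMod.natCast_zmod_val]
      have h4 : (t.val : ℤ) = (y.num % y.den) * (L / y.den : ℕ) + r + L * (y.num / y.den) := by
        have e1 := Int.emod_add_mul_ediv y.num y.den
        have e2 : (L : ℤ) = y.den * (L / y.den : ℕ) := by
          exact_mod_cast (Nat.mul_div_cancel' hqL).symm
        have e3 : (y.num % y.den) = y.num - y.den * (y.num / y.den) := by linarith
        have e5 : (L : ℤ) * (y.num / y.den) = y.den * (L / y.den : ℕ) * (y.num / y.den) := by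
          rw [← e2]
        rw [hr, e3, e5]
        ring
      rw [h2]
      conv_lhs => rw [h3, h4]
      simp only [Int.cast_add, Int.cast_mul, Int.cast_natCast]
      rw [ZMod.natCast_self, zero_mul, add_zero]

/-- The truncated Gaussian-weighted Weyl sum is small off the major arcs. -/
lemma exists_weyl_minor : ∃ C : ℝ, 0 < C ∧ ∀ N : ℕ, 0 < N → ∃ M : ℕ, 2 * N ≤ M ∧
    ∑ n ∈ Finset.Icc (-(M : ℤ)) M, gw N n ≤ C * N ∧
    ∀ (L R : ℕ) [NeZero L], 0 < R → (∀ q, 0 < q → q ≤ R → q ∣ L) →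
      ∀ x t : ZMod L, omega L N R t = 0 →
        ‖∑ n ∈ Finset.Icc (-(M : ℤ)) M,
          (gw N n : ℂ) * ZMod.stdAddChar (x * (n : ZMod L) + t * (n : ZMod L) ^ 2)‖ ≤
          C * (N * (R : ℝ) ^ (-(1 / 2) : ℝ)) := by
  obtain ⟨C, hC, h⟩ := exists_norm_sum_gterm_le
  refine ⟨C, hC, fun N hN => ?_⟩
  have hN1 : (1 : ℝ) ≤ N := by exact_mod_cast hN
  obtain ⟨M, hM, hK⟩ := h N hN1
  refine ⟨M, by exact_mod_cast hM, ?_, fun L R _ hR hdvd x t ht => ?_⟩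
  · have h1 := hK 0 0 0 1 one_pos (by simpa using hN1) (isUnit_of_subsingleton _) (by simp)
    have h2 : ∀ n : ℤ, gterm N 0 ((0 : ℤ) / (1 : ℕ) + 0) n = ((gw N n : ℝ) : ℂ) := fun n => by
      rw [gterm, gw, Complex.ofReal_exp]
      simp
    simp only [h2] at h1
    rw [← Complex.ofReal_sum, Complex.norm_real] at h1
    refine (le_abs_self _).trans (h1.trans ?_)
    simp
  · obtain ⟨a, q, τ, hq0, hqN, ha, hτ, hteq, hRle⟩ := exists_approx_of_omega_eq_zero hN hdvd ht
    have h1 := hK ((x.val : ℝ) / L) τ a q hq0 hqN ha hτ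
    rw [← hteq] at h1
    simp only [gterm_zmod] at h1
    refine h1.trans ?_
    have hR' : (0 : ℝ) < R := by exact_mod_cast hR
    exact mul_le_mul_of_nonneg_left (mul_le_mul_of_nonneg_left
      (Real.rpow_le_rpow_of_nonpos hR' hRle (by norm_num)) (by positivity)) hC.le

section LevelSet

variable {G : Type*} [AddCommGroup G] [Fintype G]

/-- The Fourier coefficient of `f` at the character `χ`. -/
def fcoef (f : G → ℂ) (χ : AddChar G ℂ) : ℂ :=
  (Fintype.card G : ℂ)⁻¹ * ∑ g, f g * (starRingEnd ℂ) (χ g)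

/-- The quadratic form with difference kernel `k`. -/
def kform (f k : G → ℂ) : ℂ :=
  (Fintype.card G : ℂ)⁻¹ ^ 2 * ∑ g, ∑ g', f g * (starRingEnd ℂ) (f g') * k (g' - g)

lemma kform_add (f k k' : G → ℂ) : kform f (fun g => k g + k' g) = kform f k + kform f k' := by
  simp only [kform, mul_add, Finset.sum_add_distrib]

lemma kform_sum {ι : Type*} (s : Finset ι) (f : G → ℂ) (k : ι → G → ℂ) :
    kform f (fun g => ∑ i ∈ s, k i g) = ∑ i ∈ s, kform f (k i) := by
  simp only [kform, Finset.mul_sum]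
  conv_rhs => rw [Finset.sum_comm]
  refine Finset.sum_congr rfl fun g _ => ?_
  rw [Finset.sum_comm]

lemma kform_const_mul (f k : G → ℂ) (a : ℂ) : kform f (fun g => a * k g) = a * kform f k := by
  simp only [kform, Finset.mul_sum]
  refine Finset.sum_congr rfl fun g _ => Finset.sum_congr rfl fun g' _ => by ring

lemma kform_char (f : G → ℂ) (χ : AddChar G ℂ) : kform f χ = ((‖fcoef f χ‖ ^ 2 : ℝ) : ℂ) := by
  have h : ((‖fcoef f χ‖ ^ 2 : ℝ) : ℂ) = fcoef f χ * (starRingEnd ℂ) (fcoef f χ) := by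
    rw [Complex.mul_conj, Complex.normSq_eq_norm_sq]
  rw [h, fcoef, kform, map_mul, map_sum, map_inv₀, Complex.conj_natCast]
  have h2 : ∀ g, (χ g)⁻¹ = (starRingEnd ℂ) (χ g) := fun g => by
    rw [Complex.inv_eq_conj (AddChar.norm_apply χ g)]
  calc _ = (Fintype.card G : ℂ)⁻¹ ^ 2 * ((∑ g, f g * (starRingEnd ℂ) (χ g)) *
        ∑ g', (starRingEnd ℂ) (f g' * (starRingEnd ℂ) (χ g'))) := by
        rw [Finset.sum_mul_sum]
        congr 1
        refine Finset.sum_congr rfl fun g _ => Finset.sum_congr rfl fun g' _ => ?_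
        rw [map_mul, Complex.conj_conj, sub_eq_add_neg, AddChar.map_add_eq_mul,
          AddChar.map_neg_eq_inv, h2]
        ring
    _ = _ := by ring

/-- The normalised `L¹` norm. -/
def nmean (f : G → ℂ) : ℝ := (Fintype.card G : ℝ)⁻¹ * ∑ g, ‖f g‖

lemma norm_fcoef_le (f : G → ℂ) (χ : AddChar G ℂ) : ‖fcoef f χ‖ ≤ nmean f := by
  rw [fcoef, nmean, norm_mul, norm_inv, Complex.norm_natCast]
  refine mul_le_mul_of_nonneg_left ((norm_sum_le _ _).trans_eq ?_) (by positivity)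
  refine Finset.sum_congr rfl fun g _ => ?_
  rw [norm_mul, RCLike.norm_conj, AddChar.norm_apply, mul_one]

lemma norm_kform_le (f k : G → ℂ) (κ : ℝ) (hk : ∀ g, ‖k g‖ ≤ κ) :
    ‖kform f k‖ ≤ κ * nmean f ^ 2 := by
  rw [kform, nmean, norm_mul, norm_pow, norm_inv, Complex.norm_natCast]
  calc _ ≤ (Fintype.card G : ℝ)⁻¹ ^ 2 * ∑ g, ∑ g', ‖f g‖ * ‖f g'‖ * κ := by
        gcongr
        refine (norm_sum_le _ _).trans (Finset.sum_le_sum fun g _ => (norm_sum_le _ _).trans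
          (Finset.sum_le_sum fun g' _ => ?_))
        rw [norm_mul, norm_mul, RCLike.norm_conj]
        gcongr
        exact hk _
    _ = _ := by
        simp only [← Finset.sum_mul, ← Finset.mul_sum]
        ring

/-- Bessel's inequality for distinct characters. -/
lemma sum_norm_fcoef_sq_le {ι : Type*} (s : Finset ι) (χ : ι → AddChar G ℂ)
    (hχ : Set.InjOn χ s) (f : G → ℂ) :
    ∑ i ∈ s, ‖fcoef f (χ i)‖ ^ 2 ≤ (Fintype.card G : ℝ)⁻¹ * ∑ g, ‖f g‖ ^ 2 := by
  classical
  have hG : (0 : ℝ) < Fintype.card G := by exact_mod_cast Fintype.card_pos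
  let v : s → EuclideanSpace ℂ G := fun i =>
    WithLp.toLp 2 fun g => (((Real.sqrt (Fintype.card G))⁻¹ : ℝ) : ℂ) * χ i g
  have hinner : ∀ i j : s, inner ℂ (v i) (v j) =
      (Fintype.card G : ℂ)⁻¹ * ∑ g, (χ j - χ i) g := fun i j => by
    simp only [v, PiLp.inner_apply, RCLike.inner_apply, map_mul, Complex.conj_ofReal]
    rw [Finset.mul_sum]
    refine Finset.sum_congr rfl fun g _ => ?_
    rw [AddChar.sub_apply, AddChar.map_neg_eq_inv, Complex.inv_eq_conj (AddChar.norm_apply _ g)]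
    have : (((Real.sqrt (Fintype.card G))⁻¹ : ℝ) : ℂ) * (((Real.sqrt (Fintype.card G))⁻¹ : ℝ) : ℂ) =
        (Fintype.card G : ℂ)⁻¹ := by
      rw [← Complex.ofReal_mul, ← mul_inv, Real.mul_self_sqrt hG.le]
      simp
    rw [← this]
    ring
  have hv : Orthonormal ℂ v := by
    rw [orthonormal_iff_ite]
    intro i j
    rw [hinner, AddChar.sum_eq_ite]
    by_cases hij : i = j
    · subst hij
      rw [if_pos (sub_self _), if_pos rfl, inv_mul_cancel₀]
      exact_mod_cast hG.ne'
    · rw [if_neg, if_neg hij, mul_zero]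
      intro h
      exact hij (Subtype.ext (hχ i.2 j.2 (sub_eq_zero.1 h).symm))
  have h := hv.sum_inner_products_le (WithLp.toLp 2 f) (s := Finset.univ)
  rw [EuclideanSpace.norm_sq_eq] at h
  have h1 : ∀ i : s, ‖inner ℂ (v i) (WithLp.toLp 2 f : EuclideanSpace ℂ G)‖ ^ 2 =
      Fintype.card G * ‖fcoef f (χ i)‖ ^ 2 := fun i => by
    have : inner ℂ (v i) (WithLp.toLp 2 f : EuclideanSpace ℂ G) =
        ((Real.sqrt (Fintype.card G) : ℝ) : ℂ) * fcoef f (χ i) := by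
      simp only [v, PiLp.inner_apply, RCLike.inner_apply, map_mul, Complex.conj_ofReal, fcoef]
      have e : (((Real.sqrt (Fintype.card G))⁻¹ : ℝ) : ℂ) =
          ((Real.sqrt (Fintype.card G) : ℝ) : ℂ) * (Fintype.card G : ℂ)⁻¹ := by
        have : (Real.sqrt (Fintype.card G))⁻¹ =
            Real.sqrt (Fintype.card G) * (Fintype.card G : ℝ)⁻¹ := by
          have h2 := Real.mul_self_sqrt hG.le
          have h3 : Real.sqrt (Fintype.card G) ≠ 0 := (Real.sqrt_pos.2 hG).ne'
          field_simp
          rw [sq, h2]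
        rw [this]
        simp
      rw [← mul_assoc, ← e, Finset.mul_sum]
      refine Finset.sum_congr rfl fun g _ => by ring
    rw [this, norm_mul, mul_pow, Complex.norm_real, Real.norm_eq_abs, sq_abs, Real.sq_sqrt hG.le]
  simp only [h1] at h
  rw [← Finset.mul_sum, Finset.sum_coe_sort s (fun i => ‖fcoef f (χ i)‖ ^ 2)] at h
  rw [inv_mul_eq_div, le_div_iff₀ hG, mul_comm]
  exact h

end LevelSet

section LevelSet

variable {G : Type*} [AddCommGroup G] [Fintype G]

/-- The normalised size of a superlevel set. -/
def dens (u : G → ℝ) (l : ℝ) : ℝ :=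
  (Fintype.card G : ℝ)⁻¹ * ((Finset.univ.filter fun g => l < u g).card : ℝ)

lemma dens_nonneg (u : G → ℝ) (l : ℝ) : 0 ≤ dens u l := by rw [dens]; positivity

/-- The unimodular dual function of a superlevel set. -/
def dualFn (Φ : G → ℂ) (l : ℝ) (g : G) : ℂ := if l < ‖Φ g‖ then Φ g / ‖Φ g‖ else 0

lemma norm_dualFn (Φ : G → ℂ) {l : ℝ} (hl : 0 ≤ l) (g : G) :
    ‖dualFn Φ l g‖ = if l < ‖Φ g‖ then 1 else 0 := by
  rw [dualFn]
  split_ifs with h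
  · rw [norm_div, Complex.norm_real, norm_norm, div_self (hl.trans_lt h).ne']
  · exact norm_zero

lemma nmean_dualFn (Φ : G → ℂ) {l : ℝ} (hl : 0 ≤ l) :
    nmean (dualFn Φ l) = dens (fun g => ‖Φ g‖) l := by
  simp only [nmean, dens, norm_dualFn Φ hl, Finset.sum_boole]

lemma mean_sq_dualFn (Φ : G → ℂ) {l : ℝ} (hl : 0 ≤ l) :
    (Fintype.card G : ℝ)⁻¹ * ∑ g, ‖dualFn Φ l g‖ ^ 2 = dens (fun g => ‖Φ g‖) l := by
  simp only [dens, norm_dualFn Φ hl, ite_pow, one_pow, ne_eq, OfNat.ofNat_ne_zero,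
    not_false_eq_true, zero_pow, Finset.sum_boole]

lemma level_mul_dens_le {ι : Type*} (s : Finset ι) (χ : ι → AddChar G ℂ) (c : ι → ℂ)
    {l : ℝ} (hl : 0 ≤ l) :
    (l * dens (fun g => ‖∑ i ∈ s, c i * χ i g‖) l) ^ 2 ≤
      (∑ i ∈ s, ‖c i‖ ^ 2) *
        ∑ i ∈ s, ‖fcoef (dualFn (fun g => ∑ i ∈ s, c i * χ i g) l) (χ i)‖ ^ 2 := by
  set Φ : G → ℂ := fun g => ∑ i ∈ s, c i * χ i g with hΦ
  set f := dualFn Φ l with hf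
  have h1 : (Fintype.card G : ℂ)⁻¹ * ∑ g, Φ g * (starRingEnd ℂ) (f g) =
      ∑ i ∈ s, c i * (starRingEnd ℂ) (fcoef f (χ i)) := by
    simp only [hΦ, fcoef, map_mul, map_inv₀, Complex.conj_natCast, map_sum, Complex.conj_conj,
      Finset.mul_sum, Finset.sum_mul]
    rw [Finset.sum_comm]
    refine Finset.sum_congr rfl fun i _ => Finset.sum_congr rfl fun g _ => by ring
  have h2 : ∀ g, Φ g * (starRingEnd ℂ) (f g) = (((if l < ‖Φ g‖ then ‖Φ g‖ else 0 : ℝ)) : ℂ) :=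
    fun g => by
    rw [hf, dualFn]
    split_ifs with h
    · rw [map_div₀, Complex.conj_ofReal, mul_div_assoc', Complex.mul_conj,
        Complex.normSq_eq_norm_sq]
      have : (‖Φ g‖ : ℂ) ≠ 0 := by exact_mod_cast (hl.trans_lt h).ne'
      push_cast
      field_simp
    · simp
  have h3 : l * dens (fun g => ‖Φ g‖) l ≤ ‖∑ i ∈ s, c i * (starRingEnd ℂ) (fcoef f (χ i))‖ := by
    rw [← h1]
    simp only [h2]
    rw [← Complex.ofReal_sum, norm_mul, norm_inv, Complex.norm_natCast, Complex.norm_real,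
      Real.norm_of_nonneg (Finset.sum_nonneg fun g _ => by split_ifs <;> positivity), dens,
      ← Finset.sum_filter, mul_left_comm]
    refine mul_le_mul_of_nonneg_left ?_ (by positivity)
    rw [mul_comm, ← nsmul_eq_mul]
    exact Finset.card_nsmul_le_sum _ _ _ fun g hg => (Finset.mem_filter.1 hg).2.le
  calc _ ≤ ‖∑ i ∈ s, c i * (starRingEnd ℂ) (fcoef f (χ i))‖ ^ 2 :=
        pow_le_pow_left₀ (mul_nonneg hl (dens_nonneg _ _)) h3 2
    _ ≤ (∑ i ∈ s, ‖c i‖ * ‖fcoef f (χ i)‖) ^ 2 := by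
        refine pow_le_pow_left₀ (norm_nonneg _) ((norm_sum_le _ _).trans_eq ?_) 2
        refine Finset.sum_congr rfl fun i _ => ?_
        rw [norm_mul, RCLike.norm_conj]
    _ ≤ _ := Finset.sum_mul_sq_le_sq_mul_sq _ _ _

/-- Hölder with the trivial and the Bessel bound. -/
lemma sum_mul_sq_le_holder {κ : Type*} (s : Finset κ) (x y : κ → ℝ) (hx : ∀ i ∈ s, 0 ≤ x i)
    (hy : ∀ i ∈ s, 0 ≤ y i) {α : ℝ} (hα : 0 ≤ α) (hyα : ∀ i ∈ s, y i ≤ α)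
    (hsum : ∑ i ∈ s, y i ^ 2 ≤ α) {B : ℕ} (hB : 2 ≤ B) :
    ∑ i ∈ s, x i * y i ^ 2 ≤ (∑ i ∈ s, x i ^ B) ^ ((B : ℝ)⁻¹) * α ^ (1 + (B : ℝ)⁻¹) := by
  have hB1 : (1 : ℝ) < B := by exact_mod_cast hB
  have hpq : (B : ℝ).HolderConjugate (Real.conjExponent B) := Real.HolderConjugate.conjExponent hB1
  set p := Real.conjExponent B with hp
  have hp1 : 1 < p := hpq.symm.lt
  have hBp : (B : ℝ)⁻¹ + p⁻¹ = 1 := hpq.inv_add_inv_eq_one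
  have h := Real.inner_le_Lp_mul_Lq_of_nonneg s hpq hx (g := fun i => y i ^ 2)
    (fun i hi => sq_nonneg _)
  refine h.trans ?_
  rw [one_div, one_div]
  simp only [Real.rpow_natCast]
  refine mul_le_mul_of_nonneg_left ?_ (by
    exact Real.rpow_nonneg (Finset.sum_nonneg fun i hi => pow_nonneg (hx i hi) _) _)
  have h2 : ∑ i ∈ s, (y i ^ 2) ^ p ≤ α ^ (2 * p - 1) := by
    rcases hα.eq_or_lt with h0 | h0
    · have : ∀ i ∈ s, (y i ^ 2) ^ p = 0 := fun i hi => by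
        have : y i = 0 := le_antisymm (h0 ▸ hyα i hi) (hy i hi)
        rw [this, zero_pow two_ne_zero, Real.zero_rpow (by linarith)]
      rw [Finset.sum_eq_zero this]
      positivity
    calc _ ≤ ∑ i ∈ s, α ^ (2 * p - 2) * y i ^ 2 := by
          refine Finset.sum_le_sum fun i hi => ?_
          rcases (hy i hi).eq_or_lt with h1 | h1
          · rw [← h1, zero_pow two_ne_zero, Real.zero_rpow (by linarith), mul_zero]
          · have e : (y i ^ 2) ^ p = y i ^ (2 * p - 2) * y i ^ 2 := by
              rw [← Real.rpow_natCast, ← Real.rpow_mul h1.le, ← Real.rpow_add h1]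
              congr 1
              push_cast
              ring
            rw [e]
            exact mul_le_mul_of_nonneg_right
              (Real.rpow_le_rpow h1.le (hyα i hi) (by linarith)) (sq_nonneg _)
      _ = α ^ (2 * p - 2) * ∑ i ∈ s, y i ^ 2 := by rw [Finset.mul_sum]
      _ ≤ α ^ (2 * p - 2) * α := by gcongr
      _ = _ := by
          nth_rewrite 2 [← Real.rpow_one α]
          rw [← Real.rpow_add h0]
          congr 1
          ring
  calc _ ≤ (α ^ (2 * p - 1)) ^ p⁻¹ := Real.rpow_le_rpow (Finset.sum_nonneg fun i _ => by positivity) h2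
        (by positivity)
    _ = _ := by
        rw [← Real.rpow_mul hα]
        congr 1
        have : p * p⁻¹ = 1 := mul_inv_cancel₀ (by linarith)
        linear_combination 2 * this - hBp

/-- Circle-method level set estimate in abstract form. -/
theorem level_set_bound {ι κ : Type*} [DecidableEq κ] (s s' : Finset ι) (hs : s' ⊆ s)
    (k : Finset κ) {n₀ : κ} (hn₀ : n₀ ∈ k) (χ : ι → AddChar G ℂ) (η : κ → AddChar G ℂ)
    (hη : η n₀ = 0) (hinj : Set.InjOn (fun z : ι × κ => χ z.1 + η z.2) (s ×ˢ k : Finset (ι × κ)))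
    (w : ι → ℝ) (hw0 : ∀ i, 0 ≤ w i) (hw1 : ∀ i, w i ≤ 1) {ε : ℝ} (hε : 0 < ε)
    (hwε : ∀ i ∈ s', ε ≤ w i) (ω : G → ℝ) (hω : ∀ g, ω g = 0 ∨ ω g = 1) (oh : κ → ℂ)
    (hoh : ∀ g, (ω g : ℂ) = ∑ n ∈ k, oh n * η n g) (hoh0 : ‖oh n₀‖ ≤ 1 / 2)
    {δ : ℝ} (hδ0 : 0 ≤ δ) (hδ : ∀ g, ω g = 0 → ‖∑ i ∈ s, (w i : ℂ) * χ i g‖ ≤ δ)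
    {B : ℕ} (hB : 2 ≤ B) (c : ι → ℂ) {l : ℝ} (hl : 0 ≤ l)
    (hlδ : 4 * δ * (∑ i ∈ s', ‖c i‖ ^ 2) ≤ ε * l ^ 2) :
    ε * l ^ 2 * dens (fun g => ‖∑ i ∈ s', c i * χ i g‖) l ^ 2 ≤
      4 * (∑ i ∈ s', ‖c i‖ ^ 2) *
        (((∑ i ∈ s, w i) * ∑ n ∈ k.erase n₀, ‖oh n‖ ^ B) ^ ((B : ℝ)⁻¹) *
          dens (fun g => ‖∑ i ∈ s', c i * χ i g‖) l ^ (1 + (B : ℝ)⁻¹)) := by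
  classical
  have hA := level_mul_dens_le s' χ c hl
  set Φ : G → ℂ := fun g => ∑ i ∈ s', c i * χ i g with hΦ
  set f := dualFn Φ l with hf
  set α := dens (fun g => ‖Φ g‖) l with hαdef
  have hα0 : 0 ≤ α := dens_nonneg _ _
  have hmean : nmean f = α := nmean_dualFn Φ hl
  set V : ℝ := ∑ i ∈ s, w i * ‖fcoef f (χ i)‖ ^ 2 with hV
  have hV0 : 0 ≤ V := Finset.sum_nonneg fun i _ => mul_nonneg (hw0 i) (sq_nonneg _)
  have hbess : ε * ∑ i ∈ s', ‖fcoef f (χ i)‖ ^ 2 ≤ V := by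
    rw [Finset.mul_sum]
    refine le_trans (Finset.sum_le_sum fun i hi => ?_)
      (Finset.sum_le_sum_of_subset_of_nonneg hs fun i _ _ => mul_nonneg (hw0 i) (sq_nonneg _))
    exact mul_le_mul_of_nonneg_right (hwε i hi) (sq_nonneg _)
  set K : G → ℂ := fun g => ∑ i ∈ s, (w i : ℂ) * χ i g with hK
  have hKV : kform f K = (V : ℂ) := by
    rw [hK, kform_sum, hV, Complex.ofReal_sum]
    refine Finset.sum_congr rfl fun i _ => ?_
    rw [kform_const_mul, kform_char]
    push_cast
    rfl
  set T : ℝ := ∑ z ∈ s ×ˢ k.erase n₀, (w z.1 * ‖oh z.2‖) * ‖fcoef f (χ z.1 + η z.2)‖ ^ 2 with hT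
  have hω1 : ‖kform f (fun g => ω g * K g)‖ ≤ 1 / 2 * V + T := by
    have e : (fun g => (ω g : ℂ) * K g) = fun g => ∑ z ∈ s ×ˢ k,
        ((w z.1 : ℂ) * oh z.2) * (χ z.1 + η z.2) g := by
      funext g
      rw [hoh, hK, mul_comm, Finset.sum_mul_sum, Finset.sum_product]
      refine Finset.sum_congr rfl fun i _ => Finset.sum_congr rfl fun n _ => ?_
      rw [AddChar.add_apply]
      ring
    rw [e, kform_sum, Finset.sum_product]
    simp only [kform_const_mul, kform_char]
    have e2 : ∀ i, ∑ n ∈ k, (w i : ℂ) * oh n * ((‖fcoef f (χ i + η n)‖ ^ 2 : ℝ) : ℂ) =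
        oh n₀ * ((w i * ‖fcoef f (χ i)‖ ^ 2 : ℝ) : ℂ) + ∑ n ∈ k.erase n₀,
          (w i : ℂ) * oh n * ((‖fcoef f (χ i + η n)‖ ^ 2 : ℝ) : ℂ) := fun i => by
      rw [← Finset.add_sum_erase _ _ hn₀, hη, add_zero]
      push_cast
      ring
    simp only [e2]
    rw [Finset.sum_add_distrib, ← Finset.mul_sum, ← Complex.ofReal_sum]
    refine (norm_add_le _ _).trans (add_le_add ?_ ?_)
    · rw [norm_mul, Complex.norm_real, Real.norm_of_nonneg hV0]
      exact mul_le_mul_of_nonneg_right hoh0 hV0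
    · rw [hT, Finset.sum_product]
      refine (norm_sum_le _ _).trans (Finset.sum_le_sum fun i _ => (norm_sum_le _ _).trans_eq
        (Finset.sum_congr rfl fun n _ => ?_))
      rw [norm_mul, norm_mul, Complex.norm_real, Complex.norm_real, Real.norm_of_nonneg (hw0 i),
        Real.norm_of_nonneg (sq_nonneg _)]
  have hω2 : ‖kform f (fun g => (1 - ω g) * K g)‖ ≤ δ * α ^ 2 := by
    rw [← hmean]
    refine norm_kform_le f _ δ fun g => ?_
    rcases hω g with h | h
    · rw [h]
      simpa using hδ g h
    · rw [h]
      simpa using hδ0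
  have hVle : V ≤ 1 / 2 * V + T + δ * α ^ 2 := by
    have : kform f K = kform f (fun g => ω g * K g) + kform f (fun g => (1 - ω g) * K g) := by
      rw [← kform_add]
      congr 1
      funext g
      ring
    have h1 : V = ‖kform f K‖ := by rw [hKV, Complex.norm_real, Real.norm_of_nonneg hV0]
    rw [this] at h1
    calc V = _ := h1
      _ ≤ _ := norm_add_le _ _
      _ ≤ _ := add_le_add hω1 hω2
  have hTle : T ≤ ((∑ i ∈ s, w i) * ∑ n ∈ k.erase n₀, ‖oh n‖ ^ B) ^ ((B : ℝ)⁻¹) *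
      α ^ (1 + (B : ℝ)⁻¹) := by
    have hsub : s ×ˢ k.erase n₀ ⊆ s ×ˢ k :=
      Finset.product_subset_product_right (Finset.erase_subset _ _)
    have hb := sum_norm_fcoef_sq_le (s ×ˢ k.erase n₀) (fun z : ι × κ => χ z.1 + η z.2)
      (hinj.mono (by exact_mod_cast hsub)) f
    rw [mean_sq_dualFn Φ hl] at hb
    refine (sum_mul_sq_le_holder _ _ _ (fun z _ => mul_nonneg (hw0 _) (norm_nonneg _))
      (fun z _ => norm_nonneg _) hα0 (fun z _ => hmean ▸ norm_fcoef_le _ _) hb hB).trans ?_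
    refine mul_le_mul_of_nonneg_right (Real.rpow_le_rpow
      (Finset.sum_nonneg fun z _ => pow_nonneg (mul_nonneg (hw0 _) (norm_nonneg _)) _) ?_
      (by positivity)) (by positivity)
    rw [Finset.sum_mul_sum, Finset.sum_product]
    refine Finset.sum_le_sum fun i _ => Finset.sum_le_sum fun n _ => ?_
    rw [mul_pow]
    gcongr
    exact pow_le_of_le_one (hw0 i) (hw1 i) (by omega)
  set S := ∑ i ∈ s', ‖c i‖ ^ 2 with hS
  have hS0 : 0 ≤ S := Finset.sum_nonneg fun i _ => sq_nonneg _
  have h1 : ε * (l * α) ^ 2 ≤ S * V := by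
    calc ε * (l * α) ^ 2 ≤ ε * (S * ∑ i ∈ s', ‖fcoef f (χ i)‖ ^ 2) := by gcongr
      _ = S * (ε * ∑ i ∈ s', ‖fcoef f (χ i)‖ ^ 2) := by ring
      _ ≤ _ := by gcongr
  have h2 : S * V ≤ S * (2 * T + 2 * (δ * α ^ 2)) := by
    gcongr
    linarith
  have h3 : 4 * δ * S * α ^ 2 ≤ ε * l ^ 2 * α ^ 2 := by gcongr
  have h4 : S * T ≤ S * (((∑ i ∈ s, w i) * ∑ n ∈ k.erase n₀, ‖oh n‖ ^ B) ^ ((B : ℝ)⁻¹) *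
      α ^ (1 + (B : ℝ)⁻¹)) := by gcongr
  nlinarith

end LevelSet

/-- The sum of three squares. -/
def sqForm : AnisoForm 3 2 where
  Q ξ := ∑ i, ξ i ^ 2
  S := 2 • AddMonoidHom.id _
  map_add ξ η := by
    simp [dotProduct, Fin.sum_univ_three]
    ring
  map_smul k η := by
    simp [Fin.sum_univ_three]
    ring
  aniso v h := by
    have key : ∀ a b c : ZMod 4, a ^ 2 + b ^ 2 + c ^ 2 = 0 →
        (2 * a = 0 ∧ 2 * b = 0 ∧ 2 * c = 0) := by decide
    have h0 : (((v 0 ^ 2 + v 1 ^ 2 + v 2 ^ 2 : ℤ)) : ZMod 4) = 0 := by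
      rw [ZMod.intCast_zmod_eq_zero_iff_dvd]
      simpa [Fin.sum_univ_three] using h
    push_cast at h0
    have h2 : ∀ z : ℤ, (2 * z : ZMod 4) = 0 → 2 ∣ z := fun z hz => by
      have : ((2 * z : ℤ) : ZMod 4) = 0 := by push_cast; exact hz
      rw [ZMod.intCast_zmod_eq_zero_iff_dvd] at this
      omega
    obtain ⟨ha, hb, hc⟩ := key _ _ _ h0
    intro i
    fin_cases i
    · exact h2 _ ha
    · exact h2 _ hb
    · exact h2 _ hc

/-- The embedding of `(ℤ / L) ^ n` as the `L`-torsion of the torus. -/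
def grid (n L : ℕ) [NeZero L] : (Fin n → ZMod L) →+ Tor n where
  toFun a j := ZMod.toAddCircle (a j)
  map_zero' := by ext j; simp
  map_add' a b := by ext j; simp

lemma grid_apply {n L : ℕ} [NeZero L] (a : Fin n → ZMod L) (j : Fin n) :
    grid n L a j = ZMod.toAddCircle (a j) := rfl

lemma chr_grid {n L : ℕ} [NeZero L] (v : Fin n → ℤ) (a : Fin n → ZMod L) :
    chr v (grid n L a) = ZMod.stdAddChar (∑ j, a j * (v j : ZMod L)) := by
  have : pair v (grid n L a) = ZMod.toAddCircle (∑ j, a j * (v j : ZMod L)) := by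
    rw [pair, map_sum]
    refine Finset.sum_congr rfl fun j _ => ?_
    rw [grid_apply, ← map_zsmul, zsmul_eq_mul, mul_comm]
  rw [chr, this, ZMod.stdAddChar_apply]
  rfl

lemma tors_range_le_grid {n r L : ℕ} [NeZero L] (h : 2 ^ r ∣ L) :
    (tors n r).range ≤ (grid n L).range := by
  rintro _ ⟨a, rfl⟩
  obtain ⟨k, rfl⟩ := h
  have hk : k ≠ 0 := by
    rintro rfl
    exact NeZero.ne (2 ^ r * 0) (by simp)
  refine ⟨fun j => (((a j).val * k : ℕ) : ZMod (2 ^ r * k)), ?_⟩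
  ext j
  rw [grid_apply, tors_apply]
  conv_rhs => rw [← ZMod.natCast_zmod_val (a j)]
  rw [ZMod.toAddCircle_natCast, ZMod.toAddCircle_natCast]
  congr 1
  have : (k : ℝ) ≠ 0 := by exact_mod_cast hk
  push_cast
  field_simp

/-- The decoupling bound for frequencies that are distinct modulo `2 ^ n`. -/
lemma exists_havg_Fp_le {ε : ℝ} (hε : 0 < ε) : ∃ C : ℝ, 0 < C ∧ ∀ (n L : ℕ) [NeZero L],
    2 ^ (2 * n) ∣ L → ∀ s : Finset (Fin 3 → ℤ), (∀ ξ ∈ s, ∀ i, 2 * |ξ i| < 2 ^ n) →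
      ∀ (c : (Fin 3 → ℤ) → ℂ) (g : Tor 4), havg (grid 4 L) (sqForm.Fp s id c) g ≤
        C * (2 : ℝ) ^ (ε * n) * (∑ ξ ∈ s, ‖c ξ‖ ^ 2) ^ (5 / 3 : ℝ) := by
  obtain ⟨C, hC, h⟩ := AnisoForm.exists_dec 2 3 le_rfl ε hε
  refine ⟨C, hC, fun n L _ hL s hs c g => ?_⟩
  refine ((h sqForm n).havg_le (by positivity) (grid 4 L) (tors_range_le_grid hL) s id c g).trans ?_
  have hdn : sqForm.dn (grid 4 L) s id c n g ≤ ∑ ξ ∈ s, ‖c ξ‖ ^ 2 := by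
    rw [AnisoForm.dn, ← sum_fil s (id : (Fin 3 → ℤ) → Fin 3 → ℤ) n]
    refine Finset.sum_le_sum fun θ _ => ?_
    have hcard : ∀ ξ ∈ fil s (id : (Fin 3 → ℤ) → Fin 3 → ℤ) n θ,
        ∀ ξ' ∈ fil s (id : (Fin 3 → ℤ) → Fin 3 → ℤ) n θ, ξ = ξ' := by
      intro ξ hξ ξ' hξ'
      rw [mem_fil] at hξ hξ'
      obtain ⟨η, hη⟩ := cap_eq_iff.1 (hξ.2.trans hξ'.2.symm)
      funext i
      have e := congrFun hη i
      simp only [id, Pi.add_apply, Pi.smul_apply, smul_eq_mul] at e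
      have h1 := abs_lt.1 ((abs_mul 2 (ξ i)).trans_lt (by simpa using hs ξ hξ.1 i))
      have h2 := abs_lt.1 ((abs_mul 2 (ξ' i)).trans_lt (by simpa using hs ξ' hξ'.1 i))
      have hp : (0 : ℤ) < 2 ^ n := by positivity
      have : η i = 0 := by
        have h3 : -1 < η i := by nlinarith
        have h4 : η i < 1 := by nlinarith
        omega
      rw [e, this, mul_zero, add_zero]
    generalize fil s (id : (Fin 3 → ℤ) → Fin 3 → ℤ) n θ = t at hcard
    rcases t.eq_empty_or_nonempty with rfl | ⟨ξ, hξ⟩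
    · rw [Finset.sum_empty]
      refine le_of_eq ?_
      have : ∀ x, sqForm.Fp (∅ : Finset (Fin 3 → ℤ)) id c x = 0 := fun x => by
        simp [AnisoForm.Fp, AnisoForm.F]
      rw [havg]
      simp only [this]
      simp
    · have ht : t = {ξ} := Finset.eq_singleton_iff_unique_mem.2 ⟨hξ, fun x hx => hcard x hx ξ hξ⟩
      subst ht
      have : ∀ x, sqForm.Fp ({ξ} : Finset (Fin 3 → ℤ)) id c x = ‖c ξ‖ ^ (10 / 3 : ℝ) := fun x => by
        simp [AnisoForm.Fp, AnisoForm.F]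
      rw [Finset.sum_singleton, havg_of_inv _ (fun a => by rw [this, this]), this,
        ← Real.rpow_mul (norm_nonneg _)]
      norm_num
  gcongr
  exact sqForm.dn_nonneg _ _ _ _ _ _

/-- The character of `(ℤ / L) ^ n` with frequency `v`. -/
def gchar {n L : ℕ} [NeZero L] (v : Fin n → ZMod L) : AddChar (Fin n → ZMod L) ℂ :=
  ZMod.stdAddChar.compAddMonoidHom
    { toFun := fun a => a ⬝ᵥ v, map_zero' := zero_dotProduct v,
      map_add' := fun a b => add_dotProduct a b v }

lemma gchar_apply {n L : ℕ} [NeZero L] (v a : Fin n → ZMod L) :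
    gchar v a = ZMod.stdAddChar (a ⬝ᵥ v) := rfl

lemma gchar_add {n L : ℕ} [NeZero L] (v w : Fin n → ZMod L) :
    gchar v + gchar w = gchar (v + w) := by
  ext a
  rw [AddChar.add_apply, gchar_apply, gchar_apply, gchar_apply, dotProduct_add,
    AddChar.map_add_eq_mul]

lemma gchar_zero {n L : ℕ} [NeZero L] : gchar (0 : Fin n → ZMod L) = 0 := by
  ext a
  rw [gchar_apply, dotProduct_zero, AddChar.map_zero_eq_one, AddChar.zero_apply]

lemma gchar_injective {n L : ℕ} [NeZero L] :
    Function.Injective (gchar : (Fin n → ZMod L) → AddChar (Fin n → ZMod L) ℂ) := by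
  intro v w h
  funext j
  have := DFunLike.congr_fun h (Pi.single j 1)
  rw [gchar_apply, gchar_apply, single_one_dotProduct, single_one_dotProduct] at this
  exact ZMod.injective_stdAddChar this

lemma chr_grid_eq_gchar {n L : ℕ} [NeZero L] (v : Fin n → ℤ) (a : Fin n → ZMod L) :
    chr v (grid n L a) = gchar (fun j => (v j : ZMod L)) a := chr_grid v a

lemma eq_of_intCast_eq {L M : ℕ} (hL : 2 * M < L) {x y : ℤ} (hx : |x| ≤ M) (hy : |y| ≤ M)
    (h : (x : ZMod L) = (y : ZMod L)) : x = y := by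
  rw [ZMod.intCast_eq_intCast_iff_dvd_sub] at h
  have h1 := abs_le.1 hx
  have h2 := abs_le.1 hy
  have : y - x = 0 := Int.eq_zero_of_abs_lt_dvd h (by rw [abs_lt]; omega)
  omega

lemma gw_pos (N : ℕ) (n : ℤ) : 0 < gw N n := Real.exp_pos _

lemma gw_le_one (N : ℕ) (n : ℤ) : gw N n ≤ 1 := by
  rw [gw, Real.exp_le_one_iff]
  have := Real.pi_pos
  have : 0 ≤ Real.pi * (1 / (N : ℝ) ^ 2) * (n : ℝ) ^ 2 := by positivity
  linarith

lemma exp_neg_pi_le_gw {N : ℕ} (hN : 0 < N) {n : ℤ} (hn : |n| ≤ N) :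
    Real.exp (-Real.pi) ≤ gw N n := by
  rw [gw, Real.exp_le_exp]
  have hN' : (0 : ℝ) < N := by exact_mod_cast hN
  have h1 : |(n : ℝ)| ≤ N := by exact_mod_cast hn
  have h2 : (n : ℝ) ^ 2 ≤ (N : ℝ) ^ 2 := by rw [← sq_abs]; gcongr
  have h3 : 1 / (N : ℝ) ^ 2 * (n : ℝ) ^ 2 ≤ 1 := by
    rw [one_div, inv_mul_le_one₀ (by positivity)]
    exact h2
  nlinarith [Real.pi_pos]

/-- The bound for the `B`-th moment of the Fourier transform of the major arcs. -/
def arcMoment (N R B : ℕ) : ℝ :=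
  2 * (6 * R * (1 + Real.log R)) ^ B * (1 + B * Real.log R) ^ (2 ^ B) / (((N : ℝ) ^ 2) ^ (B - 1))

/-- Level set estimate on a fine grid. -/
theorem exists_grid_level_set : ∃ C : ℝ, 0 < C ∧ ∀ N : ℕ, 0 < N → ∃ M : ℕ, ∀ (L : ℕ) [NeZero L],
    M ≤ L → ∀ R : ℕ, 0 < R → 6 * R ^ 2 ≤ N ^ 2 → (∀ q, 0 < q → q ≤ R → q ∣ L) →
    ∀ B : ℕ, 2 ≤ B → ∀ s : Finset (Fin 3 → ℤ), (∀ ξ ∈ s, ∀ i, |ξ i| ≤ N) →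
    ∀ (c : (Fin 3 → ℤ) → ℂ) (g : Tor 4) (l : ℝ), 0 ≤ l →
      C * ((N : ℝ) ^ 3 * (R : ℝ) ^ (-(3 / 2) : ℝ)) * (∑ ξ ∈ s, ‖c ξ‖ ^ 2) ≤ l ^ 2 →
      l ^ 2 * dens (fun a => ‖sqForm.F s id c (g + grid 4 L a)‖) l ^ 2 ≤
        C * (∑ ξ ∈ s, ‖c ξ‖ ^ 2) * ((C * (N : ℝ) ^ 3 * arcMoment N R B) ^ ((B : ℝ)⁻¹) *
          dens (fun a => ‖sqForm.F s id c (g + grid 4 L a)‖) l ^ (1 + (B : ℝ)⁻¹)) := by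
  obtain ⟨C, hC, hW⟩ := exists_weyl_minor
  set ε := Real.exp (-Real.pi) ^ 3 with hε
  have hε0 : 0 < ε := by positivity
  set C' := max (max (4 / ε * C ^ 3) (C ^ 3)) (4 / ε) with hC'
  have hC'0 : 0 < C' := lt_of_lt_of_le (by positivity) (le_max_right _ _)
  refine ⟨C', hC'0, fun N hN => ?_⟩
  obtain ⟨M, hM, hsumW, hminor⟩ := hW N hN
  refine ⟨max (2 * M + 1) (N ^ 2), fun L _ hL R hR hRN hdvd B hB s hs c g l hl hlR => ?_⟩
  have hLM : 2 * M < L := lt_of_lt_of_le (Nat.lt_succ_self _) ((le_max_left _ _).trans hL)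
  have hLN : N ^ 2 ≤ L := (le_max_right _ _).trans hL
  have hN0 : (0 : ℝ) < N := by exact_mod_cast hN
  have hR0 : (0 : ℝ) < R := by exact_mod_cast hR
  let S : Finset (Fin 3 → ℤ) := Fintype.piFinset fun _ => Finset.Icc (-(M : ℤ)) M
  have hSM : ∀ ξ ∈ S, ∀ i, |ξ i| ≤ M := fun ξ hξ i =>
    abs_le.2 (Finset.mem_Icc.1 (Fintype.mem_piFinset.1 hξ i))
  let χ : (Fin 3 → ℤ) → AddChar (Fin 4 → ZMod L) ℂ := fun ξ =>
    gchar fun j => ((sqForm.pt ξ j : ℤ) : ZMod L)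
  let η : ZMod L → AddChar (Fin 4 → ZMod L) ℂ := fun n => gchar (Pi.single 0 n)
  let w : (Fin 3 → ℤ) → ℝ := fun ξ => ∏ i, gw N (ξ i)
  have hF : ∀ a, sqForm.F s id c (g + grid 4 L a) =
      ∑ ξ ∈ s, (c ξ * chr (sqForm.pt ξ) g) * χ ξ a := fun a => by
    rw [AnisoForm.F]
    refine Finset.sum_congr rfl fun ξ _ => ?_
    rw [id, chr_add, chr_grid_eq_gchar, mul_assoc]
  have hc : ∑ ξ ∈ s, ‖c ξ * chr (sqForm.pt ξ) g‖ ^ 2 = ∑ ξ ∈ s, ‖c ξ‖ ^ 2 := by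
    refine Finset.sum_congr rfl fun ξ _ => ?_
    rw [norm_mul, norm_chr, mul_one]
  have hK : ∀ a : Fin 4 → ZMod L, ∑ ξ ∈ S, (w ξ : ℂ) * χ ξ a = ∏ i : Fin 3,
      ∑ n ∈ Finset.Icc (-(M : ℤ)) M, (gw N n : ℂ) *
        ZMod.stdAddChar (a i.succ * (n : ZMod L) + a 0 * (n : ZMod L) ^ 2) := fun a => by
    rw [Finset.prod_univ_sum]
    refine Finset.sum_congr rfl fun ξ _ => ?_
    rw [Finset.prod_mul_distrib]
    congr 1
    · simp only [w, Complex.ofReal_prod]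
    · have hprod : ∏ i : Fin 3, (ZMod.stdAddChar (a i.succ * (ξ i : ZMod L) +
          a 0 * (ξ i : ZMod L) ^ 2) : ℂ) = ZMod.stdAddChar (∑ i : Fin 3,
            (a i.succ * (ξ i : ZMod L) + a 0 * (ξ i : ZMod L) ^ 2)) := by
        simp only [Fin.prod_univ_three, Fin.sum_univ_three, AddChar.map_add_eq_mul]
      rw [hprod]
      simp only [χ, gchar_apply]
      congr 1
      rw [dotProduct, Fin.sum_univ_succ, Finset.sum_add_distrib, add_comm, ← Finset.mul_sum]
      simp [AnisoForm.pt, sqForm]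
  have hR12 : ((R : ℝ) ^ (-(1 / 2) : ℝ)) ^ 3 = (R : ℝ) ^ (-(3 / 2) : ℝ) := by
    rw [← Real.rpow_natCast, ← Real.rpow_mul hR0.le]
    norm_num
  have hSub : s ⊆ S := fun ξ hξ => Fintype.mem_piFinset.2 fun i =>
    Finset.mem_Icc.2 (abs_le.1 ((hs ξ hξ i).trans (by exact_mod_cast (by omega : N ≤ M))))
  have hwε : ∀ ξ ∈ s, ε ≤ w ξ := fun ξ hξ => by
    have : ε = ∏ _i : Fin 3, Real.exp (-Real.pi) := by simp [hε]
    rw [this]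
    exact Finset.prod_le_prod (fun _ _ => (Real.exp_pos _).le)
      fun i _ => exp_neg_pi_le_gw hN (hs ξ hξ i)
  have hsum1 : ∑ ξ ∈ S, w ξ ≤ C ^ 3 * (N : ℝ) ^ 3 := by
    have : ∑ ξ ∈ S, w ξ = (∑ n ∈ Finset.Icc (-(M : ℤ)) M, gw N n) ^ 3 := by
      have h3 : (∑ n ∈ Finset.Icc (-(M : ℤ)) M, gw N n) ^ 3 =
          ∏ _i : Fin 3, ∑ n ∈ Finset.Icc (-(M : ℤ)) M, gw N n := by simp
      rw [h3, Finset.prod_univ_sum]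
    rw [this, ← mul_pow]
    exact pow_le_pow_left₀ (Finset.sum_nonneg fun n _ => (gw_pos N n).le) hsumW 3
  have hinj : Set.InjOn (fun z : (Fin 3 → ℤ) × ZMod L => χ z.1 + η z.2)
      (S ×ˢ (Finset.univ : Finset (ZMod L)) : Finset ((Fin 3 → ℤ) × ZMod L)) := by
    rintro ⟨ξ, n⟩ hz ⟨ξ', n'⟩ hz' h
    have hξ : ξ ∈ S := (Finset.mem_product.1 hz).1
    have hξ' : ξ' ∈ S := (Finset.mem_product.1 hz').1
    simp only [χ, η, gchar_add] at h
    have h1 := gchar_injective h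
    have h2 : ξ = ξ' := by
      funext i
      have := congrFun h1 i.succ
      simp [AnisoForm.pt] at this
      exact eq_of_intCast_eq hLM (hSM ξ hξ i) (hSM ξ' hξ' i) this
    subst h2
    have := congrFun h1 0
    simp at this
    rw [this]
  have hoh0 : ‖omegaHat L N R 0‖ ≤ 1 / 2 := by
    refine (norm_omegaHat_zero_le hN hLN).trans ?_
    rw [div_le_div_iff₀ (by positivity) two_pos]
    have : (6 * R ^ 2 : ℝ) ≤ N ^ 2 := by exact_mod_cast hRN
    linarith
  have hRN' : 2 * R ^ 2 < N ^ 2 := by nlinarith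
  set δ := C ^ 3 * ((N : ℝ) ^ 3 * (R : ℝ) ^ (-(3 / 2) : ℝ)) with hδ
  have hδ0 : 0 ≤ δ := by positivity
  set T := ∑ ξ ∈ s, ‖c ξ‖ ^ 2 with hT
  have hT0 : 0 ≤ T := Finset.sum_nonneg fun _ _ => sq_nonneg _
  have key := level_set_bound S s hSub Finset.univ (Finset.mem_univ (0 : ZMod L)) χ η
    (by simp only [η, Pi.single_zero, gchar_zero]) hinj w
    (fun ξ => Finset.prod_nonneg fun i _ => (gw_pos N _).le)
    (fun ξ => Finset.prod_le_one (fun i _ => (gw_pos N _).le) fun i _ => gw_le_one N _)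
    hε0 hwε (fun a => omega L N R (a 0)) (fun a => omega_eq_zero_or_one hN hRN' hdvd (a 0))
    (omegaHat L N R) (fun a => by
      rw [omegaHat_inversion]
      refine Finset.sum_congr rfl fun n _ => ?_
      simp only [η, gchar_apply, dotProduct_single]) hoh0 hδ0
    (fun a ha => by
      rw [hK, norm_prod]
      refine (Finset.prod_le_prod (fun _ _ => norm_nonneg _)
        fun i _ => hminor L R hR hdvd (a i.succ) (a 0) ha).trans_eq ?_
      rw [Finset.prod_const, Finset.card_univ, Fintype.card_fin, hδ, ← hR12]
      ring) hB (fun ξ => c ξ * chr (sqForm.pt ξ) g) hl (by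
      rw [hc]
      have h1 : 4 / ε * C ^ 3 ≤ C' := (le_max_left _ _).trans (le_max_left _ _)
      have h2 : 4 / ε * C ^ 3 * ((N : ℝ) ^ 3 * (R : ℝ) ^ (-(3 / 2) : ℝ)) * T ≤ l ^ 2 := by
        refine le_trans ?_ hlR
        gcongr
      calc 4 * δ * T = ε * (4 / ε * C ^ 3 * ((N : ℝ) ^ 3 * (R : ℝ) ^ (-(3 / 2) : ℝ)) * T) := by
            rw [hδ]
            field_simp
        _ ≤ _ := by gcongr)
  rw [hc] at key
  simp only [← hF] at key
  set α := dens (fun a => ‖sqForm.F s id c (g + grid 4 L a)‖) l with hα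
  have hα0 : 0 ≤ α := dens_nonneg _ _
  have hmom : ∑ n ∈ Finset.univ.erase 0, ‖omegaHat L N R n‖ ^ B ≤ arcMoment N R B := by
    refine le_trans (le_of_eq ?_) (sum_norm_omegaHat_pow_le hN hR hLN hdvd B hB)
    refine Finset.sum_congr ?_ fun _ _ => rfl
    ext n
    simp
  have hmom0 : 0 ≤ ∑ n ∈ Finset.univ.erase 0, ‖omegaHat L N R n‖ ^ B :=
    Finset.sum_nonneg fun _ _ => by positivity
  have hle : (∑ ξ ∈ S, w ξ) * ∑ n ∈ Finset.univ.erase 0, ‖omegaHat L N R n‖ ^ B ≤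
      C' * (N : ℝ) ^ 3 * arcMoment N R B := by
    have h1 : C ^ 3 ≤ C' := (le_max_right _ _).trans (le_max_left _ _)
    refine mul_le_mul (hsum1.trans ?_) hmom hmom0 (by positivity)
    gcongr
  have h1 : 4 / ε ≤ C' := le_max_right _ _
  have hw0 : 0 ≤ (∑ ξ ∈ S, w ξ) * ∑ n ∈ Finset.univ.erase 0, ‖omegaHat L N R n‖ ^ B :=
    mul_nonneg (Finset.sum_nonneg fun ξ _ => Finset.prod_nonneg fun i _ => (gw_pos N _).le) hmom0
  calc l ^ 2 * α ^ 2 = ε⁻¹ * (ε * l ^ 2 * α ^ 2) := by field_simp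
    _ ≤ ε⁻¹ * (4 * T * (((∑ ξ ∈ S, w ξ) * ∑ n ∈ Finset.univ.erase 0, ‖omegaHat L N R n‖ ^ B) ^
          ((B : ℝ)⁻¹) * α ^ (1 + (B : ℝ)⁻¹))) := by gcongr
    _ = 4 / ε * T * (((∑ ξ ∈ S, w ξ) * ∑ n ∈ Finset.univ.erase 0, ‖omegaHat L N R n‖ ^ B) ^
          ((B : ℝ)⁻¹) * α ^ (1 + (B : ℝ)⁻¹)) := by ring
    _ ≤ _ := by gcongr

lemma one_add_mul_log_le {δ b x : ℝ} (hδ : 0 < δ) (hb : 0 ≤ b) (hx : 1 ≤ x) :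
    1 + b * Real.log x ≤ (1 + b / δ) * x ^ δ := by
  have h1 := Real.log_le_rpow_div (by linarith : 0 ≤ x) hδ
  have h2 : 1 ≤ x ^ δ := Real.one_le_rpow hx hδ.le
  calc 1 + b * Real.log x ≤ x ^ δ + b * (x ^ δ / δ) := by gcongr
    _ = _ := by ring

/-- The `B`-th root of the moment loses only an arbitrarily small power. -/
lemma exists_arcMoment_root_le {C ε : ℝ} (hC : 0 < C) (hε : 0 < ε) {B : ℕ} (hB : 2 ≤ B) :
    ∃ D : ℝ, 0 < D ∧ ∀ N R : ℕ, 0 < N → 0 < R →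
      (C * (N : ℝ) ^ 3 * arcMoment N R B) ^ ((B : ℝ)⁻¹) ≤
        D * (R : ℝ) ^ (1 + ε) * (N : ℝ) ^ (5 * (B : ℝ)⁻¹ - 2) := by
  have hB0 : (0 : ℝ) < B := by positivity
  set k : ℕ := B + 2 ^ B with hk
  have hk0 : (0 : ℝ) < k := by positivity
  set δ : ℝ := ε * B / k with hδ
  have hδ0 : 0 < δ := by positivity
  set E : ℝ := 1 + B / δ with hE
  have hE0 : 0 < E := by positivity
  set A : ℝ := 2 * C * 6 ^ B * E ^ k with hA
  have hA0 : 0 < A := by positivity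
  refine ⟨A ^ ((B : ℝ)⁻¹), by positivity, fun N R hN hR => ?_⟩
  have hN0 : (0 : ℝ) < N := by exact_mod_cast hN
  have hR1 : (1 : ℝ) ≤ R := by exact_mod_cast hR
  have hR0 : (0 : ℝ) < R := by linarith
  have hlog : 0 ≤ Real.log R := Real.log_nonneg hR1
  have hB1 : (1 : ℝ) ≤ B := by exact_mod_cast (by omega : 1 ≤ B)
  have h1 : 1 + B * Real.log R ≤ E * (R : ℝ) ^ δ := one_add_mul_log_le hδ0 hB0.le hR1
  have h2 : 1 + Real.log R ≤ E * (R : ℝ) ^ δ := by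
    refine le_trans ?_ h1
    nlinarith
  have hN5 : (N : ℝ) ^ 3 / ((N : ℝ) ^ 2) ^ (B - 1) = (N : ℝ) ^ (5 - 2 * B : ℝ) := by
    rw [← pow_mul, ← Real.rpow_natCast, ← Real.rpow_natCast, ← Real.rpow_sub hN0]
    congr 1
    push_cast [Nat.cast_sub (by omega : 1 ≤ B)]
    ring
  have hRk : ((R : ℝ) ^ δ) ^ k = (R : ℝ) ^ (ε * B) := by
    rw [← Real.rpow_natCast, ← Real.rpow_mul hR0.le]
    congr 1
    rw [hδ]
    field_simp
  have hm : C * (N : ℝ) ^ 3 * arcMoment N R B ≤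
      A * (R : ℝ) ^ ((1 + ε) * B) * (N : ℝ) ^ (5 - 2 * B : ℝ) := by
    calc C * (N : ℝ) ^ 3 * arcMoment N R B = 2 * C * 6 ^ B * (R : ℝ) ^ B *
          ((1 + Real.log R) ^ B * (1 + B * Real.log R) ^ (2 ^ B)) *
            ((N : ℝ) ^ 3 / ((N : ℝ) ^ 2) ^ (B - 1)) := by
          rw [arcMoment, mul_pow, mul_pow]
          ring
      _ ≤ 2 * C * 6 ^ B * (R : ℝ) ^ B *
          ((E * (R : ℝ) ^ δ) ^ B * (E * (R : ℝ) ^ δ) ^ (2 ^ B)) *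
            ((N : ℝ) ^ 3 / ((N : ℝ) ^ 2) ^ (B - 1)) := by gcongr
      _ = 2 * C * 6 ^ B * (R : ℝ) ^ B * (E ^ k * (R : ℝ) ^ (ε * B)) *
            (N : ℝ) ^ (5 - 2 * B : ℝ) := by
          rw [hN5, ← pow_add, ← hk, mul_pow, hRk]
      _ = _ := by
          rw [add_mul, one_mul, Real.rpow_add hR0, Real.rpow_natCast, hA]
          ring
  have hAM : 0 ≤ arcMoment N R B := by
    rw [arcMoment]
    positivity
  refine (Real.rpow_le_rpow (by positivity) hm (by positivity)).trans_eq ?_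
  rw [Real.mul_rpow (by positivity) (by positivity), Real.mul_rpow hA0.le (by positivity),
    ← Real.rpow_mul hR0.le, ← Real.rpow_mul hN0.le]
  congr 3 <;> field_simp

lemma dens_mul_rpow_le {G : Type*} [AddCommGroup G] [Fintype G] (u : G → ℝ) (hu : ∀ g, 0 ≤ u g)
    {l r : ℝ} (hl : 0 ≤ l) (hr : 0 ≤ r) :
    dens u l * l ^ r ≤ (Fintype.card G : ℝ)⁻¹ * ∑ g, u g ^ r := by
  rw [dens, mul_assoc]
  refine mul_le_mul_of_nonneg_left ?_ (by positivity)
  calc _ = ∑ g ∈ Finset.univ.filter fun g => l < u g, l ^ r := by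
        rw [Finset.sum_const, nsmul_eq_mul]
    _ ≤ ∑ g ∈ Finset.univ.filter fun g => l < u g, u g ^ r := Finset.sum_le_sum fun g hg =>
        Real.rpow_le_rpow hl (Finset.mem_filter.1 hg).2.le hr
    _ ≤ _ := Finset.sum_le_sum_of_subset_of_nonneg (Finset.filter_subset _ _)
        fun g _ _ => Real.rpow_nonneg (hu g) _

lemma card_box_le {N : ℕ} (s : Finset (Fin 3 → ℤ)) (hN : 0 < N) (hs : ∀ ξ ∈ s, ∀ i, |ξ i| ≤ N) :
    (s.card : ℝ) ≤ 27 * (N : ℝ) ^ 3 := by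
  have hsub : s ⊆ Fintype.piFinset fun _ : Fin 3 => Finset.Icc (-(N : ℤ)) N := fun ξ hξ =>
    Fintype.mem_piFinset.2 fun i => Finset.mem_Icc.2 (abs_le.1 (hs ξ hξ i))
  have h := Finset.card_le_card hsub
  rw [Fintype.card_piFinset] at h
  simp only [Int.card_Icc, Finset.prod_const, Finset.card_univ, Fintype.card_fin] at h
  have h2 : (N + 1 - -(N : ℤ)).toNat ≤ 3 * N := by omega
  have h3 : s.card ≤ 27 * N ^ 3 := h.trans ((Nat.pow_le_pow_left h2 3).trans_eq (by ring))
  exact_mod_cast h3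

/-- The trivial pointwise bound. -/
lemma norm_F_le {N : ℕ} (s : Finset (Fin 3 → ℤ)) (hN : 0 < N) (hs : ∀ ξ ∈ s, ∀ i, |ξ i| ≤ N)
    (c : (Fin 3 → ℤ) → ℂ) (g : Tor 4) :
    ‖sqForm.F s id c g‖ ≤ 6 * ((N : ℝ) ^ (3 / 2 : ℝ) * √(∑ ξ ∈ s, ‖c ξ‖ ^ 2)) := by
  have hN0 : (0 : ℝ) < N := by exact_mod_cast hN
  have h1 : ‖sqForm.F s id c g‖ ≤ ∑ ξ ∈ s, 1 * ‖c ξ‖ := by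
    refine (norm_sum_le _ _).trans_eq (Finset.sum_congr rfl fun ξ _ => ?_)
    rw [norm_mul, norm_chr, mul_one, one_mul]
  have h2 := Finset.sum_mul_sq_le_sq_mul_sq s (fun _ => (1 : ℝ)) fun ξ => ‖c ξ‖
  have hT0 : 0 ≤ ∑ ξ ∈ s, ‖c ξ‖ ^ 2 := Finset.sum_nonneg fun _ _ => sq_nonneg _
  refine abs_le_of_sq_le_sq' ?_ (by positivity) |>.2
  have h3 : ‖sqForm.F s id c g‖ ^ 2 ≤ (∑ ξ ∈ s, 1 * ‖c ξ‖) ^ 2 :=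
    pow_le_pow_left₀ (norm_nonneg _) h1 2
  refine h3.trans (h2.trans ?_)
  have e : ((N : ℝ) ^ (3 / 2 : ℝ)) ^ 2 = (N : ℝ) ^ 3 := by
    rw [← Real.rpow_natCast, ← Real.rpow_mul hN0.le, ← Real.rpow_natCast]
    norm_num
  rw [mul_pow, mul_pow, Real.sq_sqrt hT0, e]
  simp only [one_pow, Finset.sum_const, nsmul_eq_mul, mul_one]
  have := card_box_le s hN hs
  have h4 : (0 : ℝ) ≤ (N : ℝ) ^ 3 := by positivity
  nlinarith [mul_le_mul_of_nonneg_right this hT0, mul_nonneg h4 hT0]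

lemma le_of_rpow_le_mul_rpow {x y A θ : ℝ} (hx : 0 ≤ x) (hy : 0 ≤ y) (hA : 0 ≤ A) (hθ : 0 < θ)
    (h : x ^ θ ≤ A * y ^ θ) : x ≤ A ^ θ⁻¹ * y := by
  have h1 := Real.rpow_le_rpow (by positivity) h (inv_nonneg.2 hθ.le)
  rwa [Real.mul_rpow hA (by positivity), ← Real.rpow_mul hx, ← Real.rpow_mul hy,
    mul_inv_cancel₀ hθ.ne', Real.rpow_one, Real.rpow_one] at h1

/-- Weak-type estimate at every exponent above the critical one. -/
theorem exists_dens_le {q : ℝ} (hq : 10 / 3 < q) : ∃ C : ℝ, 0 < C ∧ ∀ m : ℕ, ∃ (L : ℕ)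
    (_ : NeZero L), ∀ s : Finset (Fin 3 → ℤ), (∀ ξ ∈ s, ∀ i, |ξ i| ≤ 2 ^ m) →
    ∀ (c : (Fin 3 → ℤ) → ℂ) (g : Tor 4) (l : ℝ), 0 < l →
      dens (fun a => ‖sqForm.F s id c (g + grid 4 L a)‖) l ≤
        C * (((2 : ℝ) ^ m) ^ (-5 : ℝ) *
          (((2 : ℝ) ^ m) ^ (3 / 2 : ℝ) * √(∑ ξ ∈ s, ‖c ξ‖ ^ 2) / l) ^ q) := by
  obtain ⟨C₁, hC₁, hcirc⟩ := exists_grid_level_set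
  obtain ⟨B, hB, hBq⟩ : ∃ B : ℕ, 2 ≤ B ∧ 10 / 3 < q * (1 - (B : ℝ)⁻¹) := by
    obtain ⟨n, hn⟩ := exists_nat_gt (q / (q - 10 / 3))
    have hq' : 0 < q - 10 / 3 := by linarith
    have hn1 : 1 < (n : ℝ) := lt_trans (by rw [lt_div_iff₀ hq']; linarith) hn
    refine ⟨n, by exact_mod_cast hn1, ?_⟩
    rw [div_lt_iff₀ hq'] at hn
    have hn0 : (0 : ℝ) < n := by linarith
    have : q * (n : ℝ)⁻¹ < q - 10 / 3 := by
      rw [← div_eq_mul_inv, div_lt_iff₀ hn0]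
      linarith
    linarith
  have hB0 : (0 : ℝ) < B := by positivity
  have hBinv : (B : ℝ)⁻¹ ≤ 2⁻¹ := inv_anti₀ two_pos (by exact_mod_cast hB)
  set θ : ℝ := 1 - (B : ℝ)⁻¹ with hθ
  have hθ0 : 0 < θ := by rw [hθ]; linarith
  set ε₁ : ℝ := 3 / 4 * (q * θ - 10 / 3) with hε₁
  have hε₁0 : 0 < ε₁ := by rw [hε₁]; linarith
  obtain ⟨D, hD, hroot⟩ := exists_arcMoment_root_le hC₁ hε₁0 hB
  set ε₂ : ℝ := 3 / 16 * (q - 10 / 3) with hε₂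
  have hε₂0 : 0 < ε₂ := by rw [hε₂]; linarith
  obtain ⟨C₂, hC₂, hdec⟩ := exists_havg_Fp_le hε₂0
  set A : ℝ := C₁ ^ (2 / 3 : ℝ) + 72 with hA
  have hA0 : 0 < A := by positivity
  set K₁ : ℝ := (C₁ * D * A ^ (1 + ε₁)) ^ θ⁻¹ with hK₁
  set K₂ : ℝ := C₂ * 4 ^ ε₂ * (A ^ 4) ^ ε₂ with hK₂
  have hK₁0 : 0 < K₁ := by positivity
  have hK₂0 : 0 < K₂ := by positivity
  refine ⟨max K₁ K₂, lt_max_of_lt_left hK₁0, fun m => ?_⟩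
  set N : ℕ := 2 ^ m with hN
  have hNpos : 0 < N := by positivity
  have hN0 : (0 : ℝ) < N := by exact_mod_cast hNpos
  have hNcast : (2 : ℝ) ^ m = N := by rw [hN]; push_cast; rfl
  obtain ⟨M, hM⟩ := hcirc N hNpos
  have hL0 : 2 ^ (2 * (m + 2)) * (M + 1) * N.factorial ≠ 0 := by positivity
  refine ⟨2 ^ (2 * (m + 2)) * (M + 1) * N.factorial, ⟨hL0⟩, fun s hs c g l hl => ?_⟩
  have hNZ : NeZero (2 ^ (2 * (m + 2)) * (M + 1) * N.factorial) := ⟨hL0⟩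
  set L := 2 ^ (2 * (m + 2)) * (M + 1) * N.factorial with hL
  have hs' : ∀ ξ ∈ s, ∀ i, |ξ i| ≤ N := fun ξ hξ i => by
    rw [hN]; push_cast; exact hs ξ hξ i
  rw [hNcast]
  set T := ∑ ξ ∈ s, ‖c ξ‖ ^ 2 with hT
  have hT0 : 0 ≤ T := Finset.sum_nonneg fun _ _ => sq_nonneg _
  set u : (Fin 4 → ZMod L) → ℝ := fun a => ‖sqForm.F s id c (g + grid 4 L a)‖ with hu
  set μ : ℝ := (N : ℝ) ^ (3 / 2 : ℝ) * √T / l with hμ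
  have hμ0 : 0 ≤ μ := by positivity
  have hα0 : 0 ≤ dens u l := dens_nonneg _ _
  by_cases hμ6 : 6 * μ ≤ 1
  · have h0 : dens u l = 0 := by
      rw [dens, Finset.filter_false_of_mem, Finset.card_empty, Nat.cast_zero, mul_zero]
      intro a _
      rw [not_lt]
      refine (norm_F_le s hNpos hs' c _).trans ?_
      rw [hμ, mul_div_assoc', div_le_one hl] at hμ6
      exact hμ6
    rw [h0]
    positivity
  rw [not_le] at hμ6
  have hμ1 : 1 / 6 < μ := by linarith
  have hμpos : 0 < μ := by linarith
  have hTpos : 0 < T := by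
    rcases hT0.eq_or_lt with h | h
    · rw [hμ, ← h, Real.sqrt_zero] at hμpos
      simp at hμpos
    · exact h
  have hl2 : l ^ 2 = (N : ℝ) ^ 3 * T / μ ^ 2 := by
    have e : ((N : ℝ) ^ (3 / 2 : ℝ)) ^ 2 = (N : ℝ) ^ 3 := by
      rw [← Real.rpow_natCast, ← Real.rpow_mul hN0.le, ← Real.rpow_natCast]
      norm_num
    rw [hμ, div_pow, mul_pow, Real.sq_sqrt hT0, e]
    field_simp
  set R : ℕ := ⌈C₁ ^ (2 / 3 : ℝ) * μ ^ (4 / 3 : ℝ)⌉₊ + 1 with hR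
  have hRpos : 0 < R := Nat.succ_pos _
  have hR2 : 2 ≤ R := by
    have : 0 < ⌈C₁ ^ (2 / 3 : ℝ) * μ ^ (4 / 3 : ℝ)⌉₊ := Nat.ceil_pos.2 (by positivity)
    omega
  have hR0 : (0 : ℝ) < R := by exact_mod_cast hRpos
  have hRlow : C₁ ^ (2 / 3 : ℝ) * μ ^ (4 / 3 : ℝ) ≤ R := by
    rw [hR]
    push_cast
    linarith [Nat.le_ceil (C₁ ^ (2 / 3 : ℝ) * μ ^ (4 / 3 : ℝ))]
  have hμ43 : 1 ≤ 36 * μ ^ (4 / 3 : ℝ) := by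
    have h1 : (1 : ℝ) ≤ (6 * μ) ^ (4 / 3 : ℝ) := Real.one_le_rpow hμ6.le (by norm_num)
    have h2 : (6 : ℝ) ^ (4 / 3 : ℝ) ≤ 36 := by
      calc (6 : ℝ) ^ (4 / 3 : ℝ) ≤ (6 : ℝ) ^ (2 : ℝ) :=
            Real.rpow_le_rpow_of_exponent_le (by norm_num) (by norm_num)
        _ = 36 := by norm_num
    rw [Real.mul_rpow (by norm_num) hμ0] at h1
    exact h1.trans (mul_le_mul_of_nonneg_right h2 (by positivity))
  have hRup : (R : ℝ) ≤ A * μ ^ (4 / 3 : ℝ) := by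
    have := Nat.ceil_lt_add_one (by positivity : 0 ≤ C₁ ^ (2 / 3 : ℝ) * μ ^ (4 / 3 : ℝ))
    rw [hR, hA]
    push_cast
    linarith
  rcases le_or_gt (R ^ 4) N with hcase | hcase
  · have hRN : R ≤ N := (Nat.le_self_pow (by norm_num) R).trans hcase
    have h6 : 6 * R ^ 2 ≤ N ^ 2 := by
      have h1 : R ^ 4 * R ^ 4 ≤ N ^ 2 := by rw [sq]; exact Nat.mul_le_mul hcase hcase
      have h2 : 2 ^ 6 ≤ R ^ 6 := Nat.pow_le_pow_left hR2 6
      calc 6 * R ^ 2 ≤ R ^ 6 * R ^ 2 := Nat.mul_le_mul_right _ (by omega)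
        _ = R ^ 4 * R ^ 4 := by ring
        _ ≤ _ := h1
    have hML : M ≤ L := by
      have h1 : 0 < 2 ^ (2 * (m + 2)) := by positivity
      have h2 := Nat.factorial_pos N
      rw [hL]
      nlinarith [Nat.mul_le_mul h1 h2, Nat.zero_le M]
    have hdvd : ∀ q, 0 < q → q ≤ R → q ∣ L := fun q hq0 hqR =>
      (Nat.dvd_factorial hq0 (hqR.trans hRN)).trans (Dvd.intro_left _ rfl)
    have hcond : C₁ * ((N : ℝ) ^ 3 * (R : ℝ) ^ (-(3 / 2) : ℝ)) * T ≤ l ^ 2 := by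
      have h1 : C₁ * μ ^ 2 ≤ (R : ℝ) ^ (3 / 2 : ℝ) := by
        have := Real.rpow_le_rpow (by positivity) hRlow (by norm_num : (0 : ℝ) ≤ 3 / 2)
        rw [Real.mul_rpow (by positivity) (by positivity), ← Real.rpow_mul hC₁.le,
          ← Real.rpow_mul hμ0] at this
        norm_num at this
        exact this
      have h2 : (R : ℝ) ^ (-(3 / 2) : ℝ) = ((R : ℝ) ^ (3 / 2 : ℝ))⁻¹ := Real.rpow_neg hR0.le _
      rw [hl2, h2, le_div_iff₀ (by positivity)]
      have h3 : C₁ * μ ^ 2 * ((R : ℝ) ^ (3 / 2 : ℝ))⁻¹ ≤ 1 := by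
        rw [← div_eq_mul_inv, div_le_one (by positivity)]
        exact h1
      calc _ = (N : ℝ) ^ 3 * T * (C₁ * μ ^ 2 * ((R : ℝ) ^ (3 / 2 : ℝ))⁻¹) := by ring
        _ ≤ (N : ℝ) ^ 3 * T * 1 := by gcongr
        _ = _ := mul_one _
    have key := hM L hML R hRpos h6 hdvd B hB s hs' c g l hl.le hcond
    rw [← hu] at key
    set α := dens u l with hα
    rcases hα0.eq_or_lt with h0 | hαpos
    · rw [← h0]; positivity
    have hα2 : α ^ 2 = α ^ θ * α ^ (1 + (B : ℝ)⁻¹) := by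
      rw [← Real.rpow_add hαpos, ← Real.rpow_natCast]
      congr 1
      rw [hθ]
      push_cast
      ring
    have hmain : (N : ℝ) ^ 3 / μ ^ 2 * α ^ θ ≤
        C₁ * (D * (R : ℝ) ^ (1 + ε₁) * (N : ℝ) ^ (5 * (B : ℝ)⁻¹ - 2)) := by
      have h1 : l ^ 2 * α ^ θ * α ^ (1 + (B : ℝ)⁻¹) ≤
          C₁ * T * (D * (R : ℝ) ^ (1 + ε₁) * (N : ℝ) ^ (5 * (B : ℝ)⁻¹ - 2)) *
            α ^ (1 + (B : ℝ)⁻¹) := by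
        calc _ = l ^ 2 * α ^ 2 := by rw [hα2]; ring
          _ ≤ _ := key
          _ ≤ C₁ * T * ((D * (R : ℝ) ^ (1 + ε₁) * (N : ℝ) ^ (5 * (B : ℝ)⁻¹ - 2)) *
                α ^ (1 + (B : ℝ)⁻¹)) := by
              gcongr
              exact hroot N R hNpos hRpos
          _ = _ := by ring
      have h2 := le_of_mul_le_mul_right h1 (by positivity)
      rw [hl2] at h2
      refine le_of_mul_le_mul_right (a := T) ?_ hTpos
      calc _ = (N : ℝ) ^ 3 * T / μ ^ 2 * α ^ θ := by ring
        _ ≤ _ := h2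
        _ = _ := by ring
    have hfin : α ^ θ ≤ (C₁ * D * A ^ (1 + ε₁)) * ((N : ℝ) ^ (-5 : ℝ) * μ ^ q) ^ θ := by
      have hR' : (R : ℝ) ^ (1 + ε₁) ≤ A ^ (1 + ε₁) * (μ ^ (4 / 3 : ℝ)) ^ (1 + ε₁) := by
        rw [← Real.mul_rpow hA0.le (by positivity)]
        exact Real.rpow_le_rpow hR0.le hRup (by linarith)
      have e1 : ((N : ℝ) ^ (-5 : ℝ) * μ ^ q) ^ θ =
          (μ ^ (4 / 3 : ℝ)) ^ (1 + ε₁) * μ ^ 2 * ((N : ℝ) ^ (5 * (B : ℝ)⁻¹ - 2) / (N : ℝ) ^ 3) := by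
        rw [Real.mul_rpow (by positivity) (by positivity), ← Real.rpow_mul hN0.le,
          ← Real.rpow_mul hμ0, ← Real.rpow_mul hμ0, ← Real.rpow_natCast μ 2,
          ← Real.rpow_natCast (N : ℝ) 3, ← Real.rpow_add hμpos, ← Real.rpow_sub hN0, mul_comm]
        congr 2
        · rw [hε₁]; push_cast; ring
        · rw [hθ]; push_cast; ring
      rw [e1]
      rw [div_mul_eq_mul_div, div_le_iff₀ (by positivity)] at hmain
      have h3 : (0 : ℝ) < (N : ℝ) ^ 3 := by positivity
      refine le_of_mul_le_mul_left (a := (N : ℝ) ^ 3) ?_ h3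
      refine hmain.trans ?_
      calc _ ≤ C₁ * (D * (A ^ (1 + ε₁) * (μ ^ (4 / 3 : ℝ)) ^ (1 + ε₁)) *
            (N : ℝ) ^ (5 * (B : ℝ)⁻¹ - 2)) * μ ^ 2 := by gcongr
        _ = _ := by field_simp
    refine (le_of_rpow_le_mul_rpow hα0 (by positivity) (by positivity) hθ0 hfin).trans ?_
    exact mul_le_mul_of_nonneg_right (le_max_left _ _) (by positivity)
  · have hcheb := dens_mul_rpow_le u (fun a => norm_nonneg _) hl.le (by norm_num : (0 : ℝ) ≤ 10 / 3)
    have hd := hdec (m + 2) L (by rw [hL, mul_assoc]; exact Dvd.intro _ rfl) s (fun ξ hξ i => by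
      have := hs ξ hξ i
      have h2 : (0 : ℤ) < 2 ^ m := by positivity
      rw [pow_add]
      linarith) c g
    have he : havg (grid 4 L) (sqForm.Fp s id c) g =
        (Fintype.card (Fin 4 → ZMod L) : ℝ)⁻¹ * ∑ a, u a ^ (10 / 3 : ℝ) := by
      rw [havg, div_eq_inv_mul]
      rfl
    rw [← he] at hcheb
    have h1 := hcheb.trans hd
    have h2 : (2 : ℝ) ^ (ε₂ * (m + 2 : ℕ)) = 4 ^ ε₂ * (N : ℝ) ^ ε₂ := by
      rw [← Real.mul_rpow (by norm_num) hN0.le, mul_comm ε₂, Real.rpow_mul (by norm_num),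
        Real.rpow_natCast, pow_add, hNcast]
      norm_num [mul_comm]
    have h3 : (N : ℝ) ^ ε₂ ≤ (A ^ 4) ^ ε₂ * μ ^ (q - 10 / 3) := by
      have h4 : (N : ℝ) ≤ A ^ 4 * (μ ^ (4 / 3 : ℝ)) ^ 4 := by
        rw [← mul_pow]
        calc (N : ℝ) ≤ (R : ℝ) ^ 4 := by exact_mod_cast hcase.le
          _ ≤ _ := by gcongr
      calc _ ≤ (A ^ 4 * (μ ^ (4 / 3 : ℝ)) ^ 4) ^ ε₂ := by gcongr
        _ = _ := by
          rw [Real.mul_rpow (by positivity) (by positivity), ← Real.rpow_natCast (μ ^ (4 / 3 : ℝ)),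
            ← Real.rpow_mul hμ0, ← Real.rpow_mul hμ0]
          congr 2
          rw [hε₂]
          push_cast
          ring
    have hl103 : T ^ (5 / 3 : ℝ) / l ^ (10 / 3 : ℝ) = (N : ℝ) ^ (-5 : ℝ) * μ ^ (10 / 3 : ℝ) := by
      have e : μ ^ (10 / 3 : ℝ) = (N : ℝ) ^ (5 : ℝ) * T ^ (5 / 3 : ℝ) / l ^ (10 / 3 : ℝ) := by
        rw [hμ, Real.div_rpow (by positivity) hl.le, Real.mul_rpow (by positivity) (by positivity),
          ← Real.rpow_mul hN0.le, Real.sqrt_eq_rpow, ← Real.rpow_mul hT0]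
        norm_num
      rw [e, ← mul_div_assoc, ← mul_assoc, ← Real.rpow_add hN0]
      norm_num
    have hlp : 0 < l ^ (10 / 3 : ℝ) := by positivity
    rw [← le_div_iff₀ hlp] at h1
    calc dens u l ≤ _ := h1
      _ = C₂ * (4 ^ ε₂ * (N : ℝ) ^ ε₂) * (T ^ (5 / 3 : ℝ) / l ^ (10 / 3 : ℝ)) := by
          rw [h2, mul_div_assoc]
      _ ≤ C₂ * (4 ^ ε₂ * ((A ^ 4) ^ ε₂ * μ ^ (q - 10 / 3))) *
          (T ^ (5 / 3 : ℝ) / l ^ (10 / 3 : ℝ)) := by gcongr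
      _ = K₂ * ((N : ℝ) ^ (-5 : ℝ) * (μ ^ (q - 10 / 3) * μ ^ (10 / 3 : ℝ))) := by
          rw [hl103, hK₂]
          ring
      _ = K₂ * ((N : ℝ) ^ (-5 : ℝ) * μ ^ q) := by
          rw [← Real.rpow_add hμpos]
          norm_num
      _ ≤ _ := mul_le_mul_of_nonneg_right (le_max_right _ _) (by positivity)

/-- Dyadic layers. -/
lemma rpow_le_sum_layers {v Λ q : ℝ} (hv : 0 ≤ v) (hvΛ : v ≤ Λ) (hq : 0 < q) (J : ℕ) :
    v ^ q ≤ (∑ j ∈ Finset.range J, (Λ * (1 / 2) ^ j) ^ q *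
      if Λ * (1 / 2) ^ (j + 1) < v then 1 else 0) + (Λ * (1 / 2) ^ J) ^ q := by
  have hΛ : 0 ≤ Λ := hv.trans hvΛ
  have hterm : ∀ j : ℕ, 0 ≤ (Λ * (1 / 2) ^ j) ^ q *
      (if Λ * (1 / 2) ^ (j + 1) < v then 1 else 0 : ℝ) := fun j => by split_ifs <;> positivity
  have hs : ∀ J : ℕ, 0 ≤ ∑ j ∈ Finset.range J, (Λ * (1 / 2) ^ j) ^ q *
      (if Λ * (1 / 2) ^ (j + 1) < v then 1 else 0 : ℝ) :=
    fun J => Finset.sum_nonneg fun j _ => hterm j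
  have key : v ≤ Λ * (1 / 2) ^ J ∨ v ^ q ≤ ∑ j ∈ Finset.range J, (Λ * (1 / 2) ^ j) ^ q *
      if Λ * (1 / 2) ^ (j + 1) < v then 1 else 0 := by
    induction J with
    | zero => left; simpa using hvΛ
    | succ J ih =>
      rw [Finset.sum_range_succ]
      rcases ih with h | h
      · by_cases h2 : Λ * (1 / 2) ^ (J + 1) < v
        · right
          rw [if_pos h2, mul_one]
          have := Real.rpow_le_rpow hv h hq.le
          linarith [hs J]
        · left
          exact not_lt.1 h2
      · right
        linarith [hterm J]
  rcases key with h | h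
  · have := Real.rpow_le_rpow hv h hq.le
    linarith [hs J]
  · have : 0 ≤ (Λ * (1 / 2) ^ J) ^ q := by positivity
    linarith

/-- Scale-invariant estimate on a fine grid. -/
theorem exists_havg_rpow_le {q : ℝ} (hq : 10 / 3 < q) : ∃ C : ℝ, 0 < C ∧ ∀ m : ℕ, ∃ (L : ℕ)
    (_ : NeZero L), ∀ s : Finset (Fin 3 → ℤ), (∀ ξ ∈ s, ∀ i, |ξ i| ≤ 2 ^ m) →
    ∀ (c : (Fin 3 → ℤ) → ℂ) (g : Tor 4),
      havg (grid 4 L) (fun x => ‖sqForm.F s id c x‖ ^ q) g ≤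
        C * (((2 : ℝ) ^ m) ^ (-5 : ℝ) *
          (((2 : ℝ) ^ m) ^ (3 / 2 : ℝ) * √(∑ ξ ∈ s, ‖c ξ‖ ^ 2)) ^ q) := by
  set r := (q + 10 / 3) / 2 with hr
  have hr1 : 10 / 3 < r := by rw [hr]; linarith
  have hrq : r < q := by rw [hr]; linarith
  obtain ⟨C, hC, h⟩ := exists_dens_le hr1
  set ρ : ℝ := (1 / 2) ^ (q - r) with hρ
  have hρ0 : 0 < ρ := by positivity
  have hρ1 : ρ < 1 := Real.rpow_lt_one (by norm_num) (by norm_num) (by linarith)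
  have hρ2 : 0 < 1 - ρ := by linarith
  refine ⟨C * 6 ^ q * (1 - ρ)⁻¹, by positivity, fun m => ?_⟩
  obtain ⟨L, hL, hd⟩ := h m
  refine ⟨L, hL, fun s hs c g => ?_⟩
  set N : ℝ := (2 : ℝ) ^ m with hN
  have hN0 : 0 < N := by positivity
  set Y := N ^ (3 / 2 : ℝ) * √(∑ ξ ∈ s, ‖c ξ‖ ^ 2) with hY
  have hY0 : 0 ≤ Y := by positivity
  have hub : ∀ x, ‖sqForm.F s id c x‖ ≤ 6 * Y := fun x => by
    have := norm_F_le (N := 2 ^ m) s (by positivity) (by exact_mod_cast hs) c x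
    push_cast at this
    exact this
  rcases hY0.eq_or_lt with h0 | hYpos
  · have hz : ∀ x, ‖sqForm.F s id c x‖ ^ q = 0 := fun x => by
      have := hub x
      rw [← h0, mul_zero] at this
      rw [le_antisymm this (norm_nonneg _), Real.zero_rpow (by linarith)]
    rw [havg]
    simp only [hz]
    rw [Finset.sum_const_zero, zero_div]
    positivity
  have hfin : ∀ J : ℕ, havg (grid 4 L) (fun x => ‖sqForm.F s id c x‖ ^ q) g ≤
      C * 6 ^ q * (1 - ρ)⁻¹ * (N ^ (-5 : ℝ) * Y ^ q) + (6 * Y) ^ q * ((1 / 2 : ℝ) ^ q) ^ J := by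
    intro J
    have h1 : havg (grid 4 L) (fun x => ‖sqForm.F s id c x‖ ^ q) g ≤
        (∑ j ∈ Finset.range J, (6 * Y * (1 / 2) ^ j) ^ q *
          dens (fun a => ‖sqForm.F s id c (g + grid 4 L a)‖) (6 * Y * (1 / 2) ^ (j + 1))) +
            (6 * Y * (1 / 2) ^ J) ^ q := by
      refine (havg_mono (grid 4 L) (fun x => rpow_le_sum_layers (norm_nonneg _) (hub x)
        (by linarith) J) g).trans_eq ?_
      rw [havg_add, havg_sum, havg_of_inv (f := fun _ => (6 * Y * (1 / 2) ^ J) ^ q) _ fun _ => rfl]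
      congr 1
      refine Finset.sum_congr rfl fun j _ => ?_
      rw [havg_const_mul]
      congr 1
      rw [havg, dens, Finset.sum_boole, div_eq_inv_mul]
    refine h1.trans (add_le_add ?_ (le_of_eq ?_))
    · have h2 : ∀ j ∈ Finset.range J, (6 * Y * (1 / 2) ^ j) ^ q *
          dens (fun a => ‖sqForm.F s id c (g + grid 4 L a)‖) (6 * Y * (1 / 2) ^ (j + 1)) ≤
          C * 6 ^ q * (N ^ (-5 : ℝ) * Y ^ q) * ρ ^ j := by
        intro j _
        have h3 := hd s hs c g (6 * Y * (1 / 2) ^ (j + 1)) (by positivity)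
        rw [← hY] at h3
        have h4 : (Y / (6 * Y * (1 / 2) ^ (j + 1))) ^ r ≤ ((1 / 2 : ℝ) ^ (-r)) ^ j := by
          have e : Y / (6 * Y * (1 / 2) ^ (j + 1)) = 1 / 3 * ((1 / 2 : ℝ) ^ j)⁻¹ := by
            rw [pow_succ]
            field_simp
            norm_num
          have e2 : ((1 / 2 : ℝ) ^ (-r)) ^ j = (((1 / 2 : ℝ) ^ j)⁻¹) ^ r := by
            rw [← Real.rpow_natCast, ← Real.rpow_mul (by norm_num), ← Real.rpow_natCast,
              ← Real.rpow_neg (by norm_num), ← Real.rpow_mul (by norm_num)]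
            congr 1
            ring
          rw [e, e2]
          refine Real.rpow_le_rpow (by positivity) ?_ (by linarith)
          have : 0 < ((1 / 2 : ℝ) ^ j)⁻¹ := by positivity
          linarith
        have e3 : (6 * Y * (1 / 2) ^ j) ^ q = 6 ^ q * Y ^ q * ((1 / 2 : ℝ) ^ q) ^ j := by
          rw [Real.mul_rpow (by positivity) (by positivity), Real.mul_rpow (by norm_num) hY0,
            ← Real.rpow_natCast, ← Real.rpow_natCast, ← Real.rpow_mul (by norm_num),
            ← Real.rpow_mul (by norm_num), mul_comm (j : ℝ)]
        have e4 : ρ ^ j = ((1 / 2 : ℝ) ^ q) ^ j * ((1 / 2 : ℝ) ^ (-r)) ^ j := by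
          rw [← mul_pow, ← Real.rpow_add (by norm_num), hρ, sub_eq_add_neg]
        rw [e3, e4]
        calc _ ≤ 6 ^ q * Y ^ q * ((1 / 2 : ℝ) ^ q) ^ j *
              (C * (N ^ (-5 : ℝ) * ((1 / 2 : ℝ) ^ (-r)) ^ j)) := by
              refine mul_le_mul_of_nonneg_left (h3.trans ?_) (by positivity)
              gcongr
          _ = _ := by ring
      refine (Finset.sum_le_sum h2).trans ?_
      rw [← Finset.mul_sum]
      have h5 : ∑ j ∈ Finset.range J, ρ ^ j ≤ (1 - ρ)⁻¹ := by
        rw [← tsum_geometric_of_lt_one hρ0.le hρ1]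
        exact (summable_geometric_of_lt_one hρ0.le hρ1).sum_le_tsum _ fun j _ => by positivity
      calc _ ≤ C * 6 ^ q * (N ^ (-5 : ℝ) * Y ^ q) * (1 - ρ)⁻¹ := by gcongr
        _ = _ := by ring
    · rw [Real.mul_rpow (by positivity) (by positivity), ← Real.rpow_natCast (1 / 2 : ℝ),
        ← Real.rpow_mul (by norm_num), mul_comm (J : ℝ), Real.rpow_mul (by norm_num),
        Real.rpow_natCast]
  have hlim : Filter.Tendsto (fun J : ℕ => C * 6 ^ q * (1 - ρ)⁻¹ * (N ^ (-5 : ℝ) * Y ^ q) +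
      (6 * Y) ^ q * ((1 / 2 : ℝ) ^ q) ^ J) Filter.atTop
      (nhds (C * 6 ^ q * (1 - ρ)⁻¹ * (N ^ (-5 : ℝ) * Y ^ q) + (6 * Y) ^ q * 0)) := by
    refine tendsto_const_nhds.add (tendsto_const_nhds.mul ?_)
    exact tendsto_pow_atTop_nhds_zero_of_lt_one (by positivity)
      (Real.rpow_lt_one (by norm_num) (by norm_num) (by linarith))
  rw [mul_zero, add_zero] at hlim
  exact ge_of_tendsto' hlim hfin

lemma continuous_chr {n : ℕ} (v : Fin n → ℤ) : Continuous (chr v) := by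
  unfold chr pair
  have h : Continuous fun g : Tor n => ∑ j, v j • g j :=
    continuous_finsetSum _ fun j _ => (continuous_apply j).zsmul _
  exact continuous_subtype_val.comp (AddCircle.continuous_toCircle.comp h)

lemma continuous_F (s : Finset (Fin 3 → ℤ)) (c : (Fin 3 → ℤ) → ℂ) :
    Continuous (sqForm.F s id c) :=
  continuous_finsetSum _ fun _ _ => continuous_const.mul (continuous_chr _)

/-- Averaging over a finite subgroup does not change the integral. -/
lemma integral_havg {A : Type*} [AddCommGroup A] [Fintype A] {n : ℕ} (φ : A →+ Tor n)
    {f : Tor n → ℝ} (hf : Continuous f) : ∫ g, havg φ f g = ∫ g, f g := by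
  unfold havg
  have hint : ∀ a, Integrable (fun g => f (g + φ a)) volume := fun a =>
    (hf.comp (continuous_add_const _)).integrable_of_hasCompactSupport
      (HasCompactSupport.of_compactSpace _)
  rw [integral_div, integral_finsetSum _ fun a _ => hint a]
  simp only [integral_add_right_eq_self f]
  rw [Finset.sum_const, nsmul_eq_mul, Finset.card_univ, mul_div_assoc, mul_comm,
    div_mul_cancel₀ _ (card_pos_real A).ne']

/-- Scale-invariant Strichartz estimate on the torus. -/
theorem exists_integral_rpow_le {q : ℝ} (hq : 10 / 3 < q) : ∃ C : ℝ, 0 < C ∧ ∀ m : ℕ,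
    ∀ s : Finset (Fin 3 → ℤ), (∀ ξ ∈ s, ∀ i, |ξ i| ≤ 2 ^ m) →
    ∀ c : (Fin 3 → ℤ) → ℂ, ∫ g, ‖sqForm.F s id c g‖ ^ q ≤
        C * (((2 : ℝ) ^ m) ^ (-5 : ℝ) *
          (((2 : ℝ) ^ m) ^ (3 / 2 : ℝ) * √(∑ ξ ∈ s, ‖c ξ‖ ^ 2)) ^ q) := by
  obtain ⟨C, hC, h⟩ := exists_havg_rpow_le hq
  refine ⟨C, hC, fun m s hs c => ?_⟩
  obtain ⟨L, hL, hd⟩ := h m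
  have hcont : Continuous fun g => ‖sqForm.F s id c g‖ ^ q :=
    (continuous_F s c).norm.rpow_const fun _ => Or.inr (by linarith)
  rw [← integral_havg (grid 4 L) hcont]
  have hcont2 : Continuous (havg (grid 4 L) fun g => ‖sqForm.F s id c g‖ ^ q) := by
    unfold havg
    exact (continuous_finsetSum _ fun a _ => hcont.comp (continuous_add_const _)).div_const _
  refine (integral_mono (hcont2.integrable_of_hasCompactSupport
    (HasCompactSupport.of_compactSpace _)) (integrable_const _) (hd s hs c)).trans_eq ?_
  have hvol : (volume : Measure (Tor 4)).real Set.univ = 1 := by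
    simp [Measure.real, volume_pi, Measure.pi_univ]
  rw [integral_const, hvol, one_smul]

/-- The covering map of the circle of length one by the line, with period `2π`. -/
def wrap (t : ℝ) : UnitAddCircle := ((t * (2 * Real.pi)⁻¹ : ℝ) : UnitAddCircle)

lemma continuous_wrap : Continuous wrap :=
  (AddCircle.continuous_mk' 1).comp (continuous_id.mul continuous_const)

lemma measurePreserving_wrap :
    MeasurePreserving wrap (volume.restrict (Set.Ioc (-Real.pi) Real.pi))
      (ENNReal.ofReal (2 * Real.pi) • volume) := by
  refine ⟨continuous_wrap.measurable, ?_⟩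
  have hpi := Real.pi_pos
  have hc : (2 * Real.pi)⁻¹ ≠ 0 := by positivity
  have hpre : Set.Ioc (-Real.pi) Real.pi =
      (fun t : ℝ => t * (2 * Real.pi)⁻¹) ⁻¹' Set.Ioc (-(1 / 2)) (-(1 / 2) + 1) := by
    ext t
    simp only [Set.mem_Ioc, Set.mem_preimage, ← div_eq_mul_inv]
    rw [lt_div_iff₀ (by positivity), div_le_iff₀ (by positivity)]
    constructor <;> rintro ⟨h1, h2⟩ <;> constructor <;> linarith
  have hm : Measurable fun t : ℝ => t * (2 * Real.pi)⁻¹ := by fun_prop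
  have hw : wrap = ((↑) : ℝ → UnitAddCircle) ∘ fun t : ℝ => t * (2 * Real.pi)⁻¹ := rfl
  rw [hw, ← Measure.map_map AddCircle.measurable_mk' hm, hpre,
    ← Measure.restrict_map hm measurableSet_Ioc, Real.map_volume_mul_right hc,
    Measure.restrict_smul, Measure.map_smul, inv_inv, abs_of_pos (by positivity)]
  congr 1
  exact (AddCircle.measurePreserving_mk 1 (-(1 / 2))).map_eq

lemma restrict_cube3 : (volume : Measure (Fin 3 → ℝ)).restrict cube3 =
    Measure.pi fun _ => volume.restrict (Set.Ioc (-Real.pi) Real.pi) := by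
  rw [cube3, volume_pi, Measure.restrict_pi_pi]
  congr 1
  ext1 i
  exact (Measure.restrict_congr_set Ioc_ae_eq_Icc).symm

lemma pi_smul_volume (k : ENNReal) (hk : k ≠ ⊤) :
    Measure.pi (fun _ : Fin 3 => k • (volume : Measure UnitAddCircle)) =
      k ^ 3 • (volume : Measure (Tor 3)) := by
  have : IsFiniteMeasure (k • (volume : Measure UnitAddCircle)) :=
    Measure.smul_finite _ hk
  refine Measure.pi_eq fun s _ => ?_
  simp [volume_pi, Measure.pi_pi, Finset.prod_mul_distrib]

/-- The point of the four-dimensional torus attached to a time and a position. -/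
def wrapPoint (z : ℝ × (Fin 3 → ℝ)) : Tor 4 := Fin.cons (-wrap z.1) fun i => wrap (z.2 i)

lemma measurePreserving_wrapPoint :
    MeasurePreserving wrapPoint
      ((volume.restrict (Set.Ioc (-Real.pi) Real.pi)).prod (volume.restrict cube3))
      (ENNReal.ofReal (2 * Real.pi) ^ 4 • volume) := by
  set k := ENNReal.ofReal (2 * Real.pi) with hk
  have hkt : k ≠ ⊤ := ENNReal.ofReal_ne_top
  have hfin : IsFiniteMeasure (k • (volume : Measure UnitAddCircle)) :=
    Measure.smul_finite _ hkt
  have h1 : MeasurePreserving (fun t => -wrap t)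
      (volume.restrict (Set.Ioc (-Real.pi) Real.pi)) (k • volume) :=
    ((Measure.measurePreserving_neg (volume : Measure UnitAddCircle)).smul_measure k).comp
      measurePreserving_wrap
  have h2 := measurePreserving_pi (fun _ : Fin 3 => volume.restrict (Set.Ioc (-Real.pi) Real.pi))
    (fun _ => k • (volume : Measure UnitAddCircle)) fun _ => measurePreserving_wrap
  rw [pi_smul_volume k hkt, ← restrict_cube3] at h2
  have h3 := h1.prod h2
  have h4 := ((volume_preserving_piFinSuccAbove (fun _ : Fin 4 => UnitAddCircle) 0).symm).smul_measure
    (k ^ 4)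
  have h5 : (k • (volume : Measure UnitAddCircle)).prod (k ^ 3 • (volume : Measure (Tor 3))) =
      k ^ 4 • volume := by
    rw [Measure.prod_smul_left, Measure.prod_smul_right, smul_smul, ← pow_succ']
    rfl
  rw [h5] at h3
  have h6 : wrapPoint = (MeasurableEquiv.piFinSuccAbove (fun _ : Fin 4 => UnitAddCircle) 0).symm ∘
      Prod.map (fun t => -wrap t) fun x i => wrap (x i) := by
    funext z
    exact (Fin.insertNth_zero' (β := UnitAddCircle) _ _).symm
  rw [h6]
  exact h4.comp h3

/-- A space-time integral over a unit time interval, dominated by the pull-back of a function on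
the torus, is bounded by the integral over the torus. -/
lemma setIntegral_le_of_le_wrapPoint {f : Tor 4 → ℝ} (hf : Continuous f) (hf0 : ∀ g, 0 ≤ f g)
    {α β : ℝ} (hα : 0 ≤ α) (hβ : β ≤ 1) {u : ℝ → (Fin 3 → ℝ) → ℝ} {k : ℝ} (hk : 0 ≤ k)
    (hu0 : ∀ t x, 0 ≤ u t x)
    (hu : ∀ t ∈ Set.Ioo α β, ∀ x ∈ cube3, u t x ≤ k * f (wrapPoint (t, x))) :
    ∫ t in Set.Ioo α β, ∫ x in cube3, u t x ≤ k * ((2 * Real.pi) ^ 4 * ∫ g, f g) := by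
  have hmp := measurePreserving_wrapPoint
  have hint : Integrable f ((ENNReal.ofReal (2 * Real.pi) ^ 4) • (volume : Measure (Tor 4))) :=
    (hf.integrable_of_hasCompactSupport (HasCompactSupport.of_compactSpace _)).smul_measure
      (ENNReal.pow_ne_top ENNReal.ofReal_ne_top)
  have hint2 := hmp.integrable_comp_of_integrable hint
  have hsub : Set.Ioo α β ⊆ Set.Ioc (-Real.pi) Real.pi := fun t ht => by
    have := Real.pi_gt_three
    exact ⟨by linarith [ht.1], by linarith [ht.2]⟩
  have hcube : MeasurableSet cube3 := MeasurableSet.univ_pi fun _ => measurableSet_Icc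
  calc ∫ t in Set.Ioo α β, ∫ x in cube3, u t x
      ≤ ∫ t in Set.Ioo α β, k * ∫ x in cube3, f (wrapPoint (t, x)) := by
        refine integral_mono_of_nonneg
          (Filter.Eventually.of_forall fun t => integral_nonneg fun x => hu0 t x)
          ((hint2.integral_prod_left.mono_measure (Measure.restrict_mono hsub le_rfl)).const_mul k)
          ?_
        filter_upwards [ae_mono (Measure.restrict_mono hsub le_rfl) hint2.prod_right_ae,
          ae_restrict_mem measurableSet_Ioo] with t ht htm
        rw [← integral_const_mul]
        refine integral_mono_of_nonneg (Filter.Eventually.of_forall fun x => hu0 t x)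
          (ht.const_mul k) ?_
        filter_upwards [ae_restrict_mem hcube] with x hx using hu t htm x hx
    _ = k * ∫ t in Set.Ioo α β, ∫ x in cube3, f (wrapPoint (t, x)) := integral_const_mul _ _
    _ ≤ k * ∫ t in Set.Ioc (-Real.pi) Real.pi, ∫ x in cube3, f (wrapPoint (t, x)) := by
        refine mul_le_mul_of_nonneg_left ?_ hk
        exact setIntegral_mono_set hint2.integral_prod_left
          (Filter.Eventually.of_forall fun t => integral_nonneg fun x => hf0 _)
          (LE.le.eventuallyLE hsub)
    _ = k * ∫ z, f (wrapPoint z) ∂((volume.restrict (Set.Ioc (-Real.pi) Real.pi)).prod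
          (volume.restrict cube3)) :=
        congrArg (k * ·) (integral_prod _ hint2).symm
    _ = k * ∫ g, f g ∂(ENNReal.ofReal (2 * Real.pi) ^ 4 • volume) := by
        rw [← hmp.map_eq, integral_map hmp.aemeasurable]
        exact hf.aestronglyMeasurable
    _ = _ := by
        rw [integral_smul_measure, smul_eq_mul, ENNReal.toReal_pow,
          ENNReal.toReal_ofReal (by positivity)]

/-- The frequencies in the dyadic annulus of radius `2 ^ m`. -/
def shell (m : ℕ) : Finset (Fin 3 → ℤ) := by
  classical
  exact (Fintype.piFinset fun _ => Finset.Icc (-(2 ^ (m + 1) : ℤ)) (2 ^ (m + 1))).filter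
    fun ξ => (2 : ℝ) ^ m ≤ znrm ξ ∧ znrm ξ < 2 * 2 ^ m

lemma znrm_sq (ξ : Fin 3 → ℤ) : znrm ξ ^ 2 = ∑ i, (ξ i : ℝ) ^ 2 :=
  Real.sq_sqrt (Finset.sum_nonneg fun _ _ => sq_nonneg _)

lemma abs_le_znrm (ξ : Fin 3 → ℤ) (i : Fin 3) : |(ξ i : ℝ)| ≤ znrm ξ := by
  rw [znrm, ← Real.sqrt_sq_eq_abs]
  exact Real.sqrt_le_sqrt
    (Finset.single_le_sum (f := fun i => (ξ i : ℝ) ^ 2) (fun _ _ => sq_nonneg _) (Finset.mem_univ i))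

lemma abs_le_of_znrm_lt {m : ℕ} {ξ : Fin 3 → ℤ} (h : znrm ξ < 2 * 2 ^ m) (i : Fin 3) :
    |ξ i| ≤ 2 ^ (m + 1) := by
  have h1 := (abs_le_znrm ξ i).trans h.le
  rw [← pow_succ'] at h1
  exact_mod_cast h1

lemma mem_shell {m : ℕ} {ξ : Fin 3 → ℤ} :
    ξ ∈ shell m ↔ (2 : ℝ) ^ m ≤ znrm ξ ∧ znrm ξ < 2 * 2 ^ m := by
  classical
  simp only [shell, Finset.mem_filter, Fintype.mem_piFinset, Finset.mem_Icc, and_iff_right_iff_imp]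
  exact fun h i => abs_le.1 (abs_le_of_znrm_lt h.2 i)

lemma shell_disjoint {m n : ℕ} (h : m ≠ n) : Disjoint (shell m) (shell n) := by
  wlog hmn : m < n generalizing m n
  · exact (this h.symm (by omega)).symm
  refine Finset.disjoint_left.2 fun ξ h1 h2 => ?_
  have h3 := (mem_shell.1 h1).2
  have h4 := (mem_shell.1 h2).1
  have h5 : (2 : ℝ) ^ (m + 1) ≤ 2 ^ n := pow_le_pow_right₀ one_le_two hmn
  rw [pow_succ'] at h5
  linarith

lemma toCircle_zsmul_wrap (n : ℤ) (t : ℝ) :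
    (AddCircle.toCircle (n • wrap t) : ℂ) = Complex.exp (Complex.I * ((t * n : ℝ) : ℂ)) := by
  have h : n • wrap t = (((n : ℝ) * (t * (2 * Real.pi)⁻¹) : ℝ) : UnitAddCircle) := by
    rw [wrap, ← AddCircle.coe_zsmul, zsmul_eq_mul]
  rw [h, AddCircle.toCircle_apply_mk, Circle.coe_exp]
  congr 1
  rw [mul_comm]
  congr 2
  have := Real.pi_ne_zero
  field_simp

lemma chr_wrapPoint (ξ : Fin 3 → ℤ) (t : ℝ) (x : Fin 3 → ℝ) :
    chr (sqForm.pt ξ) (wrapPoint (t, x)) =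
      Complex.exp (-(Complex.I) * ((t * (znrm ξ) ^ 2 : ℝ) : ℂ)) *
        Complex.exp (Complex.I * (((∑ i, x i * (ξ i : ℝ)) : ℝ) : ℂ)) := by
  have hQ : ((sqForm.Q ξ : ℤ) : ℝ) = znrm ξ ^ 2 := by
    rw [znrm_sq]; simp [sqForm]
  have h0 : pair (sqForm.pt ξ) (wrapPoint (t, x)) =
      (-sqForm.Q ξ) • wrap t + ∑ i, ξ i • wrap (x i) := by
    rw [pair, Fin.sum_univ_succ]
    simp [AnisoForm.pt, wrapPoint]
  rw [chr, h0, AddCircle.toCircle_add, Circle.coe_mul, toCircle_zsmul_wrap]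
  congr 1
  · push_cast [← hQ]
    congr 1
    ring
  · rw [Fin.sum_univ_three, AddCircle.toCircle_add, AddCircle.toCircle_add, Circle.coe_mul,
      Circle.coe_mul, toCircle_zsmul_wrap, toCircle_zsmul_wrap, toCircle_zsmul_wrap,
      ← Complex.exp_add, ← Complex.exp_add, Fin.sum_univ_three]
    push_cast
    congr 1
    ring

lemma PKlin_eq (c : (Fin 3 → ℤ) → ℂ) (m : ℕ) (t : ℝ) (x : Fin 3 → ℝ) :
    PKlin c ((2 : ℝ) ^ m) t x = sqForm.F (shell m) id c (wrapPoint (t, x)) := by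
  rw [PKlin, tsum_eq_sum (s := shell m), AnisoForm.F]
  · refine Finset.sum_congr rfl fun ξ hξ => ?_
    rw [if_pos (mem_shell.1 hξ), id, chr_wrapPoint]
    ring
  · intro ξ hξ
    rw [if_neg (mt mem_shell.2 hξ)]
    simp

section Weights

variable {c : (Fin 3 → ℤ) → ℂ}

/-- The contribution of a dyadic annulus to the square of the `H^{1/2}` norm. -/
def shellEnergy (c : (Fin 3 → ℤ) → ℂ) (m : ℕ) : ℝ :=
  ∑ ξ ∈ shell m, Real.sqrt (1 + (znrm ξ) ^ 2) * ‖c ξ‖ ^ 2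

lemma shellEnergy_nonneg (m : ℕ) : 0 ≤ shellEnergy c m :=
  Finset.sum_nonneg fun _ _ => by positivity

lemma pow_mul_sum_le_shellEnergy (m : ℕ) :
    (2 : ℝ) ^ m * ∑ ξ ∈ shell m, ‖c ξ‖ ^ 2 ≤ shellEnergy c m := by
  rw [Finset.mul_sum]
  refine Finset.sum_le_sum fun ξ hξ => mul_le_mul_of_nonneg_right ?_ (by positivity)
  refine (mem_shell.1 hξ).1.trans (Real.le_sqrt_of_sq_le ?_)
  linarith

lemma sum_shellEnergy_le
    (hc : Summable fun ξ : Fin 3 → ℤ => Real.sqrt (1 + (znrm ξ) ^ 2) * ‖c ξ‖ ^ 2)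
    (A : Finset ℕ) : ∑ m ∈ A, shellEnergy c m ≤ H12norm c ^ 2 := by
  classical
  rw [H12norm, Real.sq_sqrt (tsum_nonneg fun _ => by positivity)]
  simp only [shellEnergy]
  rw [← Finset.sum_biUnion fun m _ n _ h => shell_disjoint h]
  exact hc.sum_le_tsum _ fun _ _ => by positivity

lemma H12norm_nonneg : 0 ≤ H12norm c := Real.sqrt_nonneg _

end Weights

section BoundedSup

variable {α : Type*} {s : Set α} {f : α → ℝ} {B : ℝ}

lemma biSup_le_of_forall_le (hB : 0 ≤ B) (h : ∀ x ∈ s, f x ≤ B) : ⨆ x ∈ s, f x ≤ B :=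
  Real.iSup_le (fun x => Real.iSup_le (fun hx => h x hx) hB) hB

lemma le_biSup_of_forall_le (hB : 0 ≤ B) (h : ∀ x ∈ s, f x ≤ B) {x : α} (hx : x ∈ s) :
    f x ≤ ⨆ x ∈ s, f x := by
  have hbdd : BddAbove (Set.range fun x => ⨆ _ : x ∈ s, f x) :=
    ⟨B, by rintro _ ⟨y, rfl⟩; exact Real.iSup_le (fun hy => h y hy) hB⟩
  refine le_trans ?_ (le_ciSup hbdd x)
  rw [ciSup_pos hx]

end BoundedSup

variable {c : (Fin 3 → ℤ) → ℂ}

lemma shellEnergy_le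
    (hc : Summable fun ξ : Fin 3 → ℤ => Real.sqrt (1 + (znrm ξ) ^ 2) * ‖c ξ‖ ^ 2) (m : ℕ) :
    shellEnergy c m ≤ H12norm c ^ 2 := by
  simpa using sum_shellEnergy_le hc {m}

/-- Bernstein's inequality for a Littlewood–Paley piece. -/
lemma norm_PKlin_le
    (hc : Summable fun ξ : Fin 3 → ℤ => Real.sqrt (1 + (znrm ξ) ^ 2) * ‖c ξ‖ ^ 2)
    (m : ℕ) (t : ℝ) (x : Fin 3 → ℝ) :
    ‖PKlin c ((2 : ℝ) ^ m) t x‖ ≤ (2 : ℝ) ^ m * (6 * 2 ^ (3 / 2 : ℝ) * H12norm c) := by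
  rw [PKlin_eq]
  have h := norm_F_le (N := 2 ^ (m + 1)) (shell m) (by positivity)
    (fun ξ hξ i => by exact_mod_cast abs_le_of_znrm_lt (mem_shell.1 hξ).2 i) c (wrapPoint (t, x))
  refine h.trans ?_
  set T := ∑ ξ ∈ shell m, ‖c ξ‖ ^ 2 with hT
  have h1 : √((2 : ℝ) ^ m * T) ≤ H12norm c := by
    rw [← Real.sqrt_sq (H12norm_nonneg (c := c))]
    exact Real.sqrt_le_sqrt ((pow_mul_sum_le_shellEnergy m).trans (shellEnergy_le hc m))
  rw [Real.sqrt_mul (by positivity)] at h1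
  have h2 : (((2 ^ (m + 1) : ℕ) : ℝ)) ^ (3 / 2 : ℝ) =
      2 ^ (3 / 2 : ℝ) * ((2 : ℝ) ^ m * √((2 : ℝ) ^ m)) := by
    have h3 : (0 : ℝ) < 2 ^ m := by positivity
    push_cast
    rw [pow_succ', Real.mul_rpow (by norm_num) h3.le, Real.sqrt_eq_rpow,
      show (3 / 2 : ℝ) = 1 + 1 / 2 by norm_num, Real.rpow_add h3, Real.rpow_one]
  rw [h2]
  calc 6 * (2 ^ (3 / 2 : ℝ) * ((2 : ℝ) ^ m * √((2 : ℝ) ^ m)) * √T)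
      = (2 : ℝ) ^ m * (6 * 2 ^ (3 / 2 : ℝ) * (√((2 : ℝ) ^ m) * √T)) := by ring
    _ ≤ _ := by gcongr

/-- The scale-invariant supremum of the Littlewood–Paley pieces over a time interval. -/
def scaledSup (c : (Fin 3 → ℤ) → ℂ) (a₀ b₀ : ℝ) : ℝ :=
  ⨆ m : ℕ, ((2 : ℝ) ^ m)⁻¹ *
    ⨆ t ∈ Set.Icc a₀ b₀, ⨆ x ∈ cube3, ‖PKlin c ((2 : ℝ) ^ m) t x‖

lemma scaledSup_nonneg (a₀ b₀ : ℝ) : 0 ≤ scaledSup c a₀ b₀ :=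
  Real.iSup_nonneg fun _ => mul_nonneg (by positivity) <| Real.iSup_nonneg fun _ =>
    Real.iSup_nonneg fun _ => Real.iSup_nonneg fun _ => Real.iSup_nonneg fun _ => norm_nonneg _

lemma norm_PKlin_le_scaledSup
    (hc : Summable fun ξ : Fin 3 → ℤ => Real.sqrt (1 + (znrm ξ) ^ 2) * ‖c ξ‖ ^ 2)
    {a₀ b₀ t : ℝ} {x : Fin 3 → ℝ} (m : ℕ) (ht : t ∈ Set.Icc a₀ b₀) (hx : x ∈ cube3) :
    ‖PKlin c ((2 : ℝ) ^ m) t x‖ ≤ (2 : ℝ) ^ m * scaledSup c a₀ b₀ := by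
  have hH := H12norm_nonneg (c := c)
  have hB : ∀ m : ℕ, 0 ≤ (2 : ℝ) ^ m * (6 * 2 ^ (3 / 2 : ℝ) * H12norm c) := fun m => by positivity
  have hx1 : ∀ (m : ℕ) (t : ℝ), ⨆ x ∈ cube3, ‖PKlin c ((2 : ℝ) ^ m) t x‖ ≤
      (2 : ℝ) ^ m * (6 * 2 ^ (3 / 2 : ℝ) * H12norm c) := fun m t =>
    biSup_le_of_forall_le (hB m) fun x _ => norm_PKlin_le hc m t x
  have hbdd : BddAbove (Set.range fun m : ℕ => ((2 : ℝ) ^ m)⁻¹ *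
      ⨆ t ∈ Set.Icc a₀ b₀, ⨆ x ∈ cube3, ‖PKlin c ((2 : ℝ) ^ m) t x‖) := by
    refine ⟨6 * 2 ^ (3 / 2 : ℝ) * H12norm c, ?_⟩
    rintro _ ⟨m, rfl⟩
    dsimp only
    rw [inv_mul_le_iff₀ (by positivity)]
    exact biSup_le_of_forall_le (hB m) fun t _ => hx1 m t
  have h1 := le_ciSup hbdd m
  rw [inv_mul_le_iff₀ (by positivity)] at h1
  refine le_trans ?_ h1
  refine le_trans ?_ (le_biSup_of_forall_le (hB m) (fun t _ => hx1 m t) ht)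
  exact le_biSup_of_forall_le (hB m) (fun x _ => norm_PKlin_le hc m t x) hx

/-- Interpolation of one Littlewood–Paley piece between a subcritical Lebesgue norm and the
supremum. -/
lemma exists_weighted_integral_le {p a : ℝ} (ha1 : a < 1) (hp : 0 < p) (hap : 10 / 3 < a * p) :
    ∃ C : ℝ, 0 < C ∧ ∀ c : (Fin 3 → ℤ) → ℂ,
      (Summable fun ξ : Fin 3 → ℤ => Real.sqrt (1 + (znrm ξ) ^ 2) * ‖c ξ‖ ^ 2) →
      ∀ a₀ b₀ α β : ℝ, 0 ≤ a₀ → a₀ ≤ α → β ≤ b₀ → b₀ ≤ 1 → ∀ m : ℕ,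
        ((2 : ℝ) ^ m) ^ (5 - p) * ∫ t in Set.Ioo α β, ∫ x in cube3,
            ‖PKlin c ((2 : ℝ) ^ m) t x‖ ^ p ≤
          C * scaledSup c a₀ b₀ ^ ((1 - a) * p) * shellEnergy c m ^ (a * p / 2) := by
  obtain ⟨C, hC, hS⟩ := exists_integral_rpow_le hap
  have hpi := Real.pi_pos
  refine ⟨(2 * Real.pi) ^ 4 * C * ((2 : ℝ) ^ (-5 : ℝ) * 2 ^ (3 / 2 * (a * p))), by positivity,
    fun c hc a₀ b₀ α β ha₀ hα hβ hb₀ m => ?_⟩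
  have hM := scaledSup_nonneg (c := c) a₀ b₀
  set M := scaledSup c a₀ b₀ with hMdef
  set N : ℝ := 2 ^ m with hN
  have hN0 : 0 < N := by positivity
  set T := ∑ ξ ∈ shell m, ‖c ξ‖ ^ 2 with hT
  have hT0 : 0 ≤ T := Finset.sum_nonneg fun _ _ => by positivity
  have he : 0 ≤ (1 - a) * p := mul_nonneg (by linarith) hp.le
  have hcont : Continuous fun g => ‖sqForm.F (shell m) id c g‖ ^ (a * p) :=
    (continuous_F _ c).norm.rpow_const fun _ => Or.inr (by linarith)
  have h1 := setIntegral_le_of_le_wrapPoint hcont (fun _ => by positivity)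
    (ha₀.trans hα) (hβ.trans hb₀) (u := fun t x => ‖PKlin c N t x‖ ^ p)
    (k := (N * M) ^ ((1 - a) * p)) (by positivity) (fun _ _ => by positivity)
    (fun t ht x hx => by
      have hle := norm_PKlin_le_scaledSup hc m
        (⟨hα.trans ht.1.le, ht.2.le.trans hβ⟩ : t ∈ Set.Icc a₀ b₀) hx
      rw [← PKlin_eq]
      calc ‖PKlin c N t x‖ ^ p = ‖PKlin c N t x‖ ^ ((1 - a) * p) * ‖PKlin c N t x‖ ^ (a * p) := by
            rw [← Real.rpow_add_of_nonneg (norm_nonneg _) he (by linarith)]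
            congr 1
            ring
        _ ≤ _ := by gcongr)
  have h2 := hS (m + 1) (shell m) (fun ξ hξ i => abs_le_of_znrm_lt (mem_shell.1 hξ).2 i) c
  have h3 : (((2 : ℝ) ^ (m + 1)) ^ (-5 : ℝ) *
      (((2 : ℝ) ^ (m + 1)) ^ (3 / 2 : ℝ) * √T) ^ (a * p)) =
      ((2 : ℝ) ^ (-5 : ℝ) * 2 ^ (3 / 2 * (a * p))) *
        (N ^ (-5 : ℝ) * N ^ (3 / 2 * (a * p))) * T ^ (a * p / 2) := by
    rw [pow_succ', ← hN, Real.mul_rpow (by norm_num) hN0.le, Real.mul_rpow (by norm_num) hN0.le,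
      Real.mul_rpow (by positivity) (by positivity), Real.mul_rpow (by positivity) (by positivity),
      ← Real.rpow_mul (by norm_num), ← Real.rpow_mul hN0.le, Real.sqrt_eq_rpow,
      ← Real.rpow_mul hT0, show 1 / 2 * (a * p) = a * p / 2 by ring]
    ring
  rw [← hT, h3] at h2
  have h4 : N ^ (5 - p) * (N ^ ((1 - a) * p) * (N ^ (-5 : ℝ) * N ^ (3 / 2 * (a * p)))) =
      N ^ (a * p / 2) := by
    rw [← Real.rpow_add hN0, ← Real.rpow_add hN0, ← Real.rpow_add hN0]
    congr 1
    ring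
  have h5 : N ^ (a * p / 2) * T ^ (a * p / 2) ≤ shellEnergy c m ^ (a * p / 2) := by
    rw [← Real.mul_rpow hN0.le hT0]
    exact Real.rpow_le_rpow (by positivity) (pow_mul_sum_le_shellEnergy m) (by linarith)
  calc N ^ (5 - p) * ∫ t in Set.Ioo α β, ∫ x in cube3, ‖PKlin c N t x‖ ^ p
      ≤ N ^ (5 - p) * ((N * M) ^ ((1 - a) * p) * ((2 * Real.pi) ^ 4 *
          (C * (((2 : ℝ) ^ (-5 : ℝ) * 2 ^ (3 / 2 * (a * p))) *
            (N ^ (-5 : ℝ) * N ^ (3 / 2 * (a * p))) * T ^ (a * p / 2))))) := by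
        refine mul_le_mul_of_nonneg_left (h1.trans ?_) (by positivity)
        gcongr
    _ = (2 * Real.pi) ^ 4 * C * ((2 : ℝ) ^ (-5 : ℝ) * 2 ^ (3 / 2 * (a * p))) *
          M ^ ((1 - a) * p) * ((N ^ (5 - p) * (N ^ ((1 - a) * p) *
            (N ^ (-5 : ℝ) * N ^ (3 / 2 * (a * p))))) * T ^ (a * p / 2)) := by
        rw [Real.mul_rpow hN0.le hM]
        ring
    _ ≤ _ := by
        rw [h4]
        gcongr

/-- The embedding of `ℓ¹` into `ℓʳ` for the dyadic energies. -/
lemma sum_shellEnergy_rpow_le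
    (hc : Summable fun ξ : Fin 3 → ℤ => Real.sqrt (1 + (znrm ξ) ^ 2) * ‖c ξ‖ ^ 2)
    {r : ℝ} (hr : 1 < r) (A : Finset ℕ) :
    ∑ m ∈ A, shellEnergy c m ^ r ≤ H12norm c ^ (2 * r) := by
  have hH := H12norm_nonneg (c := c)
  calc ∑ m ∈ A, shellEnergy c m ^ r
      ≤ ∑ m ∈ A, shellEnergy c m * (H12norm c ^ 2) ^ (r - 1) := by
        refine Finset.sum_le_sum fun m _ => ?_
        have h0 := shellEnergy_nonneg (c := c) m
        calc shellEnergy c m ^ r = shellEnergy c m ^ (1 + (r - 1)) := by ring_nf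
          _ = shellEnergy c m * shellEnergy c m ^ (r - 1) := by
            rw [Real.rpow_add_of_nonneg h0 zero_le_one (by linarith), Real.rpow_one]
          _ ≤ _ := by
            refine mul_le_mul_of_nonneg_left ?_ h0
            exact Real.rpow_le_rpow h0 (shellEnergy_le hc m) (by linarith)
    _ = (∑ m ∈ A, shellEnergy c m) * (H12norm c ^ 2) ^ (r - 1) := by rw [Finset.sum_mul]
    _ ≤ H12norm c ^ 2 * (H12norm c ^ 2) ^ (r - 1) := by
        gcongr
        exact sum_shellEnergy_le hc A
    _ = (H12norm c ^ 2) ^ (1 + (r - 1)) := by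
        rw [Real.rpow_add_of_nonneg (by positivity) zero_le_one (by linarith), Real.rpow_one]
    _ = _ := by
        rw [← Real.rpow_natCast, ← Real.rpow_mul hH]
        congr 1
        push_cast
        ring

end TorusStrichartz

/-- **Refined Strichartz estimate.**  Fix `p > 10/3` and `a ∈ (0,1)` with
`ap > 10/3`.  There is `C > 0` such that for every `f ∈ H^{1/2}(𝕋³)` (given via its
Fourier coefficients `c`) and every interval `I = [a₀,b₀] ⊆ [0,1]`,
`‖e^{itΔ}f‖_{Z(I)} ≤ C ‖f‖_{H^{1/2}}^a (sup_{N=2^m} N^{−1}‖P_N e^{itΔ}f‖_{L^∞_{t,x}(I×𝕋³)})^{1−a}`,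
where `‖u‖_{Z(I)} = sup_{J⊆I, |J|≤1} (Σ_{N=2^m} N^{5−p}‖P_N u‖^p_{L^p(J×𝕋³)})^{1/p}`. -/
theorem refined_strichartz
    (p a : ℝ) (hp : 10 / 3 < p) (ha0 : 0 < a) (ha1 : a < 1) (hap : 10 / 3 < a * p) :
    ∃ C : ℝ, 0 < C ∧
      ∀ (c : (Fin 3 → ℤ) → ℂ),
        Summable (fun ξ : Fin 3 → ℤ => Real.sqrt (1 + (znrm ξ) ^ 2) * ‖c ξ‖ ^ 2) →
        ∀ a₀ b₀ : ℝ, 0 ≤ a₀ → a₀ ≤ b₀ → b₀ ≤ 1 →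
          (⨆ J : {q : ℝ × ℝ // a₀ ≤ q.1 ∧ q.1 ≤ q.2 ∧ q.2 ≤ b₀ ∧ q.2 - q.1 ≤ 1},
              (∑' m : ℕ, ((2 : ℝ) ^ m) ^ (5 - p) *
                  ∫ t in Set.Ioo J.1.1 J.1.2, ∫ x in cube3,
                    ‖PKlin c ((2 : ℝ) ^ m) t x‖ ^ p) ^ p⁻¹)
            ≤ C * (H12norm c) ^ a *
              (⨆ m : ℕ, ((2 : ℝ) ^ m)⁻¹ *
                  ⨆ t ∈ Set.Icc a₀ b₀, ⨆ x ∈ cube3,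
                    ‖PKlin c ((2 : ℝ) ^ m) t x‖) ^ (1 - a) := by
  have hp0 : 0 < p := by linarith
  obtain ⟨C, hC, hbound⟩ := TorusStrichartz.exists_weighted_integral_le ha1 hp0 hap
  refine ⟨C ^ p⁻¹, by positivity, fun c hc a₀ b₀ ha₀ _ hb₀ => ?_⟩
  change _ ≤ C ^ p⁻¹ * H12norm c ^ a * TorusStrichartz.scaledSup c a₀ b₀ ^ (1 - a)
  have hH := TorusStrichartz.H12norm_nonneg (c := c)
  have hM := TorusStrichartz.scaledSup_nonneg (c := c) a₀ b₀
  refine Real.iSup_le (fun J => ?_) (by positivity)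
  have hterm := hbound c hc a₀ b₀ J.1.1 J.1.2 ha₀ J.2.1 J.2.2.2.1 hb₀
  have hnn : ∀ m : ℕ, 0 ≤ ((2 : ℝ) ^ m) ^ (5 - p) * ∫ t in Set.Ioo J.1.1 J.1.2, ∫ x in cube3,
      ‖PKlin c ((2 : ℝ) ^ m) t x‖ ^ p := fun m =>
    mul_nonneg (by positivity) (integral_nonneg fun _ => integral_nonneg fun _ => by positivity)
  have hsum : ∑' m : ℕ, ((2 : ℝ) ^ m) ^ (5 - p) * ∫ t in Set.Ioo J.1.1 J.1.2, ∫ x in cube3,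
      ‖PKlin c ((2 : ℝ) ^ m) t x‖ ^ p ≤
      C * TorusStrichartz.scaledSup c a₀ b₀ ^ ((1 - a) * p) * H12norm c ^ (a * p) := by
    refine Real.tsum_le_of_sum_le hnn fun A => ?_
    refine (Finset.sum_le_sum fun m _ => hterm m).trans ?_
    rw [← Finset.mul_sum]
    refine mul_le_mul_of_nonneg_left ?_ (by positivity)
    refine (TorusStrichartz.sum_shellEnergy_rpow_le hc (by linarith) A).trans_eq ?_
    congr 1
    ring
  refine (Real.rpow_le_rpow (tsum_nonneg hnn) hsum (by positivity)).trans_eq ?_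
  rw [Real.mul_rpow (by positivity) (by positivity), Real.mul_rpow hC.le (by positivity),
    ← Real.rpow_mul hM, ← Real.rpow_mul hH, mul_assoc (1 - a), mul_assoc a,
    mul_inv_cancel₀ hp0.ne', mul_one, mul_one]
  ring
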